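/- There exists an absolute constant C > 0 such that every smooth global solution u of the defocusing quintic nonlinear wave equation with E(u(t)) ≤ E for all t ∈ ℝ satisfies the spacetime bound ‖u‖_{L⁴_t L¹²_x(ℝ×ℝ³)} ≤ C (1+E)^{C E^{105/2}}. -/

import Mathlib

open MeasureTheory Real Set Function
open scoped ENNReal NNReal FourierTransform

noncomputable section

/-- Three-dimensional Euclidean space `ℝ³`. -/
abbrev E3 : Type := EuclideanSpace ℝ (Fin 3)

/-- The time derivative `∂ₜ u` of a function `u : ℝ × ℝ³ → ℝ` (curried). -/
def tderiv (u : ℝ → E3 → ℝ) (t : ℝ) (x : E3) : ℝ := deriv (fun s => u s x) t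

/-- The second time derivative `∂ₜ² u`. -/
def tderiv2 (u : ℝ → E3 → ℝ) (t : ℝ) (x : E3) : ℝ := deriv (fun s => tderiv u s x) t

/-- The spatial Laplacian `Δ f = ∑ᵢ ∂ᵢ² f` of `f : ℝ³ → ℝ`. -/
def lap (f : E3 → ℝ) (x : E3) : ℝ :=
  ∑ i : Fin 3, iteratedFDeriv ℝ 2 f x ![EuclideanSpace.single i 1, EuclideanSpace.single i 1]

/-- `f : ℝ³ → ℝ` is a Schwartz function: it is smooth and all of its derivatives decay
faster than any polynomial. -/
def IsSchwartz (f : E3 → ℝ) : Prop :=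
  ContDiff ℝ (⊤ : ℕ∞) f ∧ ∀ k n : ℕ, ∃ C : ℝ, ∀ x, ‖x‖ ^ k * ‖iteratedFDeriv ℝ n f x‖ ≤ C

/-- `u` is a smooth solution of the defocusing quintic nonlinear wave equation
`∂ₜ²u − Δu + u⁵ = 0` on the time interval `I`, Schwartz in the space variable at each time. -/
def IsNLWOn (u : ℝ → E3 → ℝ) (I : Set ℝ) : Prop :=
  ContDiffOn ℝ (⊤ : ℕ∞) (uncurry u) (I ×ˢ univ) ∧
  (∀ t ∈ I, IsSchwartz (u t) ∧ IsSchwartz (tderiv u t)) ∧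
  (∀ t ∈ I, ∀ x, tderiv2 u t x - lap (u t) x + (u t x) ^ 5 = 0)

/-- `u` is a smooth global solution of the defocusing quintic nonlinear wave equation. -/
def IsNLW (u : ℝ → E3 → ℝ) : Prop := IsNLWOn u univ

/-- The energy `E(u(t)) = ∫ (1/2)|∂ₜu|² + (1/2)|∇ₓu|² + (1/6)u⁶ dx`. -/
def energy (u : ℝ → E3 → ℝ) (t : ℝ) : ℝ :=
  ∫ x : E3, ((1/2) * (tderiv u t x) ^ 2 + (1/2) * ‖gradient (u t) x‖ ^ 2 + (1/6) * (u t x) ^ 6)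

/-- The spatial `L^q` norm (`q` finite), valued in `ℝ≥0∞`. -/
def xNorm {F : Type*} [NormedAddCommGroup F] (q : ℝ) (f : E3 → F) : ℝ≥0∞ :=
  (∫⁻ x : E3, (‖f x‖₊ : ℝ≥0∞) ^ q) ^ (1/q)

/-- The mixed norm `‖u‖_{L^p_t L^q_x (I × ℝ³)}` for finite `p, q`. -/
def mixNorm (p q : ℝ) (I : Set ℝ) (u : ℝ → E3 → ℝ) : ℝ≥0∞ :=
  (∫⁻ t in I, (xNorm q (u t)) ^ p) ^ (1/p)

/-- The mixed norm `‖u‖_{L^∞_t L^q_x (I × ℝ³)}` (essential supremum in time). -/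
def supNorm (q : ℝ) (I : Set ℝ) (u : ℝ → E3 → ℝ) : ℝ≥0∞ :=
  essSup (fun t => xNorm q (u t)) (volume.restrict I)

/-- The homogeneous Sobolev norm `‖f‖_{Ḣ^s} = (∫ |ξ|^{2s} |𝓕f(ξ)|² dξ)^{1/2}`. -/
def sobNorm (s : ℝ) (f : E3 → ℝ) : ℝ≥0∞ :=
  (∫⁻ ξ : E3, (‖ξ‖₊ : ℝ≥0∞) ^ (2*s) *
    (‖𝓕 (fun x => (f x : ℂ)) ξ‖₊ : ℝ≥0∞) ^ (2:ℝ)) ^ ((1:ℝ)/2)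

/-- The a priori bounds with constant `A`:
`‖u(t)‖_{L²} ≤ A`, `‖∂ₜu(t)‖_{Ḣ⁻¹} ≤ A`, `‖u(t)‖_{Ḣ²} ≤ A`, `‖∂ₜu(t)‖_{Ḣ¹} ≤ A` for all `t`. -/
def APriori (u : ℝ → E3 → ℝ) (A : ℝ) : Prop :=
  ∀ t : ℝ, xNorm 2 (u t) ≤ ENNReal.ofReal A ∧ sobNorm (-1) (tderiv u t) ≤ ENNReal.ofReal A ∧
    sobNorm 2 (u t) ≤ ENNReal.ofReal A ∧ sobNorm 1 (tderiv u t) ≤ ENNReal.ofReal A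

/-- The integral of `f` over the sphere of radius `r` about `x`, with respect to
two-dimensional Hausdorff (surface) measure. -/
def sphInt (x : E3) (r : ℝ) (f : E3 → ℝ) : ℝ := ∫ y in Metric.sphere x r, f y ∂(μH[2])

/-- The free wave evolution `S(t)(g, h)` given by Kirchhoff's formula. -/
def freeWave (g h : E3 → ℝ) (t : ℝ) (x : E3) : ℝ :=
  if t = 0 then g x
  else deriv (fun s => (1/(4*π*s)) * sphInt x s g) t + (1/(4*π*t)) * sphInt x t h

/-- The Duhamel integral `D_{[s₁,s₂]}u(t,x) = ∫_{s₁}^{s₂} S(t−τ)(0, u(τ)⁵) dτ`,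
written via Kirchhoff's formula. -/
def duh (u : ℝ → E3 → ℝ) (s₁ s₂ : ℝ) (t : ℝ) (x : E3) : ℝ :=
  ∫ τ in s₁..s₂, (1/(4*π*(t - τ))) * sphInt x (t - τ) (fun y => (u τ y) ^ 5)


/-! ### Directional derivatives -/

/-- Space-time `ℝ × ℝ³`. -/
abbrev Spt : Type := ℝ × E3

/-- Directional derivative. -/
def DD {V : Type*} [NormedAddCommGroup V] [NormedSpace ℝ V] (ξ : V) (f : V → ℝ) (p : V) : ℝ :=
  fderiv ℝ f p ξ

/-- The time direction in space-time. -/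
def eT : Spt := (1, 0)

/-- The spatial coordinate directions in space-time. -/
def eX (i : Fin 3) : Spt := (0, EuclideanSpace.single i 1)

section DDrules
variable {V : Type*} [NormedAddCommGroup V] [NormedSpace ℝ V] {ξ η : V} {f g : V → ℝ} {p : V}

@[fun_prop]
theorem DD_smooth (hf : ContDiff ℝ (⊤ : ℕ∞) f) : ContDiff ℝ (⊤ : ℕ∞) (DD ξ f) := by
  unfold DD
  have := hf.fderiv_right (m := (⊤ : ℕ∞)) (by simp)
  exact this.clm_apply contDiff_const

theorem smooth_diff (hf : ContDiff ℝ (⊤ : ℕ∞) f) : Differentiable ℝ f :=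
  hf.differentiable (by simp)

@[fun_prop]
theorem smooth_diffAt (hf : ContDiff ℝ (⊤ : ℕ∞) f) : DifferentiableAt ℝ f p :=
  hf.differentiable (by simp) p

theorem DD_add (hf : DifferentiableAt ℝ f p) (hg : DifferentiableAt ℝ g p) :
    DD ξ (fun x => f x + g x) p = DD ξ f p + DD ξ g p := by
  simp [DD, fderiv_fun_add hf hg]

theorem DD_sub (hf : DifferentiableAt ℝ f p) (hg : DifferentiableAt ℝ g p) :
    DD ξ (fun x => f x - g x) p = DD ξ f p - DD ξ g p := by
  simp [DD, fderiv_fun_sub hf hg]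

theorem DD_neg : DD ξ (fun x => - f x) p = - DD ξ f p := by
  simp [DD, fderiv_fun_neg]

theorem DD_mul (hf : DifferentiableAt ℝ f p) (hg : DifferentiableAt ℝ g p) :
    DD ξ (fun x => f x * g x) p = DD ξ f p * g p + f p * DD ξ g p := by
  simp [DD, fderiv_fun_mul hf hg]; ring

theorem DD_pow (hf : DifferentiableAt ℝ f p) (n : ℕ) :
    DD ξ (fun x => f x ^ n) p = n * f p ^ (n - 1) * DD ξ f p := by
  simp [DD, fderiv_fun_pow n hf]

theorem DD_const (c : ℝ) : DD ξ (fun _ => c) p = 0 := by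
  simp [DD]

theorem DD_inv (hf : DifferentiableAt ℝ f p) (h0 : f p ≠ 0) :
    DD ξ (fun x => (f x)⁻¹) p = - DD ξ f p / f p ^ 2 := by
  have h1 : HasDerivAt (fun y : ℝ => y⁻¹) (-(f p ^ 2)⁻¹) (f p) := hasDerivAt_inv h0
  have h := h1.comp_hasFDerivAt p hf.hasFDerivAt
  have h2 : fderiv ℝ (fun x => (f x)⁻¹) p = _ := h.fderiv
  simp [DD, h2]; ring

theorem DD_sum {ι : Type*} (s : Finset ι) {f : ι → V → ℝ}
    (hf : ∀ i ∈ s, DifferentiableAt ℝ (f i) p) :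
    DD ξ (fun x => ∑ i ∈ s, f i x) p = ∑ i ∈ s, DD ξ (f i) p := by
  simp [DD, fderiv_fun_sum hf]

theorem DD_comp {χ : ℝ → ℝ} (hχ : DifferentiableAt ℝ χ (f p)) (hf : DifferentiableAt ℝ f p) :
    DD ξ (fun x => χ (f x)) p = deriv χ (f p) * DD ξ f p := by
  have h := hχ.hasDerivAt.comp_hasFDerivAt p hf.hasFDerivAt
  have h2 : fderiv ℝ (fun x => χ (f x)) p = _ := h.fderiv
  simp [DD, h2]

theorem DD_comm (hf : ContDiff ℝ (⊤ : ℕ∞) f) : DD ξ (DD η f) p = DD η (DD ξ f) p := by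
  have h1 : Differentiable ℝ (fderiv ℝ f) :=
    (hf.fderiv_right (m := (⊤ : ℕ∞)) (by simp)).differentiable (by simp)
  have key : ∀ a b : V, DD a (DD b f) p = fderiv ℝ (fderiv ℝ f) p a b := by
    intro a b
    have : fderiv ℝ (fun x => fderiv ℝ f x b) p = _ :=
      ((h1 p).hasFDerivAt.clm_apply (hasFDerivAt_const b p)).fderiv
    change fderiv ℝ (fun x => fderiv ℝ f x b) p a = _
    rw [this]
    simp
  rw [key, key]
  exact second_derivative_symmetric (fun y => ((smooth_diff hf) y).hasFDerivAt)
    (h1 p).hasFDerivAt _ _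

theorem DD_hasDerivAt (hf : DifferentiableAt ℝ f p) :
    HasDerivAt (fun s : ℝ => f (p + s • ξ)) (DD ξ f p) 0 := by
  have h0 : HasFDerivAt f (fderiv ℝ f p) (p + (0:ℝ) • ξ) := by simpa using hf.hasFDerivAt
  have h1 : HasDerivAt (fun s : ℝ => p + s • ξ) ξ 0 := by
    simpa using ((hasDerivAt_id (0:ℝ)).smul_const ξ).const_add p
  exact h0.comp_hasDerivAt 0 h1

end DDrules

theorem DD_fst_T (p : Spt) : DD eT (fun q : Spt => q.1) p = 1 := by
  have : fderiv ℝ (fun q : Spt => q.1) p = ContinuousLinearMap.fst ℝ ℝ E3 := fderiv_fst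
  simp [DD, this, eT]

theorem DD_fst_X (i : Fin 3) (p : Spt) : DD (eX i) (fun q : Spt => q.1) p = 0 := by
  have : fderiv ℝ (fun q : Spt => q.1) p = ContinuousLinearMap.fst ℝ ℝ E3 := fderiv_fst
  simp [DD, this, eX]

theorem hasFDerivAt_coord (j : Fin 3) (p : Spt) : HasFDerivAt (fun q : Spt => q.2 j)
    ((EuclideanSpace.proj j : E3 →L[ℝ] ℝ).comp (ContinuousLinearMap.snd ℝ ℝ E3)) p :=
  ((EuclideanSpace.proj j : E3 →L[ℝ] ℝ).comp (ContinuousLinearMap.snd ℝ ℝ E3)).hasFDerivAt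

theorem coord_smooth (j : Fin 3) {n : WithTop ℕ∞} : ContDiff ℝ n (fun q : Spt => q.2 j) :=
  ((EuclideanSpace.proj j : E3 →L[ℝ] ℝ).comp (ContinuousLinearMap.snd ℝ ℝ E3)).contDiff

@[fun_prop]
theorem coord_smooth' (j : Fin 3) : ContDiff ℝ (⊤ : ℕ∞) (fun q : Spt => q.2 j) := coord_smooth j

@[fun_prop]
theorem coord_diffAt (j : Fin 3) (p : Spt) : DifferentiableAt ℝ (fun q : Spt => q.2 j) p :=
  (hasFDerivAt_coord j p).differentiableAt

theorem DD_snd_T (j : Fin 3) (p : Spt) : DD eT (fun q : Spt => q.2 j) p = 0 := by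
  simp [DD, (hasFDerivAt_coord j p).fderiv, eT]

theorem DD_snd_X (i j : Fin 3) (p : Spt) :
    DD (eX i) (fun q : Spt => q.2 j) p = if i = j then 1 else 0 := by
  simp [DD, (hasFDerivAt_coord j p).fderiv, eX, eq_comm]

/-- Decomposition of a directional derivative in space-time. -/
theorem fderiv_Spt (f : Spt → ℝ) (p v : Spt) :
    fderiv ℝ f p v = v.1 * DD eT f p + ∑ i, v.2 i * DD (eX i) f p := by
  have hv : v = v.1 • eT + ∑ i, v.2 i • eX i := by
    ext j
    · simp [eT, eX, Fin.sum_univ_three]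
    · simp [eT, eX, Fin.sum_univ_three]
      fin_cases j <;> simp
  conv_lhs => rw [hv]
  simp [DD]

/-! ### Integration over space -/

theorem hasDerivAt_slice_t {f : Spt → ℝ} {t : ℝ} {x : E3} (hf : DifferentiableAt ℝ f (t, x)) :
    HasDerivAt (fun s => f (s, x)) (DD eT f (t, x)) t := by
  have h1 : HasDerivAt (fun s : ℝ => ((s, x) : Spt)) eT t :=
    (hasDerivAt_id t).prodMk (hasDerivAt_const t x)
  exact hf.hasFDerivAt.comp_hasDerivAt t h1

theorem hasFDerivAt_slice_x {f : Spt → ℝ} {t : ℝ} {x : E3} (hf : DifferentiableAt ℝ f (t, x)) :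
    HasFDerivAt (fun y => f (t, y)) ((fderiv ℝ f (t, x)).comp (ContinuousLinearMap.inr ℝ ℝ E3)) x := by
  have h1 : HasFDerivAt (fun y : E3 => ((t, y) : Spt)) (ContinuousLinearMap.inr ℝ ℝ E3) x :=
    hasFDerivAt_prodMk_right t x
  exact hf.hasFDerivAt.comp x h1

theorem DD_slice_x {f : Spt → ℝ} {t : ℝ} {x : E3} (hf : DifferentiableAt ℝ f (t, x)) (i : Fin 3) :
    DD (EuclideanSpace.single i 1) (fun y => f (t, y)) x = DD (eX i) f (t, x) := by
  simp [DD, (hasFDerivAt_slice_x hf).fderiv, eX]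

/-- The integral of a derivative of a compactly supported function vanishes. -/
theorem integral_DD_eq_zero {f : E3 → ℝ} (hf : ContDiff ℝ 1 f) (hc : HasCompactSupport f)
    (ξ : E3) : ∫ x, DD ξ f x = 0 := by
  have h1 : Continuous (fun x => DD ξ f x) := by
    unfold DD
    exact (hf.continuous_fderiv (by simp)).clm_apply continuous_const
  have hc' : HasCompactSupport (fun x => DD ξ f x) := by
    refine (hc.fderiv (𝕜 := ℝ)).mono ?_
    intro x hx h
    apply hx
    simp [DD, h]
  have := integral_bilinear_hasLineDerivAt_right_eq_neg_left_of_integrable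
    (μ := (volume : Measure E3)) (f := fun _ => (1:ℝ)) (f' := fun _ => 0) (g := f)
    (g' := fun x => DD ξ f x) (v := ξ) (B := ContinuousLinearMap.mul ℝ ℝ)
    (by simp) (by simpa using h1.integrable_of_hasCompactSupport hc')
    (by simpa using hf.continuous.integrable_of_hasCompactSupport hc)
    (by intro x _; simpa using (hasFDerivAt_const (1:ℝ) x).hasLineDerivAt ξ)
    (by
      intro x _
      exact ((hf.differentiable (by simp)) x).hasFDerivAt.hasLineDerivAt ξ)
  simpa using this

theorem hasCompactSupport_of_ball {F : Type*} [NormedAddCommGroup F] {f : E3 → F} {R : ℝ}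
    (h : ∀ x, R < ‖x‖ → f x = 0) :
    HasCompactSupport f := by
  refine HasCompactSupport.of_support_subset_isCompact (isCompact_closedBall (0 : E3) R) ?_
  intro x hx
  by_contra hx'
  exact hx (h x (by simpa using hx'))

theorem integral_dx_eq_zero {f : Spt → ℝ} {t R : ℝ} (hf : ∀ x, ContDiffAt ℝ 1 f (t, x))
    (hR : ∀ x, R < ‖x‖ → f (t, x) = 0) (i : Fin 3) : ∫ x, DD (eX i) f (t, x) = 0 := by
  have h1 : ContDiff ℝ 1 (fun x => f (t, x)) := by
    rw [contDiff_iff_contDiffAt]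
    intro x
    exact (hf x).comp x (contDiffAt_const.prodMk contDiffAt_id)
  have h2 := integral_DD_eq_zero h1 (hasCompactSupport_of_ball hR) (EuclideanSpace.single i 1)
  rw [← h2]
  congr 1
  ext x
  rw [DD_slice_x ((hf x).differentiableAt (by simp))]

theorem integrable_of_ball {f : E3 → ℝ} {R : ℝ} (hf : Continuous f)
    (h : ∀ x, R < ‖x‖ → f x = 0) : Integrable f :=
  hf.integrable_of_hasCompactSupport (hasCompactSupport_of_ball h)

/-- Differentiation under the integral sign for spatially compactly supported functions. -/
theorem hasDerivAt_integral_slice {f : Spt → ℝ} {t₀ ε R : ℝ} (hε : 0 < ε)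
    (hf : ∀ t x, |t - t₀| < ε → ContDiffAt ℝ 1 f (t, x))
    (hR : ∀ t x, |t - t₀| < ε → R < ‖x‖ → f (t, x) = 0) :
    HasDerivAt (fun t => ∫ x, f (t, x)) (∫ x, DD eT f (t₀, x)) t₀ := by
  have hcont : ContinuousOn (fun p : Spt => DD eT f p) (Metric.ball t₀ ε ×ˢ univ) := by
    intro p hp
    have h := hf p.1 p.2 (by simpa [Real.dist_eq] using hp.1)
    have h2 := (h.fderiv_right (m := 0) (by simp)).continuousAt
    exact (h2.clm_apply continuousAt_const).continuousWithinAt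
  have hslice : ∀ t, |t - t₀| < ε → Continuous (fun x => f (t, x)) := by
    intro t ht
    rw [continuous_iff_continuousAt]
    intro x
    exact ((hf t x ht).continuousAt).comp (f := fun x => ((t, x) : Spt)) (by fun_prop)
  have hzero : ∀ t x, |t - t₀| < ε → R < ‖x‖ → DD eT f (t, x) = 0 := by
    intro t x ht hx
    have h1 := (hasDerivAt_slice_t ((hf t x ht).differentiableAt (by simp)))
    have h2 : (fun s => f (s, x)) =ᶠ[nhds t] fun _ => 0 := by
      have : {s | |s - t₀| < ε} ∈ nhds t :=
        (isOpen_lt (by fun_prop) (by fun_prop)).mem_nhds ht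
      filter_upwards [this] with s hs using hR s x hs hx
    have h3 := h2.hasDerivAt_iff.1 h1
    exact h3.unique (hasDerivAt_const t 0)
  -- bound on compact set
  have hK : IsCompact (Metric.closedBall t₀ (ε/2) ×ˢ Metric.closedBall (0:E3) R) :=
    (isCompact_closedBall _ _).prod (isCompact_closedBall _ _)
  obtain ⟨C, hC⟩ := hK.exists_bound_of_continuousOn (hcont.mono (by
    rintro ⟨t, x⟩ ⟨h1, -⟩
    refine ⟨?_, mem_univ _⟩
    simp at h1 ⊢
    linarith))
  have hball : Metric.ball t₀ (ε/2) ∈ nhds t₀ := Metric.ball_mem_nhds _ (by linarith)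
  have hlt : ∀ t ∈ Metric.ball t₀ (ε/2), |t - t₀| < ε := by
    intro t ht
    rw [Metric.mem_ball, Real.dist_eq] at ht
    linarith
  refine (hasDerivAt_integral_of_dominated_loc_of_deriv_le (μ := volume)
    (F := fun t x => f (t, x)) (F' := fun t x => DD eT f (t, x))
    (bound := (Metric.closedBall (0:E3) R).indicator (fun _ => C)) hball ?_ ?_ ?_ ?_ ?_ ?_).2
  · filter_upwards [hball] with t ht
    exact (hslice t (hlt t ht)).aestronglyMeasurable
  · exact integrable_of_ball (hslice t₀ (by simpa)) (fun x hx => hR t₀ x (by simpa) hx)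
  · have : Continuous (fun x => DD eT f (t₀, x)) := by
      rw [continuous_iff_continuousAt]
      intro x
      have h := (hcont.continuousAt (x := (t₀, x))
        ((Metric.isOpen_ball.prod isOpen_univ).mem_nhds ⟨by simpa, mem_univ _⟩))
      exact h.comp (f := fun x => ((t₀, x) : Spt)) (by fun_prop)
    exact this.aestronglyMeasurable
  · filter_upwards with x t ht
    by_cases hx : x ∈ Metric.closedBall (0:E3) R
    · simp only [hx, indicator_of_mem]
      exact hC (t, x) ⟨Metric.ball_subset_closedBall ht, hx⟩
    · rw [hzero t x (hlt t ht) (by simpa using hx)]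
      simp [hx]
  · exact (integrable_indicator_iff measurableSet_closedBall).2
      (integrableOn_const (by exact (isCompact_closedBall (0:E3) R).measure_lt_top.ne))
  · filter_upwards with x t ht
    exact hasDerivAt_slice_t ((hf t x (hlt t ht)).differentiableAt (by simp))

/-! ### Balance laws and solutions -/

theorem integrable_DD_slice {f : Spt → ℝ} {t₀ ε R : ℝ} (hε : 0 < ε)
    (hf : ∀ t x, |t - t₀| < ε → ContDiffAt ℝ 1 f (t, x))
    (hR : ∀ t x, |t - t₀| < ε → R < ‖x‖ → f (t, x) = 0) (ξ : Spt) :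
    Integrable (fun x => DD ξ f (t₀, x)) := by
  refine integrable_of_ball (R := R) ?_ ?_
  · rw [continuous_iff_continuousAt]
    intro x
    have h2 := ((hf t₀ x (by simpa)).fderiv_right (m := 0) (by simp)).continuousAt
    exact (h2.clm_apply continuousAt_const).comp (f := fun x => ((t₀, x) : Spt)) (by fun_prop)
  · intro x hx
    have h1 : f =ᶠ[nhds ((t₀, x) : Spt)] fun _ => 0 := by
      have : {p : Spt | |p.1 - t₀| < ε ∧ R < ‖p.2‖} ∈ nhds ((t₀, x) : Spt) :=
        (IsOpen.inter (s := {p : Spt | |p.1 - t₀| < ε}) (t := {p : Spt | R < ‖p.2‖})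
          (isOpen_lt (by fun_prop) (by fun_prop))
          (isOpen_lt (by fun_prop) (by fun_prop))).mem_nhds ⟨by simpa, hx⟩
      filter_upwards [this] with p hp using hR p.1 p.2 hp.1 hp.2
    simp [DD, h1.fderiv_eq]

/-- Localised balance law: if `∂ₜ q = div V + S` then `∫ φ q` has the expected derivative. -/
theorem balance {φ q : Spt → ℝ} {V : Fin 3 → Spt → ℝ} {S : E3 → ℝ} {t₀ ε R : ℝ} (hε : 0 < ε)
    (hφ : ∀ t x, |t - t₀| < ε → ContDiffAt ℝ 1 φ (t, x))
    (hq : ∀ t x, |t - t₀| < ε → ContDiffAt ℝ 1 q (t, x))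
    (hV : ∀ i t x, |t - t₀| < ε → ContDiffAt ℝ 1 (V i) (t, x))
    (hR : ∀ t x, |t - t₀| < ε → R < ‖x‖ → φ (t, x) = 0)
    (heq : ∀ x, DD eT q (t₀, x) = ∑ i, DD (eX i) (V i) (t₀, x) + S x) :
    HasDerivAt (fun t => ∫ x, φ (t, x) * q (t, x))
      (∫ x, (DD eT φ (t₀, x) * q (t₀, x) - ∑ i, DD (eX i) φ (t₀, x) * V i (t₀, x)
        + φ (t₀, x) * S x)) t₀ ∧
    Integrable (fun x => DD eT φ (t₀, x) * q (t₀, x) - ∑ i, DD (eX i) φ (t₀, x) * V i (t₀, x)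
        + φ (t₀, x) * S x) := by
  have h0 : |t₀ - t₀| < ε := by simpa
  have d := hasDerivAt_integral_slice (f := fun p => φ p * q p) (R := R) hε
    (fun t x ht => (hφ t x ht).mul (hq t x ht)) (fun t x ht hx => by simp [hR t x ht hx])
  have hI := integrable_DD_slice (f := fun p => φ p * q p) (R := R) hε
    (fun t x ht => (hφ t x ht).mul (hq t x ht)) (fun t x ht hx => by simp [hR t x ht hx]) eT
  have hJ := fun i => integrable_DD_slice (f := fun p => φ p * V i p) (R := R) hε
    (fun t x ht => (hφ t x ht).mul (hV i t x ht)) (fun t x ht hx => by simp [hR t x ht hx]) (eX i)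
  have hZ := fun i => integral_dx_eq_zero (f := fun p => φ p * V i p) (t := t₀) (R := R)
    (fun x => (hφ t₀ x h0).mul (hV i t₀ x h0)) (fun x hx => by simp [hR t₀ x h0 hx]) i
  have this : ∫ x, (DD eT (fun p => φ p * q p) (t₀, x)
      - ∑ i, DD (eX i) (fun p => φ p * V i p) (t₀, x)) = _ :=
    integral_sub hI (integrable_finsetSum _ fun i _ => hJ i)
  have h_int := hI.sub (integrable_finsetSum Finset.univ fun i _ => hJ i)
  rw [integral_finsetSum _ fun i _ => hJ i] at this
  simp only [hZ, Finset.sum_const_zero, sub_zero] at this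
  have hfun : (fun x => DD eT φ (t₀, x) * q (t₀, x) - ∑ i, DD (eX i) φ (t₀, x) * V i (t₀, x)
        + φ (t₀, x) * S x) = fun x => DD eT (fun p => φ p * q p) (t₀, x)
      - ∑ i, DD (eX i) (fun p => φ p * V i p) (t₀, x) := by
    ext x
    have e1 := (hφ t₀ x h0).differentiableAt (by simp)
    have e2 := (hq t₀ x h0).differentiableAt (by simp)
    have e3 := fun i => (hV i t₀ x h0).differentiableAt (by simp)
    simp only [DD_mul e1 e2, DD_mul e1 (e3 _), heq, Finset.sum_add_distrib, ← Finset.mul_sum]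
    ring
  rw [hfun]
  refine ⟨?_, h_int⟩
  rw [this]
  exact d

/-- Squared spatial gradient. -/
def gsq (v : Spt → ℝ) (p : Spt) : ℝ := ∑ i, DD (eX i) v p ^ 2

/-- Energy density. -/
def ed (v : Spt → ℝ) (p : Spt) : ℝ :=
  (1/2) * DD eT v p ^ 2 + (1/2) * gsq v p + (1/6) * v p ^ 6

/-- Smooth finite energy solutions with energy at most `E`. -/
structure Sol (v : Spt → ℝ) (E : ℝ) : Prop where
  smooth : ContDiff ℝ (⊤ : ℕ∞) v
  eqn : ∀ p, DD eT (DD eT v) p = ∑ i, DD (eX i) (DD (eX i) v) p - v p ^ 5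
  int_ed : ∀ t, Integrable (fun x => ed v (t, x))
  ed_le : ∀ t, ∫ x, ed v (t, x) ≤ E
  int_sq : ∀ t, Integrable (fun x => v (t, x) ^ 2)

theorem gsq_nonneg (v : Spt → ℝ) (p : Spt) : 0 ≤ gsq v p :=
  Finset.sum_nonneg fun _ _ => sq_nonneg _

theorem ed_nonneg (v : Spt → ℝ) (p : Spt) : 0 ≤ ed v p := by
  have := gsq_nonneg v p
  unfold ed
  positivity

theorem pow6_le_ed (v : Spt → ℝ) (p : Spt) : v p ^ 6 ≤ 6 * ed v p := by
  have := gsq_nonneg v p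
  have := sq_nonneg (DD eT v p)
  unfold ed
  linarith

theorem sqT_le_ed (v : Spt → ℝ) (p : Spt) : DD eT v p ^ 2 ≤ 2 * ed v p := by
  have := gsq_nonneg v p
  have : 0 ≤ v p ^ 6 := by positivity
  unfold ed
  linarith

theorem gsq_le_ed (v : Spt → ℝ) (p : Spt) : gsq v p ≤ 2 * ed v p := by
  have := sq_nonneg (DD eT v p)
  have : 0 ≤ v p ^ 6 := by positivity
  unfold ed
  linarith

@[fun_prop]
theorem gsq_smooth {v : Spt → ℝ} (h : ContDiff ℝ (⊤ : ℕ∞) v) :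
    ContDiff ℝ (⊤ : ℕ∞) (gsq v) := by
  unfold gsq; fun_prop

@[fun_prop]
theorem ed_smooth {v : Spt → ℝ} (h : ContDiff ℝ (⊤ : ℕ∞) v) :
    ContDiff ℝ (⊤ : ℕ∞) (ed v) := by
  unfold ed; fun_prop

theorem smooth_one {f : Spt → ℝ} (h : ContDiff ℝ (⊤ : ℕ∞) f) (p : Spt) : ContDiffAt ℝ 1 f p :=
  (h.of_le (by exact_mod_cast le_top)).contDiffAt

namespace Sol
variable {v : Spt → ℝ} {E : ℝ}

theorem energy_law (h : Sol v E) (p : Spt) :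
    DD eT (ed v) p = ∑ i, DD (eX i) (fun p => DD eT v p * DD (eX i) v p) p := by
  have hs := h.smooth
  have hc : ∀ i, DD eT (DD (eX i) v) p = DD (eX i) (DD eT v) p := fun i => DD_comm hs
  unfold ed gsq
  simp (disch := fun_prop) only [DD_add, DD_mul, DD_pow, DD_const, DD_sum, h.eqn, hc,
    Finset.sum_add_distrib, ← Finset.mul_sum]
  simp only [Fin.sum_univ_three]
  push_cast
  ring

theorem energy_flux (h : Sol v E) {φ : Spt → ℝ} {t₀ ε R : ℝ} (hε : 0 < ε)
    (hφ : ∀ t x, |t - t₀| < ε → ContDiffAt ℝ 1 φ (t, x))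
    (hR : ∀ t x, |t - t₀| < ε → R < ‖x‖ → φ (t, x) = 0) :
    HasDerivAt (fun t => ∫ x, φ (t, x) * ed v (t, x))
      (∫ x, (DD eT φ (t₀, x) * ed v (t₀, x)
        - ∑ i, DD (eX i) φ (t₀, x) * (DD eT v (t₀, x) * DD (eX i) v (t₀, x)))) t₀ := by
  have hs := h.smooth
  obtain ⟨this, -⟩ := balance (V := fun i p => DD eT v p * DD (eX i) v p) (q := ed v) (S := 0) hε hφ
    (fun t x _ => smooth_one (by fun_prop) _) (fun i t x _ => smooth_one (by fun_prop) _) hR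
    (fun x => by simpa using h.energy_law (t₀, x))
  simpa using this

/-- The energy flux through a surface with normal `a` is controlled by the energy density. -/
theorem flux_le (v : Spt → ℝ) (p : Spt) (a : Fin 3 → ℝ) {b : ℝ} (hb : 0 ≤ b)
    (hab : ∑ i, a i ^ 2 ≤ b ^ 2) :
    |∑ i, a i * (DD eT v p * DD (eX i) v p)| ≤ b * ed v p := by
  have h1 : ∑ i, a i * (DD eT v p * DD (eX i) v p)
      = DD eT v p * ∑ i, a i * DD (eX i) v p := by
    rw [Finset.mul_sum]; congr 1; ext i; ring
  have h2 : (∑ i, a i * DD (eX i) v p) ^ 2 ≤ b ^ 2 * gsq v p := by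
    refine (Finset.sum_mul_sq_le_sq_mul_sq _ _ _).trans ?_
    exact mul_le_mul_of_nonneg_right hab (gsq_nonneg v p)
  have h3 : |∑ i, a i * DD (eX i) v p| ≤ b * √(gsq v p) := by
    rw [← Real.sqrt_sq hb, ← Real.sqrt_mul (sq_nonneg b)]
    exact Real.abs_le_sqrt h2
  rw [h1, abs_mul]
  have h4 := Real.sq_sqrt (gsq_nonneg v p)
  have h5 : 0 ≤ v p ^ 6 := by positivity
  calc |DD eT v p| * |∑ i, a i * DD (eX i) v p| ≤ |DD eT v p| * (b * √(gsq v p)) := by gcongr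
    _ = b * (|DD eT v p| * √(gsq v p)) := by ring
    _ ≤ b * ed v p := by
      gcongr
      unfold ed
      nlinarith [sq_nonneg (|DD eT v p| - √(gsq v p)), sq_abs (DD eT v p)]

theorem translate (h : Sol v E) (a : Spt) : Sol (fun p => v (p + a)) E := by
  have hs := h.smooth
  have hD : ∀ {f : Spt → ℝ}, ∀ ξ : Spt,
      DD ξ (fun p => f (p + a)) = fun p => DD ξ f (p + a) := by
    intro f ξ; ext p; simp [DD, fderiv_comp_add_right]
  have he : ∀ p, ed (fun p => v (p + a)) p = ed v (p + a) := by
    intro p; simp [ed, gsq, hD]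
  refine ⟨by fun_prop, ?_, ?_, ?_, ?_⟩
  · intro p; simp only [hD, h.eqn]
  · intro t
    simp only [he]
    exact (h.int_ed (t + a.1)).comp_add_right a.2
  · intro t
    simp only [he]
    have := integral_add_right_eq_self (μ := (volume : Measure E3))
      (fun x => ed v (t + a.1, x)) a.2
    exact (this.trans_le (h.ed_le _))
  · intro t
    exact (h.int_sq (t + a.1)).comp_add_right a.2

theorem reverse (h : Sol v E) : Sol (fun p => v (-p.1, p.2)) E := by
  have hs := h.smooth
  let L : Spt →L[ℝ] Spt := (-(ContinuousLinearMap.fst ℝ ℝ E3)).prod (ContinuousLinearMap.snd ℝ ℝ E3)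
  have hL : ∀ p, L p = (-p.1, p.2) := fun p => rfl
  have hD : ∀ {f : Spt → ℝ}, Differentiable ℝ f → ∀ ξ p,
      DD ξ (fun p : Spt => f (-p.1, p.2)) p = DD (L ξ) f (-p.1, p.2) := by
    intro f hf ξ p
    have := ((hf (L p)).hasFDerivAt.comp p L.hasFDerivAt).fderiv
    have h2 : fderiv ℝ (fun p : Spt => f (-p.1, p.2)) p = _ := this
    rw [DD, h2]; rfl
  have hT : L eT = - eT := by simp [hL, eT]
  have hX : ∀ i, L (eX i) = eX i := by intro i; simp [hL, eX]
  have hneg : ∀ f : Spt → ℝ, DD (-eT) f = fun p => - DD eT f p := by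
    intro f; ext p; simp [DD]
  have h1 : DD eT (fun p : Spt => v (-p.1, p.2)) = fun p : Spt => - DD eT v (-p.1, p.2) := by
    ext p; rw [hD (smooth_diff hs), hT, hneg]
  have h2 : ∀ i, DD (eX i) (fun p : Spt => v (-p.1, p.2))
      = fun p : Spt => DD (eX i) v (-p.1, p.2) := by
    intro i; ext p; rw [hD (smooth_diff hs), hX]
  have he : ∀ p : Spt, ed (fun p : Spt => v (-p.1, p.2)) p = ed v (-p.1, p.2) := by
    intro p; simp [ed, gsq, h1, h2]
  refine ⟨by fun_prop, ?_, ?_, ?_, ?_⟩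
  · intro p
    have h3 : DD eT (fun p : Spt => DD eT v (-p.1, p.2)) p = - DD eT (DD eT v) (-p.1, p.2) := by
      rw [hD (smooth_diff (DD_smooth hs)), hT, hneg]
    have h4 : ∀ i, DD (eX i) (fun p : Spt => DD (eX i) v (-p.1, p.2)) p
        = DD (eX i) (DD (eX i) v) (-p.1, p.2) := by
      intro i; rw [hD (smooth_diff (DD_smooth hs)), hX]
    simp only [h1, h2, DD_neg, h3, h4, neg_neg, h.eqn]
  · intro t; simpa only [he] using h.int_ed (-t)
  · intro t; simpa only [he] using h.ed_le (-t)
  · intro t; exact h.int_sq (-t)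

theorem nonneg (h : Sol v E) : 0 ≤ E :=
  (integral_nonneg fun _ => ed_nonneg v _).trans (h.ed_le 0)

end Sol

/-! ### Cutoffs and finite speed of propagation -/

/-- Derivative of the smooth transition function. -/
def stD (s : ℝ) : ℝ := deriv smoothTransition s

theorem stD_nonneg (s : ℝ) : 0 ≤ stD s := smoothTransition.monotone.deriv_nonneg

theorem stD_of_nonpos {s : ℝ} (hs : s ≤ 0) : stD s = 0 := by
  apply IsLocalMin.deriv_eq_zero
  filter_upwards with y
  rw [smoothTransition.zero_of_nonpos hs]
  exact smoothTransition.nonneg y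

theorem stD_of_one_le {s : ℝ} (hs : 1 ≤ s) : stD s = 0 := by
  apply IsLocalMax.deriv_eq_zero
  filter_upwards with y
  rw [smoothTransition.one_of_one_le hs]
  exact smoothTransition.le_one y

theorem stD_continuous : Continuous stD :=
  (smoothTransition.contDiff (n := 1)).continuous_deriv (by simp)

theorem exists_stD_le : ∃ C : ℝ, 1 ≤ C ∧ ∀ s, stD s ≤ C := by
  obtain ⟨C, hC⟩ := (isCompact_Icc (a := (0:ℝ)) (b := 1)).exists_bound_of_continuousOn
    stD_continuous.continuousOn
  refine ⟨max C 1, le_max_right _ _, fun s => ?_⟩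
  by_cases h : s ∈ Icc (0:ℝ) 1
  · exact (le_abs_self _).trans ((hC s h).trans (le_max_left _ _))
  · rw [mem_Icc, not_and_or, not_le, not_le] at h
    rcases h with h | h
    · rw [stD_of_nonpos h.le]; positivity
    · rw [stD_of_one_le h.le]; positivity

theorem DD_st {V : Type*} [NormedAddCommGroup V] [NormedSpace ℝ V] {ξ : V} {f : V → ℝ} {p : V}
    (hf : DifferentiableAt ℝ f p) :
    DD ξ (fun x => smoothTransition (f x)) p = stD (f p) * DD ξ f p :=
  DD_comp ((smoothTransition.contDiff (n := 1)).differentiable (by simp) _) hf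

/-- The squared norm of the space component. -/
def nsq (p : Spt) : ℝ := ∑ i, p.2 i ^ 2

theorem nsq_eq (p : Spt) : nsq p = ‖p.2‖ ^ 2 := by
  rw [nsq, EuclideanSpace.norm_sq_eq]; simp

@[fun_prop]
theorem nsq_smooth : ContDiff ℝ (⊤ : ℕ∞) nsq := by
  unfold nsq; fun_prop

theorem DD_nsq_T (p : Spt) : DD eT nsq p = 0 := by
  have : nsq = fun p : Spt => ∑ i, p.2 i ^ 2 := rfl
  rw [this, DD_sum _ (fun i _ => by fun_prop)]
  refine Finset.sum_eq_zero fun i _ => ?_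
  rw [DD_pow (by fun_prop), DD_snd_T]; simp

theorem DD_nsq_X (i : Fin 3) (p : Spt) : DD (eX i) nsq p = 2 * p.2 i := by
  have : nsq = fun p : Spt => ∑ i, p.2 i ^ 2 := rfl
  rw [this, DD_sum _ (fun i _ => by fun_prop)]
  rw [Finset.sum_eq_single i]
  · rw [DD_pow (by fun_prop), DD_snd_X]; simp
  · intro j _ hj
    rw [DD_pow (by fun_prop), DD_snd_X, if_neg (Ne.symm hj)]; simp
  · simp

namespace Sol
variable {v : Spt → ℝ} {E : ℝ}

theorem finite_speed_origin (h : Sol v E) {r t : ℝ} (hr : 0 < r) (ht : 0 ≤ t) :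
    ∫ x in Metric.closedBall (0 : E3) r, ed v (0, x) ≤
      ∫ x in Metric.closedBall (0 : E3) (2 * r + t), ed v (t, x) := by
  set ψ : Spt → ℝ := fun p => (3 * r ^ 2)⁻¹ * ((p.1 + 2 * r) ^ 2 - nsq p) with hψ
  have hψs : ContDiff ℝ (⊤ : ℕ∞) ψ := by fun_prop
  set φ : Spt → ℝ := fun p => smoothTransition (ψ p) with hφ
  have hφs : ContDiff ℝ (⊤ : ℕ∞) φ := smoothTransition.contDiff.comp hψs
  have hr2 : 0 < (3 * r ^ 2)⁻¹ := by positivity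
  have hψ0 : ∀ s x, 0 ≤ s + 2 * r → s + 2 * r ≤ ‖x‖ → ψ (s, x) ≤ 0 := by
    intro s x h1 h2
    simp only [hψ, nsq_eq]
    have : (s + 2 * r) ^ 2 ≤ ‖x‖ ^ 2 := pow_le_pow_left₀ h1 h2 2
    exact mul_nonpos_of_nonneg_of_nonpos hr2.le (by linarith)
  have hderT : ∀ p, DD eT φ p = stD (ψ p) * ((3 * r ^ 2)⁻¹ * (2 * (p.1 + 2 * r))) := by
    intro p
    rw [hφ, DD_st (by fun_prop), hψ]
    rw [DD_mul (by fun_prop) (by fun_prop), DD_sub (by fun_prop) (by fun_prop),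
      DD_pow (by fun_prop), DD_add (by fun_prop) (by fun_prop), DD_fst_T, DD_const, DD_const,
      DD_nsq_T]
    simp
  have hderX : ∀ i p, DD (eX i) φ p = stD (ψ p) * ((3 * r ^ 2)⁻¹ * (- (2 * p.2 i))) := by
    intro i p
    rw [hφ, DD_st (by fun_prop), hψ]
    rw [DD_mul (by fun_prop) (by fun_prop), DD_sub (by fun_prop) (by fun_prop),
      DD_pow (by fun_prop), DD_add (by fun_prop) (by fun_prop), DD_fst_X, DD_const, DD_const,
      DD_nsq_X]
    simp
  have hflux : ∀ s, -r < s → HasDerivAt (fun t => ∫ x, φ (t, x) * ed v (t, x))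
      (∫ x, (DD eT φ (s, x) * ed v (s, x)
        - ∑ i, DD (eX i) φ (s, x) * (DD eT v (s, x) * DD (eX i) v (s, x)))) s := by
    intro s hs
    refine h.energy_flux (ε := r) (R := s + r + 2 * r) hr (fun t x _ => smooth_one hφs _) ?_
    intro t x ht hx
    have := abs_lt.1 ht
    exact smoothTransition.zero_of_nonpos (hψ0 t x (by linarith) (by linarith))
  have hmono : MonotoneOn (fun t => ∫ x, φ (t, x) * ed v (t, x)) (Icc 0 t) := by
    refine monotoneOn_of_deriv_nonneg (convex_Icc 0 t) ?_ ?_ ?_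
    · intro s hs
      exact (hflux s (by linarith [hs.1])).continuousAt.continuousWithinAt
    · intro s hs
      rw [interior_Icc] at hs
      exact (hflux s (by linarith [hs.1])).differentiableAt.differentiableWithinAt
    · intro s hs
      rw [interior_Icc] at hs
      rw [(hflux s (by linarith [hs.1])).deriv]
      refine integral_nonneg fun x => ?_
      have hs0 := hs.1
      simp only [Pi.zero_apply]
      by_cases hx : s + 2 * r ≤ ‖x‖
      · have : stD (ψ (s, x)) = 0 := stD_of_nonpos (hψ0 s x (by linarith) hx)
        simp [hderT, hderX, this]
      · push Not at hx
        have hb : 0 ≤ DD eT φ (s, x) := by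
          rw [hderT]
          have := stD_nonneg (ψ (s, x))
          have : 0 ≤ 2 * (s + 2 * r) := by linarith
          positivity
        have := flux_le v (s, x) (fun i => DD (eX i) φ (s, x)) hb (by
          simp only [hderT, hderX, mul_pow, ← Finset.mul_sum]
          gcongr ?_ * (?_ * ?_)
          have e1 : ∑ i, (-(2 * x i)) ^ 2 = 4 * ‖x‖ ^ 2 := by
            have := nsq_eq (s, x)
            simp only [nsq] at this
            rw [← this, Finset.mul_sum]
            congr 1; ext i; ring
          have e2 : ‖x‖ ^ 2 ≤ (s + 2 * r) ^ 2 := pow_le_pow_left₀ (norm_nonneg _) hx.le 2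
          calc _ = 4 * ‖x‖ ^ 2 := e1
            _ ≤ 4 * (s + 2 * r) ^ 2 := by linarith
            _ = _ := by ring)
        have := (abs_le.1 this).2
        linarith
  have h01 := hmono (left_mem_Icc.2 ht) (right_mem_Icc.2 ht) ht
  simp only at h01
  have h_int : ∀ s, Integrable (fun x => φ (s, x) * ed v (s, x)) := by
    intro s
    refine (h.int_ed s).bdd_mul (c := 1) ?_ ?_
    · exact (hφs.continuous.comp (by fun_prop : Continuous fun x : E3 => ((s, x) : Spt))).aestronglyMeasurable
    · filter_upwards with x
      rw [Real.norm_eq_abs, abs_of_nonneg (smoothTransition.nonneg _)]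
      exact smoothTransition.le_one _
  calc ∫ x in Metric.closedBall (0 : E3) r, ed v (0, x)
      ≤ ∫ x, φ (0, x) * ed v (0, x) := by
        rw [← integral_indicator Metric.isClosed_closedBall.measurableSet]
        refine integral_mono ((h.int_ed 0).indicator Metric.isClosed_closedBall.measurableSet)
          (h_int 0) fun x => ?_
        by_cases hx : x ∈ Metric.closedBall (0 : E3) r
        · simp only [indicator_of_mem hx]
          have : φ (0, x) = 1 := by
            apply smoothTransition.one_of_one_le
            simp only [hψ, nsq_eq]
            have h1 : ‖x‖ ^ 2 ≤ r ^ 2 := pow_le_pow_left₀ (norm_nonneg _) (by simpa using hx) 2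
            rw [inv_mul_eq_div, le_div_iff₀ (by positivity)]
            nlinarith
          rw [this, one_mul]
        · simp only [indicator_of_notMem hx]
          exact mul_nonneg (smoothTransition.nonneg _) (ed_nonneg _ _)
    _ ≤ ∫ x, φ (t, x) * ed v (t, x) := h01
    _ ≤ _ := by
        rw [← integral_indicator Metric.isClosed_closedBall.measurableSet]
        refine integral_mono (h_int t)
          ((h.int_ed t).indicator Metric.isClosed_closedBall.measurableSet) fun x => ?_
        by_cases hx : x ∈ Metric.closedBall (0 : E3) (2 * r + t)
        · simp only [indicator_of_mem hx]
          exact mul_le_of_le_one_left (ed_nonneg _ _) (smoothTransition.le_one _)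
        · simp only [indicator_of_notMem hx]
          have hx' : 2 * r + t < ‖x‖ := by simpa using hx
          have : φ (t, x) = 0 :=
            smoothTransition.zero_of_nonpos (hψ0 t x (by linarith) (by linarith))
          rw [this, zero_mul]

theorem ed_translate (a p : Spt) : ed (fun p => v (p + a)) p = ed v (p + a) := by
  have hD : ∀ ξ : Spt, DD ξ (fun p => v (p + a)) p = DD ξ v (p + a) := by
    intro ξ; simp [DD, fderiv_comp_add_right]
  simp [ed, gsq, hD]

theorem ed_reverse (h : ContDiff ℝ (⊤ : ℕ∞) v) (p : Spt) :
    ed (fun p : Spt => v (-p.1, p.2)) p = ed v (-p.1, p.2) := by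
  let L : Spt →L[ℝ] Spt := (-(ContinuousLinearMap.fst ℝ ℝ E3)).prod (ContinuousLinearMap.snd ℝ ℝ E3)
  have hL : ∀ p, L p = (-p.1, p.2) := fun p => rfl
  have hD : ∀ ξ p, DD ξ (fun p : Spt => v (-p.1, p.2)) p = DD (L ξ) v (-p.1, p.2) := by
    intro ξ p
    have := (((smooth_diff h) (L p)).hasFDerivAt.comp p L.hasFDerivAt).fderiv
    have h2 : fderiv ℝ (fun p : Spt => v (-p.1, p.2)) p = _ := this
    rw [DD, h2]; rfl
  have hT : L eT = - eT := by simp [hL, eT]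
  have hX : ∀ i, L (eX i) = eX i := by intro i; simp [hL, eX]
  simp only [ed, gsq, hD, hT, hX]
  simp [DD]

theorem setIntegral_closedBall_add (f : E3 → ℝ) (y : E3) (r : ℝ) :
    ∫ x in Metric.closedBall (0 : E3) r, f (x + y) = ∫ x in Metric.closedBall y r, f x := by
  rw [← integral_indicator Metric.isClosed_closedBall.measurableSet,
    ← integral_indicator Metric.isClosed_closedBall.measurableSet,
    ← integral_add_right_eq_self ((Metric.closedBall y r).indicator f) y]
  congr 1; ext x
  simp [indicator, dist_eq_norm]

/-- Finite speed of propagation for the local energy. -/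
theorem finite_speed (h : Sol v E) {r : ℝ} (hr : 0 < r) (t₀ t : ℝ) (y : E3) :
    ∫ x in Metric.closedBall y r, ed v (t₀, x) ≤
      ∫ x in Metric.closedBall y (2 * r + |t - t₀|), ed v (t, x) := by
  have h1 := h.translate (t₀, y)
  rcases le_total t₀ t with h0 | h0
  · have := h1.finite_speed_origin hr (sub_nonneg.2 h0)
    simp only [ed_translate, Prod.mk_add_mk, sub_add_cancel, zero_add] at this
    rw [setIntegral_closedBall_add (fun x => ed v (t₀, x)),
      setIntegral_closedBall_add (fun x => ed v (t, x))] at this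
    rwa [abs_of_nonneg (sub_nonneg.2 h0)]
  · have := h1.reverse.finite_speed_origin hr (sub_nonneg.2 h0)
    simp only [ed_reverse h1.smooth] at this
    simp only [ed_translate, Prod.mk_add_mk, neg_sub, sub_add_cancel, zero_add, neg_zero] at this
    rw [setIntegral_closedBall_add (fun x => ed v (t₀, x)),
      setIntegral_closedBall_add (fun x => ed v (t, x))] at this
    rwa [abs_of_nonpos (sub_nonpos.2 h0), neg_sub]

end Sol

/-! ### The Morawetz-type balance law -/

/-- The radial derivative `x · ∇v`. -/
def rad (v : Spt → ℝ) (p : Spt) : ℝ := ∑ i, p.2 i * DD (eX i) v p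

/-- Morawetz density centred at time `-a`. -/
def mq (v : Spt → ℝ) (a : ℝ) (p : Spt) : ℝ :=
  (p.1 + a) * ed v p + DD eT v p * rad v p + v p * DD eT v p
    + (p.1 + a)⁻¹ * ((3/2) * v p ^ 2 + v p * rad v p)

/-- Morawetz flux centred at time `-a`. -/
def mV (v : Spt → ℝ) (a : ℝ) (i : Fin 3) (p : Spt) : ℝ :=
  (p.1 + a) * (DD eT v p * DD (eX i) v p) + DD (eX i) v p * rad v p + v p * DD (eX i) v p
    + p.2 i * ((1/2) * DD eT v p ^ 2 - (1/2) * gsq v p - (1/6) * v p ^ 6)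
    + p.2 i * ((p.1 + a)⁻¹ * (v p * DD eT v p) - (p.1 + a)⁻¹ ^ 2 * ((1/2) * v p ^ 2))

@[fun_prop]
theorem rad_smooth {v : Spt → ℝ} (h : ContDiff ℝ (⊤ : ℕ∞) v) :
    ContDiff ℝ (⊤ : ℕ∞) (rad v) := by
  unfold rad; fun_prop

theorem inv_time_smooth {a : ℝ} {p : Spt} (hp : p.1 + a ≠ 0) {n : WithTop ℕ∞} :
    ContDiffAt ℝ n (fun p : Spt => (p.1 + a)⁻¹) p :=
  (by fun_prop : ContDiffAt ℝ n (fun p : Spt => p.1 + a) p).inv hp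

theorem mq_smooth {v : Spt → ℝ} (h : ContDiff ℝ (⊤ : ℕ∞) v) {a : ℝ} {p : Spt}
    (hp : p.1 + a ≠ 0) : ContDiffAt ℝ 1 (mq v a) p := by
  have h1 := inv_time_smooth hp (n := 1)
  have e0 := smooth_one h p
  have e1 := smooth_one (ed_smooth h) p
  have e2 := smooth_one (rad_smooth h) p
  have e3 := smooth_one (DD_smooth (ξ := eT) h) p
  unfold mq
  fun_prop

theorem mV_smooth {v : Spt → ℝ} (h : ContDiff ℝ (⊤ : ℕ∞) v) {a : ℝ} {p : Spt}
    (hp : p.1 + a ≠ 0) (i : Fin 3) : ContDiffAt ℝ 1 (mV v a i) p := by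
  have h1 := inv_time_smooth hp (n := 1)
  have e0 := smooth_one h p
  have e1 := smooth_one (gsq_smooth h) p
  have e2 := smooth_one (rad_smooth h) p
  have e3 := smooth_one (DD_smooth (ξ := eT) h) p
  have e4 := smooth_one (DD_smooth (ξ := eX i) h) p
  have e5 := coord_smooth (n := 1) i |>.contDiffAt (x := p)
  unfold mV
  fun_prop

theorem Sol.morawetz_law {v : Spt → ℝ} {E : ℝ} (h : Sol v E) {a : ℝ} {p : Spt}
    (hp : p.1 + a ≠ 0) :
    DD eT (mq v a) p = ∑ i, DD (eX i) (mV v a i) p + (- (1/3) * v p ^ 6) := by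
  have hs := h.smooth
  have hc : ∀ i, DD (eX i) (DD eT v) p = DD eT (DD (eX i) v) p := fun i => DD_comm hs
  have hc2 : ∀ i j, DD (eX i) (DD (eX j) v) p = DD (eX j) (DD (eX i) v) p := fun i j => DD_comm hs
  have hd : DifferentiableAt ℝ (fun p : Spt => (p.1 + a)⁻¹) p :=
    (inv_time_smooth hp (n := 1)).differentiableAt (by simp)
  have hiT : DD eT (fun p : Spt => (p.1 + a)⁻¹) p = - (p.1 + a)⁻¹ ^ 2 := by
    rw [DD_inv (f := fun p : Spt => p.1 + a) (by fun_prop) hp, DD_add (by fun_prop) (by fun_prop), DD_fst_T, DD_const]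
    field_simp
    norm_num
  have hiX : ∀ i, DD (eX i) (fun p : Spt => (p.1 + a)⁻¹) p = 0 := by
    intro i
    rw [DD_inv (f := fun p : Spt => p.1 + a) (by fun_prop) hp, DD_add (by fun_prop) (by fun_prop), DD_fst_X, DD_const]
    simp
  have h10 := hc2 1 0
  have h20 := hc2 2 0
  have h21 := hc2 2 1
  unfold mq mV ed gsq rad
  simp (disch := fun_prop) only [DD_add, DD_sub, DD_mul, DD_pow, DD_const, DD_sum, h.eqn, hc,
    hiT, hiX, DD_fst_T, DD_fst_X, DD_snd_T, DD_snd_X]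
  simp only [Fin.sum_univ_three, h10, h20, h21]
  simp only [Fin.isValue, reduceIte, Fin.reduceEq]
  push_cast
  generalize (p.1 + a)⁻¹ = s at *
  generalize p.1 + a = τ at *
  generalize v p = u
  generalize DD eT v p = ut
  ring

/-! ### Pointwise bounds for the Morawetz quantities -/

theorem rad_sq_le (v : Spt → ℝ) (p : Spt) : rad v p ^ 2 ≤ ‖p.2‖ ^ 2 * gsq v p := by
  rw [← nsq_eq]
  exact Finset.sum_mul_sq_le_sq_mul_sq _ _ _

theorem partial_sq_le (v : Spt → ℝ) (p : Spt) (i : Fin 3) : DD (eX i) v p ^ 2 ≤ gsq v p :=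
  Finset.single_le_sum (f := fun i => DD (eX i) v p ^ 2) (fun _ _ => sq_nonneg _)
    (Finset.mem_univ i)

theorem coord_sq_le (p : Spt) (i : Fin 3) : p.2 i ^ 2 ≤ ‖p.2‖ ^ 2 := by
  rw [← nsq_eq]
  exact Finset.single_le_sum (f := fun i => p.2 i ^ 2) (fun _ _ => sq_nonneg _)
    (Finset.mem_univ i)

section
variable {v : Spt → ℝ} {a : ℝ} {p : Spt}

theorem exists_scaled (hτ : 0 < p.1 + a) (hx : ‖p.2‖ ≤ p.1 + a) :
    ∃ U X : ℝ, v p = (p.1 + a) * U ∧ rad v p = (p.1 + a) * X ∧ X ^ 2 ≤ gsq v p ∧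
      U ^ 2 = (v p / (p.1 + a)) ^ 2 := by
  refine ⟨v p / (p.1 + a), rad v p / (p.1 + a), by field_simp, by field_simp, ?_, rfl⟩
  rw [div_pow, div_le_iff₀ (by positivity)]
  have h1 := rad_sq_le v p
  have h2 : ‖p.2‖ ^ 2 ≤ (p.1 + a) ^ 2 := pow_le_pow_left₀ (norm_nonneg _) hx 2
  nlinarith [gsq_nonneg v p]

theorem mq_lower (hτ : 0 < p.1 + a) (hx : ‖p.2‖ ≤ p.1 + a) :
    (p.1 + a) * ((1/6) * v p ^ 6) ≤ mq v a p := by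
  obtain ⟨U, X, hU, hX, hX2, -⟩ := exists_scaled (v := v) hτ hx
  have key : mq v a p - (p.1 + a) * ((1/6) * v p ^ 6) = (p.1 + a) *
      ((1/2) * (DD eT v p + (X + U)) ^ 2 + (1/2) * (gsq v p - X ^ 2) + U ^ 2) := by
    unfold mq ed
    rw [hX]
    generalize gsq v p = g
    generalize DD eT v p = w
    rw [hU]
    field_simp
    ring
  have : 0 ≤ (p.1 + a) *
      ((1/2) * (DD eT v p + (X + U)) ^ 2 + (1/2) * (gsq v p - X ^ 2) + U ^ 2) := by
    apply mul_nonneg hτ.le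
    nlinarith [sq_nonneg (DD eT v p + (X + U)), sq_nonneg U]
  linarith

theorem mq_abs_le (hτ : 0 < p.1 + a) (hx : ‖p.2‖ ≤ p.1 + a) :
    |mq v a p| ≤ 4 * ((p.1 + a) * (ed v p + (v p / (p.1 + a)) ^ 2)) := by
  obtain ⟨U, X, hU, hX, hX2, hU2⟩ := exists_scaled (v := v) hτ hx
  rw [← hU2]
  have h6 : 0 ≤ v p ^ 6 := by positivity
  have key : mq v a p = (p.1 + a) *
      (ed v p + DD eT v p * X + U * DD eT v p + (3/2) * U ^ 2 + U * X) := by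
    unfold mq
    rw [hX]
    generalize ed v p = g
    generalize DD eT v p = w
    rw [hU]
    field_simp
    ring
  rw [key, abs_mul, abs_of_pos hτ]
  have : |ed v p + DD eT v p * X + U * DD eT v p + (3/2) * U ^ 2 + U * X|
      ≤ 4 * (ed v p + U ^ 2) := by
    unfold ed
    generalize DD eT v p = w at *
    generalize gsq v p = g at *
    rw [abs_le]
    constructor <;>
    nlinarith [sq_nonneg (w + X), sq_nonneg (w - X), sq_nonneg (U + w), sq_nonneg (U - w),
      sq_nonneg (U + X), sq_nonneg (U - X)]
  nlinarith

theorem mV_abs_le (hτ : 0 < p.1 + a) (hx : ‖p.2‖ ≤ p.1 + a) (i : Fin 3) :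
    |mV v a i p| ≤ 6 * ((p.1 + a) * (ed v p + (v p / (p.1 + a)) ^ 2)) := by
  obtain ⟨U, X, hU, hX, hX2, hU2⟩ := exists_scaled (v := v) hτ hx
  rw [← hU2]
  have h6 : 0 ≤ v p ^ 6 := by positivity
  have hi := partial_sq_le v p i
  obtain ⟨ξ, hξ, hξ2⟩ : ∃ ξ : ℝ, p.2 i = (p.1 + a) * ξ ∧ |ξ| ≤ 1 := by
    refine ⟨p.2 i / (p.1 + a), by field_simp, ?_⟩
    rw [abs_div, abs_of_pos hτ, div_le_one hτ]
    exact (abs_le_of_sq_le_sq (coord_sq_le p i) (norm_nonneg _)).trans' (le_refl _) |>.trans hx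
  have key : mV v a i p = (p.1 + a) *
      (DD eT v p * DD (eX i) v p + DD (eX i) v p * X + U * DD (eX i) v p +
        ξ * ((1/2) * DD eT v p ^ 2 - (1/2) * gsq v p - (1/6) * v p ^ 6 + U * DD eT v p
          - (1/2) * U ^ 2)) := by
    unfold mV
    rw [hX, hξ]
    generalize gsq v p = g
    generalize DD eT v p = w
    generalize DD (eX i) v p = y
    generalize v p ^ 6 = k
    rw [hU]
    field_simp
    ring
  rw [key, abs_mul, abs_of_pos hτ]
  generalize hk : v p ^ 6 = k at *
  have e1 : |ξ * ((1/2) * DD eT v p ^ 2 - (1/2) * gsq v p - (1/6) * k + U * DD eT v p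
          - (1/2) * U ^ 2)| ≤ 2 * ed v p + U ^ 2 := by
    rw [abs_mul]
    refine (mul_le_of_le_one_left (abs_nonneg _) hξ2).trans ?_
    unfold ed
    rw [hk]
    have := gsq_nonneg v p
    generalize DD eT v p = w at *
    generalize gsq v p = g at *
    rw [abs_le]
    constructor <;> nlinarith [sq_nonneg (U + w), sq_nonneg (U - w)]
  have e2 : |DD eT v p * DD (eX i) v p + DD (eX i) v p * X + U * DD (eX i) v p|
      ≤ 4 * ed v p + U ^ 2 := by
    unfold ed
    rw [hk]
    generalize DD eT v p = w at *
    generalize gsq v p = g at *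
    generalize DD (eX i) v p = y at *
    rw [abs_le]
    constructor <;>
    nlinarith [sq_nonneg (w + y), sq_nonneg (w - y), sq_nonneg (y + X), sq_nonneg (y - X),
      sq_nonneg (U + y), sq_nonneg (U - y)]
  have e3 := (abs_add_le (DD eT v p * DD (eX i) v p + DD (eX i) v p * X + U * DD (eX i) v p)
    (ξ * ((1/2) * DD eT v p ^ 2 - (1/2) * gsq v p - (1/6) * k + U * DD eT v p
          - (1/2) * U ^ 2))).trans (add_le_add e2 e1)
  have e4 : 0 ≤ U ^ 2 := sq_nonneg U
  nlinarith

theorem div_sq_le (v : Spt → ℝ) (p : Spt) {τ η : ℝ} (hτ : 0 < τ) (hη : 0 < η) :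
    (v p / τ) ^ 2 ≤ η⁻¹ ^ 2 * (6 * ed v p) + η * τ⁻¹ ^ 3 := by
  have h1 := pow6_le_ed v p
  have : (v p / τ) ^ 2 ≤ η⁻¹ ^ 2 * v p ^ 6 + η * τ⁻¹ ^ 3 := by
    obtain ⟨b, hb, hb3⟩ : ∃ b : ℝ, 0 < b ∧ b ^ 3 = η := by
      refine ⟨η ^ (1/3 : ℝ), by positivity, ?_⟩
      rw [← Real.rpow_natCast, ← Real.rpow_mul hη.le]; norm_num
    obtain ⟨c, hc, hc2⟩ : ∃ c : ℝ, 0 < c ∧ c ^ 2 = τ⁻¹ :=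
      ⟨√τ⁻¹, by positivity, Real.sq_sqrt (by positivity)⟩
    have key : ∀ x y : ℝ, 0 ≤ x → 0 ≤ y → x * y ^ 2 ≤ x ^ 3 + y ^ 3 := by
      intro x y hx hy
      nlinarith [mul_nonneg hx (sq_nonneg (x - y)), mul_nonneg hy (sq_nonneg (x - y)),
        mul_nonneg hx hy, pow_nonneg hx 3, pow_nonneg hy 3, mul_nonneg (mul_nonneg hx hx) hy]
    have := key ((b⁻¹) ^ 2 * v p ^ 2) (b * c ^ 2) (by positivity) (by positivity)
    rw [hc2] at this
    calc (v p / τ) ^ 2 = b⁻¹ ^ 2 * v p ^ 2 * (b * τ⁻¹) ^ 2 := by field_simp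
      _ ≤ _ := this
      _ = _ := by rw [← hb3]; ring
  have h2 : η⁻¹ ^ 2 * v p ^ 6 ≤ η⁻¹ ^ 2 * (6 * ed v p) := by gcongr
  linarith

end

/-! ### Decay of the potential energy inside cones with small energy flux -/

/-- Thickness parameter of the conical cutoff. -/
def coneB (κ : ℝ) : ℝ := κ + (3/4) * κ ^ 2

/-- Argument of the conical cutoff. -/
def coneψ (κ : ℝ) (p : Spt) : ℝ := (coneB κ)⁻¹ * ((1 + κ) ^ 2 - nsq p * p.1⁻¹ ^ 2)

/-- Smooth cutoff to the forward cone `|x| ≤ (1 + κ/2) t`. -/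
def coneφ (κ : ℝ) (p : Spt) : ℝ := smoothTransition (coneψ κ p)

/-- Energy inside the forward cone. -/
def coneE (κ : ℝ) (v : Spt → ℝ) (t : ℝ) : ℝ := ∫ x, coneφ κ (t, x) * ed v (t, x)

section cone
variable {κ t : ℝ} {x : E3}

theorem coneφ_nonneg (κ : ℝ) (p : Spt) : 0 ≤ coneφ κ p := smoothTransition.nonneg _

theorem coneφ_le_one (κ : ℝ) (p : Spt) : coneφ κ p ≤ 1 := smoothTransition.le_one _

theorem coneB_pos (hκ : 0 < κ) : 0 < coneB κ := by unfold coneB; positivity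

theorem coneψ_one_le (hκ : 0 < κ) (ht : 0 < t) (hx : ‖x‖ ≤ (1 + κ/2) * t) :
    1 ≤ coneψ κ (t, x) := by
  rw [coneψ, nsq_eq, inv_mul_eq_div, le_div_iff₀ (coneB_pos hκ)]
  have h1 : ‖x‖ ^ 2 * t⁻¹ ^ 2 ≤ (1 + κ/2) ^ 2 := by
    rw [← mul_pow, ← div_eq_mul_inv]
    apply pow_le_pow_left₀ (by positivity)
    rwa [div_le_iff₀ ht]
  simp only
  unfold coneB
  nlinarith

theorem coneψ_nonpos (hκ : 0 < κ) (ht : 0 < t) (hx : (1 + κ) * t ≤ ‖x‖) :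
    coneψ κ (t, x) ≤ 0 := by
  rw [coneψ, nsq_eq]
  have h1 : (1 + κ) ^ 2 ≤ ‖x‖ ^ 2 * t⁻¹ ^ 2 := by
    rw [← mul_pow, ← div_eq_mul_inv]
    apply pow_le_pow_left₀ (by positivity)
    rwa [le_div_iff₀ ht]
  exact mul_nonpos_of_nonneg_of_nonpos (inv_nonneg.2 (coneB_pos hκ).le) (by simp only; linarith)

theorem coneφ_eq_one (hκ : 0 < κ) (ht : 0 < t) (hx : ‖x‖ ≤ (1 + κ/2) * t) :
    coneφ κ (t, x) = 1 := smoothTransition.one_of_one_le (coneψ_one_le hκ ht hx)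

theorem coneφ_eq_zero (hκ : 0 < κ) (ht : 0 < t) (hx : (1 + κ) * t ≤ ‖x‖) :
    coneφ κ (t, x) = 0 := smoothTransition.zero_of_nonpos (coneψ_nonpos hκ ht hx)

theorem coneφ_eq_zero' (hκ : 0 < κ) {t₀ : ℝ} (t : ℝ) (x : E3)
    (h : |t - t₀| < t₀) (hx : (1 + κ) * (2 * t₀) < ‖x‖) : coneφ κ (t, x) = 0 := by
  have h1 := abs_lt.1 h
  refine coneφ_eq_zero hκ (by linarith) ?_
  nlinarith

theorem stD_cone_eq_zero (hκ : 0 < κ) (ht : 0 < t)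
    (hx : ¬ ((1 + κ/2) * t < ‖x‖ ∧ ‖x‖ < (1 + κ) * t)) : stD (coneψ κ (t, x)) = 0 := by
  rw [not_and_or, not_lt, not_lt] at hx
  rcases hx with hx | hx
  · exact stD_of_one_le (coneψ_one_le hκ ht hx)
  · exact stD_of_nonpos (coneψ_nonpos hκ ht hx)

theorem coneψ_smooth (ht : t ≠ 0) {n : ℕ∞} : ContDiffAt ℝ n (coneψ κ) (t, x) := by
  have h1 : ContDiffAt ℝ n (fun p : Spt => p.1⁻¹) (t, x) := contDiffAt_fst.inv ht
  have h2 : ContDiffAt ℝ n nsq (t, x) :=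
    (nsq_smooth.of_le (by exact_mod_cast le_top)).contDiffAt
  unfold coneψ
  fun_prop

theorem coneφ_smooth (ht : t ≠ 0) {n : ℕ∞} : ContDiffAt ℝ n (coneφ κ) (t, x) :=
  smoothTransition.contDiff.contDiffAt.comp _ (coneψ_smooth ht)

theorem coneφ_smooth' {t₀ : ℝ} (t : ℝ) (x : E3)
    (h : |t - t₀| < t₀) : ContDiffAt ℝ 1 (coneφ κ) (t, x) := by
  have h1 := abs_lt.1 h
  exact coneφ_smooth (n := 1) (by linarith)

theorem DD_coneφ_T (ht : t ≠ 0) : DD eT (coneφ κ) (t, x) =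
    stD (coneψ κ (t, x)) * ((coneB κ)⁻¹ * (2 * ‖x‖ ^ 2 * t⁻¹ ^ 3)) := by
  have h0 : DifferentiableAt ℝ (fun p : Spt => p.1⁻¹) (t, x) :=
    (contDiffAt_fst.inv ht : ContDiffAt ℝ 1 (fun p : Spt => p.1⁻¹) (t, x)).differentiableAt (by simp)
  have : coneφ κ = fun p => smoothTransition (coneψ κ p) := rfl
  rw [this, DD_st ((coneψ_smooth (n := 1) ht).differentiableAt (by simp))]
  have : coneψ κ = fun p => (coneB κ)⁻¹ * ((1 + κ) ^ 2 - nsq p * p.1⁻¹ ^ 2) := rfl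
  rw [this, DD_mul (by fun_prop) (by fun_prop), DD_sub (by fun_prop) (by fun_prop),
    DD_mul (by fun_prop) (by fun_prop), DD_pow h0, DD_inv (f := fun p : Spt => p.1) (by fun_prop) ht, DD_fst_T, DD_const,
    DD_const, DD_nsq_T, nsq_eq]
  simp only
  push_cast
  field_simp
  ring

theorem DD_coneφ_X (ht : t ≠ 0) (i : Fin 3) : DD (eX i) (coneφ κ) (t, x) =
    stD (coneψ κ (t, x)) * ((coneB κ)⁻¹ * (- 2 * x i * t⁻¹ ^ 2)) := by
  have h0 : DifferentiableAt ℝ (fun p : Spt => p.1⁻¹) (t, x) :=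
    (contDiffAt_fst.inv ht : ContDiffAt ℝ 1 (fun p : Spt => p.1⁻¹) (t, x)).differentiableAt (by simp)
  have : coneφ κ = fun p => smoothTransition (coneψ κ p) := rfl
  rw [this, DD_st ((coneψ_smooth (n := 1) ht).differentiableAt (by simp))]
  have : coneψ κ = fun p => (coneB κ)⁻¹ * ((1 + κ) ^ 2 - nsq p * p.1⁻¹ ^ 2) := rfl
  rw [this, DD_mul (by fun_prop) (by fun_prop), DD_sub (by fun_prop) (by fun_prop),
    DD_mul (by fun_prop) (by fun_prop), DD_pow h0, DD_inv (f := fun p : Spt => p.1) (by fun_prop) ht, DD_fst_X, DD_const,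
    DD_const, DD_nsq_X]
  simp only
  push_cast
  field_simp
  ring

theorem cone_flux_ge (hκ : 0 < κ) (hκ1 : κ ≤ 1) (ht : 0 < t) (v : Spt → ℝ) :
    (1/2) * t⁻¹ * stD (coneψ κ (t, x)) * ed v (t, x) ≤ DD eT (coneφ κ) (t, x) * ed v (t, x)
        - ∑ i, DD (eX i) (coneφ κ) (t, x) * (DD eT v (t, x) * DD (eX i) v (t, x)) := by
  by_cases hx : (1 + κ/2) * t < ‖x‖ ∧ ‖x‖ < (1 + κ) * t
  swap
  · simp [DD_coneφ_T ht.ne', DD_coneφ_X ht.ne', stD_cone_eq_zero hκ ht hx]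
  have hs := stD_nonneg (coneψ κ (t, x))
  have hB := coneB_pos hκ
  have he := ed_nonneg v (t, x)
  have h1 := Sol.flux_le v (t, x) (fun i => DD (eX i) (coneφ κ) (t, x))
    (b := stD (coneψ κ (t, x)) * ((coneB κ)⁻¹ * (2 * ‖x‖ * t⁻¹ ^ 2))) (by positivity) (by
      apply le_of_eq
      simp only [DD_coneφ_X ht.ne']
      have := nsq_eq (t, x)
      simp only [nsq] at this
      simp only [mul_pow, ← this, ← Finset.mul_sum, ← Finset.sum_mul]
      ring)
  have h2 := (abs_le.1 h1).2
  rw [DD_coneφ_T ht.ne']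
  set σ := stD (coneψ κ (t, x))
  have h3 : (1/2) * t⁻¹ ≤ (coneB κ)⁻¹ * (2 * ‖x‖ ^ 2 * t⁻¹ ^ 3)
      - (coneB κ)⁻¹ * (2 * ‖x‖ * t⁻¹ ^ 2) := by
    have e1 : (coneB κ)⁻¹ * (2 * ‖x‖ ^ 2 * t⁻¹ ^ 3) - (coneB κ)⁻¹ * (2 * ‖x‖ * t⁻¹ ^ 2)
        = (coneB κ)⁻¹ * (2 * ‖x‖ * (‖x‖ - t)) * t⁻¹ ^ 3 := by
      field_simp
    have e2 : coneB κ * t ^ 2 ≤ 4 * ‖x‖ * (‖x‖ - t) := by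
      unfold coneB
      have e3 : t ≤ ‖x‖ := by nlinarith
      have e4 : t * (κ/2 * t) ≤ ‖x‖ * (‖x‖ - t) := by
        apply mul_le_mul e3 (by linarith) (by positivity) (by positivity)
      nlinarith [mul_pos hκ (pow_pos ht 2)]
    rw [e1]
    rw [← sub_nonneg]
    have : (coneB κ)⁻¹ * (2 * ‖x‖ * (‖x‖ - t)) * t⁻¹ ^ 3 - 1/2 * t⁻¹ =
      (1/2) * (coneB κ)⁻¹ * t⁻¹ ^ 3 * (4 * ‖x‖ * (‖x‖ - t) - coneB κ * t ^ 2) := by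
      field_simp
      ring
    rw [this]
    have : 0 ≤ 4 * ‖x‖ * (‖x‖ - t) - coneB κ * t ^ 2 := by linarith
    positivity
  have h4 := mul_le_mul_of_nonneg_left h3 (mul_nonneg hs he)
  nlinarith

theorem coneE_hasDeriv {v : Spt → ℝ} {E : ℝ} (h : Sol v E) (hκ : 0 < κ) (ht : 0 < t) :
    HasDerivAt (coneE κ v) (∫ x, (DD eT (coneφ κ) (t, x) * ed v (t, x)
        - ∑ i, DD (eX i) (coneφ κ) (t, x) * (DD eT v (t, x) * DD (eX i) v (t, x)))) t :=
  h.energy_flux ht coneφ_smooth' (coneφ_eq_zero' hκ)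

theorem coneE_mono {v : Spt → ℝ} {E : ℝ} (h : Sol v E) (hκ : 0 < κ) (hκ1 : κ ≤ 1) :
    MonotoneOn (coneE κ v) (Ioi 0) := by
  refine monotoneOn_of_deriv_nonneg (convex_Ioi 0) ?_ ?_ ?_
  · intro s hs
    exact (coneE_hasDeriv h hκ hs).continuousAt.continuousWithinAt
  · intro s hs
    rw [interior_Ioi] at hs
    exact (coneE_hasDeriv h hκ hs).differentiableAt.differentiableWithinAt
  · intro s hs
    rw [interior_Ioi] at hs
    rw [(coneE_hasDeriv h hκ hs).deriv]
    refine integral_nonneg fun x => le_trans ?_ (cone_flux_ge hκ hκ1 hs v)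
    have := stD_nonneg (coneψ κ (s, x))
    have := ed_nonneg v (s, x)
    have : 0 < s := hs
    simp only [Pi.zero_apply]
    positivity

theorem integrable_cone {v : Spt → ℝ} {E : ℝ} (h : Sol v E) (ht : 0 < t) :
    Integrable (fun x => coneφ κ (t, x) * ed v (t, x)) := by
  refine (h.int_ed t).bdd_mul (c := 1) ?_ ?_
  · refine Continuous.aestronglyMeasurable ?_
    rw [continuous_iff_continuousAt]
    intro x
    exact (coneφ_smooth (n := 0) ht.ne').continuousAt.comp (f := fun x : E3 => ((t, x) : Spt))
      (by fun_prop)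
  · filter_upwards with x
    rw [Real.norm_eq_abs, abs_of_nonneg (coneφ_nonneg _ _)]
    exact coneφ_le_one _ _

theorem coneE_le {v : Spt → ℝ} {E : ℝ} (h : Sol v E) (ht : 0 < t) : coneE κ v t ≤ E := by
  refine le_trans (integral_mono (integrable_cone h ht) (h.int_ed t) fun x => ?_) (h.ed_le t)
  exact mul_le_of_le_one_left (ed_nonneg _ _) (coneφ_le_one _ _)

theorem coneE_nonneg (v : Spt → ℝ) : 0 ≤ coneE κ v t :=
  integral_nonneg fun _ => mul_nonneg (coneφ_nonneg _ _) (ed_nonneg _ _)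

end cone

/-- Volume of the unit ball in `ℝ³`. -/
def vol1 : ℝ := (volume : Measure E3).real (Metric.ball 0 1)

theorem vol1_pos : 0 < vol1 := by
  unfold vol1
  exact ENNReal.toReal_pos (Metric.measure_ball_pos _ _ one_pos).ne' measure_ball_lt_top.ne

theorem volume_real_closedBall (x : E3) {r : ℝ} (hr : 0 ≤ r) :
    (volume : Measure E3).real (Metric.closedBall x r) = r ^ 3 * vol1 := by
  rw [Measure.addHaar_real_closedBall volume x hr]
  simp [vol1]

theorem volume_closedBall_ne_top (x : E3) (r : ℝ) :
    (volume : Measure E3) (Metric.closedBall x r) ≠ ⊤ := measure_closedBall_lt_top.ne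

/-- Spherical shell. -/
def shell (κ t : ℝ) : Set E3 :=
  Metric.closedBall 0 ((1 + κ) * t) \ Metric.closedBall 0 ((1 + κ/2) * t)

theorem measurableSet_shell (κ t : ℝ) : MeasurableSet (shell κ t) :=
  Metric.isClosed_closedBall.measurableSet.diff Metric.isClosed_closedBall.measurableSet

theorem shell_ne_top (κ t : ℝ) : (volume : Measure E3) (shell κ t) ≠ ⊤ :=
  ((measure_mono sdiff_subset).trans_lt measure_closedBall_lt_top).ne

theorem shell_volume {κ t : ℝ} (hκ : 0 < κ) (hκ1 : κ ≤ 1) (ht : 0 < t) :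
    (volume : Measure E3).real (shell κ t) ≤ 6 * κ * t ^ 3 * vol1 := by
  have hsub : Metric.closedBall (0 : E3) ((1 + κ/2) * t) ⊆ Metric.closedBall 0 ((1 + κ) * t) :=
    Metric.closedBall_subset_closedBall (by nlinarith)
  rw [shell, measureReal_sdiff hsub Metric.isClosed_closedBall.measurableSet
    (volume_closedBall_ne_top _ _),
    volume_real_closedBall _ (by positivity), volume_real_closedBall _ (by positivity)]
  have : ((1 + κ) * t) ^ 3 - ((1 + κ/2) * t) ^ 3 ≤ 6 * κ * t ^ 3 := by
    have h3 : 0 < t ^ 3 := by positivity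
    have : (1 + κ) ^ 3 - (1 + κ/2) ^ 3 ≤ 6 * κ := by
      nlinarith [mul_pos hκ hκ, mul_nonneg hκ.le (sub_nonneg.2 hκ1),
        mul_nonneg (mul_pos hκ hκ).le (sub_nonneg.2 hκ1)]
    nlinarith
  nlinarith [vol1_pos]

theorem cone_error {κ η t T : ℝ} {x : E3} {v : Spt → ℝ} (hκ : 0 < κ) (hκ1 : κ ≤ 1) (hη : 0 < η)
    (ht : 0 < t) (htT : t ≤ T) :
    DD eT (coneφ κ) (t, x) * mq v (κ * T) (t, x)
      - ∑ i, DD (eX i) (coneφ κ) (t, x) * mV v (κ * T) i (t, x) ≤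
    104 * κ⁻¹ * (4 * T * (1 + 6 * η⁻¹ ^ 2)) *
      ((1/2) * t⁻¹ * stD (coneψ κ (t, x)) * ed v (t, x)) +
    104 * κ⁻¹ * η * t⁻¹ ^ 3 * stD (coneψ κ (t, x)) := by
  have hs := stD_nonneg (coneψ κ (t, x))
  have hB := coneB_pos hκ
  have he := ed_nonneg v (t, x)
  have hT : 0 < T := ht.trans_le htT
  by_cases hx : (1 + κ/2) * t < ‖x‖ ∧ ‖x‖ < (1 + κ) * t
  swap
  · simp [DD_coneφ_T ht.ne', DD_coneφ_X ht.ne', stD_cone_eq_zero hκ ht hx]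
  have hτ : 0 < t + κ * T := by positivity
  have hxτ : ‖x‖ ≤ t + κ * T := by nlinarith [hx.2]
  have hx2 : ‖x‖ ≤ 2 * t := by nlinarith [hx.2]
  have hBi : (coneB κ)⁻¹ ≤ κ⁻¹ := by
    apply inv_anti₀ hκ; unfold coneB; nlinarith [sq_nonneg κ]
  have m1 := mq_abs_le (v := v) (a := κ * T) (p := (t, x)) hτ hxτ
  have m2 := mV_abs_le (v := v) (a := κ * T) (p := (t, x)) hτ hxτ
  have m3 := div_sq_le v (t, x) hτ hη
  simp only at m1 m2 m3
  set τ := t + κ * T with hτdef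
  set D := ed v (t, x) + (v (t, x) / τ) ^ 2 with hD
  have hD0 : 0 ≤ D := by positivity
  have dT : |DD eT (coneφ κ) (t, x)| ≤ stD (coneψ κ (t, x)) * (κ⁻¹ * (8 * t⁻¹)) := by
    rw [DD_coneφ_T ht.ne', abs_of_nonneg (by positivity)]
    have e : 2 * ‖x‖ ^ 2 * t⁻¹ ^ 3 ≤ 8 * t⁻¹ := by
      calc 2 * ‖x‖ ^ 2 * t⁻¹ ^ 3 ≤ 2 * (2 * t) ^ 2 * t⁻¹ ^ 3 := by gcongr
        _ = 8 * t⁻¹ := by field_simp; norm_num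
    exact mul_le_mul_of_nonneg_left (mul_le_mul hBi e (by positivity) (by positivity)) hs
  have dX : ∀ i, |DD (eX i) (coneφ κ) (t, x)| ≤ stD (coneψ κ (t, x)) * (κ⁻¹ * (4 * t⁻¹)) := by
    intro i
    rw [DD_coneφ_X ht.ne', abs_mul, abs_of_nonneg hs, abs_mul, abs_of_pos (by positivity)]
    gcongr
    rw [abs_mul, abs_of_pos (by positivity : 0 < t⁻¹ ^ 2), abs_mul]
    have : |x i| ≤ 2 * t :=
      (abs_le_of_sq_le_sq (coord_sq_le (t, x) i) (norm_nonneg _)).trans hx2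
    calc |(-2:ℝ)| * |x i| * t⁻¹ ^ 2 ≤ |(-2:ℝ)| * (2 * t) * t⁻¹ ^ 2 := by gcongr
      _ = 4 * t⁻¹ := by norm_num; field_simp; norm_num
  have hA : DD eT (coneφ κ) (t, x) * mq v (κ * T) (t, x) ≤
      stD (coneψ κ (t, x)) * (κ⁻¹ * (8 * t⁻¹)) * (4 * (τ * D)) := by
    refine (le_abs_self _).trans ?_
    rw [abs_mul]
    gcongr
  have hBn : - ∑ i, DD (eX i) (coneφ κ) (t, x) * mV v (κ * T) i (t, x) ≤
      3 * (stD (coneψ κ (t, x)) * (κ⁻¹ * (4 * t⁻¹)) * (6 * (τ * D))) := by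
    refine (neg_le_abs _).trans ((Finset.abs_sum_le_sum_abs _ _).trans ?_)
    have : ∀ i ∈ (Finset.univ : Finset (Fin 3)),
      |DD (eX i) (coneφ κ) (t, x) * mV v (κ * T) i (t, x)| ≤
        stD (coneψ κ (t, x)) * (κ⁻¹ * (4 * t⁻¹)) * (6 * (τ * D)) := by
      intro i _
      rw [abs_mul]
      gcongr
      · exact dX i
      · exact m2 i
    refine (Finset.sum_le_card_nsmul _ _ _ this).trans ?_
    simp
  have hτ2 : τ ≤ 2 * T := by nlinarith
  have hDτ : τ * D ≤ 2 * T * (1 + 6 * η⁻¹ ^ 2) * ed v (t, x) + η * t⁻¹ ^ 2 := by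
    have e1 : τ * D ≤ τ * ((1 + 6 * η⁻¹ ^ 2) * ed v (t, x)) + η * τ⁻¹ ^ 2 := by
      have : τ * (η * τ⁻¹ ^ 3) = η * τ⁻¹ ^ 2 := by field_simp
      rw [← this, ← mul_add]
      gcongr
      rw [hD]; linarith
    have e2 : τ * ((1 + 6 * η⁻¹ ^ 2) * ed v (t, x)) ≤ 2 * T * ((1 + 6 * η⁻¹ ^ 2) * ed v (t, x)) := by
      gcongr
    have e3 : η * τ⁻¹ ^ 2 ≤ η * t⁻¹ ^ 2 := by
      gcongr; nlinarith [mul_pos hκ hT]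
    nlinarith
  calc _ ≤ 104 * κ⁻¹ * t⁻¹ * stD (coneψ κ (t, x)) * (τ * D) := by nlinarith
    _ ≤ 104 * κ⁻¹ * t⁻¹ * stD (coneψ κ (t, x)) *
        (2 * T * (1 + 6 * η⁻¹ ^ 2) * ed v (t, x) + η * t⁻¹ ^ 2) := by gcongr
    _ = _ := by ring

/-- Potential energy decays inside a forward cone unless energy flows into the cone. -/
theorem exists_decay : ∃ K : ℝ, 1 ≤ K ∧ ∀ (v : Spt → ℝ) (E : ℝ), Sol v E →
    ∀ κ η T : ℝ, 0 < κ → κ ≤ 1 → 0 < η → 0 < T →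
    ∫ x in Metric.closedBall (0 : E3) ((1 + κ/2) * T), v (T, x) ^ 6 ≤
      K * (κ * (E + 1) + (1 + 6 * η⁻¹ ^ 2) * κ⁻¹ * (coneE κ v T - coneE κ v (κ * T)) + η) := by
  obtain ⟨Cs, hCs1, hCs⟩ := exists_stD_le
  have hv1 := vol1_pos
  refine ⟨2496 + 3744 * vol1 * Cs, by nlinarith, ?_⟩
  intro v E h κ η T hκ hκ1 hη hT
  have hE := h.nonneg
  set a := κ * T with ha
  have ha0 : 0 < a := by positivity
  have haT : a ≤ T := by nlinarith
  set c1 := 104 * κ⁻¹ * (4 * T * (1 + 6 * η⁻¹ ^ 2)) with hc1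
  have hc10 : 0 ≤ c1 := by positivity
  set c2 := 624 * vol1 * Cs * η with hc2
  set G : ℝ → ℝ := fun t => ∫ x, coneφ κ (t, x) * (mq v a (t, x) - c1 * ed v (t, x)) with hG
  have hder : ∀ t, 0 < t → t ≤ T → ∃ g, HasDerivAt G g t ∧ g ≤ c2 := by
    intro t ht htT
    have hpos : ∀ s, |s - t| < t → s + a ≠ 0 := by
      intro s hs
      have := (abs_lt.1 hs).1
      linarith
    obtain ⟨b1, b2⟩ := balance (φ := coneφ κ) (q := fun p => mq v a p - c1 * ed v p)
      (V := fun i p => mV v a i p - c1 * (DD eT v p * DD (eX i) v p))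
      (S := fun x => - (1/3) * v (t, x) ^ 6) (t₀ := t) ht
      coneφ_smooth' (fun s x hs => (mq_smooth h.smooth (hpos s hs)).sub
        (contDiffAt_const.mul (smooth_one (ed_smooth h.smooth) _)))
      (fun i s x hs => (mV_smooth h.smooth (hpos s hs) i).sub
        (contDiffAt_const.mul (((smooth_one (DD_smooth h.smooth) _)).mul
          ((smooth_one (DD_smooth h.smooth) _))))) (coneφ_eq_zero' hκ) (by
        intro x
        have hp := hpos t (by simpa)
        have hs := h.smooth
        have e1 := (mq_smooth hs (p := (t, x)) hp).differentiableAt (by simp)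
        have e2 := fun i => (mV_smooth hs (p := (t, x)) hp i).differentiableAt (by simp)
        rw [DD_sub e1 (by fun_prop), DD_mul (by fun_prop) (by fun_prop), DD_const,
          h.morawetz_law hp, h.energy_law]
        have : ∀ i, DD (eX i) (fun p => mV v a i p - c1 * (DD eT v p * DD (eX i) v p)) (t, x)
          = DD (eX i) (mV v a i) (t, x)
            - c1 * DD (eX i) (fun p => DD eT v p * DD (eX i) v p) (t, x) := by
          intro i
          rw [DD_sub (e2 i) (by fun_prop),
            DD_mul (f := fun _ => c1) (g := fun p => DD eT v p * DD (eX i) v p)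
              (by fun_prop) (by fun_prop), DD_const]
          ring
        simp only [this, Finset.sum_sub_distrib, ← Finset.mul_sum]
        ring)
    refine ⟨_, b1, ?_⟩
    have hdom : Integrable ((shell κ t).indicator
        (fun _ : E3 => 104 * κ⁻¹ * η * t⁻¹ ^ 3 * Cs)) :=
      (integrable_indicator_iff (measurableSet_shell _ _)).2
        (integrableOn_const (shell_ne_top _ _))
    refine (integral_mono b2 hdom fun x => ?_).trans ?_
    · have f1 := cone_flux_ge (x := x) hκ hκ1 ht v
      have f2 := cone_error (x := x) (v := v) hκ hκ1 hη ht htT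
      have f3 : 0 ≤ v (t, x) ^ 6 := by positivity
      have f4 := coneφ_nonneg κ (t, x)
      have f5 := mul_le_mul_of_nonneg_left f1 hc10
      have f6 : 104 * κ⁻¹ * η * t⁻¹ ^ 3 * stD (coneψ κ (t, x)) ≤ (shell κ t).indicator
          (fun _ : E3 => 104 * κ⁻¹ * η * t⁻¹ ^ 3 * Cs) x := by
        by_cases hx : x ∈ shell κ t
        · rw [indicator_of_mem hx]
          have := hCs (coneψ κ (t, x))
          gcongr
        · rw [indicator_of_notMem hx, stD_cone_eq_zero hκ ht, mul_zero]
          intro hx2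
          apply hx
          simp only [shell, mem_sdiff, mem_closedBall_zero_iff]
          exact ⟨hx2.2.le, not_le.2 hx2.1⟩
      simp only [mul_sub, Finset.sum_sub_distrib]
      have f7 : ∑ i, DD (eX i) (coneφ κ) (t, x) * (c1 * (DD eT v (t, x) * DD (eX i) v (t, x)))
        = c1 * ∑ i, DD (eX i) (coneφ κ) (t, x) * (DD eT v (t, x) * DD (eX i) v (t, x)) := by
        rw [Finset.mul_sum]; congr 1; ext i; ring
      rw [f7]
      have f8 : 0 ≤ coneφ κ (t, x) * v (t, x) ^ 6 := by positivity
      linarith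
    · rw [integral_indicator_const _ (measurableSet_shell _ _), smul_eq_mul]
      have hc : 0 ≤ 104 * κ⁻¹ * η * t⁻¹ ^ 3 * Cs := by positivity
      refine (mul_le_mul_of_nonneg_right (shell_volume hκ hκ1 ht) hc).trans (le_of_eq ?_)
      rw [hc2]
      field_simp
      norm_num
  have hstep : G T - G a ≤ c2 * (T - a) := by
    refine Convex.image_sub_le_mul_sub_of_deriv_le (convex_Icc a T) ?_ ?_ ?_ a
      (left_mem_Icc.2 haT) T (right_mem_Icc.2 haT) haT
    · intro s hs
      obtain ⟨g, hg, -⟩ := hder s (ha0.trans_le hs.1) hs.2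
      exact hg.continuousAt.continuousWithinAt
    · intro s hs
      rw [interior_Icc] at hs
      obtain ⟨g, hg, -⟩ := hder s (ha0.trans hs.1) hs.2.le
      exact hg.differentiableAt.differentiableWithinAt
    · intro s hs
      rw [interior_Icc] at hs
      obtain ⟨g, hg, hg2⟩ := hder s (ha0.trans hs.1) hs.2.le
      rwa [hg.deriv]
  have hmqint : ∀ t, 0 < t → Integrable (fun x => coneφ κ (t, x) * mq v a (t, x)) := by
    intro t ht
    refine integrable_of_ball (R := (1 + κ) * t) ?_ ?_
    · rw [continuous_iff_continuousAt]
      intro x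
      have h1 := (mq_smooth h.smooth (a := a) (p := (t, x)) (by simp only; positivity)).continuousAt
      have h2 := (coneφ_smooth (κ := κ) (x := x) (n := 0) ht.ne').continuousAt
      exact (h2.mul h1).comp (f := fun x : E3 => ((t, x) : Spt)) (by fun_prop)
    · intro x hx
      rw [coneφ_eq_zero hκ ht hx.le, zero_mul]
  have hsplit : ∀ t, 0 < t → ∫ x, coneφ κ (t, x) * mq v a (t, x) = G t + c1 * coneE κ v t := by
    intro t ht
    rw [hG, coneE, ← integral_const_mul]
    have : Integrable (fun x => c1 * (coneφ κ (t, x) * ed v (t, x))) :=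
      (integrable_cone h ht).const_mul c1
    rw [← integral_add _ this]
    · congr 1; ext x; ring
    · have := (hmqint t ht).sub this
      refine this.congr (Filter.Eventually.of_forall fun x => ?_)
      simp only [Pi.sub_apply]; ring
  -- lower bound at the final time
  have hlow : T * ((1/6) * ∫ x in Metric.closedBall (0 : E3) ((1 + κ/2) * T), v (T, x) ^ 6) ≤
      ∫ x, coneφ κ (T, x) * mq v a (T, x) := by
    rw [← integral_indicator Metric.isClosed_closedBall.measurableSet, ← integral_const_mul,
      ← integral_const_mul]
    refine integral_mono ?_ (hmqint T hT) fun x => ?_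
    · have h6 : Integrable (fun x => v (T, x) ^ 6) := by
        refine ((h.int_ed T).const_mul 6).mono'
          ((h.smooth.continuous.comp (by fun_prop)).pow 6).aestronglyMeasurable ?_
        filter_upwards with x
        rw [Real.norm_eq_abs, abs_of_nonneg (by positivity)]
        exact pow6_le_ed v (T, x)
      exact ((h6.indicator Metric.isClosed_closedBall.measurableSet).const_mul _).const_mul _
    · have hTa : 0 < T + a := by positivity
      by_cases hx : x ∈ Metric.closedBall (0 : E3) ((1 + κ/2) * T)
      · simp only [indicator_of_mem hx]
        have hx' : ‖x‖ ≤ (1 + κ/2) * T := by simpa using hx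
        rw [coneφ_eq_one hκ hT hx', one_mul]
        refine le_trans ?_ (mq_lower (p := (T, x)) hTa ?_)
        · simp only
          gcongr
          linarith
        · simp only [ha]; nlinarith
      · simp only [indicator_of_notMem hx, mul_zero]
        by_cases hx2 : (1 + κ) * T ≤ ‖x‖
        · rw [coneφ_eq_zero hκ hT hx2, zero_mul]
        · push Not at hx2
          have := mq_lower (v := v) (p := (T, x)) hTa (by simp only [ha]; nlinarith)
          have h0 : 0 ≤ mq v a (T, x) := le_trans (by simp only; positivity) this
          exact mul_nonneg (coneφ_nonneg _ _) h0
  -- upper bound at the initial time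
  have hup : ∫ x, coneφ κ (a, x) * mq v a (a, x) ≤ 8 * a * (7 * E + vol1) := by
    have hdom : Integrable ((Metric.closedBall (0 : E3) (2 * a)).indicator
        (fun _ => 4 * ((2 * a) * (2 * a)⁻¹ ^ 3))) :=
      (integrable_indicator_iff Metric.isClosed_closedBall.measurableSet).2
        (integrableOn_const (volume_closedBall_ne_top _ _))
    have hdom2 := ((h.int_ed a).const_mul (4 * ((2 * a) * 7)))
    calc ∫ x, coneφ κ (a, x) * mq v a (a, x)
        ≤ ∫ x, (4 * ((2 * a) * 7) * ed v (a, x) + (Metric.closedBall (0 : E3) (2 * a)).indicator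
            (fun _ => 4 * ((2 * a) * (2 * a)⁻¹ ^ 3)) x) := by
          refine integral_mono (hmqint a ha0) (hdom2.add hdom) fun x => ?_
          have he := ed_nonneg v (a, x)
          by_cases hx : x ∈ Metric.closedBall (0 : E3) (2 * a)
          · simp only [indicator_of_mem hx]
            have hx' : ‖x‖ ≤ a + a := by have := mem_closedBall_zero_iff.1 hx; linarith
            have b1 := mq_abs_le (v := v) (a := a) (p := (a, x)) (by simp only; positivity) hx'
            have b2 := div_sq_le v (a, x) (τ := a + a) (by positivity) one_pos
            simp only at b1 b2
            have b3 : coneφ κ (a, x) * mq v a (a, x) ≤ |mq v a (a, x)| := by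
              refine (le_abs_self _).trans ?_
              rw [abs_mul, abs_of_nonneg (coneφ_nonneg _ _)]
              exact mul_le_of_le_one_left (abs_nonneg _) (coneφ_le_one _ _)
            rw [← two_mul] at b1 b2
            refine b3.trans (b1.trans ?_)
            have : ed v (a, x) + (v (a, x) / (2 * a)) ^ 2 ≤ 7 * ed v (a, x) + (2 * a)⁻¹ ^ 3 := by
              norm_num at b2 ⊢; linarith
            have := mul_le_mul_of_nonneg_left this (by positivity : 0 ≤ 4 * (2 * a))
            linarith
          · simp only [indicator_of_notMem hx]
            have hx' : 2 * a < ‖x‖ := by simpa using hx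
            rw [coneφ_eq_zero hκ ha0 (by nlinarith)]
            simp only [zero_mul, add_zero]
            positivity
      _ = 4 * ((2 * a) * 7) * (∫ x, ed v (a, x)) + 8 * a * vol1 := by
          rw [integral_add hdom2 hdom, integral_const_mul,
            integral_indicator_const _ Metric.isClosed_closedBall.measurableSet,
            volume_real_closedBall _ (by positivity), smul_eq_mul]
          congr 1
          field_simp
          norm_num
      _ ≤ _ := by
          have := mul_le_mul_of_nonneg_left (h.ed_le a) (by positivity : 0 ≤ 4 * ((2 * a) * 7))
          nlinarith
  rw [hsplit T hT] at hlow
  rw [hsplit a ha0] at hup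
  have hmono := coneE_mono h hκ hκ1 (mem_Ioi.2 ha0) (mem_Ioi.2 hT) haT
  set P := ∫ x in Metric.closedBall (0 : E3) ((1 + κ/2) * T), v (T, x) ^ 6
  set ΔF := coneE κ v T - coneE κ v a with hΔ
  have hΔ0 : 0 ≤ ΔF := by rw [hΔ]; linarith
  have hc20 : 0 ≤ c2 := by rw [hc2]; positivity
  have hfin : T * ((1/6) * P) ≤ 8 * a * (7 * E + vol1) + c1 * ΔF + c2 * T := by
    rw [hΔ]; nlinarith
  have hfin2 : P ≤ 48 * κ * (7 * E + vol1) + 2496 * ((1 + 6 * η⁻¹ ^ 2) * κ⁻¹ * ΔF)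
      + 3744 * vol1 * Cs * η := by
    have : T * P ≤ T * (48 * κ * (7 * E + vol1) + 2496 * ((1 + 6 * η⁻¹ ^ 2) * κ⁻¹ * ΔF)
      + 3744 * vol1 * Cs * η) := by
      rw [ha, hc1, hc2] at hfin
      linarith
    exact le_of_mul_le_mul_left this hT
  refine hfin2.trans ?_
  have g1 : 0 ≤ (1 + 6 * η⁻¹ ^ 2) * κ⁻¹ * ΔF := by positivity
  have g2 : 0 ≤ κ * E := by positivity
  have g3 : vol1 ≤ vol1 * Cs := by nlinarith
  have g4 : 0 ≤ vol1 * Cs := by positivity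
  nlinarith [mul_le_mul_of_nonneg_left g3 hκ.le, mul_nonneg g4 g2, mul_nonneg g4 g1,
    mul_nonneg g4 hκ.le]

/-- The field seen from `q` forwards in time. -/
def fwd (v : Spt → ℝ) (q : Spt) : Spt → ℝ := fun p => v (p + q)

/-- The field seen from `q` backwards in time. -/
def bwd (v : Spt → ℝ) (q : Spt) : Spt → ℝ := fun p => v ((-p.1, p.2) + q)

theorem Sol.fwd {v : Spt → ℝ} {E : ℝ} (h : Sol v E) (q : Spt) : Sol (fwd v q) E := h.translate q

theorem Sol.bwd {v : Spt → ℝ} {E : ℝ} (h : Sol v E) (q : Spt) : Sol (bwd v q) E :=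
  (h.translate q).reverse

theorem Sol.int_pow6 {v : Spt → ℝ} {E : ℝ} (h : Sol v E) (t : ℝ) :
    Integrable (fun x => v (t, x) ^ 6) := by
  refine ((h.int_ed t).const_mul 6).mono'
    ((h.smooth.continuous.comp (by fun_prop)).pow 6).aestronglyMeasurable ?_
  filter_upwards with x
  rw [Real.norm_eq_abs, abs_of_nonneg (by positivity)]
  exact pow6_le_ed v (t, x)

theorem Sol.setInt_mono {v : Spt → ℝ} {E : ℝ} (h : Sol v E) (t : ℝ) {A B : Set E3} (hAB : A ⊆ B) :
    ∫ x in A, ed v (t, x) ≤ ∫ x in B, ed v (t, x) :=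
  setIntegral_mono_set (h.int_ed t).integrableOn
    (Filter.Eventually.of_forall fun x => ed_nonneg v (t, x)) hAB.eventuallyLE

theorem Sol.pow6_setInt_le {v : Spt → ℝ} {E : ℝ} (h : Sol v E) (t : ℝ) (A : Set E3) :
    ∫ x in A, v (t, x) ^ 6 ≤ 6 * ∫ x in A, ed v (t, x) := by
  rw [← integral_const_mul]
  exact integral_mono (h.int_pow6 t).integrableOn ((h.int_ed t).const_mul 6).integrableOn
    fun x => pow6_le_ed v (t, x)

/-- Data for the counting argument. -/
structure Count (v : Spt → ℝ) (E d κ ε : ℝ) : Prop where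
  sol : Sol v E
  d_pos : 0 < d
  κ_pos : 0 < κ
  κ_le : κ ≤ 1
  gain_fwd : ∀ (q : Spt) (T : ℝ), 0 < T →
    d/2 ≤ ∫ x in Metric.closedBall q.2 ((1 + κ/2) * T), v (q.1 + T, x) ^ 6 →
    ε + coneE κ (fwd v q) (κ * T) ≤ coneE κ (fwd v q) T
  gain_bwd : ∀ (q : Spt) (T : ℝ), 0 < T →
    d/2 ≤ ∫ x in Metric.closedBall q.2 ((1 + κ/2) * T), v (q.1 - T, x) ^ 6 →
    ε + coneE κ (bwd v q) (κ * T) ≤ coneE κ (bwd v q) T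

/-- A separated family of bubbles. -/
structure Bub (v : Spt → ℝ) (d : ℝ) (R : Spt → ℝ) (P : Finset Spt) : Prop where
  pos : ∀ p ∈ P, 0 < R p
  mass : ∀ p ∈ P, d ≤ ∫ x in Metric.closedBall p.2 (R p), v (p.1, x) ^ 6
  sep : ∀ p ∈ P, ∀ q ∈ P, p ≠ q → R p ≤ |p.1 - q.1|

theorem Bub.subset {v : Spt → ℝ} {d : ℝ} {R : Spt → ℝ} {P Q : Finset Spt} (h : Bub v d R P)
    (hQ : Q ⊆ P) : Bub v d R Q :=
  ⟨fun p hp => h.pos p (hQ hp), fun p hp => h.mass p (hQ hp),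
    fun p hp q hq => h.sep p (hQ hp) q (hQ hq)⟩

theorem exists_large_fiber {α β : Type*} [DecidableEq β] (s : Finset α) (hs : s.Nonempty)
    (t : Finset β) (f : α → β) (hf : ∀ a ∈ s, f a ∈ t) (m : ℕ) (hm : t.card ≤ m) :
    ∃ b ∈ t, (s.filter (fun a => f a = b)).Nonempty ∧
      s.card ≤ m * (s.filter (fun a => f a = b)).card := by
  have ht : t.Nonempty := ⟨_, hf _ hs.choose_spec⟩
  obtain ⟨b, hb, hmax⟩ := t.exists_max_image (fun b => (s.filter (fun a => f a = b)).card) ht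
  have h1 := Finset.card_le_mul_card_image_of_maps_to hf _ hmax
  have h2 : s.card ≤ m * (s.filter (fun a => f a = b)).card := by
    refine h1.trans ?_
    rw [mul_comm]
    gcongr
  refine ⟨b, hb, ?_, h2⟩
  rw [← Finset.card_pos]
  by_contra h0
  have : (s.filter (fun a => f a = b)).card = 0 := by omega
  rw [this, mul_zero] at h2
  have := hs.card_pos
  omega

section counting
variable {v : Spt → ℝ} {E d κ ε : ℝ} {R : Spt → ℝ} {P : Finset Spt}

theorem Bub.energy (h : Sol v E) (hP : Bub v d R P) {p : Spt} (hp : p ∈ P) :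
    d/6 ≤ ∫ x in Metric.closedBall p.2 (R p), ed v (p.1, x) := by
  have h1 := hP.mass p hp
  have h2 := h.pow6_setInt_le p.1 (Metric.closedBall p.2 (R p))
  linarith

/-- Spatial clustering of bubbles at comparable times. -/
theorem Bub.cluster (h : Sol v E) (hd : 0 < d) (hP : Bub v d R P) (hne : P.Nonempty) {l : ℝ}
    (hl : 0 < l) (ht : ∀ p ∈ P, ∀ q ∈ P, |p.1 - q.1| ≤ l) {m : ℕ} (hm1 : 1 ≤ m)
    (hm : 6 * E / d ≤ m) :
    ∃ Q ⊆ P, Q.Nonempty ∧ P.card ≤ m * Q.card ∧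
      ∀ p ∈ Q, ∀ q ∈ Q, dist p.2 q.2 ≤ 14 * l := by
  classical
  by_cases hc : P.card ≤ 1
  · refine ⟨P, subset_rfl, hne, by nlinarith, ?_⟩
    intro p hp q hq
    rw [Finset.card_le_one.1 hc p hp q hq, dist_self]
    positivity
  push Not at hc
  have hR : ∀ p ∈ P, R p ≤ l := by
    intro p hp
    obtain ⟨q, hq, hqp⟩ := Finset.exists_mem_ne hc p
    exact (hP.sep p hp q hq hqp.symm).trans (ht p hp q hq)
  -- a maximal separated subset
  let F := P.powerset.filter (fun S => ∀ p ∈ S, ∀ q ∈ S, p ≠ q → 7 * l < dist p.2 q.2)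
  have hF : F.Nonempty := ⟨∅, by simp [F]⟩
  obtain ⟨S, hSF, hmax⟩ := F.exists_max_image Finset.card hF
  simp only [F, Finset.mem_filter, Finset.mem_powerset] at hSF
  obtain ⟨hSP, hSsep⟩ := hSF
  have hnear : ∀ p ∈ P, ∃ s ∈ S, dist p.2 s.2 ≤ 7 * l := by
    intro p hp
    by_contra! hcon
    have hpS : p ∉ S := fun hpS => by
      have := hcon p hpS
      rw [dist_self] at this
      linarith
    have hins : insert p S ∈ F := by
      simp only [F, Finset.mem_filter, Finset.mem_powerset]
      refine ⟨Finset.insert_subset hp hSP, ?_⟩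
      intro a ha b hb hab
      rw [Finset.mem_insert] at ha hb
      rcases ha with rfl | ha <;> rcases hb with rfl | hb
      · exact absurd rfl hab
      · exact hcon b hb
      · rw [dist_comm]; exact hcon a ha
      · exact hSsep a ha b hb hab
    have := hmax _ hins
    rw [Finset.card_insert_of_notMem hpS] at this
    omega
  -- few separated points
  have hScard : S.card ≤ m := by
    obtain ⟨p0, hp0⟩ := hne
    have hdisj : Set.Pairwise (↑S : Set Spt) (Disjoint on fun s => Metric.closedBall s.2 (3 * l)) := by
      intro a ha b hb hab
      refine Metric.closedBall_disjoint_closedBall ?_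
      have := hSsep a ha b hb hab
      linarith
    have hsum : ∑ s ∈ S, ∫ x in Metric.closedBall s.2 (3 * l), ed v (p0.1, x) ≤ E := by
      rw [← integral_biUnion_finset S (fun s _ => Metric.isClosed_closedBall.measurableSet) hdisj
        (fun s _ => (h.int_ed p0.1).integrableOn)]
      exact (setIntegral_le_integral (h.int_ed p0.1)
        (Filter.Eventually.of_forall fun x => ed_nonneg v (p0.1, x))).trans (h.ed_le _)
    have hlow : ∀ s ∈ S, d/6 ≤ ∫ x in Metric.closedBall s.2 (3 * l), ed v (p0.1, x) := by
      intro s hs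
      have hsP := hSP hs
      refine (hP.energy h hsP).trans ((h.finite_speed (hP.pos s hsP) s.1 p0.1 s.2).trans ?_)
      refine h.setInt_mono _ (Metric.closedBall_subset_closedBall ?_)
      have := hR s hsP
      have := ht p0 hp0 s hsP
      linarith
    have h3 := (Finset.card_nsmul_le_sum S _ _ hlow).trans hsum
    rw [nsmul_eq_mul] at h3
    have : (S.card : ℝ) ≤ m := by
      refine le_trans ?_ hm
      rw [le_div_iff₀ hd]
      linarith
    exact_mod_cast this
  choose! f hfS hfd using hnear
  obtain ⟨s, hs, hne2, hcard⟩ := exists_large_fiber P hne S f hfS m hScard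
  refine ⟨_, Finset.filter_subset _ _, hne2, hcard, ?_⟩
  intro p hp q hq
  rw [Finset.mem_filter] at hp hq
  have h1 := hfd p hp.1
  have h2 := hfd q hq.1
  rw [hp.2] at h1
  rw [hq.2] at h2
  have := dist_triangle_right p.2 q.2 s.2
  linarith

/-- Time localisation of bubbles. -/
theorem exists_slab (P : Finset Spt) (hne : P.Nonempty) {t₀ D : ℝ} (hD : 0 < D)
    (ht : ∀ p ∈ P, t₀ ≤ p.1 ∧ p.1 ≤ t₀ + D) {B : ℕ} (hB : 0 < B) :
    ∃ Q ⊆ P, Q.Nonempty ∧ P.card ≤ (B + 1) * Q.card ∧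
      ∀ p ∈ Q, ∀ q ∈ Q, |p.1 - q.1| ≤ D / B := by
  classical
  have hB' : (0:ℝ) < B := by exact_mod_cast hB
  obtain ⟨j, -, hne2, hcard⟩ := exists_large_fiber P hne (Finset.range (B + 1))
    (fun p => ⌊(p.1 - t₀) / (D / B)⌋₊) (by
      intro p hp
      rw [Finset.mem_range, Nat.lt_succ_iff]
      apply Nat.floor_le_of_le
      rw [div_le_iff₀ (by positivity)]
      have := (ht p hp).2
      have e : (B:ℝ) * (D / B) = D := by field_simp
      linarith) (B + 1) (by simp)
  refine ⟨_, Finset.filter_subset _ _, hne2, hcard, ?_⟩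
  intro p hp q hq
  rw [Finset.mem_filter] at hp hq
  have hl : 0 < D / B := by positivity
  have key : ∀ p ∈ P, ⌊(p.1 - t₀) / (D / B)⌋₊ = j →
      j * (D / B) ≤ p.1 - t₀ ∧ p.1 - t₀ ≤ (j + 1) * (D / B) := by
    intro p hp hj
    have h0 : 0 ≤ (p.1 - t₀) / (D / B) := div_nonneg (sub_nonneg.2 (ht p hp).1) hl.le
    have h1 := Nat.floor_le h0
    have h2 := Nat.lt_floor_add_one ((p.1 - t₀) / (D / B))
    rw [hj] at h1 h2
    rw [le_div_iff₀ hl] at h1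
    rw [div_lt_iff₀ hl] at h2
    exact ⟨h1, h2.le⟩
  have h1 := key p hp.1 hp.2
  have h2 := key q hq.1 hq.2
  rw [abs_le]
  constructor <;> linarith

/-- The statement proved by induction on the number of bubbles. -/
def CountClaim (v : Spt → ℝ) (d κ ε : ℝ) (M : ℕ) (P : Finset Spt) (L : ℝ) : Prop :=
  ∃ q ∈ P, ∃ nU nF nP : ℕ, P.card ≤ M ^ (nU + nF + nP) ∧
    (∀ t, d/12 * nU ≤ ∫ x in Metric.closedBall q.2 (|t - q.1| + 31 * L), ed v (t, x)) ∧
    (∀ T, 0 < T → (∀ b ∈ P, |b.1 - q.1| ≤ T) → ε * nF ≤ coneE κ (fwd v q) T) ∧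
    (∀ T, 0 < T → (∀ b ∈ P, |b.1 - q.1| ≤ T) → ε * nP ≤ coneE κ (bwd v q) T)

theorem countClaim (hC : Count v E d κ ε) {B m : ℕ} (hB : 186 / κ ≤ B) (hm1 : 1 ≤ m)
    (hm : 6 * E / d ≤ m) : ∀ (n : ℕ) (P : Finset Spt), P.card ≤ n → Bub v d R P → P.Nonempty →
    ∀ L : ℝ, 0 < L → (∀ p ∈ P, ∀ q ∈ P, |p.1 - q.1| ≤ L) →
    (∀ p ∈ P, ∀ q ∈ P, dist p.2 q.2 ≤ 14 * L) →
    CountClaim v d κ ε ((B + 1) * m) P L := by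
  have h := hC.sol
  have hd := hC.d_pos
  have hκ := hC.κ_pos
  have hκ1 := hC.κ_le
  have hB186 : (186:ℝ) ≤ B := le_trans (by rw [le_div_iff₀ hκ]; linarith) hB
  have hBκ : 186 ≤ κ * B := by rw [div_le_iff₀ hκ] at hB; linarith
  have hB0 : (0:ℝ) < B := by linarith
  intro n
  induction n with
  | zero =>
    intro P hn _ hne
    have := hne.card_pos
    omega
  | succ n ih =>
    intro P hn hP hne L hL htL hxL
    by_cases hc : P.card ≤ 1
    · obtain ⟨q, hq⟩ := hne
      refine ⟨q, hq, 0, 0, 0, by simpa using hc, ?_, ?_, ?_⟩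
      · intro t
        simp only [Nat.cast_zero, mul_zero]
        exact integral_nonneg fun x => ed_nonneg v (t, x)
      · intro T _ _
        simpa using coneE_nonneg (fwd v q)
      · intro T _ _
        simpa using coneE_nonneg (bwd v q)
    push Not at hc
    obtain ⟨pm, hpm, hmin⟩ := P.exists_min_image (fun p => p.1) hne
    obtain ⟨pM, hpM, hmax⟩ := P.exists_max_image (fun p => p.1) hne
    set D := pM.1 - pm.1 with hDdef
    have hDpair : ∀ p ∈ P, ∀ q ∈ P, |p.1 - q.1| ≤ D := by
      intro p hp q hq
      rw [abs_le]
      have := hmin p hp; have := hmin q hq; have := hmax p hp; have := hmax q hq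
      constructor <;> linarith
    have hD : 0 < D := by
      obtain ⟨q, hq, hqp⟩ := Finset.exists_mem_ne hc pm
      have h1 := hP.sep pm hpm q hq hqp.symm
      have h2 := hP.pos pm hpm
      exact (h2.trans_le h1).trans_le (hDpair pm hpm q hq)
    have hDL : D ≤ L := (le_abs_self _).trans (htL pM hpM pm hpm)
    have hRD : ∀ p ∈ P, R p ≤ D := by
      intro p hp
      obtain ⟨q, hq, hqp⟩ := Finset.exists_mem_ne hc p
      exact (hP.sep p hp q hq hqp.symm).trans (hDpair p hp q hq)
    set l := D / B with hl
    have hl0 : 0 < l := by positivity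
    have hlD : 186 * l ≤ κ * D := by
      rw [hl, ← mul_div_assoc, div_le_iff₀ hB0]
      nlinarith
    have hlD' : 186 * l ≤ D := by nlinarith
    obtain ⟨P1, hP1, hne1, hcard1, ht1⟩ := exists_slab P hne hD (t₀ := pm.1)
      (fun p hp => ⟨hmin p hp, by have := hmax p hp; linarith⟩)
      (B := B) (by exact_mod_cast hB0)
    obtain ⟨P2, hP2, hne2, hcard2, hx2⟩ := (hP.subset hP1).cluster h hd hne1 hl0 ht1 hm1 hm
    have hP2P : P2 ⊆ P := hP2.trans hP1
    have ht2 : ∀ p ∈ P2, ∀ q ∈ P2, |p.1 - q.1| ≤ l :=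
      fun p hp q hq => ht1 p (hP2 hp) q (hP2 hq)
    have hcard : P.card ≤ (B + 1) * m * P2.card := by
      calc P.card ≤ (B + 1) * P1.card := hcard1
        _ ≤ (B + 1) * (m * P2.card) := by gcongr
        _ = _ := by ring
    have hlt : P2.card < P.card := by
      refine Finset.card_lt_card (Finset.ssubset_iff_subset_ne.2 ⟨hP2P, ?_⟩)
      intro he
      have := ht2 pM (he ▸ hpM) pm (he ▸ hpm)
      have := le_abs_self (pM.1 - pm.1)
      linarith
    obtain ⟨q, hq, nU, nF, nP, hM, hU, hF, hPa⟩ := ih P2 (by omega) (hP.subset hP2P) hne2 l hl0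
      ht2 hx2
    have hqP := hP2P hq
    have hM' : P.card ≤ ((B + 1) * m) ^ (nU + nF + nP + 1) := by
      calc P.card ≤ (B + 1) * m * P2.card := hcard
        _ ≤ (B + 1) * m * ((B + 1) * m) ^ (nU + nF + nP) := by gcongr
        _ = _ := by ring
    have hUL : ∀ t, d/12 * nU ≤ ∫ x in Metric.closedBall q.2 (|t - q.1| + 31 * L), ed v (t, x) := by
      intro t
      refine (hU t).trans (h.setInt_mono _ (Metric.closedBall_subset_closedBall ?_))
      linarith
    have hFL : ∀ T, 0 < T → (∀ b ∈ P, |b.1 - q.1| ≤ T) → ε * nF ≤ coneE κ (fwd v q) T :=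
      fun T hT hb => hF T hT fun b hb2 => hb b (hP2P hb2)
    have hPL : ∀ T, 0 < T → (∀ b ∈ P, |b.1 - q.1| ≤ T) → ε * nP ≤ coneE κ (bwd v q) T :=
      fun T hT hb => hPa T hT fun b hb2 => hb b (hP2P hb2)
    -- an extreme bubble far in time from the cluster
    obtain ⟨p, hp, hpfar, hpq⟩ : ∃ p ∈ P, D/3 ≤ |p.1 - q.1| ∧ (p = pm ∨ p = pM) := by
      by_cases hcase : D/3 ≤ q.1 - pm.1
      · refine ⟨pm, hpm, ?_, Or.inl rfl⟩
        rw [abs_sub_comm]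
        exact hcase.trans (le_abs_self _)
      · refine ⟨pM, hpM, ?_, Or.inr rfl⟩
        refine le_trans ?_ (le_abs_self _)
        push Not at hcase
        linarith
    set Γ := Metric.closedBall q.2 (|p.1 - q.1| + 31 * l) with hΓ
    have hΓm : MeasurableSet Γ := Metric.isClosed_closedBall.measurableSet
    by_cases hseen : d/2 ≤ ∫ x in Γ, v (p.1, x) ^ 6
    · set T := |p.1 - q.1| with hT
      have hT0 : 0 < T := by linarith
      have hTκ : T + 31 * l ≤ (1 + κ/2) * T := by nlinarith
      have hball : d/2 ≤ ∫ x in Metric.closedBall q.2 ((1 + κ/2) * T), v (p.1, x) ^ 6 :=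
        hseen.trans (setIntegral_mono_set (h.int_pow6 p.1).integrableOn
          (Filter.Eventually.of_forall fun x => by simp only [Pi.zero_apply]; positivity)
          (Metric.closedBall_subset_closedBall hTκ).eventuallyLE)
      have hκT : ∀ b ∈ P2, |b.1 - q.1| ≤ κ * T := by
        intro b hb
        refine (ht2 b hb q hq).trans ?_
        nlinarith
      have hκT0 : 0 < κ * T := by positivity
      rcases le_total q.1 p.1 with hle | hle
      · have hpT : p.1 = q.1 + T := by rw [hT, abs_of_nonneg (sub_nonneg.2 hle)]; ring
        rw [hpT] at hball
        have hg := hC.gain_fwd q T hT0 hball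
        refine ⟨q, hqP, nU, nF + 1, nP, hM'.trans (le_of_eq (by ring)), hUL, ?_, hPL⟩
        intro T' hT' hb
        have h1 := coneE_mono (h.fwd q) hκ hκ1 (mem_Ioi.2 hT0) (mem_Ioi.2 hT') (hb p hp)
        have h2 := hF (κ * T) hκT0 hκT
        push_cast
        linarith
      · have hpT : p.1 = q.1 - T := by rw [hT, abs_of_nonpos (sub_nonpos.2 hle)]; ring
        rw [hpT] at hball
        have hg := hC.gain_bwd q T hT0 hball
        refine ⟨q, hqP, nU, nF, nP + 1, hM'.trans (le_of_eq (by ring)), hUL, hFL, ?_⟩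
        intro T' hT' hb
        have h1 := coneE_mono (h.bwd q) hκ hκ1 (mem_Ioi.2 hT0) (mem_Ioi.2 hT') (hb p hp)
        have h2 := hPa (κ * T) hκT0 hκT
        push_cast
        linarith
    · push Not at hseen
      refine ⟨q, hqP, nU + 1, nF, nP, hM'.trans (le_of_eq (by ring)), ?_, hFL, hPL⟩
      set Bp := Metric.closedBall p.2 (R p) with hBp
      have hBm : MeasurableSet Bp := Metric.isClosed_closedBall.measurableSet
      have hout : d/2 ≤ ∫ x in Bp \ Γ, v (p.1, x) ^ 6 := by
        have h1 := hP.mass p hp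
        have h2 : ∫ x in Bp, v (p.1, x) ^ 6 ≤ ∫ x in (Bp \ Γ) ∪ Γ, v (p.1, x) ^ 6 :=
          setIntegral_mono_set (h.int_pow6 p.1).integrableOn
            (Filter.Eventually.of_forall fun x => by simp only [Pi.zero_apply]; positivity)
            (show Bp ⊆ (Bp \ Γ) ∪ Γ by
              rw [sdiff_union_self]; exact subset_union_left).eventuallyLE
        rw [setIntegral_union disjoint_sdiff_left hΓm (h.int_pow6 p.1).integrableOn
          (h.int_pow6 p.1).integrableOn] at h2
        linarith
      have hen : d/12 ≤ ∫ x in Bp \ Γ, ed v (p.1, x) := by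
        have := h.pow6_setInt_le p.1 (Bp \ Γ)
        linarith
      have htot : d/12 * ((nU + 1 : ℕ) : ℝ) ≤
          ∫ x in Metric.closedBall q.2 (15 * L), ed v (p.1, x) := by
        have h1 := hU p.1
        have h2 : ∫ x in (Bp \ Γ) ∪ Γ, ed v (p.1, x) ≤
            ∫ x in Metric.closedBall q.2 (15 * L), ed v (p.1, x) := by
          refine h.setInt_mono _ (union_subset (sdiff_subset.trans ?_) ?_)
          · refine Metric.closedBall_subset_closedBall' ?_
            have := hRD p hp
            have := hxL p hp q hqP
            linarith
          · refine Metric.closedBall_subset_closedBall ?_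
            have := hDpair p hp q hqP
            linarith
        rw [setIntegral_union disjoint_sdiff_left hΓm (h.int_ed p.1).integrableOn
          (h.int_ed p.1).integrableOn] at h2
        push_cast
        linarith
      intro t
      refine htot.trans ((h.finite_speed (by positivity) p.1 t q.2).trans
        (h.setInt_mono _ (Metric.closedBall_subset_closedBall ?_)))
      have h1 := htL q hqP p hp
      have h2 := abs_sub_le t q.1 p.1
      linarith

/-- A separated family of bubbles has bounded cardinality. -/
theorem Count.card_le (hC : Count v E d κ ε) (hε : 0 < ε) {B m : ℕ} (hB : 186 / κ ≤ B)
    (hm1 : 1 ≤ m) (hm : 6 * E / d ≤ m) (hP : Bub v d R P) {N : ℕ}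
    (hN : 12 * E / d + 2 * (E / ε) ≤ N) : P.card ≤ ((B + 1) * m) ^ N := by
  rcases P.eq_empty_or_nonempty with rfl | hne
  · simp
  have h := hC.sol
  have hd := hC.d_pos
  obtain ⟨L, hL0, hLt, hLx⟩ : ∃ L : ℝ, 0 < L ∧ (∀ p ∈ P, ∀ q ∈ P, |p.1 - q.1| ≤ L) ∧
      (∀ p ∈ P, ∀ q ∈ P, dist p.2 q.2 ≤ 14 * L) := by
    have hb : Bornology.IsBounded (↑P : Set Spt) := P.finite_toSet.isBounded
    refine ⟨Metric.diam (↑P : Set Spt) + 1, by positivity, ?_, ?_⟩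
    · intro p hp q hq
      have h1 := Metric.dist_le_diam_of_mem hb (Finset.mem_coe.2 hp) (Finset.mem_coe.2 hq)
      rw [Prod.dist_eq] at h1
      have := (le_max_left _ _).trans h1
      rw [Real.dist_eq] at this
      linarith
    · intro p hp q hq
      have h1 := Metric.dist_le_diam_of_mem hb (Finset.mem_coe.2 hp) (Finset.mem_coe.2 hq)
      rw [Prod.dist_eq] at h1
      have := (le_max_right _ _).trans h1
      have : 0 ≤ Metric.diam (↑P : Set Spt) := Metric.diam_nonneg
      linarith
  obtain ⟨q, hq, nU, nF, nP, hM, hU, hF, hPa⟩ :=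
    countClaim hC hB hm1 hm P.card P le_rfl hP hne L hL0 hLt hLx
  refine hM.trans (Nat.pow_le_pow_right (by positivity) ?_)
  have e1 : d/12 * nU ≤ E := (hU 0).trans ((setIntegral_le_integral (h.int_ed 0)
    (Filter.Eventually.of_forall fun x => ed_nonneg v (0, x))).trans (h.ed_le 0))
  have e2 : ε * nF ≤ E := (hF L hL0 fun b hb => hLt b hb q hq).trans (coneE_le (h.fwd q) hL0)
  have e3 : ε * nP ≤ E := (hPa L hL0 fun b hb => hLt b hb q hq).trans (coneE_le (h.bwd q) hL0)
  have f1 : (nU : ℝ) ≤ 12 * E / d := by rw [le_div_iff₀ hd]; linarith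
  have f2 : (nF : ℝ) ≤ E / ε := by rw [le_div_iff₀ hε]; linarith
  have f3 : (nP : ℝ) ≤ E / ε := by rw [le_div_iff₀ hε]; linarith
  have : ((nU + nF + nP : ℕ) : ℝ) ≤ N := by push_cast; linarith
  exact_mod_cast this

end counting

theorem exists_count : ∃ K : ℝ, 1 ≤ K ∧ ∀ (v : Spt → ℝ) (E d : ℝ), Sol v E → 1 ≤ E → 0 < d →
    d ≤ 1 → ∃ κ ε : ℝ, Count v E d κ ε ∧ d / (K * E) ≤ κ ∧ d ^ 4 / (K * E) ≤ ε := by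
  obtain ⟨K, hK1, hK⟩ := exists_decay
  have hK0 : 0 < K := by linarith
  refine ⟨3104 * 2 * K ^ 3 * (16 * K), ?_, ?_⟩
  · have := one_le_pow₀ hK1 (n := 3)
    nlinarith
  intro v E d h hE hd hd1
  set κ := d / (16 * K * E) with hκ
  set η := d / (8 * K) with hη
  have hκ0 : 0 < κ := by positivity
  have hη0 : 0 < η := by positivity
  have hκ1 : κ ≤ 1 := by
    rw [hκ, div_le_one (by positivity)]
    nlinarith
  set A := K * (1 + 6 * η⁻¹ ^ 2) * κ⁻¹ with hA
  have hA0 : 0 < A := by positivity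
  have key : ∀ (w : Spt → ℝ), Sol w E → ∀ T : ℝ, 0 < T →
      d/2 ≤ ∫ x in Metric.closedBall (0 : E3) ((1 + κ/2) * T), w (T, x) ^ 6 →
      d / (4 * A) + coneE κ w (κ * T) ≤ coneE κ w T := by
    intro w hw T hT hb
    have h1 := hb.trans (hK w E hw κ η T hκ0 hκ1 hη0 hT)
    have h2 : K * (κ * (E + 1)) ≤ d/8 := by
      have : K * (κ * (E + 1)) = d/8 * ((E + 1) / (2 * E)) := by rw [hκ]; field_simp; norm_num
      rw [this]
      have : (E + 1) / (2 * E) ≤ 1 := by rw [div_le_one (by positivity)]; linarith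
      nlinarith
    have h3 : K * η = d/8 := by rw [hη]; field_simp
    have h4 : d/4 ≤ A * (coneE κ w T - coneE κ w (κ * T)) := by rw [hA]; nlinarith
    have h5 : d / (4 * A) ≤ coneE κ w T - coneE κ w (κ * T) := by
      rw [div_le_iff₀ (by positivity)]; linarith
    linarith
  refine ⟨κ, d / (4 * A), ⟨h, hd, hκ0, hκ1, ?_, ?_⟩, ?_, ?_⟩
  · intro q T hT hb
    refine key _ (h.fwd q) T hT (hb.trans (le_of_eq ?_))
    rw [← Sol.setIntegral_closedBall_add]
    simp only [fwd]
    congr 1; ext x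
    congr 2
    ext1
    · simp [add_comm]
    · simp
  · intro q T hT hb
    refine key _ (h.bwd q) T hT (hb.trans (le_of_eq ?_))
    rw [← Sol.setIntegral_closedBall_add]
    congr 1; ext x
    simp only [bwd]
    congr 2
    ext1
    · simp; ring
    · simp
  · rw [hκ]
    apply div_le_div_of_nonneg_left hd.le (by positivity)
    have := one_le_pow₀ hK1 (n := 3)
    have : 0 ≤ 16 * K * E := by positivity
    nlinarith
  · rw [div_le_div_iff₀ (by positivity) (by positivity)]
    have h1 : 1 + 6 * η⁻¹ ^ 2 ≤ 388 * K ^ 2 / d ^ 2 := by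
      rw [hη, inv_div, le_div_iff₀ (by positivity)]
      have : (1 + 6 * (8 * K / d) ^ 2) * d ^ 2 = d ^ 2 + 384 * K ^ 2 := by field_simp; ring
      rw [this]
      have : d ^ 2 ≤ 1 := pow_le_one₀ hd.le hd1
      have := one_le_pow₀ hK1 (n := 2)
      linarith
    have h2 : A ≤ K * (388 * K ^ 2 / d ^ 2) * κ⁻¹ := by rw [hA]; gcongr
    have h3 : K * (388 * K ^ 2 / d ^ 2) * κ⁻¹ = 388 * 16 * K ^ 4 * E / d ^ 3 := by
      rw [hκ, inv_div]; field_simp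
    rw [h3, le_div_iff₀ (by positivity)] at h2
    have h4 : 0 < K ^ 4 * E := by positivity
    nlinarith

/-- Number of separated bubbles. -/
theorem exists_card_le : ∃ C : ℝ, 1 ≤ C ∧ ∀ (v : Spt → ℝ) (E d : ℝ), Sol v E → 1 ≤ E → 0 < d →
    d ≤ 1 → ∀ (P : Finset Spt) (R : Spt → ℝ), Bub v d R P →
    (P.card : ℝ) ≤ (C * (E ^ 2 / d ^ 2)) ^ (C * (E ^ 2 / d ^ 4)) := by
  obtain ⟨K, hK1, hK⟩ := exists_count
  refine ⟨2000 * K, by linarith, ?_⟩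
  intro v E d h hE hd hd1 P R hP
  obtain ⟨κ, ε, hC, hκ, hε⟩ := hK v E d h hE hd hd1
  have hκ0 := hC.κ_pos
  have hκ1 := hC.κ_le
  have hε0 : 0 < ε := lt_of_lt_of_le (by positivity) hε
  have hd4 : d ^ 4 ≤ d := by
    have : d ^ 3 ≤ 1 := pow_le_one₀ hd.le hd1
    nlinarith
  set N := ⌈12 * E / d + 2 * (E / ε)⌉₊ with hN
  set B := ⌈186 / κ⌉₊ with hB
  set m := ⌈6 * E / d⌉₊ with hm
  have hEd : 1 ≤ E / d := by rw [one_le_div hd]; linarith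
  have hκi : 1 ≤ 1 / κ := by rw [one_le_div hκ0]; exact hκ1
  have hκi2 : 1 / κ ≤ K * (E / d) := by
    rw [div_le_iff₀ hκ0]
    rw [div_le_iff₀ (by positivity)] at hκ
    have : d ≤ κ * (K * E) := hκ
    rw [← div_le_iff₀' (by positivity)] at hκ
    calc (1:ℝ) = d / d := by field_simp
      _ ≤ κ * (K * E) / d := by gcongr
      _ = _ := by ring
  have hmp : 1 ≤ m := Nat.one_le_ceil_iff.2 (by positivity)
  have hcard := hC.card_le hε0 (Nat.le_ceil _) hmp (Nat.le_ceil _) hP (Nat.le_ceil _)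
  have hBle : (B : ℝ) + 1 ≤ 188 * (K * (E / d)) := by
    have := (Nat.ceil_lt_add_one (by positivity : 0 ≤ 186 / κ)).le
    rw [← hB] at this
    have e : 186 / κ = 186 * (1 / κ) := by ring
    rw [e] at this
    linarith
  have hmle : (m : ℝ) ≤ 7 * (E / d) := by
    have := (Nat.ceil_lt_add_one (by positivity : 0 ≤ 6 * E / d)).le
    rw [← hm, mul_div_assoc] at this
    linarith
  have hM : (((B + 1) * m : ℕ) : ℝ) ≤ 2000 * K * (E ^ 2 / d ^ 2) := by
    push_cast
    calc ((B:ℝ) + 1) * m ≤ 188 * (K * (E / d)) * (7 * (E / d)) := by gcongr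
      _ = 1316 * (K * (E ^ 2 / d ^ 2)) := by field_simp; norm_num
      _ ≤ _ := by nlinarith [show 0 ≤ K * (E ^ 2 / d ^ 2) by positivity]
  have hE4 : E / d ≤ E ^ 2 / d ^ 4 := by
    gcongr
    nlinarith
  have hNle : (N : ℝ) ≤ 2000 * K * (E ^ 2 / d ^ 4) := by
    have := (Nat.ceil_lt_add_one (by positivity : 0 ≤ 12 * E / d + 2 * (E / ε))).le
    rw [← hN, mul_div_assoc] at this
    have h1 : E / ε ≤ K * (E ^ 2 / d ^ 4) := by
      rw [div_le_iff₀ hε0]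
      have e : E = K * (E ^ 2 / d ^ 4) * (d ^ 4 / (K * E)) := by field_simp
      calc E = K * (E ^ 2 / d ^ 4) * (d ^ 4 / (K * E)) := e
        _ ≤ _ := by gcongr
    have h2 : E ^ 2 / d ^ 4 ≤ K * (E ^ 2 / d ^ 4) := by
      have : 0 ≤ E ^ 2 / d ^ 4 := by positivity
      nlinarith
    linarith
  have hM1 : (1:ℝ) ≤ (((B + 1) * m : ℕ) : ℝ) := by
    exact_mod_cast Nat.one_le_iff_ne_zero.2 (by positivity)
  calc (P.card : ℝ) ≤ (((B + 1) * m : ℕ) : ℝ) ^ N := by exact_mod_cast hcard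
    _ = (((B + 1) * m : ℕ) : ℝ) ^ (N : ℝ) := (Real.rpow_natCast _ _).symm
    _ ≤ (((B + 1) * m : ℕ) : ℝ) ^ (2000 * K * (E ^ 2 / d ^ 4)) :=
        Real.rpow_le_rpow_of_exponent_le hM1 hNle
    _ ≤ _ := Real.rpow_le_rpow (by positivity) hM (by positivity)

/-! ### Potentials -/

/-- Convolution of a function on space-time with a measure. -/
def mconv (μ : Measure Spt) (H : Spt → ℝ) (p : Spt) : ℝ := ∫ y, H (p - y) ∂μ

section mconv
variable {μ : Measure Spt} [IsLocallyFiniteMeasure μ] {H : Spt → ℝ}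

theorem hasCompactSupport_DD {V : Type*} [NormedAddCommGroup V] [NormedSpace ℝ V] {H : V → ℝ}
    (hc : HasCompactSupport H) (ξ : V) : HasCompactSupport (DD ξ H) := by
  refine (hc.fderiv (𝕜 := ℝ)).mono ?_
  intro x hx h
  exact hx (by simp [DD, h])

theorem mconv_smooth (hH : ContDiff ℝ (⊤ : ℕ∞) H) (hc : HasCompactSupport H) :
    ContDiff ℝ (⊤ : ℕ∞) (mconv μ H) := by
  have h := hc.contDiff_convolution_right (μ := μ) (f := fun _ : Spt => (1:ℝ))
    (n := (⊤ : ℕ∞)) (ContinuousLinearMap.mul ℝ ℝ) (locallyIntegrable_const 1) hH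
  convert h using 1
  ext p
  simp [mconv, convolution]

theorem mconv_slice_compact (hc : HasCompactSupport H) (p : Spt) :
    HasCompactSupport (fun y => H (p - y)) :=
  hc.comp_homeomorph (Homeomorph.subLeft p)

theorem mconv_integrable (hH : Continuous H) (hc : HasCompactSupport H) (p : Spt) :
    Integrable (fun y => H (p - y)) μ :=
  (hH.comp (by fun_prop)).integrable_of_hasCompactSupport (mconv_slice_compact hc p)

theorem DD_mconv (hH : ContDiff ℝ (⊤ : ℕ∞) H) (hc : HasCompactSupport H) (ξ p : Spt) :
    DD ξ (mconv μ H) p = mconv μ (DD ξ H) p := by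
  have h1 := DD_hasDerivAt (ξ := ξ) (f := mconv μ H) (p := p)
    (smooth_diffAt (mconv_smooth hH hc))
  have hD := DD_smooth (ξ := ξ) hH
  have hDc := hasCompactSupport_DD hc ξ
  obtain ⟨C, hC⟩ := hDc.exists_bound_of_continuous hD.continuous
  set K : Set Spt := (fun q : ℝ × Spt => p + q.1 • ξ - q.2) ''
    (Metric.closedBall (0:ℝ) 1 ×ˢ tsupport (DD ξ H)) with hK
  have hKc : IsCompact K :=
    ((isCompact_closedBall _ _).prod hDc.isCompact).image (by fun_prop)
  have h2 := (hasDerivAt_integral_of_dominated_loc_of_deriv_le (μ := μ)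
    (F := fun s y => H (p + s • ξ - y)) (F' := fun s y => DD ξ H (p + s • ξ - y))
    (bound := K.indicator (fun _ => C)) (x₀ := (0:ℝ)) (Metric.ball_mem_nhds _ one_pos)
    ?_ ?_ ?_ ?_ ?_ ?_).2
  · have := h1.unique h2
    simpa [mconv] using this
  · exact Filter.Eventually.of_forall fun s =>
      (hH.continuous.comp (by fun_prop)).aestronglyMeasurable
  · exact mconv_integrable hH.continuous hc _
  · exact (hD.continuous.comp (by fun_prop)).aestronglyMeasurable
  · filter_upwards with y s hs
    by_cases hy : y ∈ K
    · simpa [hy] using hC _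
    · have : DD ξ H (p + s • ξ - y) = 0 := by
        by_contra h
        exact hy ⟨(s, p + s • ξ - y), ⟨Metric.ball_subset_closedBall hs, subset_tsupport _ h⟩,
          by simp⟩
      simp [this, hy]
  · exact (integrable_indicator_iff hKc.measurableSet).2
      (integrableOn_const (by exact hKc.measure_lt_top.ne))
  · filter_upwards with y s hs
    have h := DD_hasDerivAt (ξ := ξ) (f := H) (p := p + s • ξ - y) (smooth_diffAt hH)
    have h3 : HasDerivAt (fun r : ℝ => r - s) 1 s := (hasDerivAt_id s).sub_const s
    have h4 := HasDerivAt.scomp_of_eq (h := fun r : ℝ => r - s) s h h3 (by simp)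
    simp only [one_smul] at h4
    convert h4 using 1
    ext r
    simp only [Function.comp]
    congr 1
    module

end mconv

/-- The measure with density `1/|y|` on `ℝ³`. -/
def kmeas : Measure E3 := volume.withDensity (fun y => ENNReal.ofReal ‖y‖⁻¹)

theorem locallyIntegrable_inv_norm : LocallyIntegrable (fun y : E3 => ‖y‖⁻¹) := by
  refine locallyIntegrable_of_norm_le_rpow (C := 1) (α := 1) (by simp) (by simp) ?_ ?_
  · filter_upwards with x
    simp [Real.rpow_neg_one]
  · exact (measurable_norm.inv).aestronglyMeasurable

theorem integral_kmeas (f : E3 → ℝ) : ∫ y, f y ∂kmeas = ∫ y, ‖y‖⁻¹ * f y := by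
  unfold kmeas
  rw [integral_withDensity_eq_integral_toReal_smul (by fun_prop)
    (Filter.Eventually.of_forall fun _ => ENNReal.ofReal_lt_top)]
  congr 1
  ext y
  rw [ENNReal.toReal_ofReal (by positivity), smul_eq_mul]

theorem integrable_kmeas {f : E3 → ℝ} :
    Integrable f kmeas ↔ Integrable (fun y => ‖y‖⁻¹ * f y) := by
  unfold kmeas
  rw [integrable_withDensity_iff_integrable_smul' (by fun_prop)
    (Filter.Eventually.of_forall fun _ => ENNReal.ofReal_lt_top)]
  refine integrable_congr (Filter.Eventually.of_forall fun y => ?_)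
  simp only
  rw [ENNReal.toReal_ofReal (by positivity), smul_eq_mul]

theorem kmeas_compact {K : Set E3} (hK : IsCompact K) : kmeas K < ⊤ := by
  unfold kmeas
  rw [withDensity_apply _ hK.measurableSet]
  have := (locallyIntegrable_inv_norm.integrableOn_isCompact hK).2
  rw [HasFiniteIntegral] at this
  refine lt_of_le_of_lt (lintegral_mono fun y => ?_) this
  rw [← ofReal_norm]
  exact ENNReal.ofReal_le_ofReal (le_abs_self _)

/-- The measure whose convolution gives the potential `pot lam`. -/
def potm (lam : ℝ) : Measure Spt := kmeas.map (fun y => ((lam * ‖y‖, y) : Spt))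

/-- Retarded (for `lam = 1`) and Newtonian (for `lam = 0`) potentials. -/
def pot (lam : ℝ) (H : Spt → ℝ) : Spt → ℝ := mconv (potm lam) H

instance (lam : ℝ) : IsLocallyFiniteMeasure (potm lam) := by
  refine ⟨fun p => ⟨Metric.ball p 1, Metric.ball_mem_nhds _ one_pos, ?_⟩⟩
  unfold potm
  rw [Measure.map_apply (by fun_prop) Metric.isOpen_ball.measurableSet]
  refine lt_of_le_of_lt (measure_mono ?_) (kmeas_compact (isCompact_closedBall p.2 1))
  intro y hy
  have h1 : dist ((lam * ‖y‖, y) : Spt) p < 1 := hy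
  rw [Prod.dist_eq] at h1
  exact (lt_of_le_of_lt (le_max_right _ _) h1).le

theorem pot_eq (lam : ℝ) {H : Spt → ℝ} (hH : Continuous H) (p : Spt) :
    pot lam H p = ∫ y, ‖y‖⁻¹ * H (p - (lam * ‖y‖, y)) := by
  unfold pot mconv potm
  rw [integral_map (by fun_prop) (by exact (hH.comp (by fun_prop)).aestronglyMeasurable),
    integral_kmeas]

theorem pot_smooth (lam : ℝ) {H : Spt → ℝ} (hH : ContDiff ℝ (⊤ : ℕ∞) H)
    (hc : HasCompactSupport H) : ContDiff ℝ (⊤ : ℕ∞) (pot lam H) := mconv_smooth hH hc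

theorem DD_pot (lam : ℝ) {H : Spt → ℝ} (hH : ContDiff ℝ (⊤ : ℕ∞) H)
    (hc : HasCompactSupport H) (ξ p : Spt) : DD ξ (pot lam H) p = pot lam (DD ξ H) p :=
  DD_mconv hH hc ξ p

theorem pot_integrable (lam : ℝ) {H : Spt → ℝ} (hH : Continuous H)
    (hc : HasCompactSupport H) (p : Spt) :
    Integrable (fun y => ‖y‖⁻¹ * H (p - (lam * ‖y‖, y))) := by
  have h := mconv_integrable (μ := potm lam) hH hc p
  unfold potm at h
  rw [integrable_map_measure (by exact (hH.comp (by fun_prop)).aestronglyMeasurable)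
    (by fun_prop)] at h
  exact integrable_kmeas.1 h

/-! ### The fundamental solution identity -/

/-- Coordinate directions in space. -/
abbrev eE (i : Fin 3) : E3 := EuclideanSpace.single i 1

theorem DD_coordE (i j : Fin 3) (y : E3) :
    DD (eE i) (fun z : E3 => z j) y = if i = j then 1 else 0 := by
  have h : HasFDerivAt (fun z : E3 => z j) (EuclideanSpace.proj j : E3 →L[ℝ] ℝ) y :=
    (EuclideanSpace.proj j : E3 →L[ℝ] ℝ).hasFDerivAt
  simp [DD, h.fderiv, eq_comm]

@[fun_prop]
theorem coordE_smooth (j : Fin 3) {n : WithTop ℕ∞} : ContDiff ℝ n (fun z : E3 => z j) :=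
  (EuclideanSpace.proj j : E3 →L[ℝ] ℝ).contDiff

theorem coordE_diffAt (j : Fin 3) (y : E3) : DifferentiableAt ℝ (fun z : E3 => z j) y :=
  (coordE_smooth j (n := 1)).differentiable (by simp) y

theorem normE_sq (y : E3) : ‖y‖ ^ 2 = ∑ i, y i ^ 2 := by
  rw [EuclideanSpace.norm_sq_eq]; simp

theorem DD_nsqE (i : Fin 3) (y : E3) : DD (eE i) (fun z : E3 => ‖z‖ ^ 2) y = 2 * y i := by
  simp only [normE_sq]
  rw [DD_sum (f := fun j z => (z : E3) j ^ 2) _ (fun j _ => (coordE_diffAt j y).pow 2)]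
  rw [Finset.sum_eq_single i]
  · rw [DD_pow (coordE_diffAt i y), DD_coordE]; simp
  · intro j _ hj
    rw [DD_pow (coordE_diffAt j y), DD_coordE, if_neg (Ne.symm hj)]; simp
  · simp

theorem normE_diffAt {y : E3} (hy : y ≠ 0) : DifferentiableAt ℝ (fun z : E3 => ‖z‖) y :=
  (contDiffAt_norm ℝ hy (n := 1)).differentiableAt (by simp)

theorem DD_normE (i : Fin 3) {y : E3} (hy : y ≠ 0) :
    DD (eE i) (fun z : E3 => ‖z‖) y = y i * ‖y‖⁻¹ := by
  have h := DD_nsqE i y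
  rw [DD_pow (normE_diffAt hy)] at h
  have h0 : ‖y‖ ≠ 0 := by simpa
  field_simp
  simp at h
  linarith

theorem DD_inv_normE (i : Fin 3) {y : E3} (hy : y ≠ 0) :
    DD (eE i) (fun z : E3 => ‖z‖⁻¹) y = - y i * ‖y‖⁻¹ ^ 3 := by
  rw [DD_inv (f := fun z : E3 => ‖z‖) (normE_diffAt hy) (by simpa), DD_normE i hy]
  have h0 : ‖y‖ ≠ 0 := by simpa
  field_simp

theorem hasFDerivAt_move {lam : ℝ} {p : Spt} {y : E3} (hy : y ≠ 0) :
    HasFDerivAt (fun z : E3 => p - ((lam * ‖z‖, z) : Spt))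
      (-(((lam • fderiv ℝ (fun z : E3 => ‖z‖) y)).prod (ContinuousLinearMap.id ℝ E3))) y :=
  (((normE_diffAt hy).hasFDerivAt.const_mul lam).prodMk (hasFDerivAt_id y)).const_sub p

theorem DD_move {lam : ℝ} {p : Spt} {F : Spt → ℝ} {y : E3} (hy : y ≠ 0)
    (hF : Differentiable ℝ F) (i : Fin 3) :
    DD (eE i) (fun z : E3 => F (p - ((lam * ‖z‖, z) : Spt))) y =
      - (lam * (y i * ‖y‖⁻¹) * DD eT F (p - (lam * ‖y‖, y)))
        - DD (eX i) F (p - (lam * ‖y‖, y)) := by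
  have h := ((hF (p - (lam * ‖y‖, y))).hasFDerivAt.comp y (hasFDerivAt_move (lam := lam) (p := p) hy))
  have h2 : fderiv ℝ (fun z : E3 => F (p - ((lam * ‖z‖, z) : Spt))) y = _ := h.fderiv
  unfold DD
  rw [h2, ContinuousLinearMap.comp_apply, fderiv_Spt]
  have h3 : fderiv ℝ (fun z : E3 => ‖z‖) y (eE i) = y i * ‖y‖⁻¹ := DD_normE i hy
  simp [h3, DD]
  ring

theorem contDiffAt_move {lam : ℝ} {p : Spt} {F : Spt → ℝ} {y : E3} (hy : y ≠ 0)
    (hF : ContDiff ℝ (⊤ : ℕ∞) F) :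
    ContDiffAt ℝ 1 (fun z : E3 => F (p - ((lam * ‖z‖, z) : Spt))) y := by
  have h1 : ContDiffAt ℝ 1 (fun z : E3 => p - ((lam * ‖z‖, z) : Spt)) y :=
    contDiffAt_const.sub ((contDiffAt_const.mul (contDiffAt_norm ℝ hy)).prodMk contDiffAt_id)
  exact ((hF.of_le (by exact_mod_cast le_top)).contDiffAt).comp y h1

/-- The wave operator with speed parameter. -/
def boxL (lam : ℝ) (H : Spt → ℝ) (p : Spt) : ℝ :=
  lam ^ 2 * DD eT (DD eT H) p - ∑ i, DD (eX i) (DD (eX i) H) p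

/-- Cutoff vanishing near the origin. -/
def zc (ε : ℝ) (y : E3) : ℝ := smoothTransition ((ε ^ 2)⁻¹ * ‖y‖ ^ 2 - 1)

theorem zc_smooth (ε : ℝ) : ContDiff ℝ 1 (zc ε) :=
  smoothTransition.contDiff.comp ((contDiff_const.mul (contDiff_norm_sq ℝ)).sub contDiff_const)

theorem DD_zc (ε : ℝ) (i : Fin 3) (y : E3) :
    DD (eE i) (zc ε) y = stD ((ε ^ 2)⁻¹ * ‖y‖ ^ 2 - 1) * ((ε ^ 2)⁻¹ * (2 * y i)) := by
  have h1 : DifferentiableAt ℝ (fun z : E3 => ‖z‖ ^ 2) y :=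
    (contDiff_norm_sq ℝ (n := 1)).differentiable (by simp) y
  unfold zc
  rw [DD_st ((h1.const_mul _).sub_const _), DD_sub (h1.const_mul _) (by fun_prop),
    DD_mul (by fun_prop) h1, DD_const, DD_const, DD_nsqE]
  simp

theorem zc_zero {ε : ℝ} (hε : 0 < ε) {y : E3} (hy : ‖y‖ ≤ ε) : zc ε y = 0 := by
  apply smoothTransition.zero_of_nonpos
  have : ‖y‖ ^ 2 ≤ ε ^ 2 := by gcongr
  rw [sub_nonpos, inv_mul_le_iff₀ (by positivity)]
  linarith

/-- The vector field whose divergence yields the fundamental solution identity. -/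
def fsV (lam : ℝ) (H : Spt → ℝ) (p : Spt) (i : Fin 3) (y : E3) : ℝ :=
  lam * y i * ‖y‖⁻¹ ^ 2 * DD eT H (p - (lam * ‖y‖, y))
    - ‖y‖⁻¹ * DD (eX i) H (p - (lam * ‖y‖, y))
    + y i * ‖y‖⁻¹ ^ 3 * H (p - (lam * ‖y‖, y))

theorem contDiffAt_inv_norm {y : E3} (hy : y ≠ 0) : ContDiffAt ℝ 1 (fun z : E3 => ‖z‖⁻¹) y :=
  (contDiffAt_norm ℝ hy).inv (by simpa)

theorem fsV_contDiffAt {lam : ℝ} {H : Spt → ℝ} {p : Spt} (hH : ContDiff ℝ (⊤ : ℕ∞) H) (i : Fin 3)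
    {y : E3} (hy : y ≠ 0) : ContDiffAt ℝ 1 (fsV lam H p i) y := by
  have h1 := contDiffAt_move (lam := lam) (p := p) hy (DD_smooth (ξ := eT) hH)
  have h2 := contDiffAt_move (lam := lam) (p := p) hy (DD_smooth (ξ := eX i) hH)
  have h3 := contDiffAt_move (lam := lam) (p := p) hy hH
  have h4 := contDiffAt_inv_norm hy
  have h5 : ContDiffAt ℝ 1 (fun z : E3 => z i) y := (coordE_smooth i).contDiffAt
  unfold fsV
  exact ((((contDiffAt_const.mul h5).mul (h4.pow 2)).mul h1).sub (h4.mul h2)).add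
    ((h5.mul (h4.pow 3)).mul h3)

theorem DD_fsV_aux {a r F₁ F₂ F₃ : E3 → ℝ} {ξ y : E3} (lam : ℝ) (ha : DifferentiableAt ℝ a y)
    (hr : DifferentiableAt ℝ r y) (h₁ : DifferentiableAt ℝ F₁ y) (h₂ : DifferentiableAt ℝ F₂ y)
    (h₃ : DifferentiableAt ℝ F₃ y) :
    DD ξ (fun z => lam * a z * r z ^ 2 * F₁ z - r z * F₂ z + a z * r z ^ 3 * F₃ z) y =
      (lam * DD ξ a y * r y ^ 2 + lam * a y * (2 * r y * DD ξ r y)) * F₁ y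
        + lam * a y * r y ^ 2 * DD ξ F₁ y
      - (DD ξ r y * F₂ y + r y * DD ξ F₂ y)
      + ((DD ξ a y * r y ^ 3 + a y * (3 * r y ^ 2 * DD ξ r y)) * F₃ y
        + a y * r y ^ 3 * DD ξ F₃ y) := by
  rw [DD_add (by fun_prop) (by fun_prop), DD_sub (by fun_prop) (by fun_prop),
    DD_mul (by fun_prop) h₁, DD_mul (f := fun z => lam * a z) (by fun_prop) (by fun_prop),
    DD_mul hr h₂, DD_mul (by fun_prop) h₃, DD_mul ha (by fun_prop), DD_pow hr, DD_pow hr,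
    DD_mul (by fun_prop) ha, DD_const]
  simp

theorem fsV_div {lam : ℝ} {H : Spt → ℝ} {p : Spt} (hH : ContDiff ℝ (⊤ : ℕ∞) H)
    {y : E3} (hy : y ≠ 0) :
    ∑ i, DD (eE i) (fsV lam H p i) y = - (‖y‖⁻¹ * boxL lam H (p - (lam * ‖y‖, y))) := by
  have key : ∀ i, DD (eE i) (fsV lam H p i) y =
      (lam * 1 * ‖y‖⁻¹ ^ 2 + lam * y i * (2 * ‖y‖⁻¹ * (- y i * ‖y‖⁻¹ ^ 3)))
          * DD eT H (p - (lam * ‖y‖, y))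
        + lam * y i * ‖y‖⁻¹ ^ 2 * (- (lam * (y i * ‖y‖⁻¹) * DD eT (DD eT H) (p - (lam * ‖y‖, y)))
        - DD (eX i) (DD eT H) (p - (lam * ‖y‖, y)))
      - ((- y i * ‖y‖⁻¹ ^ 3) * DD (eX i) H (p - (lam * ‖y‖, y))
        + ‖y‖⁻¹ * (- (lam * (y i * ‖y‖⁻¹) * DD eT (DD (eX i) H) (p - (lam * ‖y‖, y)))
        - DD (eX i) (DD (eX i) H) (p - (lam * ‖y‖, y))))
      + ((1 * ‖y‖⁻¹ ^ 3 + y i * (3 * ‖y‖⁻¹ ^ 2 * (- y i * ‖y‖⁻¹ ^ 3))) * H (p - (lam * ‖y‖, y))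
        + y i * ‖y‖⁻¹ ^ 3 * (- (lam * (y i * ‖y‖⁻¹) * DD eT H (p - (lam * ‖y‖, y)))
        - DD (eX i) H (p - (lam * ‖y‖, y)))) := by
    intro i
    have d1 := (contDiffAt_move (lam := lam) (p := p) hy (DD_smooth (ξ := eT) hH)).differentiableAt
      (by simp)
    have d2 := (contDiffAt_move (lam := lam) (p := p) hy
      (DD_smooth (ξ := eX i) hH)).differentiableAt (by simp)
    have d3 := (contDiffAt_move (lam := lam) (p := p) hy hH).differentiableAt (by simp)
    have d4 := (contDiffAt_inv_norm hy).differentiableAt (by simp)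
    have d5 := coordE_diffAt i y
    unfold fsV
    rw [DD_fsV_aux lam d5 d4 d1 d2 d3, DD_coordE, DD_inv_normE i hy,
      DD_move hy (smooth_diff (DD_smooth hH)), DD_move hy (smooth_diff (DD_smooth hH)),
      DD_move hy (smooth_diff hH)]
    simp
  simp only [key, boxL]
  have hr : (y 0 ^ 2 + y 1 ^ 2 + y 2 ^ 2) * ‖y‖⁻¹ ^ 2 = 1 := by
    have := normE_sq y
    rw [Fin.sum_univ_three] at this
    rw [← this, ← mul_pow, mul_inv_cancel₀ (by simpa), one_pow]
  have hc : ∀ i, DD eT (DD (eX i) H) (p - (lam * ‖y‖, y))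
      = DD (eX i) (DD eT H) (p - (lam * ‖y‖, y)) := fun i => DD_comm hH
  simp only [hc, Fin.sum_univ_three]
  set r := ‖y‖⁻¹
  linear_combination (-3 * lam * r ^ 2 * DD eT H (p - (lam * ‖y‖, y))
    - lam ^ 2 * r * DD eT (DD eT H) (p - (lam * ‖y‖, y))
    - 3 * r ^ 3 * H (p - (lam * ‖y‖, y))) * hr

instance : IsLocallyFiniteMeasure kmeas :=
  ⟨fun y => ⟨Metric.ball y 1, Metric.ball_mem_nhds _ one_pos,
    lt_of_le_of_lt (measure_mono Metric.ball_subset_closedBall)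
      (kmeas_compact (isCompact_closedBall y 1))⟩⟩

theorem integrable_inv_norm_mul {f : E3 → ℝ} {R : ℝ} (hf : Continuous f)
    (h : ∀ x, R < ‖x‖ → f x = 0) : Integrable (fun y => ‖y‖⁻¹ * f y) :=
  integrable_kmeas.1 (hf.integrable_of_hasCompactSupport (hasCompactSupport_of_ball h))

theorem DD_eventually_zero {V : Type*} [NormedAddCommGroup V] [NormedSpace ℝ V] {H : V → ℝ}
    {p ξ : V} (h : H =ᶠ[nhds p] 0) : DD ξ H =ᶠ[nhds p] 0 := by
  filter_upwards [h.fderiv (𝕜 := ℝ)] with q hq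
  simp only [DD, hq]
  simp [fderiv_zero]

@[fun_prop]
theorem boxL_smooth (lam : ℝ) {H : Spt → ℝ} (hH : ContDiff ℝ (⊤ : ℕ∞) H) :
    ContDiff ℝ (⊤ : ℕ∞) (boxL lam H) := by
  unfold boxL; fun_prop

theorem boxL_eq_zero (lam : ℝ) {H : Spt → ℝ} {p : Spt} (h : H =ᶠ[nhds p] 0) :
    boxL lam H p = 0 := by
  have h1 := fun ξ : Spt => (DD_eventually_zero (ξ := ξ) (DD_eventually_zero (ξ := ξ) h)).eq_of_nhds
  simp only [boxL, h1]
  simp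

theorem ae_ne_zero : ∀ᵐ y : E3, y ≠ 0 := by
  rw [ae_iff]
  simp

/-- The integrand in the rescaled cutoff identity. -/
def fsG (lam : ℝ) (H : Spt → ℝ) (p : Spt) (ε : ℝ) (z : E3) : ℝ :=
  stD (‖z‖ ^ 2 - 1) * (ε * lam * DD eT H (p - (lam * (ε * ‖z‖), ε • z))
    - ε * (‖z‖⁻¹ * ∑ i, z i * DD (eX i) H (p - (lam * (ε * ‖z‖), ε • z)))
    + ‖z‖⁻¹ * H (p - (lam * (ε * ‖z‖), ε • z)))

section fs
variable {lam : ℝ} {H : Spt → ℝ} {p : Spt} {ρ : ℝ}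

theorem fs_integrable (hH : ContDiff ℝ (⊤ : ℕ∞) H)
    (hloc : ∀ y : E3, ρ ≤ ‖y‖ → H =ᶠ[nhds (p - (lam * ‖y‖, y))] 0) :
    Integrable (fun y : E3 => ‖y‖⁻¹ * boxL lam H (p - (lam * ‖y‖, y))) :=
  integrable_inv_norm_mul (R := ρ) ((boxL_smooth lam hH).continuous.comp (by fun_prop))
    (fun y hy => boxL_eq_zero lam (hloc y hy.le))

theorem zc_nonneg (ε : ℝ) (y : E3) : 0 ≤ zc ε y := smoothTransition.nonneg _

theorem zc_le_one (ε : ℝ) (y : E3) : zc ε y ≤ 1 := smoothTransition.le_one _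

theorem zc_mul_fsV_contDiff (hH : ContDiff ℝ (⊤ : ℕ∞) H) {ε : ℝ} (hε : 0 < ε) (i : Fin 3) :
    ContDiff ℝ 1 (fun y => zc ε y * fsV lam H p i y) := by
  rw [contDiff_iff_contDiffAt]
  intro y
  by_cases hy : y = 0
  · have : (fun y => zc ε y * fsV lam H p i y) =ᶠ[nhds y] fun _ => 0 := by
      filter_upwards [Metric.ball_mem_nhds y hε] with z hz
      rw [hy, mem_ball_zero_iff] at hz
      rw [zc_zero hε hz.le, zero_mul]
    exact contDiffAt_const.congr_of_eventuallyEq this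
  · exact (zc_smooth ε).contDiffAt.mul (fsV_contDiffAt hH i hy)

theorem fsV_eq_zero {i : Fin 3} {y : E3} (h : H =ᶠ[nhds (p - (lam * ‖y‖, y))] 0) :
    fsV lam H p i y = 0 := by
  have h1 := fun ξ : Spt => (DD_eventually_zero (ξ := ξ) h).eq_of_nhds
  have h2 := h.eq_of_nhds
  simp only [fsV, h1, h2]
  simp

theorem fs_cutoff (hH : ContDiff ℝ (⊤ : ℕ∞) H)
    (hloc : ∀ y : E3, ρ ≤ ‖y‖ → H =ᶠ[nhds (p - (lam * ‖y‖, y))] 0) {ε : ℝ} (hε : 0 < ε) :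
    ∫ y, zc ε y * (‖y‖⁻¹ * boxL lam H (p - (lam * ‖y‖, y))) = 2 * ∫ z, fsG lam H p ε z := by
  have hs := zc_mul_fsV_contDiff (lam := lam) (p := p) hH hε
  have hsup : ∀ i (y : E3), ρ < ‖y‖ → zc ε y * fsV lam H p i y = 0 := fun i y hy => by
    rw [fsV_eq_zero (hloc y hy.le), mul_zero]
  have h0 : ∀ i, ∫ y, DD (eE i) (fun y => zc ε y * fsV lam H p i y) y = 0 := fun i =>
    integral_DD_eq_zero (hs i) (hasCompactSupport_of_ball (hsup i)) _
  have hI : ∀ i, Integrable (DD (eE i) (fun y => zc ε y * fsV lam H p i y)) := fun i =>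
    Continuous.integrable_of_hasCompactSupport
      (((hs i).continuous_fderiv (by simp)).clm_apply continuous_const)
      (hasCompactSupport_DD (hasCompactSupport_of_ball (hsup i)) _)
  have hsum : ∫ y, ∑ i, DD (eE i) (fun y => zc ε y * fsV lam H p i y) y = 0 := by
    rw [integral_finsetSum _ fun i _ => hI i]
    simp [h0]
  have hB : Integrable (fun y => zc ε y * (‖y‖⁻¹ * boxL lam H (p - (lam * ‖y‖, y)))) := by
    refine (fs_integrable hH hloc).bdd_mul (c := 1) (zc_smooth ε).continuous.aestronglyMeasurable ?_
    filter_upwards with y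
    rw [Real.norm_eq_abs, abs_of_nonneg (zc_nonneg _ _)]
    exact zc_le_one _ _
  have hg : ∀ᵐ y : E3, ∑ i, DD (eE i) (fun y => zc ε y * fsV lam H p i y) y
      + zc ε y * (‖y‖⁻¹ * boxL lam H (p - (lam * ‖y‖, y)))
      = 2 * ((ε ^ 3)⁻¹ * fsG lam H p ε (ε⁻¹ • y)) := by
    filter_upwards [ae_ne_zero] with y hy
    have e1 : ∀ i, DD (eE i) (fun y => zc ε y * fsV lam H p i y) y
        = DD (eE i) (zc ε) y * fsV lam H p i y + zc ε y * DD (eE i) (fsV lam H p i) y := fun i =>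
      DD_mul ((zc_smooth ε).differentiable (by simp) y)
        ((fsV_contDiffAt hH i hy).differentiableAt (by simp))
    simp only [e1, Finset.sum_add_distrib, ← Finset.mul_sum, fsV_div hH hy]
    have hr : (y 0 ^ 2 + y 1 ^ 2 + y 2 ^ 2) * ‖y‖⁻¹ ^ 2 = 1 := by
      have := normE_sq y
      rw [Fin.sum_univ_three] at this
      rw [← this, ← mul_pow, mul_inv_cancel₀ (by simpa), one_pow]
    have hn : ‖y‖ ≠ 0 := by simpa
    have e2 : ‖ε⁻¹ • y‖ = ε⁻¹ * ‖y‖ := by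
      rw [norm_smul, Real.norm_of_nonneg (by positivity)]
    have e3 : ε • ε⁻¹ • y = y := by rw [smul_smul, mul_inv_cancel₀ hε.ne', one_smul]
    have e4 : ε * (ε⁻¹ * ‖y‖) = ‖y‖ := by field_simp
    have e5 : (ε ^ 2)⁻¹ * ‖y‖ ^ 2 = (ε⁻¹ * ‖y‖) ^ 2 := by rw [mul_pow, inv_pow]
    simp only [fsG, e2, e3, e4, DD_zc, fsV, Fin.sum_univ_three, PiLp.smul_apply, smul_eq_mul,
      mul_inv, inv_inv]
    rw [e5]
    set r := ‖y‖⁻¹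
    set A := stD ((ε⁻¹ * ‖y‖) ^ 2 - 1)
    have e6 : ε⁻¹ ^ 2 = (ε ^ 2)⁻¹ := by rw [inv_pow]
    have e7 : ε⁻¹ ^ 3 = (ε ^ 3)⁻¹ := by rw [inv_pow]
    have e8 : ε * ε⁻¹ = 1 := mul_inv_cancel₀ hε.ne'
    simp only [← e6, ← e7]
    set δ := ε⁻¹
    linear_combination (2 * A * δ ^ 2 * (lam * DD eT H (p - (lam * ‖y‖, y))
      + r * H (p - (lam * ‖y‖, y)))) * hr
      - (2 * A * δ ^ 2 * (lam * DD eT H (p - (lam * ‖y‖, y)) + r * H (p - (lam * ‖y‖, y))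
        - r * (ε * δ + 1) * (y 0 * DD (eX 0) H (p - (lam * ‖y‖, y))
          + y 1 * DD (eX 1) H (p - (lam * ‖y‖, y)) + y 2 * DD (eX 2) H (p - (lam * ‖y‖, y))))) * e8
  have h3 : ∫ y, (ε ^ 3)⁻¹ * fsG lam H p ε (ε⁻¹ • y) = ∫ z, fsG lam H p ε z := by
    rw [integral_const_mul, Measure.integral_comp_smul]
    simp only [finrank_euclideanSpace, Fintype.card_fin, smul_eq_mul]
    rw [abs_of_pos (by positivity), ← mul_assoc, inv_pow, inv_inv, inv_mul_cancel₀ (by positivity),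
      one_mul]
  have h4 := integral_congr_ae hg
  rw [integral_add (integrable_finsetSum _ fun i _ => hI i) hB, hsum, integral_const_mul, h3,
    zero_add] at h4
  exact h4

/-- The normalising constant of the fundamental solution. -/
def c0 : ℝ := 2 * ∫ z : E3, stD (‖z‖ ^ 2 - 1) * ‖z‖⁻¹

theorem stD_norm_continuous {f : ℝ × E3 → ℝ} (hf : ∀ q : ℝ × E3, q.2 ≠ 0 → ContinuousAt f q) :
    Continuous (fun q : ℝ × E3 => stD (‖q.2‖ ^ 2 - 1) * f q) := by
  rw [continuous_iff_continuousAt]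
  intro q
  by_cases hq : q.2 = 0
  · have : (fun q : ℝ × E3 => stD (‖q.2‖ ^ 2 - 1) * f q) =ᶠ[nhds q] fun _ => 0 := by
      have : {q : ℝ × E3 | ‖q.2‖ < 1} ∈ nhds q :=
        (isOpen_lt (by fun_prop) (by fun_prop)).mem_nhds (by simp [hq])
      filter_upwards [this] with z hz
      have hz' : ‖z.2‖ < 1 := hz
      rw [stD_of_nonpos, zero_mul]
      nlinarith [norm_nonneg z.2]
    exact continuousAt_const.congr this.symm
  · have h1 : Continuous (fun q : ℝ × E3 => stD (‖q.2‖ ^ 2 - 1)) :=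
      stD_continuous.comp (by fun_prop)
    exact h1.continuousAt.mul (hf q hq)

theorem stD_norm_zero {z : E3} (hz : 2 < ‖z‖) : stD (‖z‖ ^ 2 - 1) = 0 :=
  stD_of_one_le (by nlinarith)

theorem c0_pos : 0 < c0 := by
  have hc0 : Continuous (fun q : ℝ × E3 => stD (‖q.2‖ ^ 2 - 1) * ‖q.2‖⁻¹) :=
    stD_norm_continuous (f := fun q => ‖q.2‖⁻¹) fun q hq =>
      (show ContinuousAt (fun q : ℝ × E3 => ‖q.2‖) q by fun_prop).inv₀ (by simpa)
  have hc1 : Continuous (fun z : E3 => ((0:ℝ), z)) := by fun_prop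
  have hc : Continuous (fun z : E3 => stD (‖z‖ ^ 2 - 1) * ‖z‖⁻¹) := by
    have h := hc0.comp hc1
    simp only [Function.comp_def] at h
    exact h
  obtain ⟨s, hs⟩ : ∃ s, stD s ≠ 0 := by
    by_contra! h
    have := is_const_of_deriv_eq_zero
      ((smoothTransition.contDiff (n := 1)).differentiable (by simp)) h 0 1
    simp at this
  have hs0 : 0 < s := by
    by_contra! h
    exact hs (stD_of_nonpos h)
  have := hc.integral_pos_of_hasCompactSupport_nonneg_nonzero (μ := volume)
    (hasCompactSupport_of_ball (R := 2) fun z hz => by rw [stD_norm_zero hz, zero_mul])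
    (fun z => mul_nonneg (stD_nonneg _) (by positivity))
    (x := EuclideanSpace.single 0 (√(s + 1))) (by
      have h1 : ‖(EuclideanSpace.single 0 (√(s + 1)) : E3)‖ = √(s + 1) := by
        simp
      simp only [h1]
      rw [Real.sq_sqrt (by linarith), add_sub_cancel_right]
      exact mul_ne_zero hs (by positivity))
  unfold c0
  linarith

theorem fsG_tendsto (hH : ContDiff ℝ (⊤ : ℕ∞) H) :
    Filter.Tendsto (fun ε => 2 * ∫ z, fsG lam H p ε z) (nhds 0) (nhds (c0 * H p)) := by
  have hc : Continuous (uncurry (fsG lam H p)) := by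
    unfold fsG
    refine stD_norm_continuous (f := fun q => _) fun q hq => ?_
    have h1 : Continuous (fun q : ℝ × E3 => p - ((lam * (q.1 * ‖q.2‖), q.1 • q.2) : Spt)) := by
      fun_prop
    have h2 : ∀ ξ, ContinuousAt
        (fun q : ℝ × E3 => DD ξ H (p - ((lam * (q.1 * ‖q.2‖), q.1 • q.2) : Spt))) q :=
      fun ξ => ((DD_smooth (ξ := ξ) hH).continuous.comp h1).continuousAt
    have h3 : ContinuousAt
        (fun q : ℝ × E3 => H (p - ((lam * (q.1 * ‖q.2‖), q.1 • q.2) : Spt))) q :=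
      (hH.continuous.comp h1).continuousAt
    have h4 : ContinuousAt (fun q : ℝ × E3 => ‖q.2‖⁻¹) q :=
      ((continuous_norm.comp continuous_snd).continuousAt).inv₀ (by simpa)
    have h5 : ∀ i, ContinuousAt (fun q : ℝ × E3 => q.2 i) q := fun i => by fun_prop
    have h6 : ContinuousAt (fun q : ℝ × E3 => q.1) q := continuousAt_fst
    refine ((((h6.mul continuousAt_const).mul (h2 eT))).sub (h6.mul (h4.mul ?_))).add (h4.mul h3)
    exact tendsto_finsetSum _ fun i _ => (h5 i).mul (h2 (eX i))
  have h := continuous_parametric_integral_of_continuous (μ := volume) hc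
    (isCompact_closedBall (0:E3) 2)
  have h1 : ∀ ε, ∫ z in Metric.closedBall (0:E3) 2, fsG lam H p ε z = ∫ z, fsG lam H p ε z := by
    intro ε
    refine setIntegral_eq_integral_of_forall_compl_eq_zero fun z hz => ?_
    rw [fsG, stD_norm_zero (by simpa using hz), zero_mul]
  simp only [h1] at h
  have h2 := (h.tendsto 0).const_mul 2
  have h3 : 2 * ∫ z, fsG lam H p 0 z = c0 * H p := by
    have : ∀ z, fsG lam H p 0 z = stD (‖z‖ ^ 2 - 1) * ‖z‖⁻¹ * H p := by
      intro z
      have : p - ((0:ℝ), (0:E3)) = p := by ext <;> simp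
      simp [fsG, this]
      ring
    simp only [this, integral_mul_const, c0]
    ring
  rwa [h3] at h2

/-- The kernel `1/|y|` is a fundamental solution. -/
theorem fundamental (hH : ContDiff ℝ (⊤ : ℕ∞) H)
    (hloc : ∀ y : E3, ρ ≤ ‖y‖ → H =ᶠ[nhds (p - (lam * ‖y‖, y))] 0) :
    ∫ y, ‖y‖⁻¹ * boxL lam H (p - (lam * ‖y‖, y)) = c0 * H p := by
  have hu : Filter.Tendsto (fun n : ℕ => 1 / ((n:ℝ) + 1)) Filter.atTop (nhds 0) :=
    tendsto_one_div_add_atTop_nhds_zero_nat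
  have h1 := (fsG_tendsto (lam := lam) (p := p) hH).comp hu
  have hI := fs_integrable hH hloc
  have h2 : Filter.Tendsto (fun n : ℕ => ∫ y, zc (1 / ((n:ℝ) + 1)) y
      * (‖y‖⁻¹ * boxL lam H (p - (lam * ‖y‖, y)))) Filter.atTop
      (nhds (∫ y, ‖y‖⁻¹ * boxL lam H (p - (lam * ‖y‖, y)))) := by
    refine tendsto_integral_of_dominated_convergence _
      (fun n => (zc_smooth _).continuous.aestronglyMeasurable.mul hI.aestronglyMeasurable)
      hI.norm ?_ ?_
    · intro n
      filter_upwards with y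
      rw [norm_mul, Real.norm_eq_abs (zc _ _), abs_of_nonneg (zc_nonneg _ _)]
      exact mul_le_of_le_one_left (norm_nonneg _) (zc_le_one _ _)
    · filter_upwards [ae_ne_zero] with y hy
      refine tendsto_const_nhds.congr' ?_
      have hpos : 0 < ‖y‖ := by simpa
      have := (hu.eventually (gt_mem_nhds (show 0 < ‖y‖ / 2 by positivity)))
      filter_upwards [this] with n hn
      have hn0 : 0 < 1 / ((n:ℝ) + 1) := by positivity
      rw [zc, smoothTransition.one_of_one_le, one_mul]
      have : (2 * (1 / ((n:ℝ) + 1))) ^ 2 ≤ ‖y‖ ^ 2 := by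
        gcongr
        linarith
      rw [le_sub_iff_add_le, inv_mul_eq_div, le_div_iff₀ (by positivity)]
      nlinarith
  refine tendsto_nhds_unique h2 (h1.congr fun n => ?_)
  exact (fs_cutoff hH hloc (by positivity)).symm

end fs

/-! ### Positivity of the Newtonian pairing -/

/-- A standard bump function. -/
def bump : E3 → ℝ := (⟨1, 2, one_pos, one_lt_two⟩ : ContDiffBump (0 : E3))

theorem bump_smooth : ContDiff ℝ (⊤ : ℕ∞) bump :=
  ContDiffBump.contDiff _

theorem bump_nonneg (x : E3) : 0 ≤ bump x := ContDiffBump.nonneg _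

theorem bump_le_one (x : E3) : bump x ≤ 1 := ContDiffBump.le_one _

theorem bump_one {x : E3} (hx : ‖x‖ ≤ 1) : bump x = 1 :=
  ContDiffBump.one_of_mem_closedBall _ (by simpa using hx)

theorem bump_zero {x : E3} (hx : 2 ≤ ‖x‖) : bump x = 0 :=
  ContDiffBump.zero_of_le_dist _ (by simpa using hx)

theorem bump_compact : HasCompactSupport bump := ContDiffBump.hasCompactSupport _

theorem DD_bump_zero {x : E3} (hx : ‖x‖ < 1 ∨ 2 < ‖x‖) (ξ : E3) : DD ξ bump =ᶠ[nhds x] 0 := by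
  rcases hx with hx | hx
  · have h : bump =ᶠ[nhds x] fun _ => 1 := by
      filter_upwards [(isOpen_lt continuous_norm continuous_const).mem_nhds hx] with y hy
      exact bump_one (le_of_lt hy)
    filter_upwards [h.fderiv (𝕜 := ℝ)] with q hq
    simp [DD, hq]
  · have h : bump =ᶠ[nhds x] 0 := by
      filter_upwards [(isOpen_lt continuous_const continuous_norm).mem_nhds hx] with y hy
      exact bump_zero (le_of_lt hy)
    exact DD_eventually_zero h

theorem exists_bump_bound : ∃ K : ℝ, 1 ≤ K ∧ (∀ i x, |DD (eE i) bump x| ≤ K) ∧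
    ∀ i x, |DD (eE i) (DD (eE i) bump) x| ≤ K := by
  have h1 : ∀ i, ∃ K, ∀ x, |DD (eE i) bump x| ≤ K := fun i =>
    (hasCompactSupport_DD bump_compact _).exists_bound_of_continuous
      (DD_smooth bump_smooth).continuous
  have h2 : ∀ i, ∃ K, ∀ x, |DD (eE i) (DD (eE i) bump) x| ≤ K := fun i =>
    (hasCompactSupport_DD (hasCompactSupport_DD bump_compact _) _).exists_bound_of_continuous
      (DD_smooth (DD_smooth bump_smooth)).continuous
  choose K1 hK1 using h1
  choose K2 hK2 using h2
  have n1 : ∀ i, 0 ≤ K1 i := fun i => (abs_nonneg _).trans (hK1 i 0)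
  have n2 : ∀ i, 0 ≤ K2 i := fun i => (abs_nonneg _).trans (hK2 i 0)
  have s1 : 0 ≤ ∑ i, K1 i := Finset.sum_nonneg fun i _ => n1 i
  have s2 : 0 ≤ ∑ i, K2 i := Finset.sum_nonneg fun i _ => n2 i
  refine ⟨1 + ∑ i, K1 i + ∑ i, K2 i, by linarith, fun i x => ?_, fun i x => ?_⟩
  · have := Finset.single_le_sum (fun i _ => n1 i) (Finset.mem_univ i)
    linarith [hK1 i x]
  · have := Finset.single_le_sum (fun i _ => n2 i) (Finset.mem_univ i)
    linarith [hK2 i x]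

theorem DD_scale {f : E3 → ℝ} (c : ℝ) (ξ x : E3) :
    DD ξ (fun y => f (c • y)) x = c * DD ξ f (c • x) := by
  unfold DD
  rw [fderiv_comp_smul]
  simp

theorem setIntegral_const_ball {r c : ℝ} (hr : 0 ≤ r) :
    ∫ x, (Metric.closedBall (0:E3) r).indicator (fun _ => c) x = r ^ 3 * vol1 * c := by
  rw [integral_indicator measurableSet_closedBall, setIntegral_const,
    volume_real_closedBall _ hr, smul_eq_mul]

theorem integrable_const_ball (r c : ℝ) :
    Integrable ((Metric.closedBall (0:E3) r).indicator (fun _ => c)) :=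
  (integrable_indicator_iff measurableSet_closedBall).2
    (integrableOn_const (by exact (isCompact_closedBall (0:E3) r).measure_lt_top.ne))

theorem integral_sum_DD_eq_zero {F : Fin 3 → E3 → ℝ}
    (h : ∀ i, ContDiff ℝ (⊤ : ℕ∞) (F i) ∧ HasCompactSupport (F i)) :
    ∫ x, ∑ i, DD (eE i) (F i) x = 0 ∧ Integrable (fun x => ∑ i, DD (eE i) (F i) x) := by
  have hI : ∀ i, Integrable (DD (eE i) (F i)) := fun i =>
    Continuous.integrable_of_hasCompactSupport (DD_smooth (h i).1).continuous
      (hasCompactSupport_DD (h i).2 _)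
  refine ⟨?_, integrable_finsetSum _ fun i _ => hI i⟩
  rw [integral_finsetSum _ fun i _ => hI i]
  exact Finset.sum_eq_zero fun i _ =>
    integral_DD_eq_zero ((h i).1.of_le (by exact_mod_cast le_top)) (h i).2 _

theorem psd_quad {f g u : E3 → ℝ} {R C : ℝ} (hg : ContDiff ℝ (⊤ : ℕ∞) g)
    (hu : ContDiff ℝ (⊤ : ℕ∞) u) (hC : 0 ≤ C)
    (hfg : ∀ x, f x = - ∑ i, DD (eE i) (DD (eE i) g) x) (hf0 : ∀ x, R < ‖x‖ → f x = 0)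
    (hgd : ∀ x, R ≤ ‖x‖ → |g x| ≤ C / ‖x‖) (hgd' : ∀ i x, R ≤ ‖x‖ → |DD (eE i) g x| ≤ C / ‖x‖)
    (hu2 : Integrable (fun x => u x ^ 2)) (hdu : Integrable (fun x => ∑ i, DD (eE i) u x ^ 2))
    (lam : ℝ) :
    0 ≤ (∫ x, ∑ i, DD (eE i) u x ^ 2) + 2 * lam * (∫ x, u x * f x) + lam ^ 2 * (∫ x, g x * f x) := by
  obtain ⟨K, hK1, hKd, hKdd⟩ := exists_bump_bound
  have hfs : ContDiff ℝ (⊤ : ℕ∞) f := by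
    have : f = fun x => - ∑ i, DD (eE i) (DD (eE i) g) x := funext hfg
    rw [this]
    fun_prop
  have hIuf : Integrable (fun x => u x * f x) :=
    integrable_of_ball (R := R) (hu.continuous.mul hfs.continuous)
      fun x hx => by rw [hf0 x hx, mul_zero]
  have hIgf : Integrable (fun x => g x * f x) :=
    integrable_of_ball (R := R) (hg.continuous.mul hfs.continuous)
      fun x hx => by rw [hf0 x hx, mul_zero]
  set M : ℝ := |lam| * (∫ x, u x ^ 2) + |lam| * (72 * K ^ 2 * C ^ 2 * vol1)
    + lam ^ 2 * (12 * C ^ 2 * K * vol1) with hM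
  have key : ∀ n : ℕ, 1 ≤ n → R ≤ (n:ℝ) ^ 2 →
      0 ≤ (∫ x, ∑ i, DD (eE i) u x ^ 2) + 2 * lam * (∫ x, u x * f x)
        + lam ^ 2 * (∫ x, g x * f x) + M / n := by
    intro n hn hRn
    have hn1 : (1:ℝ) ≤ n := by exact_mod_cast hn
    set ρ : ℝ := (n:ℝ) ^ 2 with hρ
    have hρ0 : 0 < ρ := by positivity
    have hρ1 : 1 ≤ ρ := by nlinarith
    set η : E3 → ℝ := fun x => bump (ρ⁻¹ • x) with hη
    have hηs : ContDiff ℝ (⊤ : ℕ∞) η := bump_smooth.comp (contDiff_const_smul _)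
    have hd : ∀ i x, DD (eE i) η x = ρ⁻¹ * DD (eE i) bump (ρ⁻¹ • x) := fun i x => DD_scale _ _ _
    have hdd : ∀ i x, DD (eE i) (DD (eE i) η) x
        = ρ⁻¹ * (ρ⁻¹ * DD (eE i) (DD (eE i) bump) (ρ⁻¹ • x)) := by
      intro i x
      have : DD (eE i) η = fun x => ρ⁻¹ * DD (eE i) bump (ρ⁻¹ • x) := funext (hd i)
      rw [this, DD_mul (by fun_prop) (by
        have : ContDiff ℝ (⊤ : ℕ∞) (fun x : E3 => DD (eE i) bump (ρ⁻¹ • x)) :=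
          (DD_smooth bump_smooth).comp (contDiff_const_smul _)
        exact smooth_diffAt this), DD_const, DD_scale]
      ring
    have hnorm : ∀ x : E3, ‖ρ⁻¹ • x‖ = ρ⁻¹ * ‖x‖ := fun x => by
      rw [norm_smul, Real.norm_of_nonneg (by positivity)]
    have hsc : ∀ x : E3, 2 * ρ < ‖x‖ → 2 < ‖ρ⁻¹ • x‖ := fun x hx => by
      rw [hnorm, inv_mul_eq_div, lt_div_iff₀ hρ0]; exact hx
    have hη0 : ∀ x, 2 * ρ < ‖x‖ → η x = 0 := fun x hx => bump_zero (hsc x hx).le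
    have hd0 : ∀ i (x : E3), (‖x‖ < ρ ∨ 2 * ρ < ‖x‖) → DD (eE i) η x = 0 ∧
        DD (eE i) (DD (eE i) η) x = 0 := by
      intro i x hx
      have hx' : ‖ρ⁻¹ • x‖ < 1 ∨ 2 < ‖ρ⁻¹ • x‖ := by
        rcases hx with hx | hx
        · left
          rw [hnorm, inv_mul_eq_div, div_lt_one hρ0]; exact hx
        · exact Or.inr (hsc x hx)
      have e := DD_bump_zero hx' (eE i)
      have e1 := e.eq_of_nhds
      have e2 := (DD_eventually_zero (ξ := eE i) e).eq_of_nhds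
      rw [hd, hdd, e1, e2]
      simp
    have hXI : ∀ i, ContDiff ℝ (⊤ : ℕ∞) (fun x => η x * g x * DD (eE i) g x
        - (1/2) * g x ^ 2 * DD (eE i) η x) ∧ HasCompactSupport (fun x => η x * g x * DD (eE i) g x
        - (1/2) * g x ^ 2 * DD (eE i) η x) := fun i =>
      ⟨by fun_prop, hasCompactSupport_of_ball (R := 2 * ρ) fun x hx => by
        rw [hη0 x hx, (hd0 i x (Or.inr hx)).1]; ring⟩
    have hYI : ∀ i, ContDiff ℝ (⊤ : ℕ∞) (fun x => η x * u x * DD (eE i) g x) ∧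
        HasCompactSupport (fun x => η x * u x * DD (eE i) g x) := fun i =>
      ⟨by fun_prop, hasCompactSupport_of_ball (R := 2 * ρ) fun x hx => by
        rw [hη0 x hx]; ring⟩
    obtain ⟨hX, hXi⟩ := integral_sum_DD_eq_zero hXI
    obtain ⟨hY, hYi⟩ := integral_sum_DD_eq_zero hYI
    have hηf : ∀ x, η x * f x = f x := by
      intro x
      by_cases hx : R < ‖x‖
      · rw [hf0 x hx, mul_zero]
      · rw [hη]
        simp only
        rw [bump_one, one_mul]
        rw [hnorm, inv_mul_eq_div, div_le_one hρ0]
        linarith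
    have hη01 : ∀ x, 0 ≤ η x ∧ η x ≤ 1 := fun x => ⟨bump_nonneg _, bump_le_one _⟩
    set i₁ : E3 → ℝ := (Metric.closedBall (0:E3) (2 * ρ)).indicator
      (fun _ => n * (9 * K ^ 2 * C ^ 2 / ρ ^ 4)) with hi₁
    set i₂ : E3 → ℝ := (Metric.closedBall (0:E3) (2 * ρ)).indicator
      (fun _ => (1/2) * (3 * K * C ^ 2 / ρ ^ 4)) with hi₂
    have hρi : ρ⁻¹ * ρ = 1 := inv_mul_cancel₀ hρ0.ne'
    have he : ∀ x, n * (∑ i, DD (eE i) η x * DD (eE i) g x) ^ 2 ≤ i₁ x ∧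
        (1/2) * g x ^ 2 * ∑ i, DD (eE i) (DD (eE i) η) x ≤ i₂ x := by
      intro x
      by_cases hx : ‖x‖ < ρ ∨ 2 * ρ < ‖x‖
      · simp only [(hd0 _ x hx).1, (hd0 _ x hx).2]
        constructor
        · simp only [zero_mul, Finset.sum_const_zero]
          rw [zero_pow two_ne_zero, mul_zero]
          exact indicator_nonneg (fun _ _ => by positivity) _
        · simp only [Finset.sum_const_zero, mul_zero]
          exact indicator_nonneg (fun _ _ => by positivity) _
      · push Not at hx
        have hmem : x ∈ Metric.closedBall (0:E3) (2 * ρ) := by simpa using hx.2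
        rw [hi₁, hi₂, indicator_of_mem hmem, indicator_of_mem hmem]
        have hRx : R ≤ ‖x‖ := hRn.trans hx.1
        have hCx : C / ‖x‖ ≤ C / ρ := by gcongr; exact hx.1
        have b1 : ∀ i, |DD (eE i) η x * DD (eE i) g x| ≤ (K / ρ) * (C / ρ) := by
          intro i
          rw [abs_mul]
          refine mul_le_mul ?_ ((hgd' i x hRx).trans hCx) (abs_nonneg _) (by positivity)
          rw [hd, abs_mul, abs_of_pos (by positivity : 0 < ρ⁻¹), inv_mul_eq_div]
          gcongr
          exact hKd i _
        have b2 : ∀ i, DD (eE i) (DD (eE i) η) x ≤ K / ρ ^ 2 := by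
          intro i
          rw [hdd, ← mul_assoc, ← mul_inv, ← pow_two, inv_mul_eq_div]
          gcongr
          exact (le_abs_self _).trans (hKdd i _)
        constructor
        · have b3 : |∑ i, DD (eE i) η x * DD (eE i) g x| ≤ 3 * ((K / ρ) * (C / ρ)) := by
            refine (Finset.abs_sum_le_sum_abs _ _).trans ?_
            refine (Finset.sum_le_sum fun i _ => b1 i).trans ?_
            simp
          have b4 : (∑ i, DD (eE i) η x * DD (eE i) g x) ^ 2 ≤ (3 * ((K / ρ) * (C / ρ))) ^ 2 :=
            sq_le_sq' (by linarith [abs_le.1 b3]) (abs_le.1 b3).2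
          have b5 : (3 * ((K / ρ) * (C / ρ))) ^ 2 = 9 * K ^ 2 * C ^ 2 / ρ ^ 4 := by
            field_simp
            ring
          rw [b5] at b4
          gcongr
        · have b3 : ∑ i, DD (eE i) (DD (eE i) η) x ≤ 3 * (K / ρ ^ 2) := by
            refine (Finset.sum_le_sum fun i _ => b2 i).trans ?_
            simp
          have b4 : g x ^ 2 ≤ (C / ρ) ^ 2 := by
            have := (hgd x hRx).trans hCx
            exact sq_le_sq' (by linarith [abs_le.1 this]) (abs_le.1 this).2
          calc (1/2) * g x ^ 2 * ∑ i, DD (eE i) (DD (eE i) η) x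
              ≤ (1/2) * g x ^ 2 * (3 * (K / ρ ^ 2)) := by gcongr
            _ ≤ (1/2) * (C / ρ) ^ 2 * (3 * (K / ρ ^ 2)) := by gcongr
            _ = _ := by field_simp
    have hpt : ∀ x, - (2 * lam) * (∑ i, DD (eE i) (fun x => η x * u x * DD (eE i) g x) x)
        - lam ^ 2 * (∑ i, DD (eE i) (fun x => η x * g x * DD (eE i) g x
        - (1/2) * g x ^ 2 * DD (eE i) η x) x) ≤
        ∑ i, DD (eE i) u x ^ 2 + 2 * lam * (u x * f x) + lam ^ 2 * (g x * f x)
          + (|lam| * (u x ^ 2 / n) + |lam| * i₁ x + lam ^ 2 * i₂ x) := by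
      intro x
      have eY : ∀ i, DD (eE i) (fun x => η x * u x * DD (eE i) g x) x =
          (DD (eE i) η x * u x + η x * DD (eE i) u x) * DD (eE i) g x
          + η x * u x * DD (eE i) (DD (eE i) g) x := by
        intro i
        rw [DD_mul (by fun_prop) (by fun_prop), DD_mul (by fun_prop) (by fun_prop)]
      have eX' : ∀ i, DD (eE i) (fun x => η x * g x * DD (eE i) g x
          - (1/2) * g x ^ 2 * DD (eE i) η x) x =
          (DD (eE i) η x * g x + η x * DD (eE i) g x) * DD (eE i) g x
          + η x * g x * DD (eE i) (DD (eE i) g) x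
          - (g x * DD (eE i) g x * DD (eE i) η x
            + (1/2) * g x ^ 2 * DD (eE i) (DD (eE i) η) x) := by
        intro i
        rw [DD_sub (by fun_prop) (by fun_prop), DD_mul (by fun_prop) (by fun_prop),
          DD_mul (by fun_prop) (by fun_prop),
          DD_mul (f := fun x => (1/2) * g x ^ 2) (by fun_prop) (by fun_prop),
          DD_mul (by fun_prop) (by fun_prop), DD_const, DD_pow (by fun_prop)]
        push_cast
        ring
      simp only [eY, eX']
      obtain ⟨he1, he2⟩ := he x
      have hf := hfg x
      have hηfx := hηf x
      have q1 : 0 ≤ η x * ∑ i, (DD (eE i) u x + lam * DD (eE i) g x) ^ 2 :=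
        mul_nonneg (hη01 x).1 (Finset.sum_nonneg fun _ _ => sq_nonneg _)
      have q2 : η x * ∑ i, DD (eE i) u x ^ 2 ≤ ∑ i, DD (eE i) u x ^ 2 :=
        mul_le_of_le_one_left (Finset.sum_nonneg fun _ _ => sq_nonneg _) (hη01 x).2
      have q3 : - (2 * lam) * (u x * ∑ i, DD (eE i) η x * DD (eE i) g x) ≤
          |lam| * (u x ^ 2 / n) + |lam| * (n * (∑ i, DD (eE i) η x * DD (eE i) g x) ^ 2) := by
        generalize ∑ i, DD (eE i) η x * DD (eE i) g x = e
        have hn0 : (0:ℝ) < n := by linarith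
        have h1 : 2 * |u x * e| ≤ u x ^ 2 / n + n * e ^ 2 := by
          rw [abs_mul, ← sq_abs (u x), ← sq_abs e]
          have := sq_nonneg (|u x| - n * |e|)
          have h2 : (|u x| - n * |e|) ^ 2 / n = |u x| ^ 2 / n + n * |e| ^ 2 - 2 * (|u x| * |e|) := by
            field_simp
            ring
          have h3 : 0 ≤ (|u x| - n * |e|) ^ 2 / n := by positivity
          linarith
        calc - (2 * lam) * (u x * e) ≤ |(- (2 * lam)) * (u x * e)| := le_abs_self _
          _ = |lam| * (2 * |u x * e|) := by
            rw [abs_mul, abs_neg, abs_mul, abs_two]; ring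
          _ ≤ |lam| * (u x ^ 2 / n + n * e ^ 2) := by gcongr
          _ = _ := by ring
      have q4 := mul_le_mul_of_nonneg_left he1 (abs_nonneg lam)
      have q5 := mul_le_mul_of_nonneg_left he2 (sq_nonneg lam)
      have hηu : η x * (u x * f x) = u x * f x := by
        rw [mul_left_comm, hηfx]
      have hηg : η x * (g x * f x) = g x * f x := by
        rw [mul_left_comm, hηfx]
      rw [← hηu, ← hηg]
      simp only [Fin.sum_univ_three] at *
      rw [hf]
      linarith
    have hI1 : Integrable (fun x => ∑ i, DD (eE i) u x ^ 2 + 2 * lam * (u x * f x)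
        + lam ^ 2 * (g x * f x)) :=
      (hdu.add (hIuf.const_mul _)).add (hIgf.const_mul _)
    have hI2 : Integrable (fun x => |lam| * (u x ^ 2 / n) + |lam| * i₁ x + lam ^ 2 * i₂ x) :=
      (((hu2.div_const _).const_mul _).add ((integrable_const_ball _ _).const_mul _)).add
        ((integrable_const_ball _ _).const_mul _)
    have hmono := integral_mono ((hYi.const_mul (-(2 * lam))).sub (hXi.const_mul (lam ^ 2)))
      (hI1.add hI2) hpt
    simp only [Pi.sub_apply, Pi.add_apply] at hmono
    have hI3 : Integrable (fun x => ∑ i, DD (eE i) u x ^ 2 + 2 * lam * (u x * f x)) :=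
      hdu.add (hIuf.const_mul _)
    have hi₁' : Integrable i₁ := integrable_const_ball _ _
    have hi₂' : Integrable i₂ := integrable_const_ball _ _
    have hI4 : Integrable (fun x => |lam| * (u x ^ 2 / n) + |lam| * i₁ x) :=
      ((hu2.div_const _).const_mul _).add (hi₁'.const_mul _)
    rw [integral_sub (hYi.const_mul (-(2 * lam))) (hXi.const_mul (lam ^ 2)), integral_const_mul,
      integral_const_mul, hX, hY, integral_add hI1 hI2,
      integral_add hI3 (hIgf.const_mul _),
      integral_add hdu (hIuf.const_mul _),
      integral_add hI4 (hi₂'.const_mul _),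
      integral_add ((hu2.div_const _).const_mul _) (hi₁'.const_mul _),
      integral_const_mul, integral_const_mul, integral_const_mul, integral_const_mul,
      integral_const_mul, integral_div, hi₁, hi₂, setIntegral_const_ball (by positivity),
      setIntegral_const_ball (by positivity)] at hmono
    have hMn : |lam| * ((∫ x, u x ^ 2) / n)
        + |lam| * ((2 * ρ) ^ 3 * vol1 * (n * (9 * K ^ 2 * C ^ 2 / ρ ^ 4)))
        + lam ^ 2 * ((2 * ρ) ^ 3 * vol1 * ((1/2) * (3 * K * C ^ 2 / ρ ^ 4))) ≤ M / n := by
      have hn0 : (0:ℝ) < n := by linarith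
      have e1 : (2 * ρ) ^ 3 * vol1 * (n * (9 * K ^ 2 * C ^ 2 / ρ ^ 4))
          = 72 * K ^ 2 * C ^ 2 * vol1 / n := by
        rw [hρ]; field_simp; ring
      have e2 : (2 * ρ) ^ 3 * vol1 * ((1/2) * (3 * K * C ^ 2 / ρ ^ 4))
          ≤ 12 * C ^ 2 * K * vol1 / n := by
        have : (2 * ρ) ^ 3 * vol1 * ((1/2) * (3 * K * C ^ 2 / ρ ^ 4))
          = 12 * C ^ 2 * K * vol1 / ρ := by
          field_simp; ring
        rw [this]
        have := vol1_pos
        exact div_le_div_of_nonneg_left (by positivity) hn0 (by rw [hρ]; nlinarith)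
      have e0 : M / n = |lam| * ((∫ x, u x ^ 2) / n) + |lam| * (72 * K ^ 2 * C ^ 2 * vol1 / n)
          + lam ^ 2 * (12 * C ^ 2 * K * vol1 / n) := by
        rw [hM]; ring
      rw [e0]
      exact add_le_add (add_le_add le_rfl (mul_le_mul_of_nonneg_left e1.le (abs_nonneg _)))
        (mul_le_mul_of_nonneg_left e2 (sq_nonneg _))
    linarith
  have hlim : Filter.Tendsto (fun n : ℕ => (∫ x, ∑ i, DD (eE i) u x ^ 2)
      + 2 * lam * (∫ x, u x * f x) + lam ^ 2 * (∫ x, g x * f x) + M / n) Filter.atTop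
      (nhds ((∫ x, ∑ i, DD (eE i) u x ^ 2)
      + 2 * lam * (∫ x, u x * f x) + lam ^ 2 * (∫ x, g x * f x) + 0)) :=
    tendsto_const_nhds.add (tendsto_const_div_atTop_nhds_zero_nat M)
  rw [add_zero] at hlim
  refine ge_of_tendsto hlim ?_
  obtain ⟨N, hN⟩ := exists_nat_ge (max R 1)
  filter_upwards [Filter.eventually_ge_atTop N] with n hn
  have h1 : max R 1 ≤ (n:ℝ) := hN.trans (by exact_mod_cast hn)
  have h2 : (1:ℝ) ≤ n := (le_max_right _ _).trans h1
  refine key n (by exact_mod_cast h2) (((le_max_left _ _).trans h1).trans ?_)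
  nlinarith

theorem psd_pairing {f g u : E3 → ℝ} {R C : ℝ} (hg : ContDiff ℝ (⊤ : ℕ∞) g)
    (hu : ContDiff ℝ (⊤ : ℕ∞) u) (hC : 0 ≤ C)
    (hfg : ∀ x, f x = - ∑ i, DD (eE i) (DD (eE i) g) x) (hf0 : ∀ x, R < ‖x‖ → f x = 0)
    (hgd : ∀ x, R ≤ ‖x‖ → |g x| ≤ C / ‖x‖) (hgd' : ∀ i x, R ≤ ‖x‖ → |DD (eE i) g x| ≤ C / ‖x‖)
    (hu2 : Integrable (fun x => u x ^ 2)) (hdu : Integrable (fun x => ∑ i, DD (eE i) u x ^ 2)) :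
    (∫ x, u x * f x) ^ 2 ≤ (∫ x, ∑ i, DD (eE i) u x ^ 2) * ∫ x, g x * f x := by
  have h := psd_quad hg hu hC hfg hf0 hgd hgd' hu2 hdu
  have := discrim_le_zero (a := ∫ x, g x * f x) (b := 2 * ∫ x, u x * f x)
    (c := (∫ x, ∑ i, DD (eE i) u x ^ 2)) (fun t => by linarith [h t])
  unfold discrim at this
  linarith

theorem psd_nonneg {f g : E3 → ℝ} {R C : ℝ} (hg : ContDiff ℝ (⊤ : ℕ∞) g) (hC : 0 ≤ C)
    (hfg : ∀ x, f x = - ∑ i, DD (eE i) (DD (eE i) g) x) (hf0 : ∀ x, R < ‖x‖ → f x = 0)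
    (hgd : ∀ x, R ≤ ‖x‖ → |g x| ≤ C / ‖x‖)
    (hgd' : ∀ i x, R ≤ ‖x‖ → |DD (eE i) g x| ≤ C / ‖x‖) :
    0 ≤ ∫ x, g x * f x := by
  have h := psd_quad (u := fun _ => 0) hg contDiff_const hC hfg hf0 hgd hgd' (by simp)
    (by simp [DD_const]) 1
  simpa [DD_const] using h

/-- `H` is smooth and supported in `{|t| ≤ R, ‖x‖ ≤ R}`. -/
structure Src (H : Spt → ℝ) (R : ℝ) : Prop where
  smooth : ContDiff ℝ (⊤ : ℕ∞) H
  nonneg : 0 ≤ R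
  supp : ∀ p : Spt, (R < |p.1| ∨ R < ‖p.2‖) → H p = 0

namespace Src

variable {H : Spt → ℝ} {R : ℝ}

theorem compact (h : Src H R) : HasCompactSupport H := by
  refine HasCompactSupport.intro
    ((isCompact_Icc (a := -R) (b := R)).prod (isCompact_closedBall (0:E3) R)) fun p hp => ?_
  refine h.supp p ?_
  by_contra hcon
  push Not at hcon
  exact hp ⟨abs_le.1 hcon.1, mem_closedBall_zero_iff.2 hcon.2⟩

theorem eventually_zero (h : Src H R) {p : Spt} (hp : R < |p.1| ∨ R < ‖p.2‖) :
    H =ᶠ[nhds p] 0 := by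
  have ho : IsOpen {q : Spt | R < |q.1| ∨ R < ‖q.2‖} :=
    (isOpen_lt continuous_const continuous_fst.abs).union
      (isOpen_lt continuous_const continuous_snd.norm)
  filter_upwards [ho.mem_nhds hp] with q hq
  exact h.supp q hq

theorem dd (h : Src H R) (ξ : Spt) : Src (DD ξ H) R where
  smooth := DD_smooth h.smooth
  nonneg := h.nonneg
  supp := fun _ hp => (DD_eventually_zero (h.eventually_zero hp)).eq_of_nhds

theorem pot_smooth' (h : Src H R) (lam : ℝ) : ContDiff ℝ (⊤ : ℕ∞) (pot lam H) :=
  pot_smooth lam h.smooth h.compact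

theorem pot_formula (h : Src H R) (lam : ℝ) (p : Spt) :
    pot lam H p = ∫ y, ‖y‖⁻¹ * H (p - (lam * ‖y‖, y)) :=
  pot_eq lam h.smooth.continuous p

theorem pot_int (h : Src H R) (lam : ℝ) (p : Spt) :
    Integrable (fun y => ‖y‖⁻¹ * H (p - (lam * ‖y‖, y))) :=
  pot_integrable lam h.smooth.continuous h.compact p

theorem dd_pot (h : Src H R) (lam : ℝ) (ξ : Spt) : DD ξ (pot lam H) = pot lam (DD ξ H) :=
  funext fun p => DD_pot lam h.smooth h.compact ξ p

theorem boxL_pot (h : Src H R) (lam : ℝ) (p : Spt) :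
    boxL lam (pot lam H) p = ∫ y, ‖y‖⁻¹ * boxL lam H (p - (lam * ‖y‖, y)) := by
  simp only [boxL, h.dd_pot, (h.dd _).dd_pot]
  rw [((h.dd eT).dd eT).pot_formula]
  simp only [fun i => ((h.dd (eX i)).dd (eX i)).pot_formula]
  have e : ∀ y : E3, ‖y‖⁻¹ * (lam ^ 2 * DD eT (DD eT H) (p - (lam * ‖y‖, y))
      - ∑ i, DD (eX i) (DD (eX i) H) (p - (lam * ‖y‖, y)))
      = lam ^ 2 * (‖y‖⁻¹ * DD eT (DD eT H) (p - (lam * ‖y‖, y)))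
      - ∑ i, ‖y‖⁻¹ * DD (eX i) (DD (eX i) H) (p - (lam * ‖y‖, y)) := fun y => by
    rw [mul_sub, Finset.mul_sum]; ring
  simp only [e]
  rw [integral_sub ((((h.dd _).dd _).pot_int lam p).const_mul _)
    (integrable_finsetSum _ fun i _ => ((h.dd _).dd _).pot_int lam p), integral_const_mul,
    integral_finsetSum _ fun i _ => ((h.dd _).dd _).pot_int lam p]

theorem boxL_pot_one (h : Src H R) (p : Spt) : boxL 1 (pot 1 H) p = c0 * H p := by
  rw [h.boxL_pot]
  refine fundamental (ρ := R + |p.1| + 1) h.smooth fun y hy => h.eventually_zero (Or.inl ?_)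
  simp only [Prod.fst_sub, one_mul]
  have := neg_abs_le (p.1 - ‖y‖)
  have := le_abs_self p.1
  linarith

theorem boxL_pot_zero (h : Src H R) (p : Spt) : boxL 0 (pot 0 H) p = c0 * H p := by
  rw [h.boxL_pot]
  refine fundamental (ρ := R + ‖p.2‖ + 1) h.smooth fun y hy => h.eventually_zero (Or.inr ?_)
  simp only [Prod.snd_sub]
  have := norm_sub_norm_le y p.2
  rw [norm_sub_rev] at this
  linarith

theorem pot_one_zero (h : Src H R) {p : Spt} (hp : p.1 < -R ∨ 2 * R + |p.1| < ‖p.2‖) :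
    pot 1 H p = 0 := by
  rw [h.pot_formula]
  refine integral_eq_zero_of_ae (Filter.Eventually.of_forall fun y => ?_)
  have : H (p - (1 * ‖y‖, y)) = 0 := by
    refine h.supp _ ?_
    simp only [Prod.fst_sub, Prod.snd_sub, one_mul]
    by_contra hcon
    push Not at hcon
    obtain ⟨h1, h2⟩ := hcon
    have h3 := abs_le.1 h1
    have h4 := norm_nonneg y
    rcases hp with hp | hp
    · linarith
    · have := norm_sub_norm_le p.2 y
      have := le_abs_self p.1
      linarith
  show ‖y‖⁻¹ * H (p - (1 * ‖y‖, y)) = 0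
  rw [this, mul_zero]

theorem pot_one_ev (h : Src H R) {p : Spt} (hp : p.1 < -R ∨ 2 * R + |p.1| < ‖p.2‖) :
    pot 1 H =ᶠ[nhds p] 0 := by
  have ho : IsOpen {q : Spt | q.1 < -R ∨ 2 * R + |q.1| < ‖q.2‖} :=
    (isOpen_lt continuous_fst continuous_const).union
      (isOpen_lt (continuous_const.add continuous_fst.abs) continuous_snd.norm)
  filter_upwards [ho.mem_nhds hp] with q hq
  exact h.pot_one_zero hq

theorem slice_zero (h : Src H R) (t : ℝ) : ∀ x, R < ‖x‖ → H (t, x) = 0 :=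
  fun _ hx => h.supp _ (Or.inr hx)

theorem slice_cont (h : Src H R) (t : ℝ) : Continuous fun x => H (t, x) :=
  h.smooth.continuous.comp (by fun_prop)

theorem pot_zero_decay (h : Src H R) {t : ℝ} {x : E3} (hx : 2 * R < ‖x‖) :
    |pot 0 H (t, x)| ≤ (2 * ∫ y, |H (t, y)|) / ‖x‖ := by
  have hx0 : 0 < ‖x‖ := by linarith [h.nonneg]
  rw [h.pot_formula]
  have hi : Integrable fun y => |H (t, y)| :=
    (integrable_of_ball (h.slice_cont t) (h.slice_zero t)).abs
  calc |∫ y, ‖y‖⁻¹ * H ((t, x) - (0 * ‖y‖, y))| ≤ ∫ y, |‖y‖⁻¹ * H ((t, x) - (0 * ‖y‖, y))| :=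
        abs_integral_le_integral_abs
    _ ≤ ∫ y, 2 / ‖x‖ * |H (t, x - y)| := by
        refine integral_mono (h.pot_int 0 _).abs ((hi.comp_sub_left x).const_mul _) fun y => ?_
        simp only [Prod.mk_sub_mk, zero_mul, sub_zero]
        rw [abs_mul, abs_of_nonneg (inv_nonneg.2 (norm_nonneg y))]
        by_cases hy : R < ‖x - y‖
        · rw [h.slice_zero t _ hy]; simp
        · refine mul_le_mul_of_nonneg_right ?_ (abs_nonneg _)
          have := norm_sub_norm_le x y
          have h3 : ‖x‖ / 2 ≤ ‖y‖ := by linarith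
          calc ‖y‖⁻¹ ≤ (‖x‖ / 2)⁻¹ := inv_anti₀ (by linarith) h3
            _ = 2 / ‖x‖ := by rw [inv_div]
    _ = (2 * ∫ y, |H (t, y)|) / ‖x‖ := by
        rw [integral_const_mul, integral_sub_left_eq_self (fun y => |H (t, y)|)]
        ring

end Src

theorem newton_swap {f g : E3 → ℝ} {R : ℝ} (hf : Continuous f) (hg : Continuous g)
    (hf0 : ∀ x, R < ‖x‖ → f x = 0) (hg0 : ∀ x, R < ‖x‖ → g x = 0) :
    ∫ x, f x * ∫ y, ‖y‖⁻¹ * g (x - y) = ∫ y, ∫ x, f x * g (x - y) ∂volume ∂kmeas := by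
  have h1 : ∀ x, f x * ∫ y, ‖y‖⁻¹ * g (x - y) = ∫ y, f x * g (x - y) ∂kmeas := fun x => by
    rw [integral_const_mul, integral_kmeas]
  simp only [h1]
  refine integral_integral_swap_of_hasCompactSupport (f := fun x y => f x * g (x - y)) ?_ ?_
  · exact (hf.comp continuous_fst).mul (hg.comp (continuous_fst.sub continuous_snd))
  · refine HasCompactSupport.intro
      ((isCompact_closedBall (0:E3) R).prod (isCompact_closedBall (0:E3) (2 * R))) ?_
    rintro ⟨x, y⟩ hp
    simp only [Function.uncurry]
    by_cases h : R < ‖x‖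
    · rw [hf0 x h, zero_mul]
    · by_cases h' : R < ‖x - y‖
      · rw [hg0 _ h', mul_zero]
      · refine absurd ⟨mem_closedBall_zero_iff.2 (not_lt.1 h), mem_closedBall_zero_iff.2 ?_⟩ hp
        have : ‖y‖ ≤ ‖x‖ + ‖x - y‖ := by
          calc ‖y‖ = ‖x - (x - y)‖ := by congr 1; abel
            _ ≤ _ := norm_sub_le _ _
        push Not at h h'
        linarith

theorem newton_symm {f g : E3 → ℝ} {R : ℝ} (hf : Continuous f) (hg : Continuous g)
    (hf0 : ∀ x, R < ‖x‖ → f x = 0) (hg0 : ∀ x, R < ‖x‖ → g x = 0) :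
    ∫ x, f x * ∫ y, ‖y‖⁻¹ * g (x - y) = ∫ x, g x * ∫ y, ‖y‖⁻¹ * f (x - y) := by
  rw [newton_swap hf hg hf0 hg0, newton_swap hg hf hg0 hf0, integral_kmeas, integral_kmeas,
    ← integral_neg_eq_self]
  congr 1
  ext y
  rw [norm_neg, ← integral_add_right_eq_self (fun x => f x * g (x - -y)) (-y)]
  congr 2
  ext x
  rw [mul_comm]
  congr 2; abel

/-- The wave potential of `∂ₜH`. -/
def wv (H : Spt → ℝ) : Spt → ℝ := DD eT (pot 1 H)

/-- The difference of the Newtonian and wave potentials. -/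
def qv (H : Spt → ℝ) (p : Spt) : ℝ := pot 0 H p - pot 1 H p

namespace Src

variable {H : Spt → ℝ} {R : ℝ}

theorem wv_eq (h : Src H R) : wv H = pot 1 (DD eT H) := h.dd_pot 1 eT

theorem wv_smooth (h : Src H R) : ContDiff ℝ (⊤ : ℕ∞) (wv H) := DD_smooth (h.pot_smooth' 1)

theorem qv_smooth (h : Src H R) : ContDiff ℝ (⊤ : ℕ∞) (qv H) :=
  (h.pot_smooth' 0).sub (h.pot_smooth' 1)

theorem wv_zero (h : Src H R) {p : Spt} (hp : p.1 < -R ∨ 2 * R + |p.1| < ‖p.2‖) :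
    wv H =ᶠ[nhds p] 0 := DD_eventually_zero (h.pot_one_ev hp)

theorem wv_wave (h : Src H R) (p : Spt) :
    DD eT (DD eT (wv H)) p = ∑ i, DD (eX i) (DD (eX i) (wv H)) p + c0 * DD eT H p := by
  have := (h.dd eT).boxL_pot_one p
  rw [← h.wv_eq, boxL] at this
  linarith

theorem dd_qv (h : Src H R) (ξ : Spt) : DD ξ (qv H) = qv (DD ξ H) := by
  ext p
  have e : DD ξ (qv H) p = DD ξ (pot 0 H) p - DD ξ (pot 1 H) p :=
    DD_sub (smooth_diffAt (h.pot_smooth' 0)) (smooth_diffAt (h.pot_smooth' 1))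
  rw [e, h.dd_pot, h.dd_pot, qv]

theorem lap_qv (h : Src H R) (p : Spt) :
    ∑ i, DD (eX i) (DD (eX i) (qv H)) p = - DD eT (wv H) p := by
  have h1 := h.boxL_pot_one p
  have h0 := h.boxL_pot_zero p
  simp only [boxL, h.dd_pot, (h.dd _).dd_pot] at h0 h1
  simp only [wv, h.dd_pot, (h.dd _).dd_pot, h.dd_qv, (h.dd _).dd_qv, qv, Finset.sum_sub_distrib]
  linarith

theorem newton_wt (h : Src H R) (t : ℝ) (x : E3) :
    ∫ y, ‖y‖⁻¹ * DD eT (wv H) (t, x - y) = c0 * qv H (t, x) := by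
  have hlocZ : ∀ y : E3, 2 * R + |t| + 1 + ‖x‖ ≤ ‖y‖ →
      pot 1 H =ᶠ[nhds ((t, x) - (0 * ‖y‖, y))] 0 := fun y hy => by
    refine h.pot_one_ev (Or.inr ?_)
    simp only [Prod.snd_sub, Prod.fst_sub, zero_mul, sub_zero]
    have := norm_sub_norm_le y x
    rw [norm_sub_rev] at this
    linarith
  have hZ := fundamental (lam := 0) (h.pot_smooth' 1) hlocZ
  have e : ∀ y : E3, ‖y‖⁻¹ * boxL 0 (pot 1 H) ((t, x) - (0 * ‖y‖, y))
      = c0 * (‖y‖⁻¹ * H ((t, x) - (0 * ‖y‖, y))) - ‖y‖⁻¹ * DD eT (wv H) (t, x - y) := fun y => by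
    have h1 := h.boxL_pot_one ((t, x) - (0 * ‖y‖, y))
    have h2 : DD eT (wv H) (t, x - y) = DD eT (wv H) ((t, x) - (0 * ‖y‖, y)) := by
      simp
    rw [h2]
    simp only [boxL, wv] at h1 ⊢
    linear_combination ‖y‖⁻¹ * h1
  simp only [e] at hZ
  have hwt : Integrable fun y => ‖y‖⁻¹ * DD eT (wv H) (t, x - y) := by
    refine integrable_inv_norm_mul (R := 2 * R + |t| + ‖x‖)
      ((DD_smooth h.wv_smooth).continuous.comp (by fun_prop)) fun y hy => ?_
    refine (DD_eventually_zero (h.wv_zero (Or.inr ?_))).eq_of_nhds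
    have := norm_sub_norm_le y x
    rw [norm_sub_rev] at this
    show 2 * R + |t| < ‖x - y‖
    linarith
  rw [integral_sub ((h.pot_int 0 _).const_mul _) hwt, integral_const_mul,
    ← h.pot_formula] at hZ
  simp only [qv]
  linarith

end Src

/-- The quadratic functional controlling `wv H` at time `t`. -/
def psi (H : Spt → ℝ) (t : ℝ) : ℝ := ∫ x, wv H (t, x) ^ 2 + qv H (t, x) * DD eT (wv H) (t, x)

namespace Src

variable {H : Spt → ℝ} {R : ℝ}

theorem wt_zero (h : Src H R) {p : Spt} (hp : p.1 < -R ∨ 2 * R + |p.1| < ‖p.2‖) :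
    DD eT (wv H) =ᶠ[nhds p] 0 := DD_eventually_zero (h.wv_zero hp)

theorem wt_cont (h : Src H R) (t : ℝ) : Continuous fun x => DD eT (wv H) (t, x) :=
  (DD_smooth h.wv_smooth).continuous.comp (by fun_prop)

theorem qv_cont (h : Src H R) (t : ℝ) : Continuous fun x => qv H (t, x) :=
  h.qv_smooth.continuous.comp (by fun_prop)

theorem wt_slice_zero (h : Src H R) (t : ℝ) (x : E3) (hx : 2 * R + |t| < ‖x‖) :
    DD eT (wv H) (t, x) = 0 := (h.wt_zero (p := (t, x)) (Or.inr hx)).eq_of_nhds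

theorem psi_hasDerivAt (h : Src H R) (t : ℝ) :
    HasDerivAt (psi H) (2 * c0 * ∫ x, DD eT H (t, x) * qv H (t, x)) t := by
  have hw := h.wv_smooth
  have hq := h.qv_smooth
  have hwt : ContDiff ℝ (⊤ : ℕ∞) (DD eT (wv H)) := DD_smooth hw
  have hd := hasDerivAt_integral_slice (f := fun p => wv H p ^ 2 + qv H p * DD eT (wv H) p)
    (t₀ := t) (ε := 1) (R := 2 * R + |t| + 1) one_pos
    (fun s x _ => ContDiff.contDiffAt (((hw.pow 2).add (hq.mul hwt)).of_le (by simp)))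
    (fun s x hs hx => by
      have h1 : 2 * R + |s| < ‖x‖ := by
        have := abs_sub_abs_le_abs_sub s t
        linarith
      have e1 := (h.wv_zero (p := (s, x)) (Or.inr h1)).eq_of_nhds
      have e2 := h.wt_slice_zero s x h1
      simp only [e1, e2]
      simp)
  have hR0 := h.nonneg
  set r := 2 * R + |t| with hr
  have hRr : R ≤ r := by have := abs_nonneg t; linarith
  have hpt : ∀ x, DD eT (fun p => wv H p ^ 2 + qv H p * DD eT (wv H) p) (t, x)
      = ∑ i, DD (eX i) (fun p => qv H p * DD (eX i) (wv H) p - wv H p * DD (eX i) (qv H) p) (t, x)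
      + DD eT (wv H) (t, x) * (∫ y, ‖y‖⁻¹ * DD eT H (t, x - y))
      + c0 * (DD eT H (t, x) * qv H (t, x)) := fun x => by
    have hwi : ∀ i, ContDiff ℝ (⊤ : ℕ∞) (DD (eX i) (wv H)) := fun i => DD_smooth hw
    have hqi : ∀ i, ContDiff ℝ (⊤ : ℕ∞) (DD (eX i) (qv H)) := fun i => DD_smooth hq
    have e1 : DD eT (fun p => wv H p ^ 2 + qv H p * DD eT (wv H) p) (t, x)
        = 2 * wv H (t, x) * DD eT (wv H) (t, x) + (DD eT (qv H) (t, x) * DD eT (wv H) (t, x)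
          + qv H (t, x) * DD eT (DD eT (wv H)) (t, x)) := by
      rw [DD_add (smooth_diffAt (hw.pow 2)) (smooth_diffAt (hq.mul hwt)),
        DD_pow (smooth_diffAt hw), DD_mul (smooth_diffAt hq) (smooth_diffAt hwt)]
      push_cast; ring
    have e2 : ∀ i, DD (eX i) (fun p => qv H p * DD (eX i) (wv H) p
        - wv H p * DD (eX i) (qv H) p) (t, x) = qv H (t, x) * DD (eX i) (DD (eX i) (wv H)) (t, x)
          - wv H (t, x) * DD (eX i) (DD (eX i) (qv H)) (t, x) := fun i => by
      rw [DD_sub (smooth_diffAt (hq.mul (hwi i))) (smooth_diffAt (hw.mul (hqi i))),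
        DD_mul (smooth_diffAt hq) (smooth_diffAt (hwi i)),
        DD_mul (smooth_diffAt hw) (smooth_diffAt (hqi i))]
      ring
    have e3 : DD eT (qv H) (t, x) = (∫ y, ‖y‖⁻¹ * DD eT H (t, x - y)) - wv H (t, x) := by
      rw [h.dd_qv, qv, ← h.wv_eq, (h.dd eT).pot_formula]
      simp
    simp only [e1, e2, Finset.sum_sub_distrib, ← Finset.mul_sum]
    rw [h.lap_qv, h.wv_wave, e3]
    ring
  have hdiv0 : ∀ i x, r < ‖x‖ → DD (eX i) (fun p => qv H p * DD (eX i) (wv H) p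
      - wv H p * DD (eX i) (qv H) p) =ᶠ[nhds (t, x)] 0 := fun i x hx => by
    have e1 := h.wv_zero (p := (t, x)) (Or.inr hx)
    refine DD_eventually_zero ?_
    filter_upwards [e1, DD_eventually_zero (ξ := eX i) e1] with q h1 h2
    simp [h1, h2]
  have hsm : ∀ i, ContDiff ℝ (⊤ : ℕ∞) (fun p => qv H p * DD (eX i) (wv H) p
      - wv H p * DD (eX i) (qv H) p) := fun i =>
    (hq.mul (DD_smooth hw)).sub (hw.mul (DD_smooth hq))
  have hdivint : ∀ i, Integrable fun x => DD (eX i) (fun p => qv H p * DD (eX i) (wv H) p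
      - wv H p * DD (eX i) (qv H) p) (t, x) := fun i =>
    integrable_of_ball ((DD_smooth (hsm i)).continuous.comp (by fun_prop))
      fun x hx => (hdiv0 i x hx).eq_of_nhds
  have hdivz : ∀ i, ∫ x, DD (eX i) (fun p => qv H p * DD (eX i) (wv H) p
      - wv H p * DD (eX i) (qv H) p) (t, x) = 0 := fun i =>
    integral_dx_eq_zero (R := r) (fun x => ((hsm i).of_le (by simp)).contDiffAt) (fun x hx => by
      have e1 := h.wv_zero (p := (t, x)) (Or.inr hx)
      rw [e1.eq_of_nhds, (DD_eventually_zero (ξ := eX i) e1).eq_of_nhds]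
      simp) i
  have hG0 : ∀ x, r < ‖x‖ → DD eT H (t, x) = 0 := fun x hx =>
    (h.dd eT).slice_zero t x (hRr.trans_lt hx)
  have hGc := (h.dd eT).slice_cont t
  have hpc : Continuous fun x => ∫ y, ‖y‖⁻¹ * DD eT H (t, x - y) := by
    have : (fun x => ∫ y, ‖y‖⁻¹ * DD eT H (t, x - y)) = fun x => pot 0 (DD eT H) (t, x) := by
      ext x
      rw [(h.dd eT).pot_formula]; simp
    rw [this]
    exact ((h.dd eT).pot_smooth' 0).continuous.comp (by fun_prop)
  have hI2 : Integrable fun x => DD eT (wv H) (t, x) * ∫ y, ‖y‖⁻¹ * DD eT H (t, x - y) :=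
    integrable_of_ball ((h.wt_cont t).mul hpc) fun x hx => by
      rw [h.wt_slice_zero t x hx, zero_mul]
  have hI3 : Integrable fun x => c0 * (DD eT H (t, x) * qv H (t, x)) :=
    (integrable_of_ball (R := r) (hGc.mul (h.qv_cont t)) fun x hx => by
      show DD eT H (t, x) * qv H (t, x) = 0
      rw [hG0 x hx, zero_mul]).const_mul _
  have hswap := newton_symm (h.wt_cont t) hGc (h.wt_slice_zero t) hG0
  have hval : ∫ x, DD eT (fun p => wv H p ^ 2 + qv H p * DD eT (wv H) p) (t, x)
      = 2 * c0 * ∫ x, DD eT H (t, x) * qv H (t, x) := by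
    simp only [hpt]
    have hI12 : Integrable fun x => ∑ i, DD (eX i) (fun p => qv H p * DD (eX i) (wv H) p
      - wv H p * DD (eX i) (qv H) p) (t, x)
      + DD eT (wv H) (t, x) * (∫ y, ‖y‖⁻¹ * DD eT H (t, x - y)) :=
      (integrable_finsetSum _ fun i _ => hdivint i).add hI2
    rw [integral_add hI12 hI3, integral_add (integrable_finsetSum _ fun i _ => hdivint i) hI2,
      integral_finsetSum _ fun i _ => hdivint i, hswap, integral_const_mul]
    simp only [hdivz, h.newton_wt]
    have e : ∀ x, DD eT H (t, x) * (c0 * qv H (t, x)) = c0 * (DD eT H (t, x) * qv H (t, x)) :=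
      fun x => by ring
    simp only [e, integral_const_mul]
    simp
    ring
  rw [hval] at hd
  exact hd

theorem psi_zero (h : Src H R) {t : ℝ} (ht : t < -R) : psi H t = 0 := by
  unfold psi
  have h1 : ∀ x, wv H (t, x) = 0 := fun x => (h.wv_zero (p := (t, x)) (Or.inl ht)).eq_of_nhds
  have h2 : ∀ x, DD eT (wv H) (t, x) = 0 := fun x =>
    (h.wt_zero (p := (t, x)) (Or.inl ht)).eq_of_nhds
  simp [h1, h2]

theorem pairing_continuous (h : Src H R) :
    Continuous fun t => ∫ x, DD eT H (t, x) * qv H (t, x) := by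
  have hG := (h.dd eT).smooth
  refine continuous_iff_continuousAt.2 fun t => ?_
  refine (hasDerivAt_integral_slice (f := fun p => DD eT H p * qv H p) (t₀ := t) (ε := 1) (R := R)
    one_pos (fun s x _ => ContDiff.contDiffAt ((hG.mul h.qv_smooth).of_le (by simp)))
    (fun s x _ hx => ?_)).continuousAt
  rw [(h.dd eT).slice_zero s x hx, zero_mul]

theorem psi_eq (h : Src H R) {a T : ℝ} (ha : a < -R) :
    psi H T = 2 * c0 * ∫ t in a..T, ∫ x, DD eT H (t, x) * qv H (t, x) := by
  have := intervalIntegral.integral_eq_sub_of_hasDerivAt (a := a) (b := T)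
    (fun t _ => h.psi_hasDerivAt t)
    ((continuous_const.mul h.pairing_continuous).intervalIntegrable _ _)
  rw [h.psi_zero ha, sub_zero, intervalIntegral.integral_const_mul] at this
  exact this.symm

theorem qv_decay (h : Src H R) (t : ℝ) (x : E3) (hx : 2 * R + |t| + 1 ≤ ‖x‖) :
    |qv H (t, x)| ≤ (2 * ∫ y, |H (t, y)|) / ‖x‖ := by
  have h1 : pot 1 H (t, x) = 0 := h.pot_one_zero (p := (t, x)) (Or.inr (by simp only; linarith))
  rw [qv, h1, sub_zero]
  exact h.pot_zero_decay (by have := abs_nonneg t; linarith)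

theorem slice_data (h : Src H R) (t : ℝ) : ∃ C : ℝ, 0 ≤ C ∧
    ContDiff ℝ (⊤ : ℕ∞) (fun x => qv H (t, x)) ∧
    (∀ x, DD eT (wv H) (t, x) = - ∑ i, DD (eE i) (DD (eE i) fun x => qv H (t, x)) x) ∧
    (∀ x, 2 * R + |t| + 1 ≤ ‖x‖ → |qv H (t, x)| ≤ C / ‖x‖) ∧
    ∀ i x, 2 * R + |t| + 1 ≤ ‖x‖ → |DD (eE i) (fun x => qv H (t, x)) x| ≤ C / ‖x‖ := by
  have hq := h.qv_smooth
  have e1 : ∀ i, DD (eE i) (fun x => qv H (t, x)) = fun x => DD (eX i) (qv H) (t, x) :=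
    fun i => funext fun x => DD_slice_x (smooth_diffAt hq) i
  have e2 : ∀ i x, DD (eE i) (fun x => DD (eX i) (qv H) (t, x)) x
      = DD (eX i) (DD (eX i) (qv H)) (t, x) := fun i x => DD_slice_x (smooth_diffAt (DD_smooth hq)) i
  refine ⟨2 * (∫ y, |H (t, y)|) + ∑ i, 2 * ∫ y, |DD (eX i) H (t, y)|, by positivity,
    hq.comp (by fun_prop), fun x => ?_, fun x hx => (h.qv_decay t x hx).trans ?_,
    fun i x hx => ?_⟩
  · simp only [e1, e2]
    rw [h.lap_qv, neg_neg]
  · have : 0 ≤ ∑ i, 2 * ∫ y, |DD (eX i) H (t, y)| := by positivity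
    gcongr
    linarith
  · rw [e1, h.dd_qv]
    refine ((h.dd (eX i)).qv_decay t x hx).trans ?_
    have h1 : 0 ≤ 2 * ∫ y, |H (t, y)| := by positivity
    have h2 := Finset.single_le_sum (f := fun i => 2 * ∫ y, |DD (eX i) H (t, y)|)
      (fun j _ => by positivity) (Finset.mem_univ i)
    gcongr
    linarith

theorem wv_cont (h : Src H R) (t : ℝ) : Continuous fun x => wv H (t, x) :=
  h.wv_smooth.continuous.comp (by fun_prop)

theorem wv_slice_zero (h : Src H R) (t : ℝ) (x : E3) (hx : 2 * R + |t| < ‖x‖) :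
    wv H (t, x) = 0 := (h.wv_zero (p := (t, x)) (Or.inr hx)).eq_of_nhds

theorem psi_split (h : Src H R) (t : ℝ) : psi H t
    = (∫ x, wv H (t, x) ^ 2) + ∫ x, qv H (t, x) * DD eT (wv H) (t, x) :=
  integral_add (integrable_of_ball (R := 2 * R + |t|) ((h.wv_cont t).pow 2) fun x hx => by
      rw [h.wv_slice_zero t x hx]; simp)
    (integrable_of_ball (R := 2 * R + |t|) ((h.qv_cont t).mul (h.wt_cont t)) fun x hx => by
      rw [h.wt_slice_zero t x hx]; simp)

theorem sq_wv_le_psi (h : Src H R) (t : ℝ) : ∫ x, wv H (t, x) ^ 2 ≤ psi H t := by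
  obtain ⟨C, hC, h1, h2, h3, h4⟩ := h.slice_data t
  have := psd_nonneg h1 hC h2
    (fun x hx => h.wt_slice_zero t x (by linarith)) h3 h4
  rw [h.psi_split]
  linarith

theorem pairing_le_psi (h : Src H R) (t : ℝ) {u : E3 → ℝ} (hu : ContDiff ℝ (⊤ : ℕ∞) u)
    (hu2 : Integrable (fun x => u x ^ 2)) (hdu : Integrable (fun x => ∑ i, DD (eE i) u x ^ 2)) :
    (∫ x, u x * DD eT (wv H) (t, x)) ^ 2 ≤ (∫ x, ∑ i, DD (eE i) u x ^ 2) * psi H t := by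
  obtain ⟨C, hC, h1, h2, h3, h4⟩ := h.slice_data t
  refine (psd_pairing h1 hu hC h2
    (fun x hx => h.wt_slice_zero t x (by linarith)) h3 h4 hu2 hdu).trans ?_
  have h5 : 0 ≤ ∫ x, ∑ i, DD (eE i) u x ^ 2 :=
    integral_nonneg fun x => Finset.sum_nonneg fun i _ => sq_nonneg _
  have h6 : 0 ≤ ∫ x, wv H (t, x) ^ 2 := integral_nonneg fun x => sq_nonneg _
  refine mul_le_mul_of_nonneg_left ?_ h5
  rw [h.psi_split]
  linarith

end Src

theorem young_three {f g k : E3 → ℝ≥0∞} (hf : Measurable f) (hg : Measurable g)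
    (hk : Measurable k) :
    ∫⁻ x, ∫⁻ y, f x * g (x - y) * k y
      ≤ (∫⁻ x, f x ^ (12/11 : ℝ)) ^ (11/12 : ℝ) * (∫⁻ x, g x ^ (12/11 : ℝ)) ^ (11/12 : ℝ)
        * (∫⁻ x, k x ^ (6:ℝ)) ^ (1/6 : ℝ) := by
  set A := ∫⁻ x, f x ^ (12/11 : ℝ)
  set B := ∫⁻ x, g x ^ (12/11 : ℝ)
  set K := ∫⁻ x, k x ^ (6 : ℝ)
  have hg' : Measurable fun z : E3 × E3 => g (z.1 - z.2) := hg.comp (by fun_prop)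
  have hf' : Measurable fun z : E3 × E3 => f z.1 := hf.comp measurable_fst
  have hk' : Measurable fun z : E3 × E3 => k z.2 := hk.comp measurable_snd
  let F : Fin 3 → E3 × E3 → ℝ≥0∞ := ![fun z => f z.1 ^ (12/11:ℝ) * g (z.1 - z.2) ^ (12/11:ℝ),
    fun z => f z.1 ^ (12/11:ℝ) * k z.2 ^ (6:ℝ), fun z => g (z.1 - z.2) ^ (12/11:ℝ) * k z.2 ^ (6:ℝ)]
  let q : Fin 3 → ℝ := ![10/12, 1/12, 1/12]
  have hH := ENNReal.lintegral_prod_norm_pow_le (μ := (volume : Measure (E3 × E3)))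
    (Finset.univ : Finset (Fin 3)) (f := F) (p := q)
    (fun i _ => by fin_cases i <;> simp only [F] <;> simp <;> fun_prop)
    (by
      simp only [Fin.sum_univ_three, q]
      simp only [Matrix.cons_val_zero, Matrix.cons_val_one, Matrix.cons_val]
      norm_num)
    (fun i _ => by fin_cases i <;> simp [q] <;> norm_num)
  have e1 : ∫⁻ z, F 0 z = A * B := by
    show ∫⁻ z : E3 × E3, f z.1 ^ (12/11:ℝ) * g (z.1 - z.2) ^ (12/11:ℝ) = A * B
    rw [Measure.volume_eq_prod, lintegral_prod _ (by fun_prop)]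
    simp only
    have : ∀ x, ∫⁻ y, f x ^ (12/11:ℝ) * g (x - y) ^ (12/11:ℝ) = f x ^ (12/11:ℝ) * B := fun x => by
      rw [lintegral_const_mul _ (by fun_prop),
        lintegral_sub_left_eq_self (fun y => g y ^ (12/11:ℝ)) x]
    simp only [this]
    rw [lintegral_mul_const _ (by fun_prop)]
  have e2 : ∫⁻ z, F 1 z = A * K := by
    show ∫⁻ z : E3 × E3, f z.1 ^ (12/11:ℝ) * k z.2 ^ (6:ℝ) = A * K
    rw [Measure.volume_eq_prod]
    exact lintegral_prod_mul (f := fun x => f x ^ (12/11:ℝ)) (g := fun y => k y ^ (6:ℝ))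
      (by fun_prop) (by fun_prop)
  have e3 : ∫⁻ z, F 2 z = B * K := by
    show ∫⁻ z : E3 × E3, g (z.1 - z.2) ^ (12/11:ℝ) * k z.2 ^ (6:ℝ) = B * K
    rw [Measure.volume_eq_prod, lintegral_prod_symm _ (by fun_prop)]
    have : ∀ y, ∫⁻ x, g (x - y) ^ (12/11:ℝ) * k y ^ (6:ℝ) = B * k y ^ (6:ℝ) := fun y => by
      rw [lintegral_mul_const _ (by fun_prop),
        lintegral_sub_right_eq_self (fun x => g x ^ (12/11:ℝ)) y]
    simp only [this]
    rw [lintegral_const_mul _ (by fun_prop)]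
  have hpt : ∀ z : E3 × E3, ∏ i, F i z ^ q i = f z.1 * g (z.1 - z.2) * k z.2 := fun z => by
    simp only [Fin.prod_univ_three, F, q]
    simp only [Matrix.cons_val_zero, Matrix.cons_val_one, Matrix.cons_val]
    generalize f z.1 = a
    generalize g (z.1 - z.2) = b
    generalize k z.2 = c
    rw [ENNReal.mul_rpow_of_nonneg _ _ (by norm_num), ENNReal.mul_rpow_of_nonneg _ _ (by norm_num),
      ENNReal.mul_rpow_of_nonneg _ _ (by norm_num)]
    simp only [← ENNReal.rpow_mul]
    have ea : a = a ^ (12/11 * (10/12) : ℝ) * a ^ (12/11 * (1/12) : ℝ) := by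
      rw [← ENNReal.rpow_add_of_nonneg _ _ (by norm_num) (by norm_num)]; norm_num
    have eb : b = b ^ (12/11 * (10/12) : ℝ) * b ^ (12/11 * (1/12) : ℝ) := by
      rw [← ENNReal.rpow_add_of_nonneg _ _ (by norm_num) (by norm_num)]; norm_num
    have ec : c = c ^ (6 * (1/12) : ℝ) * c ^ (6 * (1/12) : ℝ) := by
      rw [← ENNReal.rpow_add_of_nonneg _ _ (by norm_num) (by norm_num)]; norm_num
    conv_rhs => rw [ea, eb, ec]
    ring
  simp only [hpt, Fin.prod_univ_three, e1, e2, e3, q] at hH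
  simp only [Matrix.cons_val_zero, Matrix.cons_val_one, Matrix.cons_val] at hH
  rw [Measure.volume_eq_prod, lintegral_prod _ (by fun_prop)] at hH
  refine hH.trans (le_of_eq ?_)
  rw [ENNReal.mul_rpow_of_nonneg _ _ (by norm_num), ENNReal.mul_rpow_of_nonneg _ _ (by norm_num),
    ENNReal.mul_rpow_of_nonneg _ _ (by norm_num)]
  have ea : A ^ (11/12:ℝ) = A ^ (10/12:ℝ) * A ^ (1/12:ℝ) := by
    rw [← ENNReal.rpow_add_of_nonneg _ _ (by norm_num) (by norm_num)]; norm_num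
  have eb : B ^ (11/12:ℝ) = B ^ (10/12:ℝ) * B ^ (1/12:ℝ) := by
    rw [← ENNReal.rpow_add_of_nonneg _ _ (by norm_num) (by norm_num)]; norm_num
  have ec : K ^ (1/6:ℝ) = K ^ (1/12:ℝ) * K ^ (1/12:ℝ) := by
    rw [← ENNReal.rpow_add_of_nonneg _ _ (by norm_num) (by norm_num)]; norm_num
  rw [ea, eb, ec]
  ring

/-- The Newtonian kernel cut off to `‖y‖ > r`. -/
def ker (r : ℝ) (y : E3) : ℝ≥0∞ := ENNReal.ofReal (if r < ‖y‖ then ‖y‖⁻¹ else 0)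

theorem ker_measurable (r : ℝ) : Measurable (ker r) := by
  unfold ker
  refine ENNReal.measurable_ofReal.comp (Measurable.ite ?_ (by fun_prop) measurable_const)
  exact measurableSet_lt measurable_const measurable_norm

theorem lintegral_ker {r : ℝ} (hr : 0 < r) :
    ∫⁻ y, ker r y ^ (6:ℝ) = ENNReal.ofReal (vol1 * r⁻¹ ^ 3) := by
  set φ : ℝ → ℝ := fun s => if r < s then s⁻¹ ^ 6 else 0 with hφ
  have e1 : ∀ y : E3, ker r y ^ (6:ℝ) = ENNReal.ofReal (φ ‖y‖) := fun y => by
    have : (6:ℝ) = ((6:ℕ):ℝ) := by norm_num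
    rw [ker, this, ENNReal.rpow_natCast, ← ENNReal.ofReal_pow (by split_ifs <;> positivity)]
    simp only [hφ]
    split_ifs <;> simp
  have e2 : ∀ s ∈ Ioi (0:ℝ), s ^ (Module.finrank ℝ E3 - 1) • φ s
      = (Ioi r).indicator (fun s => s ^ (-4:ℝ)) s := fun s hs => by
    simp only [Set.indicator, mem_Ioi, hφ, finrank_euclideanSpace, Fintype.card_fin]
    have hs0 : (0:ℝ) < s := hs
    split_ifs
    · have : (-4:ℝ) = -((4:ℕ):ℝ) := by norm_num
      rw [this, Real.rpow_neg hs0.le, Real.rpow_natCast, smul_eq_mul]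
      field_simp
    · simp
  have hsub : Ioi r ⊆ Ioi 0 := Ioi_subset_Ioi hr.le
  have h_int : Integrable fun y : E3 => φ ‖y‖ := by
    rw [integrable_fun_norm_addHaar]
    refine (integrableOn_congr_fun e2 measurableSet_Ioi).2 ?_
    rw [IntegrableOn, integrable_indicator_iff measurableSet_Ioi, IntegrableOn,
      Measure.restrict_restrict measurableSet_Ioi, inter_eq_left.2 hsub]
    exact integrableOn_Ioi_rpow_of_lt (by norm_num) hr
  simp only [e1]
  rw [← ofReal_integral_eq_lintegral_ofReal h_int (Filter.Eventually.of_forall fun y => by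
    simp only [hφ]; split_ifs <;> positivity), integral_fun_norm_addHaar,
    setIntegral_congr_fun measurableSet_Ioi e2, setIntegral_indicator measurableSet_Ioi,
    inter_eq_right.2 hsub, integral_Ioi_rpow_of_lt (by norm_num) hr]
  congr 1
  have hv : (volume : Measure E3).real (Metric.ball 0 1) = vol1 := rfl
  rw [hv, finrank_euclideanSpace, Fintype.card_fin]
  have : (-4 + 1 : ℝ) = -((3:ℕ):ℝ) := by norm_num
  rw [this, Real.rpow_neg hr.le, Real.rpow_natCast]
  simp
  ring

theorem ker_norm {r : ℝ} (hr : 0 < r) :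
    (∫⁻ y, ker r y ^ (6:ℝ)) ^ (1/6 : ℝ)
      = ENNReal.ofReal (vol1 ^ (1/6:ℝ)) * ENNReal.ofReal (r ^ (-(1/2):ℝ)) := by
  have hv := vol1_pos
  rw [lintegral_ker hr, ENNReal.ofReal_rpow_of_pos (by positivity),
    ← ENNReal.ofReal_mul (by positivity)]
  congr 1
  rw [Real.mul_rpow hv.le (by positivity), ← Real.rpow_natCast, ← Real.rpow_mul (by positivity),
    Real.rpow_neg hr.le, Real.inv_rpow hr.le]
  norm_num

/-- The fractional kernel `z ↦ z^{-1/2}`. -/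
def frac (z : ℝ) : ℝ≥0∞ := ENNReal.ofReal (z ^ (-(1/2):ℝ))

theorem frac_measurable : Measurable frac := by unfold frac; fun_prop

theorem lintegral_frac_near {r : ℝ} (hr : 0 < r) :
    ∫⁻ z in Ioc 0 r, frac z = ENNReal.ofReal (2 * r ^ (1/2:ℝ)) := by
  unfold frac
  have hi : IntegrableOn (fun z : ℝ => z ^ (-(1/2):ℝ)) (Ioc 0 r) :=
    (intervalIntegrable_iff_integrableOn_Ioc_of_le hr.le).1
      (intervalIntegral.intervalIntegrable_rpow' (by norm_num))
  rw [← ofReal_integral_eq_lintegral_ofReal hi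
    ((ae_restrict_iff' measurableSet_Ioc).2 (Filter.Eventually.of_forall fun z hz =>
      Real.rpow_nonneg hz.1.le _)), ← intervalIntegral.integral_of_le hr.le,
    integral_rpow (Or.inl (by norm_num))]
  congr 1
  rw [Real.zero_rpow (by norm_num)]
  norm_num
  ring

theorem lintegral_frac_far {r : ℝ} (hr : 0 < r) :
    ∫⁻ z in Ioi r, frac z ^ (4:ℝ) = ENNReal.ofReal r⁻¹ := by
  have e : ∀ z ∈ Ioi r, frac z ^ (4:ℝ) = ENNReal.ofReal (z ^ (-2:ℝ)) := fun z hz => by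
    have hz0 : 0 < z := hr.trans hz
    rw [frac, ENNReal.ofReal_rpow_of_pos (by positivity), ← Real.rpow_mul hz0.le]
    norm_num
  rw [setLIntegral_congr_fun measurableSet_Ioi e, ← ofReal_integral_eq_lintegral_ofReal
    (integrableOn_Ioi_rpow_of_lt (by norm_num) hr)
    ((ae_restrict_iff' measurableSet_Ioi).2 (Filter.Eventually.of_forall fun z hz =>
      Real.rpow_nonneg (hr.trans hz).le _)), integral_Ioi_rpow_of_lt (by norm_num) hr]
  congr 1
  norm_num
  rw [Real.rpow_neg hr.le, Real.rpow_one]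

/-- Splitting estimate for the fractional integral of a function bounded by `l` with
`L^{4/3}` mass at most `N`. -/
theorem frac_split {g : ℝ → ℝ≥0∞} (hg : Measurable g) {l N : ℝ≥0∞} (hl : l ≠ ⊤) (hN : N ≠ ⊤)
    (hgl : ∀ z, g z ≤ l) (hgN : ∫⁻ z, g z ^ (4/3:ℝ) ≤ N) :
    ∫⁻ z in Ioi 0, g z * frac z ≤ 3 * (l ^ (1/3:ℝ) * N ^ (1/2:ℝ)) := by
  have hf := frac_measurable
  rcases eq_or_ne l 0 with rfl | hl0
  · have : ∀ z, g z = 0 := fun z => le_antisymm (hgl z) bot_le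
    simp [this]
  rcases eq_or_ne N 0 with rfl | hN0
  · have h0 : ∫⁻ z, g z ^ (4/3:ℝ) = 0 := le_antisymm hgN bot_le
    rw [lintegral_eq_zero_iff (by fun_prop)] at h0
    have : ∫⁻ z in Ioi 0, g z * frac z = 0 := by
      rw [lintegral_eq_zero_iff (by fun_prop)]
      refine ae_restrict_of_ae ?_
      filter_upwards [h0] with z hz
      have : g z = 0 := by
        have := (ENNReal.rpow_eq_zero_iff (x := g z) (y := 4/3)).1 hz
        norm_num at this
        exact this
      simp [this]
    rw [this]; exact bot_le
  obtain ⟨a, rfl⟩ : ∃ a : ℝ, l = ENNReal.ofReal a := ⟨l.toReal, (ENNReal.ofReal_toReal hl).symm⟩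
  obtain ⟨n, rfl⟩ : ∃ n : ℝ, N = ENNReal.ofReal n := ⟨N.toReal, (ENNReal.ofReal_toReal hN).symm⟩
  have ha : 0 < a := by
    by_contra h; exact hl0 (ENNReal.ofReal_of_nonpos (not_lt.1 h))
  have hn : 0 < n := by
    by_contra h; exact hN0 (ENNReal.ofReal_of_nonpos (not_lt.1 h))
  obtain ⟨r, hr, hnr⟩ : ∃ r : ℝ, 0 < r ∧ n = a ^ (4/3:ℝ) * r :=
    ⟨n / a ^ (4/3:ℝ), by positivity, by field_simp⟩
  have hsplit : Ioi (0:ℝ) = Ioc 0 r ∪ Ioi r := (Ioc_union_Ioi_eq_Ioi hr.le).symm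
  have hval : ENNReal.ofReal a ^ (1/3:ℝ) * ENNReal.ofReal n ^ (1/2:ℝ)
      = ENNReal.ofReal (a * r ^ (1/2:ℝ)) := by
    rw [ENNReal.ofReal_rpow_of_pos ha, ENNReal.ofReal_rpow_of_pos hn,
      ← ENNReal.ofReal_mul (by positivity)]
    congr 1
    rw [hnr, Real.mul_rpow (by positivity) hr.le, ← Real.rpow_mul ha.le, ← mul_assoc,
      ← Real.rpow_add ha]
    norm_num
  rw [hsplit, hval]
  refine (lintegral_union_le _ _ _).trans ?_
  have h1 : ∫⁻ z in Ioc 0 r, g z * frac z ≤ ENNReal.ofReal (2 * (a * r ^ (1/2:ℝ))) := by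
    calc ∫⁻ z in Ioc 0 r, g z * frac z ≤ ∫⁻ z in Ioc 0 r, ENNReal.ofReal a * frac z :=
          lintegral_mono fun z => mul_le_mul_left (hgl z) _
      _ = ENNReal.ofReal (2 * (a * r ^ (1/2:ℝ))) := by
          rw [lintegral_const_mul _ hf, lintegral_frac_near hr, ← ENNReal.ofReal_mul ha.le]
          congr 1; ring
  have h2 : ∫⁻ z in Ioi r, g z * frac z ≤ ENNReal.ofReal (a * r ^ (1/2:ℝ)) := by
    have hpq : (4/3:ℝ).HolderConjugate 4 := by
      rw [Real.holderConjugate_iff]; norm_num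
    have := ENNReal.lintegral_mul_le_Lp_mul_Lq (volume.restrict (Ioi r)) hpq
      (f := g) (g := frac) hg.aemeasurable hf.aemeasurable
    refine this.trans ?_
    rw [lintegral_frac_far hr]
    calc _ ≤ (ENNReal.ofReal n) ^ (1 / (4/3) : ℝ) * (ENNReal.ofReal r⁻¹) ^ (1/4:ℝ) := by
          gcongr
          exact (setLIntegral_le_lintegral _ _).trans hgN
      _ = _ := by
          rw [ENNReal.ofReal_rpow_of_pos hn, ENNReal.ofReal_rpow_of_pos (by positivity),
            ← ENNReal.ofReal_mul (by positivity)]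
          congr 1
          rw [hnr, Real.mul_rpow (by positivity) hr.le, ← Real.rpow_mul ha.le, Real.inv_rpow hr.le,
            ← Real.rpow_neg hr.le, mul_assoc, ← Real.rpow_add hr]
          norm_num
  refine (add_le_add h1 h2).trans (le_of_eq ?_)
  rw [← ENNReal.ofReal_add (by positivity) (by positivity),
    show (3:ℝ≥0∞) = ENNReal.ofReal 3 by simp, ← ENNReal.ofReal_mul (by norm_num)]
  congr 1; ring

theorem hls {f : ℝ → ℝ≥0∞} (hf : Measurable f) (hft : ∀ t, f t ≠ ⊤) :
    ∫⁻ t, ∫⁻ z in Ioi 0, f t * f (t - z) * frac z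
      ≤ 6 * (∫⁻ t, f t ^ (4/3:ℝ)) ^ (3/2:ℝ) := by
  set N := ∫⁻ t, f t ^ (4/3:ℝ) with hN
  have hfr := frac_measurable
  rcases eq_or_ne N ⊤ with hNt | hNt
  · rw [hNt, ENNReal.top_rpow_of_pos (by norm_num)]
    simp
  have hm1 : Measurable fun q : ℝ × ℝ => f (q.1 - q.2) := hf.comp (by fun_prop)
  have hm2 : Measurable fun q : ℝ × ℝ => f (q.1 + q.2) := hf.comp (by fun_prop)
  have hm3 : Measurable fun q : ℝ × ℝ => f q.1 := hf.comp (by fun_prop)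
  have hm4 : Measurable fun q : ℝ × ℝ => frac q.2 := hfr.comp (by fun_prop)
  have hmain : ∀ h : ℝ → ℝ → ℝ≥0∞, (∀ t, Measurable (h t)) → (∀ t z, h t z ≤ f t) →
      (∀ t, ∫⁻ z, h t z ^ (4/3:ℝ) ≤ N) →
      ∫⁻ t, ∫⁻ z in Ioi 0, f t * h t z * frac z ≤ 3 * N ^ (3/2:ℝ) := fun h hm hle hN' => by
    calc ∫⁻ t, ∫⁻ z in Ioi 0, f t * h t z * frac z
        ≤ ∫⁻ t, f t ^ (4/3:ℝ) * (3 * N ^ (1/2:ℝ)) := by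
          refine lintegral_mono fun t => ?_
          simp only [mul_assoc]
          have hmt := hm t
          rw [lintegral_const_mul _ (by fun_prop)]
          refine (mul_le_mul_right (frac_split hmt (hft t) hNt (hle t) (hN' t)) (f t)).trans
            (le_of_eq ?_)
          have : f t ^ (4/3:ℝ) = f t * f t ^ (1/3:ℝ) := by
            conv_rhs => rw [← ENNReal.rpow_one (f t), ← ENNReal.rpow_mul]
            rw [← ENNReal.rpow_add_of_nonneg _ _ (by norm_num) (by norm_num)]
            norm_num
          rw [this]; ring
      _ = N * (3 * N ^ (1/2:ℝ)) := by rw [lintegral_mul_const _ (by fun_prop)]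
      _ = 3 * N ^ (3/2:ℝ) := by
          have : N ^ (3/2:ℝ) = N * N ^ (1/2:ℝ) := by
            conv_rhs => rw [← ENNReal.rpow_one N, ← ENNReal.rpow_mul]
            rw [← ENNReal.rpow_add_of_nonneg _ _ (by norm_num) (by norm_num)]
            norm_num
          rw [this]; ring
  let h₁ : ℝ → ℝ → ℝ≥0∞ := fun t z => if f (t - z) ≤ f t then f (t - z) else 0
  let h₂ : ℝ → ℝ → ℝ≥0∞ := fun t z => if f (t + z) ≤ f t then f (t + z) else 0
  have hh₁ : Measurable fun q : ℝ × ℝ => h₁ q.1 q.2 :=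
    Measurable.ite (measurableSet_le hm1 hm3) hm1 measurable_const
  have hh₂ : Measurable fun q : ℝ × ℝ => h₂ q.1 q.2 :=
    Measurable.ite (measurableSet_le hm2 hm3) hm2 measurable_const
  have b1 := hmain h₁ (fun t => hh₁.comp measurable_prodMk_left)
    (fun t z => by simp only [h₁]; split_ifs with h; exacts [h, bot_le]) (fun t => by
      rw [hN, ← lintegral_sub_left_eq_self (fun s => f s ^ (4/3:ℝ)) t]
      refine lintegral_mono fun z => ?_
      simp only [h₁]
      split_ifs
      · exact le_rfl
      · simp)
  have b2 := hmain h₂ (fun t => hh₂.comp measurable_prodMk_left)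
    (fun t z => by simp only [h₂]; split_ifs with h; exacts [h, bot_le]) (fun t => by
      rw [hN, ← lintegral_add_left_eq_self (fun s => f s ^ (4/3:ℝ)) t]
      refine lintegral_mono fun z => ?_
      simp only [h₂]
      split_ifs
      · exact le_rfl
      · simp)
  have hpt : ∀ t z, f t * f (t - z) * frac z
      ≤ f t * h₁ t z * frac z + f (t - z) * h₂ (t - z) z * frac z := fun t z => by
    simp only [h₁, h₂, sub_add_cancel]
    rcases le_total (f (t - z)) (f t) with h | h
    · rw [if_pos h]; exact le_self_add
    · rw [if_pos h, mul_comm (f t) (f (t - z))]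
      exact le_add_self
  have hmA : Measurable fun q : ℝ × ℝ => f q.1 * h₁ q.1 q.2 * frac q.2 := (hm3.mul hh₁).mul hm4
  have hmB0 : Measurable fun q : ℝ × ℝ => f q.1 * h₂ q.1 q.2 * frac q.2 := (hm3.mul hh₂).mul hm4
  have hmB : Measurable fun q : ℝ × ℝ => f (q.1 - q.2) * h₂ (q.1 - q.2) q.2 * frac q.2 :=
    hmB0.comp (g := fun q : ℝ × ℝ => f q.1 * h₂ q.1 q.2 * frac q.2)
      (f := fun q : ℝ × ℝ => (q.1 - q.2, q.2)) (by fun_prop)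
  calc ∫⁻ t, ∫⁻ z in Ioi 0, f t * f (t - z) * frac z
      ≤ ∫⁻ t, ∫⁻ z in Ioi 0, (f t * h₁ t z * frac z + f (t - z) * h₂ (t - z) z * frac z) :=
        lintegral_mono fun t => lintegral_mono fun z => hpt t z
    _ = (∫⁻ t, ∫⁻ z in Ioi 0, f t * h₁ t z * frac z)
        + ∫⁻ t, ∫⁻ z in Ioi 0, f (t - z) * h₂ (t - z) z * frac z := by
        rw [← lintegral_add_left hmA.lintegral_prod_right']
        congr 1
        ext t
        exact lintegral_add_left (hmA.comp measurable_prodMk_left) _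
    _ = (∫⁻ t, ∫⁻ z in Ioi 0, f t * h₁ t z * frac z)
        + ∫⁻ t, ∫⁻ z in Ioi 0, f t * h₂ t z * frac z := by
        congr 1
        have sA := lintegral_lintegral_swap (μ := volume) (ν := volume.restrict (Ioi 0))
          (f := fun t z => f (t - z) * h₂ (t - z) z * frac z) hmB.aemeasurable
        have sB := lintegral_lintegral_swap (μ := volume) (ν := volume.restrict (Ioi 0))
          (f := fun t z => f t * h₂ t z * frac z) hmB0.aemeasurable
        rw [sA, sB]
        congr 1
        ext z
        exact lintegral_sub_right_eq_self (fun t => f t * h₂ t z * frac z) z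
    _ ≤ 3 * N ^ (3/2:ℝ) + 3 * N ^ (3/2:ℝ) := add_le_add b1 b2
    _ = 6 * N ^ (3/2:ℝ) := by rw [← add_mul]; norm_num

theorem Measurable.ker {α : Type*} [MeasurableSpace α] {f : α → ℝ} {g : α → E3}
    (hf : Measurable f) (hg : Measurable g) : Measurable fun a => ker (f a) (g a) := by
  unfold _root_.ker
  exact ENNReal.measurable_ofReal.comp
    (Measurable.ite (measurableSet_lt hf hg.norm) (by fun_prop) measurable_const)

/-- The spatial `L^{12/11}` norm of a time slice. -/
def sliceNorm (G : Spt → ℝ) (t : ℝ) : ℝ≥0∞ :=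
  (∫⁻ x, ‖G (t, x)‖ₑ ^ (12/11:ℝ)) ^ (11/12:ℝ)

theorem sliceNorm_measurable {G : Spt → ℝ} (hG : Continuous G) : Measurable (sliceNorm G) := by
  unfold sliceNorm
  have h : Measurable fun q : ℝ × E3 => ‖G q‖ₑ ^ (12/11:ℝ) := by
    have := hG.measurable
    fun_prop
  exact (h.lintegral_prod_right').pow_const _

theorem lintegral_rpow_ne_top_of_ball {f : E3 → ℝ} (hf : Continuous f) {R : ℝ}
    (h0 : ∀ x, R < ‖x‖ → f x = 0) {q : ℝ} (hq : 0 < q) : ∫⁻ x, ‖f x‖ₑ ^ q ≠ ⊤ := by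
  have hi : Integrable fun x => |f x| ^ q := by
    refine integrable_of_ball (R := R) (hf.abs.rpow_const fun x => Or.inr hq.le) fun x hx => ?_
    rw [h0 x hx, abs_zero, Real.zero_rpow hq.ne']
  have e : ∀ x, ‖f x‖ₑ ^ q = ENNReal.ofReal (|f x| ^ q) := fun x => by
    rw [Real.enorm_eq_ofReal_abs, ENNReal.ofReal_rpow_of_nonneg (abs_nonneg _) hq.le]
  simp only [e]
  exact hi.lintegral_lt_top.ne

theorem Src.enorm_qv_le {H : Spt → ℝ} {R : ℝ} (h : Src H R) (t : ℝ) (x : E3) :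
    ‖qv H (t, x)‖ₑ ≤ ∫⁻ y, ∫⁻ z in Ioi (0:ℝ), ‖DD eT H (t - z, x - y)‖ₑ * ker z y := by
  have e1 : qv H (t, x) = ∫ y, ‖y‖⁻¹ * (H (t, x - y) - H (t - ‖y‖, x - y)) := by
    have i0 := h.pot_int 0 (t, x)
    have i1 := h.pot_int 1 (t, x)
    rw [qv, h.pot_formula, h.pot_formula, ← integral_sub i0 i1]
    refine integral_congr_ae (Filter.Eventually.of_forall fun y => ?_)
    simp only [Prod.mk_sub_mk, zero_mul, one_mul, sub_zero]
    ring
  rw [e1]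
  refine (enorm_integral_le_lintegral_enorm _).trans (lintegral_mono fun y => ?_)
  have hr : 0 ≤ ‖y‖ := norm_nonneg y
  have hd : ∀ s, HasDerivAt (fun s => - H (t - s, x - y)) (DD eT H (t - s, x - y)) s := fun s => by
    have h1 := (hasDerivAt_slice_t (f := H) (t := t - s) (x := x - y)
      (smooth_diffAt h.smooth)).comp s ((hasDerivAt_id s).const_sub t)
    have h2 := h1.neg
    rw [mul_neg_one, neg_neg] at h2
    exact h2
  have hc : Continuous fun s => DD eT H (t - s, x - y) :=
    (DD_smooth h.smooth).continuous.comp (by fun_prop)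
  have e2 : H (t, x - y) - H (t - ‖y‖, x - y) = ∫ s in Ioo 0 ‖y‖, DD eT H (t - s, x - y) := by
    rw [← integral_Ioc_eq_integral_Ioo, ← intervalIntegral.integral_of_le hr,
      intervalIntegral.integral_eq_sub_of_hasDerivAt (fun s _ => hd s)
        (hc.intervalIntegrable _ _), sub_zero]
    ring
  rw [e2, enorm_mul]
  calc ‖‖y‖⁻¹‖ₑ * ‖∫ s in Ioo 0 ‖y‖, DD eT H (t - s, x - y)‖ₑ
      ≤ ‖‖y‖⁻¹‖ₑ * ∫⁻ s in Ioo 0 ‖y‖, ‖DD eT H (t - s, x - y)‖ₑ := by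
        gcongr
        exact enorm_integral_le_lintegral_enorm _
    _ = ∫⁻ s in Ioo 0 ‖y‖, ‖DD eT H (t - s, x - y)‖ₑ * ker s y := by
        rw [← lintegral_const_mul _ (by have := hc.measurable; fun_prop)]
        refine setLIntegral_congr_fun measurableSet_Ioo fun s hs => ?_
        simp only [ker]
        rw [if_pos hs.2, mul_comm, Real.enorm_eq_ofReal (inv_nonneg.2 hr)]
    _ ≤ _ := lintegral_mono_set Ioo_subset_Ioi_self

theorem slice_pairing_le {G : Spt → ℝ} (hG : Continuous G) (t : ℝ) :
    ∫⁻ x, ‖G (t, x)‖ₑ * ∫⁻ y, ∫⁻ z in Ioi (0:ℝ), ‖G (t - z, x - y)‖ₑ * ker z y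
      ≤ ENNReal.ofReal (vol1 ^ (1/6:ℝ)) *
        ∫⁻ z in Ioi (0:ℝ), sliceNorm G t * sliceNorm G (t - z) * frac z := by
  have hGm := hG.measurable
  have m3 : Measurable fun q : (E3 × E3) × ℝ =>
      ‖G (t, q.1.1)‖ₑ * ‖G (t - q.2, q.1.1 - q.1.2)‖ₑ * ker q.2 q.1.2 := by
    exact Measurable.mul (by fun_prop) (Measurable.ker (by fun_prop) (by fun_prop))
  have e1 : ∀ x, ‖G (t, x)‖ₑ * ∫⁻ y, ∫⁻ z in Ioi (0:ℝ), ‖G (t - z, x - y)‖ₑ * ker z y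
      = ∫⁻ z in Ioi (0:ℝ), ∫⁻ y, ‖G (t, x)‖ₑ * ‖G (t - z, x - y)‖ₑ * ker z y := fun x => by
    have m2 : Measurable fun q : E3 × ℝ => ‖G (t - q.2, x - q.1)‖ₑ * ker q.2 q.1 := by
      exact Measurable.mul (by fun_prop) (Measurable.ker (by fun_prop) (by fun_prop))
    have sw := lintegral_lintegral_swap (μ := volume) (ν := volume.restrict (Ioi (0:ℝ)))
      (f := fun y z => ‖G (t - z, x - y)‖ₑ * ker z y) m2.aemeasurable
    rw [sw, ← lintegral_const_mul _ (m2.lintegral_prod_left')]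
    congr 1
    ext z
    have m1 : Measurable fun y => ‖G (t - z, x - y)‖ₑ * ker z y :=
      m2.comp (measurable_prodMk_right (y := z))
    rw [← lintegral_const_mul _ m1]
    simp only [mul_assoc]
  simp only [e1]
  have sw := lintegral_lintegral_swap (μ := volume) (ν := volume.restrict (Ioi (0:ℝ)))
      (f := fun x z => ∫⁻ y, ‖G (t, x)‖ₑ * ‖G (t - z, x - y)‖ₑ * ker z y)
      (Measurable.aemeasurable (Measurable.lintegral_prod_right'
        (f := fun q : (E3 × ℝ) × E3 => ‖G (t, q.1.1)‖ₑ * ‖G (t - q.1.2, q.1.1 - q.2)‖ₑ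
          * ker q.1.2 q.2)
        (m3.comp (f := fun q : (E3 × ℝ) × E3 => ((q.1.1, q.2), q.1.2)) (by fun_prop))))
  rw [sw, ← lintegral_const_mul _ (by
    have := sliceNorm_measurable hG
    have := frac_measurable
    fun_prop)]
  refine setLIntegral_mono' measurableSet_Ioi fun z hz => ?_
  refine (young_three (f := fun x => ‖G (t, x)‖ₑ) (g := fun x => ‖G (t - z, x)‖ₑ) (k := ker z)
    (by fun_prop) (by fun_prop) (ker_measurable z)).trans (le_of_eq ?_)
  rw [ker_norm hz]
  simp only [sliceNorm, frac]
  ring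

/-- Strichartz-type bound for the energy functional of the linear wave `wv H`. -/
theorem Src.psi_le {H : Spt → ℝ} {R : ℝ} (h : Src H R) (T : ℝ) :
    ENNReal.ofReal (psi H T) ≤ ENNReal.ofReal (12 * c0 * vol1 ^ (1/6:ℝ)) *
      (∫⁻ t in Iic T, (∫⁻ x, ‖DD eT H (t, x)‖ₑ ^ (12/11:ℝ)) ^ (11/9:ℝ)) ^ (3/2:ℝ) := by
  have hc0 := c0_pos
  have hv := vol1_pos
  set G := DD eT H with hGdef
  have hGc : Continuous G := (DD_smooth h.smooth).continuous
  rcases lt_or_ge T (-R) with hT | hT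
  · rw [h.psi_zero hT]; simp
  set f : ℝ → ℝ≥0∞ := (Iic T).indicator (sliceNorm G) with hf
  have hfm : Measurable f := (sliceNorm_measurable hGc).indicator measurableSet_Iic
  have hft : ∀ t, f t ≠ ⊤ := fun t => by
    simp only [hf, Set.indicator]
    split_ifs
    · exact ENNReal.rpow_ne_top_of_nonneg (by norm_num)
        (lintegral_rpow_ne_top_of_ball ((h.dd eT).slice_cont t) ((h.dd eT).slice_zero t)
          (by norm_num))
    · simp
  have hpow : ∫⁻ t, f t ^ (4/3:ℝ)
      = ∫⁻ t in Iic T, (∫⁻ x, ‖G (t, x)‖ₑ ^ (12/11:ℝ)) ^ (11/9:ℝ) := by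
    rw [← lintegral_indicator measurableSet_Iic]
    congr 1
    ext t
    simp only [hf, Set.indicator, sliceNorm]
    split_ifs
    · rw [← ENNReal.rpow_mul]; norm_num
    · simp
  have key : ∫⁻ t in Iic T, ∫⁻ x, ‖G (t, x)‖ₑ * ‖qv H (t, x)‖ₑ
      ≤ ENNReal.ofReal (vol1 ^ (1/6:ℝ)) * ∫⁻ t, ∫⁻ z in Ioi 0, f t * f (t - z) * frac z := by
    rw [← lintegral_const_mul' _ _ ENNReal.ofReal_ne_top, ← lintegral_indicator measurableSet_Iic]
    refine lintegral_mono fun t => ?_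
    by_cases ht : t ∈ Iic T
    · rw [Set.indicator_of_mem ht]
      calc ∫⁻ x, ‖G (t, x)‖ₑ * ‖qv H (t, x)‖ₑ
          ≤ ∫⁻ x, ‖G (t, x)‖ₑ * ∫⁻ y, ∫⁻ z in Ioi (0:ℝ), ‖G (t - z, x - y)‖ₑ * ker z y :=
            lintegral_mono fun x => mul_le_mul_right (h.enorm_qv_le t x) _
        _ ≤ _ := slice_pairing_le hGc t
        _ = _ := by
            congr 1
            refine setLIntegral_congr_fun measurableSet_Ioi fun z hz => ?_
            have hz' : t - z ∈ Iic T := by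
              simp only [mem_Iic, mem_Ioi] at *
              linarith
            simp only [hf]
            rw [Set.indicator_of_mem ht, Set.indicator_of_mem hz']
    · rw [Set.indicator_of_notMem ht]; exact bot_le
  have h1 : psi H T ≤ 2 * c0 * |∫ t in (-R-1)..T, ∫ x, G (t, x) * qv H (t, x)| := by
    rw [h.psi_eq (a := -R - 1) (by linarith)]
    have := le_abs_self (∫ t in (-R-1)..T, ∫ x, G (t, x) * qv H (t, x))
    gcongr
  have h2 : ENNReal.ofReal |∫ t in (-R-1)..T, ∫ x, G (t, x) * qv H (t, x)|
      ≤ ∫⁻ t in Iic T, ∫⁻ x, ‖G (t, x)‖ₑ * ‖qv H (t, x)‖ₑ := by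
    rw [← Real.enorm_eq_ofReal_abs, intervalIntegral.integral_of_le (by linarith)]
    refine (enorm_integral_le_lintegral_enorm _).trans
      ((lintegral_mono_set Ioc_subset_Iic_self).trans (lintegral_mono fun t => ?_))
    refine (enorm_integral_le_lintegral_enorm _).trans (le_of_eq ?_)
    simp only [enorm_mul]
  calc ENNReal.ofReal (psi H T)
      ≤ ENNReal.ofReal (2 * c0 * |∫ t in (-R-1)..T, ∫ x, G (t, x) * qv H (t, x)|) :=
        ENNReal.ofReal_le_ofReal h1
    _ = ENNReal.ofReal (2 * c0) *
        ENNReal.ofReal |∫ t in (-R-1)..T, ∫ x, G (t, x) * qv H (t, x)| :=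
        ENNReal.ofReal_mul (by positivity)
    _ ≤ ENNReal.ofReal (2 * c0) * (ENNReal.ofReal (vol1 ^ (1/6:ℝ)) *
        (6 * (∫⁻ t, f t ^ (4/3:ℝ)) ^ (3/2:ℝ))) := by
        gcongr
        exact h2.trans (key.trans (mul_le_mul_right (hls hfm hft) _))
    _ = _ := by
        rw [hpow, show 12 * c0 * vol1 ^ (1/6:ℝ) = 2 * c0 * vol1 ^ (1/6:ℝ) * 6 by ring,
          ENNReal.ofReal_mul (p := 2 * c0 * vol1 ^ (1/6:ℝ)) (q := 6) (by positivity),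
          ENNReal.ofReal_mul (p := 2 * c0) (q := vol1 ^ (1/6:ℝ)) (by positivity),
          show ENNReal.ofReal 6 = 6 by norm_num]
        ring

theorem lintegral_ball_avg {f : E3 → ℝ≥0∞} (hf : Measurable f) {r : ℝ} (hr : 0 ≤ r) :
    ∫⁻ z, ∫⁻ x in Metric.closedBall z r, f x = ENNReal.ofReal (r ^ 3 * vol1) * ∫⁻ x, f x := by
  have hS : MeasurableSet {q : E3 × E3 | dist q.2 q.1 ≤ r} :=
    measurableSet_le (by fun_prop) measurable_const
  have hm : Measurable fun q : E3 × E3 =>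
      {q : E3 × E3 | dist q.2 q.1 ≤ r}.indicator (fun q => f q.2) q :=
    (hf.comp measurable_snd).indicator hS
  have e : ∀ z, ∫⁻ x in Metric.closedBall z r, f x
      = ∫⁻ x, {q : E3 × E3 | dist q.2 q.1 ≤ r}.indicator (fun q => f q.2) (z, x) := fun z => by
    rw [← lintegral_indicator Metric.isClosed_closedBall.measurableSet]
    rfl
  simp only [e]
  rw [lintegral_lintegral_swap hm.aemeasurable, ← lintegral_const_mul _ hf]
  congr 1
  ext x
  have e2 : ∀ z, {q : E3 × E3 | dist q.2 q.1 ≤ r}.indicator (fun q => f q.2) (z, x)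
      = (Metric.closedBall x r).indicator (fun _ => f x) z := fun z => by
    simp only [Set.indicator, Set.mem_ofPred_eq, Metric.mem_closedBall, dist_comm z x]
  simp only [e2]
  rw [lintegral_indicator Metric.isClosed_closedBall.measurableSet, setLIntegral_const,
    ← volume_real_closedBall x hr, Measure.real, ENNReal.ofReal_toReal (volume_closedBall_ne_top x r),
    mul_comm]

/-- The past `L^{4/3}_t L^{12/11}_x` size of a source, to the power `4/3`. -/
def pastNorm (G : Spt → ℝ) (T : ℝ) : ℝ≥0∞ :=
  ∫⁻ t in Iic T, (∫⁻ x, ‖G (t, x)‖ₑ ^ (12/11:ℝ)) ^ (11/9:ℝ)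

def K1 : ℝ≥0∞ := ENNReal.ofReal (12 * c0 * vol1 ^ (1/6:ℝ))

theorem Src.sq_wv_le {H : Spt → ℝ} {R : ℝ} (h : Src H R) (t : ℝ) :
    ∫⁻ x, ‖wv H (t, x)‖ₑ ^ (2:ℝ) ≤ K1 * pastNorm (DD eT H) t ^ (3/2:ℝ) := by
  refine le_trans (le_of_eq ?_) ((ENNReal.ofReal_le_ofReal (h.sq_wv_le_psi t)).trans (h.psi_le t))
  have hi : Integrable fun x => wv H (t, x) ^ 2 :=
    integrable_of_ball (R := 2 * R + |t|) ((h.wv_cont t).pow 2) fun x hx => by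
      rw [h.wv_slice_zero t x hx]; norm_num
  rw [ofReal_integral_eq_lintegral_ofReal hi (Filter.Eventually.of_forall fun x => sq_nonneg _)]
  congr 1
  ext x
  rw [Real.enorm_eq_ofReal_abs, ENNReal.ofReal_rpow_of_nonneg (abs_nonneg _) (by norm_num),
    show (2:ℝ) = ((2:ℕ):ℝ) by norm_num, Real.rpow_natCast, sq_abs]

theorem Src.localize {H : Spt → ℝ} {R : ℝ} (h : Src H R) (h0 : ∀ p : Spt, p.1 ≤ 0 → DD eT H p = 0)
    {τ : ℝ} (hτ : 0 < τ) (z : E3) :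
    ∃ H', Src H' R ∧ (∀ x ∈ Metric.closedBall z τ, wv H' (τ, x) = wv H (τ, x)) ∧
      ∀ t x, ‖DD eT H' (t, x)‖ₑ ≤ (Metric.closedBall z (3 * τ)).indicator
        (fun x => ‖DD eT H (t, x)‖ₑ) x := by
  let ζ : ContDiffBump z := ⟨2 * τ, 3 * τ, by linarith, by linarith⟩
  have hζ : ContDiff ℝ (⊤ : ℕ∞) (fun p : Spt => ζ p.2) := ζ.contDiff.comp contDiff_snd
  have hH' : Src (fun p => ζ p.2 * H p) R :=
    ⟨hζ.mul h.smooth, h.nonneg, fun p hp => by rw [h.supp p hp, mul_zero]⟩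
  have hd : ∀ p, DD eT (fun p => ζ p.2 * H p) p = ζ p.2 * DD eT H p := fun p => by
    have e : DD eT (fun p : Spt => ζ p.2) p = 0 := by
      have := hasDerivAt_slice_t (f := fun p : Spt => ζ p.2) (t := p.1) (x := p.2)
        (smooth_diffAt hζ)
      exact this.unique (hasDerivAt_const p.1 (ζ p.2))
    rw [DD_mul (smooth_diffAt hζ) (smooth_diffAt h.smooth), e]
    ring
  refine ⟨fun p => ζ p.2 * H p, hH', fun x hx => ?_, fun t x => ?_⟩
  · rw [h.wv_eq, hH'.wv_eq, (h.dd eT).pot_formula, (hH'.dd eT).pot_formula]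
    refine integral_congr_ae (Filter.Eventually.of_forall fun y => ?_)
    simp only [hd, Prod.mk_sub_mk, one_mul]
    rcases le_or_gt τ ‖y‖ with hy | hy
    · rw [h0 (τ - ‖y‖, x - y) (by simpa using hy), mul_zero]
    · rw [ζ.one_of_mem_closedBall, one_mul]
      rw [mem_closedBall_iff_norm] at hx ⊢
      show ‖x - y - z‖ ≤ 2 * τ
      have := norm_sub_le (x - z) y
      rw [show x - y - z = x - z - y by abel]
      linarith
  · rw [hd, enorm_mul]
    by_cases hx : x ∈ Metric.closedBall z (3 * τ)
    · rw [Set.indicator_of_mem hx]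
      refine mul_le_of_le_one_left' ?_
      rw [Real.enorm_eq_ofReal ζ.nonneg]
      exact ENNReal.ofReal_le_one.2 ζ.le_one
    · rw [Set.indicator_of_notMem hx, ζ.zero_of_le_dist, enorm_zero, zero_mul]
      rw [Metric.mem_closedBall, not_le] at hx
      exact hx.le

theorem Src.sq_wv_ball_le {H : Spt → ℝ} {R : ℝ} (h : Src H R)
    (h0 : ∀ p : Spt, p.1 ≤ 0 → DD eT H p = 0) {τ : ℝ} (hτ : 0 < τ) (z : E3) :
    ∫⁻ x in Metric.closedBall z τ, ‖wv H (τ, x)‖ₑ ^ (2:ℝ) ≤ K1 * (∫⁻ t in Iic τ,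
      (∫⁻ x in Metric.closedBall z (3 * τ), ‖DD eT H (t, x)‖ₑ ^ (12/11:ℝ)) ^ (11/9:ℝ))
        ^ (3/2:ℝ) := by
  obtain ⟨H', hH', h1, h2⟩ := h.localize h0 hτ z
  calc ∫⁻ x in Metric.closedBall z τ, ‖wv H (τ, x)‖ₑ ^ (2:ℝ)
      = ∫⁻ x in Metric.closedBall z τ, ‖wv H' (τ, x)‖ₑ ^ (2:ℝ) :=
        setLIntegral_congr_fun Metric.isClosed_closedBall.measurableSet fun x hx => by
          simp only [h1 x hx]
    _ ≤ ∫⁻ x, ‖wv H' (τ, x)‖ₑ ^ (2:ℝ) := setLIntegral_le_lintegral _ _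
    _ ≤ _ := hH'.sq_wv_le τ
    _ ≤ _ := by
        unfold pastNorm
        refine mul_le_mul_right (ENNReal.rpow_le_rpow (lintegral_mono fun t =>
          ENNReal.rpow_le_rpow ?_ (by norm_num)) (by norm_num)) _
        rw [← lintegral_indicator Metric.isClosed_closedBall.measurableSet]
        refine lintegral_mono fun x => ?_
        refine (ENNReal.rpow_le_rpow (h2 t x) (by norm_num)).trans (le_of_eq ?_)
        simp only [Set.indicator]
        split_ifs
        · rfl
        · exact ENNReal.zero_rpow_of_pos (by norm_num)

theorem measurable_local_integral {g : ℝ × E3 → ℝ≥0∞} (hg : Measurable g) (r : ℝ) :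
    Measurable fun q : E3 × ℝ => ∫⁻ x in Metric.closedBall q.1 r, g (q.2, x) := by
  have hS : MeasurableSet {q : (E3 × ℝ) × E3 | dist q.2 q.1.1 ≤ r} :=
    measurableSet_le (by fun_prop) measurable_const
  have h3 : Measurable fun q : (E3 × ℝ) × E3 =>
      {q : (E3 × ℝ) × E3 | dist q.2 q.1.1 ≤ r}.indicator (fun q => g (q.1.2, q.2)) q :=
    (hg.comp (f := fun q : (E3 × ℝ) × E3 => (q.1.2, q.2)) (by fun_prop)).indicator hS
  have e : ∀ q : E3 × ℝ, ∫⁻ x in Metric.closedBall q.1 r, g (q.2, x)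
      = ∫⁻ x, {q : (E3 × ℝ) × E3 | dist q.2 q.1.1 ≤ r}.indicator
        (fun q => g (q.1.2, q.2)) (q, x) := fun q => by
    rw [← lintegral_indicator Metric.isClosed_closedBall.measurableSet]
    rfl
  simp only [e]
  exact h3.lintegral_prod_right'

theorem lintegral_local_norm {g : ℝ × E3 → ℝ≥0∞} (hg : Measurable g) {r τ : ℝ} (hr : 0 ≤ r) :
    ∫⁻ z, (∫⁻ t in Iic τ, (∫⁻ x in Metric.closedBall z r, g (t, x)) ^ (11/9:ℝ)) ^ (9/8:ℝ)
      ≤ ENNReal.ofReal (r ^ 3 * vol1) *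
        (∫⁻ t in Iic τ, (∫⁻ x, g (t, x)) ^ (11/9:ℝ)) ^ (9/8:ℝ) := by
  set N := ∫⁻ t in Iic τ, (∫⁻ x, g (t, x)) ^ (11/9:ℝ) with hN
  have hm := measurable_local_integral hg r
  have hmt : Measurable fun t => ∫⁻ x, g (t, x) := hg.lintegral_prod_right'
  have hle : ∀ z t, ∫⁻ x in Metric.closedBall z r, g (t, x) ≤ ∫⁻ x, g (t, x) :=
    fun z t => setLIntegral_le_lintegral _ _
  have split : ∀ a : ℝ≥0∞, a ^ (11/9:ℝ) = a ^ (2/9:ℝ) * a := fun a => by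
    conv_rhs => rw [← ENNReal.rpow_one a, ← ENNReal.rpow_mul]
    rw [← ENNReal.rpow_add_of_nonneg _ _ (by norm_num) (by norm_num)]
    norm_num
  have split' : ∀ a : ℝ≥0∞, a ^ (9/8:ℝ) = a ^ (1/8:ℝ) * a := fun a => by
    conv_rhs => rw [← ENNReal.rpow_one a, ← ENNReal.rpow_mul]
    rw [← ENNReal.rpow_add_of_nonneg _ _ (by norm_num) (by norm_num)]
    norm_num
  have hNz : ∀ z, ∫⁻ t in Iic τ, (∫⁻ x in Metric.closedBall z r, g (t, x)) ^ (11/9:ℝ) ≤ N :=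
    fun z => lintegral_mono fun t => ENNReal.rpow_le_rpow (hle z t) (by norm_num)
  calc ∫⁻ z, (∫⁻ t in Iic τ, (∫⁻ x in Metric.closedBall z r, g (t, x)) ^ (11/9:ℝ)) ^ (9/8:ℝ)
      ≤ ∫⁻ z, N ^ (1/8:ℝ) *
          ∫⁻ t in Iic τ, (∫⁻ x in Metric.closedBall z r, g (t, x)) ^ (11/9:ℝ) := by
        refine lintegral_mono fun z => ?_
        rw [split']
        gcongr
        exact hNz z
    _ = N ^ (1/8:ℝ) * ∫⁻ t in Iic τ,
          ∫⁻ z, (∫⁻ x in Metric.closedBall z r, g (t, x)) ^ (11/9:ℝ) := by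
        have m2 : Measurable fun q : E3 × ℝ =>
          (∫⁻ x in Metric.closedBall q.1 r, g (q.2, x)) ^ (11/9:ℝ) := hm.pow_const _
        rw [lintegral_const_mul _ m2.lintegral_prod_right']
        congr 1
        exact lintegral_lintegral_swap (μ := volume) (ν := volume.restrict (Iic τ))
          (f := fun z t => (∫⁻ x in Metric.closedBall z r, g (t, x)) ^ (11/9:ℝ)) m2.aemeasurable
    _ ≤ N ^ (1/8:ℝ) * ∫⁻ t in Iic τ, ENNReal.ofReal (r ^ 3 * vol1) *
          (∫⁻ x, g (t, x)) ^ (11/9:ℝ) := by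
        gcongr with t
        calc ∫⁻ z, (∫⁻ x in Metric.closedBall z r, g (t, x)) ^ (11/9:ℝ)
            ≤ ∫⁻ z, (∫⁻ x, g (t, x)) ^ (2/9:ℝ) * ∫⁻ x in Metric.closedBall z r, g (t, x) := by
              refine lintegral_mono fun z => ?_
              rw [split]
              exact mul_le_mul_left (ENNReal.rpow_le_rpow (hle z t) (by norm_num)) _
          _ = (∫⁻ x, g (t, x)) ^ (2/9:ℝ) *
              (ENNReal.ofReal (r ^ 3 * vol1) * ∫⁻ x, g (t, x)) := by
              have m1 : Measurable fun z => ∫⁻ x in Metric.closedBall z r, g (t, x) :=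
                hm.comp (f := fun z : E3 => (z, t)) (by fun_prop)
              rw [lintegral_const_mul _ m1, lintegral_ball_avg (f := fun x => g (t, x))
                (hg.comp (f := fun x : E3 => (t, x)) (by fun_prop)) hr]
          _ = _ := by rw [split]; ring
    _ = _ := by
        rw [lintegral_const_mul _ (hmt.pow_const _), ← hN, split' N]
        ring

theorem Src.local_pairing_le {H : Spt → ℝ} {R : ℝ} (h : Src H R)
    (h0 : ∀ p : Spt, p.1 ≤ 0 → DD eT H p = 0) {τ : ℝ} (hτ : 0 < τ) {v : E3 → ℝ≥0∞}
    (hv : Measurable v) {d : ℝ≥0∞}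
    (hd : ∀ z, ∫⁻ x in Metric.closedBall z τ, v x ^ (6:ℝ) ≤ d) :
    ∫⁻ x, v x ^ (5:ℝ) * ‖wv H (τ, x)‖ₑ ≤ 9 * K1 ^ (1/2:ℝ) * d ^ (1/6:ℝ) *
      (∫⁻ x, v x ^ (12:ℝ)) ^ (1/3:ℝ) * pastNorm (DD eT H) τ ^ (3/4:ℝ) := by
  have hV := vol1_pos
  have hGc : Continuous (DD eT H) := (DD_smooth h.smooth).continuous
  have hGm := hGc.measurable
  have hwm : Measurable fun x => wv H (τ, x) := (h.wv_cont τ).measurable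
  set Nz : E3 → ℝ≥0∞ := fun z => ∫⁻ t in Iic τ,
    (∫⁻ x in Metric.closedBall z (3 * τ), ‖DD eT H (t, x)‖ₑ ^ (12/11:ℝ)) ^ (11/9:ℝ) with hNz
  set N := pastNorm (DD eT H) τ with hN
  set κ := ENNReal.ofReal (τ ^ 3 * vol1) with hκ
  have hκ0 : κ ≠ 0 := by rw [hκ, Ne, ENNReal.ofReal_eq_zero, not_le]; positivity
  have hκt : κ ≠ ⊤ := ENNReal.ofReal_ne_top
  have ball : ∀ z, ∫⁻ x in Metric.closedBall z τ, v x ^ (5:ℝ) * ‖wv H (τ, x)‖ₑ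
      ≤ K1 ^ (1/2:ℝ) * d ^ (1/6:ℝ) * ((∫⁻ x in Metric.closedBall z τ, v x ^ (12:ℝ)) ^ (1/3:ℝ) *
        Nz z ^ (3/4:ℝ)) := fun z => by
    have s1 : ∫⁻ x in Metric.closedBall z τ, v x ^ (10:ℝ)
        ≤ d ^ (1/3:ℝ) * (∫⁻ x in Metric.closedBall z τ, v x ^ (12:ℝ)) ^ (2/3:ℝ) := by
      have := ENNReal.lintegral_mul_norm_pow_le
        (μ := volume.restrict (Metric.closedBall z τ)) (f := fun x => v x ^ (6:ℝ))
        (g := fun x => v x ^ (12:ℝ)) (hv.pow_const _).aemeasurable (hv.pow_const _).aemeasurable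
        (p := 1/3) (q := 2/3) (by norm_num) (by norm_num) (by norm_num)
      refine le_trans (le_of_eq ?_) (this.trans ?_)
      · congr 1
        ext x
        rw [← ENNReal.rpow_mul, ← ENNReal.rpow_mul,
          ← ENNReal.rpow_add_of_nonneg _ _ (by norm_num) (by norm_num)]
        norm_num
      · gcongr
        exact hd z
    have s2 := ENNReal.lintegral_mul_norm_pow_le
        (μ := volume.restrict (Metric.closedBall z τ)) (f := fun x => v x ^ (10:ℝ))
        (g := fun x => ‖wv H (τ, x)‖ₑ ^ (2:ℝ)) (hv.pow_const _).aemeasurable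
        (hwm.enorm.pow_const _).aemeasurable
        (p := 1/2) (q := 1/2) (by norm_num) (by norm_num) (by norm_num)
    calc ∫⁻ x in Metric.closedBall z τ, v x ^ (5:ℝ) * ‖wv H (τ, x)‖ₑ
        = ∫⁻ x in Metric.closedBall z τ, (v x ^ (10:ℝ)) ^ (1/2:ℝ) *
            (‖wv H (τ, x)‖ₑ ^ (2:ℝ)) ^ (1/2:ℝ) := by
          congr 1
          ext x
          rw [← ENNReal.rpow_mul, ← ENNReal.rpow_mul]
          norm_num
      _ ≤ _ := s2
      _ ≤ (d ^ (1/3:ℝ) * (∫⁻ x in Metric.closedBall z τ, v x ^ (12:ℝ)) ^ (2/3:ℝ)) ^ (1/2:ℝ)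
          * (K1 * Nz z ^ (3/2:ℝ)) ^ (1/2:ℝ) := by
          gcongr
          exact h.sq_wv_ball_le h0 hτ z
      _ = _ := by
          rw [ENNReal.mul_rpow_of_nonneg _ _ (by norm_num), ENNReal.mul_rpow_of_nonneg _ _
            (by norm_num), ← ENNReal.rpow_mul, ← ENNReal.rpow_mul, ← ENNReal.rpow_mul]
          norm_num
          ring
  have hg : Measurable fun q : ℝ × E3 => ‖DD eT H q‖ₑ ^ (12/11:ℝ) := by fun_prop
  have hv12 : Measurable fun x => v x ^ (12:ℝ) := hv.pow_const _
  have hVm : Measurable fun z => ∫⁻ x in Metric.closedBall z τ, v x ^ (12:ℝ) :=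
    (measurable_local_integral (g := fun q => v q.2 ^ (12:ℝ)) (hv12.comp measurable_snd) τ).comp
      (f := fun z : E3 => (z, (0:ℝ))) (by fun_prop)
  have hNm : Measurable Nz := by
    have m2 : Measurable fun q : E3 × ℝ => (∫⁻ x in Metric.closedBall q.1 (3 * τ),
        ‖DD eT H (q.2, x)‖ₑ ^ (12/11:ℝ)) ^ (11/9:ℝ) :=
      (measurable_local_integral hg (3 * τ)).pow_const _
    exact m2.lintegral_prod_right'
  have hh : Measurable fun x => v x ^ (5:ℝ) * ‖wv H (τ, x)‖ₑ :=
    (hv.pow_const _).mul hwm.enorm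
  set V := ∫⁻ x, v x ^ (12:ℝ) with hVdef
  have hκ27 : ENNReal.ofReal ((3 * τ) ^ 3 * vol1) = 27 * κ := by
    rw [hκ, show (3 * τ) ^ 3 * vol1 = 27 * (τ ^ 3 * vol1) by ring,
      ENNReal.ofReal_mul (by norm_num)]
    norm_num
  have avg : κ * ∫⁻ x, v x ^ (5:ℝ) * ‖wv H (τ, x)‖ₑ
      ≤ κ * (9 * K1 ^ (1/2:ℝ) * d ^ (1/6:ℝ) * V ^ (1/3:ℝ) * N ^ (3/4:ℝ)) := by
    rw [hκ, ← lintegral_ball_avg hh hτ.le, ← hκ]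
    calc ∫⁻ z, ∫⁻ x in Metric.closedBall z τ, v x ^ (5:ℝ) * ‖wv H (τ, x)‖ₑ
        ≤ ∫⁻ z, K1 ^ (1/2:ℝ) * d ^ (1/6:ℝ) *
          ((∫⁻ x in Metric.closedBall z τ, v x ^ (12:ℝ)) ^ (1/3:ℝ) *
            (Nz z ^ (9/8:ℝ)) ^ (2/3:ℝ)) := by
          refine lintegral_mono fun z => (ball z).trans (le_of_eq ?_)
          rw [← ENNReal.rpow_mul]
          norm_num
      _ = K1 ^ (1/2:ℝ) * d ^ (1/6:ℝ) *
          ∫⁻ z, (∫⁻ x in Metric.closedBall z τ, v x ^ (12:ℝ)) ^ (1/3:ℝ) *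
            (Nz z ^ (9/8:ℝ)) ^ (2/3:ℝ) :=
          lintegral_const_mul _ ((hVm.pow_const _).mul ((hNm.pow_const _).pow_const _))
      _ ≤ K1 ^ (1/2:ℝ) * d ^ (1/6:ℝ) * ((κ * V) ^ (1/3:ℝ) *
            (27 * κ * N ^ (9/8:ℝ)) ^ (2/3:ℝ)) := by
          refine mul_le_mul_right ((ENNReal.lintegral_mul_norm_pow_le hVm.aemeasurable
            (hNm.pow_const _).aemeasurable (by norm_num) (by norm_num) (by norm_num)).trans ?_) _
          rw [lintegral_ball_avg hv12 hτ.le, ← hκ27]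
          exact mul_le_mul_right (ENNReal.rpow_le_rpow
            (lintegral_local_norm hg (by positivity)) (by norm_num)) _
      _ = _ := by
          have h27 : (27:ℝ≥0∞) ^ (2/3:ℝ) = 9 := by
            rw [show (27:ℝ≥0∞) = 3 ^ (3:ℝ) by norm_num, ← ENNReal.rpow_mul]
            norm_num
          have hκκ : κ ^ (1/3:ℝ) * κ ^ (2/3:ℝ) = κ := by
            rw [← ENNReal.rpow_add_of_nonneg _ _ (by norm_num) (by norm_num)]
            norm_num
          rw [ENNReal.mul_rpow_of_nonneg _ _ (by norm_num), ENNReal.mul_rpow_of_nonneg _ _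
            (by norm_num), ENNReal.mul_rpow_of_nonneg _ _ (by norm_num), ← ENNReal.rpow_mul, h27,
            show (9/8 * (2/3) : ℝ) = 3/4 by norm_num]
          conv_rhs => rw [← hκκ]
          ring
  exact (ENNReal.mul_le_mul_iff_right hκ0 hκt).1 avg

/-! ### Testing the equation against waves -/

theorem Src.exists_primitive {G : Spt → ℝ} {R : ℝ} (h : Src G R) {T : ℝ} (hT : 0 ≤ T) :
    ∃ H R', Src H R' ∧ ∀ p : Spt, p.1 ≤ T → DD eT H p = G p := by
  have hR := h.nonneg
  set M := T + R + 1 with hM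
  have hme : Measurable fun r : ℝ => ((r, 0) : Spt) := by fun_prop
  set μ : Measure Spt := (volume.restrict (Ioc 0 M)).map fun r : ℝ => ((r, 0) : Spt) with hμ
  have : IsFiniteMeasure μ := by rw [hμ]; infer_instance
  have hconv : ∀ {F : Spt → ℝ}, Continuous F → ∀ p,
      mconv μ F p = ∫ r in Ioc 0 M, F (p - (r, 0)) := fun {F} hF p => by
    rw [mconv, hμ, integral_map hme.aemeasurable]
    exact (hF.comp (by fun_prop)).aestronglyMeasurable
  have hms := mconv_smooth (μ := μ) h.smooth h.compact
  refine ⟨fun p => smoothTransition (T + 2 - p.1) * mconv μ G p, max R (T + 2), ⟨?_, ?_, ?_⟩, ?_⟩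
  · exact (smoothTransition.contDiff.comp (by fun_prop)).mul hms
  · exact hR.trans (le_max_left _ _)
  · intro p hp
    by_cases h1 : T + 2 < p.1
    · rw [smoothTransition.zero_of_nonpos (by linarith), zero_mul]
    rw [hconv h.smooth.continuous, setIntegral_eq_zero_of_forall_eq_zero, mul_zero]
    intro r hr
    refine h.supp _ ?_
    rcases hp with hp | hp
    · left
      have h2 := (le_max_left _ _).trans_lt hp
      have h3 := (le_max_right _ _).trans_lt hp
      have h4 : p.1 < 0 := by
        by_contra hcon
        rw [abs_of_nonneg (not_lt.1 hcon)] at h3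
        exact h1 h3
      rw [abs_of_neg h4] at h2
      rw [abs_of_neg (by simp only [Prod.fst_sub]; linarith [hr.1])]
      simp only [Prod.fst_sub]
      linarith [hr.1]
    · right
      simpa using (le_max_left _ _).trans_lt hp
  · intro p hp
    have hev : (fun p : Spt => smoothTransition (T + 2 - p.1) * mconv μ G p)
        =ᶠ[nhds p] mconv μ G := by
      have : {q : Spt | q.1 < T + 1} ∈ nhds p :=
        (isOpen_lt continuous_fst continuous_const).mem_nhds (show p.1 < T + 1 by linarith)
      filter_upwards [this] with q hq
      have hq' : q.1 < T + 1 := hq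
      rw [smoothTransition.one_of_one_le (by linarith), one_mul]
    have e1 : DD eT (fun p : Spt => smoothTransition (T + 2 - p.1) * mconv μ G p) p
        = DD eT (mconv μ G) p := by
      simp only [DD, hev.fderiv_eq]
    rw [e1, DD_mconv h.smooth h.compact, hconv (h.dd eT).smooth.continuous]
    have hd : ∀ r ∈ uIcc 0 M, HasDerivAt (fun r => - G (p - (r, 0))) (DD eT G (p - (r, 0))) r := by
      intro r _
      have h1 : HasDerivAt (fun r : ℝ => G (p.1 - r, p.2)) (-(DD eT G (p.1 - r, p.2))) r := by
        have h2 := (hasDerivAt_slice_t (x := p.2) (smooth_diffAt h.smooth)).comp r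
          ((hasDerivAt_id r).const_sub p.1)
        have e2 : -(DD eT G (p.1 - r, p.2)) = DD eT G (p.1 - r, p.2) * -1 := by ring
        rw [e2]
        exact h2
      have h3 := h1.neg
      simp only [neg_neg] at h3
      have e : ∀ r : ℝ, p - (r, (0:E3)) = (p.1 - r, p.2) := fun r => by ext <;> simp
      simp only [e]
      exact h3
    have hM0 : 0 ≤ M := by positivity
    have h2 := intervalIntegral.integral_eq_sub_of_hasDerivAt hd
      (((h.dd eT).smooth.continuous.comp (by fun_prop)).intervalIntegrable _ _)
    rw [intervalIntegral.integral_of_le hM0] at h2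
    rw [h2, h.supp (p - (M, 0)) (Or.inl ?_)]
    · have : p - ((0:ℝ), (0:E3)) = p := by ext <;> simp
      rw [this]; ring
    · rw [abs_of_neg (by simp only [Prod.fst_sub]; linarith)]
      simp only [Prod.fst_sub]
      linarith

theorem sq_integral_mul_le {f g : E3 → ℝ} (hf : Integrable fun x => f x ^ 2)
    (hg : Integrable fun x => g x ^ 2) (hfg : Integrable fun x => f x * g x) :
    (∫ x, f x * g x) ^ 2 ≤ (∫ x, f x ^ 2) * ∫ x, g x ^ 2 := by
  have key : ∀ s : ℝ, 0 ≤ (∫ x, g x ^ 2) * (s * s) + (2 * ∫ x, f x * g x) * s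
      + ∫ x, f x ^ 2 := fun s => by
    have h1 : 0 ≤ ∫ x, (g x ^ 2 * (s * s) + 2 * (f x * g x) * s + f x ^ 2) :=
      integral_nonneg fun x => by
        have : g x ^ 2 * (s * s) + 2 * (f x * g x) * s + f x ^ 2 = (s * g x + f x) ^ 2 := by ring
        simp only [this]
        exact sq_nonneg _
    have hI : Integrable fun x => g x ^ 2 * (s * s) + 2 * (f x * g x) * s :=
      (hg.mul_const _).add ((hfg.const_mul 2).mul_const s)
    rw [integral_add hI hf, integral_add (hg.mul_const _) ((hfg.const_mul 2).mul_const s), integral_mul_const,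
      integral_mul_const, integral_const_mul] at h1
    exact h1
  have := discrim_le_zero key
  unfold discrim at this
  linarith

/-- The symplectic pairing of a solution with `wv H`. -/
def symp (v H : Spt → ℝ) (t : ℝ) : ℝ :=
  ∫ x, v (t, x) * DD eT (wv H) (t, x) - DD eT v (t, x) * wv H (t, x)

namespace Src

variable {H v : Spt → ℝ} {R E : ℝ}

theorem symp_hasDerivAt (h : Src H R) (hv : Sol v E) (t : ℝ) :
    HasDerivAt (symp v H)
      (∫ x, c0 * (v (t, x) * DD eT H (t, x)) + v (t, x) ^ 5 * wv H (t, x)) t := by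
  have hw := h.wv_smooth
  have hs := hv.smooth
  have hst : ContDiff ℝ (⊤ : ℕ∞) (DD eT v) := DD_smooth hs
  have hwt : ContDiff ℝ (⊤ : ℕ∞) (DD eT (wv H)) := DD_smooth hw
  have hd := hasDerivAt_integral_slice
    (f := fun p => v p * DD eT (wv H) p - DD eT v p * wv H p)
    (t₀ := t) (ε := 1) (R := 2 * R + |t| + 1) one_pos
    (fun s x _ => smooth_one ((hs.mul hwt).sub (hst.mul hw)) _)
    (fun s x hs hx => by
      have h1 : 2 * R + |s| < ‖x‖ := by
        have := abs_sub_abs_le_abs_sub s t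
        linarith
      have e1 := (h.wv_zero (p := (s, x)) (Or.inr h1)).eq_of_nhds
      have e2 := h.wt_slice_zero s x h1
      simp only [e1, e2]
      simp)
  set r := 2 * R + |t| with hr
  have hRr : R ≤ r := by have := abs_nonneg t; have := h.nonneg; linarith
  have hsm : ∀ i, ContDiff ℝ (⊤ : ℕ∞) (fun p => v p * DD (eX i) (wv H) p
      - DD (eX i) v p * wv H p) := fun i =>
    (hs.mul (DD_smooth hw)).sub ((DD_smooth hs).mul hw)
  have hpt : ∀ x, DD eT (fun p => v p * DD eT (wv H) p - DD eT v p * wv H p) (t, x)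
      = ∑ i, DD (eX i) (fun p => v p * DD (eX i) (wv H) p - DD (eX i) v p * wv H p) (t, x)
      + (c0 * (v (t, x) * DD eT H (t, x)) + v (t, x) ^ 5 * wv H (t, x)) := fun x => by
    have hwi : ∀ i, ContDiff ℝ (⊤ : ℕ∞) (DD (eX i) (wv H)) := fun i => DD_smooth hw
    have hvi : ∀ i, ContDiff ℝ (⊤ : ℕ∞) (DD (eX i) v) := fun i => DD_smooth hs
    have e1 : DD eT (fun p => v p * DD eT (wv H) p - DD eT v p * wv H p) (t, x)
        = v (t, x) * DD eT (DD eT (wv H)) (t, x) - DD eT (DD eT v) (t, x) * wv H (t, x) := by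
      rw [DD_sub (smooth_diffAt (hs.mul hwt)) (smooth_diffAt (hst.mul hw)),
        DD_mul (smooth_diffAt hs) (smooth_diffAt hwt), DD_mul (smooth_diffAt hst)
        (smooth_diffAt hw)]
      ring
    have e2 : ∀ i, DD (eX i) (fun p => v p * DD (eX i) (wv H) p - DD (eX i) v p * wv H p) (t, x)
        = v (t, x) * DD (eX i) (DD (eX i) (wv H)) (t, x)
          - DD (eX i) (DD (eX i) v) (t, x) * wv H (t, x) := fun i => by
      rw [DD_sub (smooth_diffAt (hs.mul (hwi i))) (smooth_diffAt ((hvi i).mul hw)),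
        DD_mul (smooth_diffAt hs) (smooth_diffAt (hwi i)),
        DD_mul (smooth_diffAt (hvi i)) (smooth_diffAt hw)]
      ring
    simp only [e1, e2, Finset.sum_sub_distrib, ← Finset.mul_sum, ← Finset.sum_mul]
    rw [h.wv_wave, hv.eqn]
    ring
  have hdiv0 : ∀ i x, r < ‖x‖ → DD (eX i) (fun p => v p * DD (eX i) (wv H) p
      - DD (eX i) v p * wv H p) =ᶠ[nhds (t, x)] 0 := fun i x hx => by
    have e1 := h.wv_zero (p := (t, x)) (Or.inr hx)
    refine DD_eventually_zero ?_
    filter_upwards [e1, DD_eventually_zero (ξ := eX i) e1] with q h1 h2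
    simp [h1, h2]
  have hdivint : ∀ i, Integrable fun x => DD (eX i) (fun p => v p * DD (eX i) (wv H) p
      - DD (eX i) v p * wv H p) (t, x) := fun i =>
    integrable_of_ball ((DD_smooth (hsm i)).continuous.comp (by fun_prop))
      fun x hx => (hdiv0 i x hx).eq_of_nhds
  have hdivz : ∀ i, ∫ x, DD (eX i) (fun p => v p * DD (eX i) (wv H) p
      - DD (eX i) v p * wv H p) (t, x) = 0 := fun i =>
    integral_dx_eq_zero (R := r) (fun x => smooth_one (hsm i) _) (fun x hx => by
      have e1 := h.wv_zero (p := (t, x)) (Or.inr hx)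
      rw [e1.eq_of_nhds, (DD_eventually_zero (ξ := eX i) e1).eq_of_nhds]
      simp) i
  have hvc : Continuous fun x => v (t, x) := hs.continuous.comp (by fun_prop)
  have hI : Integrable fun x => c0 * (v (t, x) * DD eT H (t, x)) + v (t, x) ^ 5 * wv H (t, x) :=
    integrable_of_ball (R := r) (((hvc.mul ((h.dd eT).slice_cont t)).const_mul _).add
      ((hvc.pow 5).mul (h.wv_cont t))) fun x hx => by
      show c0 * (v (t, x) * DD eT H (t, x)) + v (t, x) ^ 5 * wv H (t, x) = 0
      rw [(h.dd eT).slice_zero t x (hRr.trans_lt hx), h.wv_slice_zero t x hx]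
      simp
  have hval : ∫ x, DD eT (fun p => v p * DD eT (wv H) p - DD eT v p * wv H p) (t, x)
      = ∫ x, c0 * (v (t, x) * DD eT H (t, x)) + v (t, x) ^ 5 * wv H (t, x) := by
    simp only [hpt]
    rw [integral_add (integrable_finsetSum _ fun i _ => hdivint i) hI,
      integral_finsetSum _ fun i _ => hdivint i]
    simp only [hdivz]
    simp
  rw [hval] at hd
  exact hd

theorem symp_zero (h : Src H R) {t : ℝ} (ht : t < -R) : symp v H t = 0 := by
  unfold symp
  have h1 : ∀ x, wv H (t, x) = 0 := fun x => (h.wv_zero (p := (t, x)) (Or.inl ht)).eq_of_nhds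
  have h2 : ∀ x, DD eT (wv H) (t, x) = 0 := fun x =>
    (h.wt_zero (p := (t, x)) (Or.inl ht)).eq_of_nhds
  simp [h1, h2]

theorem source_continuous (h : Src H R) (hv : Sol v E) :
    Continuous fun t => ∫ x, c0 * (v (t, x) * DD eT H (t, x)) + v (t, x) ^ 5 * wv H (t, x) := by
  have hG := (h.dd eT).smooth
  have hw := h.wv_smooth
  have hs := hv.smooth
  refine continuous_iff_continuousAt.2 fun t => ?_
  refine (hasDerivAt_integral_slice
    (f := fun p => c0 * (v p * DD eT H p) + v p ^ 5 * wv H p) (t₀ := t) (ε := 1)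
    (R := 2 * R + |t| + 1) one_pos (fun s x _ => smooth_one
      ((contDiff_const.mul (hs.mul hG)).add ((hs.pow 5).mul hw)) _)
    (fun s x hs hx => ?_)).continuousAt
  have h1 : 2 * R + |s| < ‖x‖ := by
    have := abs_sub_abs_le_abs_sub s t
    linarith
  rw [(h.dd eT).slice_zero s x (by have := abs_nonneg s; have := h.nonneg; linarith),
    h.wv_slice_zero s x h1]
  simp

theorem symp_eq (h : Src H R) (hv : Sol v E) {a T : ℝ} (ha : a < -R) :
    symp v H T = ∫ t in a..T, ∫ x, c0 * (v (t, x) * DD eT H (t, x)) + v (t, x) ^ 5 * wv H (t, x) := by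
  have := intervalIntegral.integral_eq_sub_of_hasDerivAt (a := a) (b := T)
    (fun t _ => h.symp_hasDerivAt hv t)
    ((h.source_continuous hv).intervalIntegrable _ _)
  rw [h.symp_zero ha, sub_zero] at this
  exact this.symm

theorem abs_symp_le (h : Src H R) (hv : Sol v E) (t : ℝ) :
    |symp v H t| ≤ 2 * √(2 * E) * √(psi H t) := by
  have hs := hv.smooth
  have hvc : Continuous fun x => v (t, x) := hs.continuous.comp (by fun_prop)
  have hvtc : Continuous fun x => DD eT v (t, x) := (DD_smooth hs).continuous.comp (by fun_prop)
  have hz := h.wv_slice_zero t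
  have hzt := h.wt_slice_zero t
  have hI1 : Integrable fun x => v (t, x) * DD eT (wv H) (t, x) :=
    integrable_of_ball (hvc.mul (h.wt_cont t)) fun x hx => by
      show _ * _ = (0:ℝ)
      rw [hzt x hx, mul_zero]
  have hI2 : Integrable fun x => DD eT v (t, x) * wv H (t, x) :=
    integrable_of_ball (hvtc.mul (h.wv_cont t)) fun x hx => by
      show _ * _ = (0:ℝ)
      rw [hz x hx, mul_zero]
  have hwsq : Integrable fun x => wv H (t, x) ^ 2 :=
    integrable_of_ball ((h.wv_cont t).pow 2) fun x hx => by
      show _ ^ 2 = (0:ℝ)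
      rw [hz x hx]; simp
  have hedc : Continuous fun x => ed v (t, x) := (ed_smooth hs).continuous.comp (by fun_prop)
  have hvtsq : Integrable fun x => DD eT v (t, x) ^ 2 := by
    refine ((hv.int_ed t).const_mul 2).mono' (hvtc.pow 2).aestronglyMeasurable
      (Filter.Eventually.of_forall fun x => ?_)
    rw [norm_of_nonneg (sq_nonneg _)]
    exact sqT_le_ed v _
  have hgs : ∀ x, ∑ i, DD (eE i) (fun x => v (t, x)) x ^ 2 = gsq v (t, x) := fun x => by
    unfold gsq
    exact Finset.sum_congr rfl fun i _ => by
      rw [show DD (eE i) (fun x => v (t, x)) x = DD (eX i) v (t, x) from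
        DD_slice_x (smooth_diffAt hs) i]
  have hgi : Integrable fun x => gsq v (t, x) := by
    refine ((hv.int_ed t).const_mul 2).mono'
      ((gsq_smooth hs).continuous.comp (by fun_prop)).aestronglyMeasurable
      (Filter.Eventually.of_forall fun x => ?_)
    rw [norm_of_nonneg (gsq_nonneg _ _)]
    exact gsq_le_ed v _
  have hpsi : 0 ≤ psi H t := (integral_nonneg fun x => sq_nonneg _).trans (h.sq_wv_le_psi t)
  have hE2 : ∫ x, 2 * ed v (t, x) ≤ 2 * E := by
    rw [integral_const_mul]; linarith [hv.ed_le t]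
  have b1 : |∫ x, v (t, x) * DD eT (wv H) (t, x)| ≤ √(2 * E) * √(psi H t) := by
    rw [← Real.sqrt_mul (by linarith [hv.nonneg])]
    refine abs_le_sqrt ?_
    have := h.pairing_le_psi t (u := fun x => v (t, x)) (hs.comp (by fun_prop)) (hv.int_sq t)
      (by simp only [hgs]; exact hgi)
    refine this.trans (mul_le_mul_of_nonneg_right ?_ hpsi)
    simp only [hgs]
    exact (integral_mono hgi ((hv.int_ed t).const_mul 2) fun x => gsq_le_ed v _).trans hE2
  have b2 : |∫ x, DD eT v (t, x) * wv H (t, x)| ≤ √(2 * E) * √(psi H t) := by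
    rw [← Real.sqrt_mul (by linarith [hv.nonneg])]
    refine abs_le_sqrt ?_
    have hcs := sq_integral_mul_le hvtsq hwsq hI2
    refine hcs.trans (mul_le_mul ?_ (h.sq_wv_le_psi t) (integral_nonneg fun x => sq_nonneg _)
      (by linarith [hv.nonneg]))
    exact (integral_mono hvtsq ((hv.int_ed t).const_mul 2) fun x => sqT_le_ed v _).trans hE2
  unfold symp
  rw [integral_sub hI1 hI2]
  refine (abs_sub _ _).trans ?_
  linarith

end Src

theorem slice_integral_continuous {f : Spt → ℝ} (hf : ContDiff ℝ (⊤ : ℕ∞) f) {R : ℝ}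
    (h0 : ∀ t x, R + |t| < ‖x‖ → f (t, x) = 0) : Continuous fun t => ∫ x, f (t, x) := by
  refine continuous_iff_continuousAt.2 fun t => ?_
  refine (hasDerivAt_integral_slice (f := f) (t₀ := t) (ε := 1)
    (R := R + |t| + 1) one_pos (fun s x _ => smooth_one hf _)
    (fun s x hs hx => h0 s x ?_)).continuousAt
  have := abs_sub_abs_le_abs_sub s t
  linarith

theorem setLIntegral_le_of_zero {α : Type*} [MeasurableSpace α] {μ : Measure α} {f : α → ℝ≥0∞}
    {A B : Set α} (hA : MeasurableSet A) (hB : MeasurableSet B)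
    (h : ∀ a ∈ A, a ∉ B → f a = 0) : ∫⁻ a in A, f a ∂μ ≤ ∫⁻ a in B, f a ∂μ := by
  rw [← lintegral_indicator hA, ← lintegral_indicator hB]
  refine lintegral_mono fun a => ?_
  by_cases ha : a ∈ A
  · by_cases hb : a ∈ B
    · simp [ha, hb]
    · simp [ha, hb, h a ha hb]
  · simp [ha]

theorem pastNorm_mono (G : Spt → ℝ) {s t : ℝ} (h : s ≤ t) : pastNorm G s ≤ pastNorm G t :=
  lintegral_mono_set (Iic_subset_Iic.2 h)

theorem pastNorm_congr {G G' : Spt → ℝ} {T : ℝ} (h : ∀ p : Spt, p.1 ≤ T → G p = G' p) :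
    pastNorm G T = pastNorm G' T := by
  unfold pastNorm
  refine setLIntegral_congr_fun measurableSet_Iic fun t ht => ?_
  have : ∀ x, G (t, x) = G' (t, x) := fun x => h (t, x) ht
  simp only [this]

theorem Src.wv_cone {H G : Spt → ℝ} {R s ρ T : ℝ} (h : Src H R)
    (hHG : ∀ p : Spt, p.1 ≤ T → DD eT H p = G p)
    (hsupp : ∀ p : Spt, p.1 ≤ T → (p.1 ≤ s ∨ ρ + p.1 ≤ ‖p.2‖) → G p = 0)
    {p : Spt} (hT : p.1 ≤ T) (hp : p.1 ≤ s ∨ ρ + p.1 ≤ ‖p.2‖) : wv H p = 0 := by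
  rw [h.wv_eq, (h.dd eT).pot_formula]
  refine integral_eq_zero_of_ae (Filter.Eventually.of_forall fun y => ?_)
  have hy := norm_nonneg y
  have h1 : (p - (1 * ‖y‖, y)).1 = p.1 - ‖y‖ := by simp
  have h2 : (p - (1 * ‖y‖, y)).2 = p.2 - y := by simp
  show ‖y‖⁻¹ * DD eT H (p - (1 * ‖y‖, y)) = 0
  rw [hHG _ (by rw [h1]; linarith), hsupp _ (by rw [h1]; linarith), mul_zero]
  rw [h1, h2]
  rcases hp with hp | hp
  · left; linarith
  · right
    have := norm_sub_norm_le p.2 y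
    linarith

/-- The duality bound for a solution tested against a source supported in a truncated cone. -/
theorem Src.cone_bound {v G : Spt → ℝ} {E R s ρ T : ℝ} (hv : Sol v E) (hG : Src G R)
    (hs : 0 ≤ s) (hsT : s < T) (hpos : ∀ p : Spt, p.1 ≤ T → 0 ≤ v p * G p)
    (hsupp : ∀ p : Spt, p.1 ≤ T → (p.1 ≤ s ∨ ρ + p.1 ≤ ‖p.2‖) → G p = 0) {d : ℝ≥0∞}
    (hd : ∀ τ, 0 < τ → τ ≤ T → ∀ z, ∫⁻ x in Metric.closedBall z τ, ‖v (τ, x)‖ₑ ^ (6:ℝ) ≤ d) :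
    ENNReal.ofReal c0 * ∫⁻ t in Iic T, ∫⁻ x, ‖v (t, x) * G (t, x)‖ₑ
      ≤ (ENNReal.ofReal (2 * √(2 * E)) * K1 ^ (1/2:ℝ) + 9 * K1 ^ (1/2:ℝ) * d ^ (1/6:ℝ)
        * ∫⁻ t in Ioc s T, (∫⁻ x in Metric.ball 0 (ρ + t), ‖v (t, x)‖ₑ ^ (12:ℝ)) ^ (1/3:ℝ))
        * pastNorm G T ^ (3/4:ℝ) := by
  obtain ⟨H, R', h, hHG⟩ := hG.exists_primitive (hs.trans hsT.le)
  have hR' := h.nonneg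
  have hcs := hv.smooth
  have hGs := (h.dd eT).smooth
  have hw := h.wv_smooth
  obtain ⟨a, ha⟩ : ∃ a, a < -R' := exists_lt _
  have haT : a ≤ T := by linarith
  have hG0 : ∀ p : Spt, p.1 ≤ 0 → DD eT H p = 0 := fun p hp => by
    rw [hHG p (by linarith)]
    exact hsupp p (by linarith) (Or.inl (by linarith))
  have hpc : pastNorm (DD eT H) T = pastNorm G T := pastNorm_congr hHG
  set P := pastNorm G T with hP
  -- the two source terms
  have z1 : ∀ t x, 2 * R' + |t| < ‖x‖ → DD eT H (t, x) = 0 := fun t x hx =>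
    (h.dd eT).slice_zero t x (by have := abs_nonneg t; linarith)
  have z2 := fun t x => h.wv_slice_zero t x
  have c1 := slice_integral_continuous (f := fun p => v p * DD eT H p) (hcs.mul hGs) (R := 2 * R')
    fun t x hx => by simp only [z1 t x hx, mul_zero]
  have c2 := slice_integral_continuous (f := fun p => v p ^ 5 * wv H p) ((hcs.pow 5).mul hw)
    (R := 2 * R') fun t x hx => by simp only [z2 t x hx, mul_zero]
  have i1 : ∀ t, Integrable fun x => v (t, x) * DD eT H (t, x) := fun t =>
    integrable_of_ball (R := 2 * R' + |t|) ((hcs.mul hGs).continuous.comp (by fun_prop))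
      fun x hx => by show _ * _ = (0:ℝ); rw [z1 t x hx, mul_zero]
  have i2 : ∀ t, Integrable fun x => v (t, x) ^ 5 * wv H (t, x) := fun t =>
    integrable_of_ball (R := 2 * R' + |t|) (((hcs.pow 5).mul hw).continuous.comp (by fun_prop))
      fun x hx => by show _ * _ = (0:ℝ); rw [z2 t x hx, mul_zero]
  have hsy := h.symp_eq hv (T := T) ha
  have e1 : ∀ t, (∫ x, c0 * (v (t, x) * DD eT H (t, x)) + v (t, x) ^ 5 * wv H (t, x))
      = c0 * (∫ x, v (t, x) * DD eT H (t, x)) + ∫ x, v (t, x) ^ 5 * wv H (t, x) := fun t => by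
    rw [integral_add ((i1 t).const_mul _) (i2 t), integral_const_mul]
  simp only [e1] at hsy
  have c3 : Continuous fun t => c0 * ∫ x, v (t, x) * DD eT H (t, x) := continuous_const.mul c1
  rw [intervalIntegral.integral_add (c3.intervalIntegrable _ _)
    (c2.intervalIntegrable _ _), intervalIntegral.integral_const_mul,
    intervalIntegral.integral_of_le haT, intervalIntegral.integral_of_le haT] at hsy
  -- the left side as a real integral
  have hnn : ∀ t ∈ Ioc a T, 0 ≤ ∫ x, v (t, x) * DD eT H (t, x) := fun t ht =>
    integral_nonneg fun x => by
      show 0 ≤ v (t, x) * DD eT H (t, x)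
      rw [hHG (t, x) ht.2]; exact hpos (t, x) ht.2
  have hL : ∫⁻ t in Iic T, ∫⁻ x, ‖v (t, x) * G (t, x)‖ₑ
      ≤ ENNReal.ofReal (∫ t in Ioc a T, ∫ x, v (t, x) * DD eT H (t, x)) := by
    rw [ofReal_integral_eq_lintegral_ofReal
      (c1.integrableOn_Ioc) ((ae_restrict_iff' measurableSet_Ioc).2
        (Filter.Eventually.of_forall hnn))]
    refine (setLIntegral_le_of_zero measurableSet_Iic (measurableSet_Ioc (a := a) (b := T))
      fun t ht ht' => ?_).trans (setLIntegral_mono' measurableSet_Ioc fun t ht => ?_)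
    · have hta : t ≤ a := by
        by_contra hcon
        exact ht' ⟨not_le.1 hcon, ht⟩
      refine lintegral_eq_zero_of_ae_eq_zero (Filter.Eventually.of_forall fun x => ?_)
      show ‖v (t, x) * G (t, x)‖ₑ = 0
      rw [hsupp (t, x) ht (Or.inl (by show t ≤ s; linarith))]
      simp
    · rw [ofReal_integral_eq_lintegral_ofReal (i1 t) (Filter.Eventually.of_forall fun x => by
        show 0 ≤ v (t, x) * DD eT H (t, x)
        rw [hHG (t, x) ht.2]; exact hpos (t, x) ht.2)]
      refine lintegral_mono fun x => ?_
      rw [hHG (t, x) ht.2, Real.enorm_of_nonneg (hpos (t, x) ht.2)]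
  -- the boundary term
  have hB : ENNReal.ofReal |symp v H T|
      ≤ ENNReal.ofReal (2 * √(2 * E)) * K1 ^ (1/2:ℝ) * P ^ (3/4:ℝ) := by
    refine (ENNReal.ofReal_le_ofReal (h.abs_symp_le hv T)).trans ?_
    rw [ENNReal.ofReal_mul (by positivity), mul_assoc]
    refine mul_le_mul_right ?_ _
    have hpsi : 0 ≤ psi H T := (integral_nonneg fun x => sq_nonneg _).trans (h.sq_wv_le_psi T)
    rw [Real.sqrt_eq_rpow, ← ENNReal.ofReal_rpow_of_nonneg hpsi (by norm_num)]
    refine (ENNReal.rpow_le_rpow (h.psi_le T) (by norm_num)).trans ?_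
    show (K1 * pastNorm (DD eT H) T ^ (3/2:ℝ)) ^ (1/2:ℝ) ≤ _
    rw [hpc, ENNReal.mul_rpow_of_nonneg _ _ (by norm_num), ← ENNReal.rpow_mul]
    norm_num
  -- the nonlinear term
  have hN : ENNReal.ofReal |∫ t in Ioc a T, ∫ x, v (t, x) ^ 5 * wv H (t, x)|
      ≤ 9 * K1 ^ (1/2:ℝ) * d ^ (1/6:ℝ)
        * (∫⁻ t in Ioc s T, (∫⁻ x in Metric.ball 0 (ρ + t), ‖v (t, x)‖ₑ ^ (12:ℝ)) ^ (1/3:ℝ))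
        * P ^ (3/4:ℝ) := by
    rw [← Real.norm_eq_abs, ofReal_norm]
    refine (enorm_integral_le_lintegral_enorm _).trans ?_
    refine (setLIntegral_le_of_zero measurableSet_Ioc (measurableSet_Ioc (a := s) (b := T))
      fun t ht ht' => ?_).trans ?_
    · have hts : t ≤ s := by
        by_contra hcon
        exact ht' ⟨not_le.1 hcon, ht.2⟩
      have : ∀ x, wv H (t, x) = 0 := fun x => h.wv_cone (p := (t, x)) hHG hsupp ht.2 (Or.inl hts)
      simp [this]
    have hmeas : Measurable fun t : ℝ =>
        (∫⁻ x in Metric.ball (0:E3) (ρ + t), ‖v (t, x)‖ₑ ^ (12:ℝ)) ^ (1/3:ℝ) := by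
      refine Measurable.pow_const ?_ _
      have e : ∀ t : ℝ, ∫⁻ x in Metric.ball (0:E3) (ρ + t), ‖v (t, x)‖ₑ ^ (12:ℝ)
          = ∫⁻ x, {p : Spt | ‖p.2‖ < ρ + p.1}.indicator (fun p => ‖v p‖ₑ ^ (12:ℝ)) (t, x) := by
        intro t
        rw [← lintegral_indicator measurableSet_ball]
        refine lintegral_congr fun x => ?_
        simp [Set.indicator]
      simp only [e]
      refine Measurable.lintegral_prod_right' ?_
      exact (hcs.continuous.measurable.enorm.pow_const _).indicator
        (measurableSet_lt (by fun_prop) (by fun_prop))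
    rw [mul_assoc, ← lintegral_mul_const _ hmeas, ← lintegral_const_mul _ (hmeas.mul_const _)]
    refine setLIntegral_mono' measurableSet_Ioc fun t ht => ?_
    have ht0 : 0 < t := hs.trans_lt ht.1
    refine (enorm_integral_le_lintegral_enorm _).trans ?_
    set vv : E3 → ℝ≥0∞ := (Metric.ball 0 (ρ + t)).indicator fun x => ‖v (t, x)‖ₑ with hvv
    have hvvm : Measurable vv :=
      (Continuous.measurable (hcs.continuous.comp (by fun_prop))).enorm.indicator measurableSet_ball
    have hvle : ∀ x, vv x ≤ ‖v (t, x)‖ₑ := fun x => Set.indicator_le_self _ _ _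
    have hloc := h.local_pairing_le hG0 ht0 hvvm (d := d) fun z =>
      (lintegral_mono fun x => ENNReal.rpow_le_rpow (hvle x) (by norm_num)).trans (hd t ht0 ht.2 z)
    have e12 : ∫⁻ x, vv x ^ (12:ℝ) = ∫⁻ x in Metric.ball (0:E3) (ρ + t), ‖v (t, x)‖ₑ ^ (12:ℝ) := by
      rw [← lintegral_indicator measurableSet_ball]
      refine lintegral_congr fun x => ?_
      by_cases hx : x ∈ Metric.ball (0:E3) (ρ + t)
      · simp [hvv, hx]
      · simp only [hvv, Set.indicator_of_notMem hx]
        exact ENNReal.zero_rpow_of_pos (by norm_num)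
    rw [e12] at hloc
    have hstep : ∫⁻ x, ‖v (t, x) ^ 5 * wv H (t, x)‖ₑ ≤ ∫⁻ x, vv x ^ (5:ℝ) * ‖wv H (t, x)‖ₑ := by
      refine lintegral_mono fun x => ?_
      by_cases hx : x ∈ Metric.ball (0:E3) (ρ + t)
      · simp only [hvv, Set.indicator_of_mem hx, enorm_mul, enorm_pow]
        norm_cast
      · rw [h.wv_cone (p := (t, x)) hHG hsupp ht.2 (Or.inr (by
          simpa using hx))]
        simp
    refine hstep.trans (hloc.trans ?_)
    rw [mul_assoc]
    refine mul_le_mul_right (mul_le_mul_right (ENNReal.rpow_le_rpow ?_ (by norm_num)) _) _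
    rw [← hpc]
    exact pastNorm_mono _ ht.2
  calc ENNReal.ofReal c0 * ∫⁻ t in Iic T, ∫⁻ x, ‖v (t, x) * G (t, x)‖ₑ
      ≤ ENNReal.ofReal c0 * ENNReal.ofReal (∫ t in Ioc a T, ∫ x, v (t, x) * DD eT H (t, x)) :=
        mul_le_mul_right hL _
    _ = ENNReal.ofReal (c0 * ∫ t in Ioc a T, ∫ x, v (t, x) * DD eT H (t, x)) :=
        (ENNReal.ofReal_mul c0_pos.le).symm
    _ ≤ ENNReal.ofReal (|symp v H T| + |∫ t in Ioc a T, ∫ x, v (t, x) ^ 5 * wv H (t, x)|) := by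
        refine ENNReal.ofReal_le_ofReal ?_
        have := le_abs_self (symp v H T)
        have := neg_abs_le (∫ t in Ioc a T, ∫ x, v (t, x) ^ 5 * wv H (t, x))
        linarith
    _ ≤ _ := by
        rw [ENNReal.ofReal_add (abs_nonneg _) (abs_nonneg _), add_mul]
        exact add_le_add hB hN

/-! ### The extremal source -/

theorem slice_integral_smooth {R : ℝ} : ∀ (n : ℕ) {f : Spt → ℝ}, Src f R →
    ContDiff ℝ n (fun t => ∫ x, f (t, x)) := by
  have hd : ∀ {f : Spt → ℝ}, Src f R → ∀ t,
      HasDerivAt (fun t => ∫ x, f (t, x)) (∫ x, DD eT f (t, x)) t := fun {f} hf t =>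
    hasDerivAt_integral_slice (R := R) one_pos (fun s x _ => smooth_one hf.smooth _)
      fun s x _ hx => hf.slice_zero s x hx
  intro n
  induction n with
  | zero =>
    intro f hf
    exact contDiff_zero.2 (continuous_iff_continuousAt.2 fun t => (hd hf t).continuousAt)
  | succ n ih =>
    intro f hf
    push_cast
    refine contDiff_succ_iff_deriv.2 ⟨fun t => (hd hf t).differentiableAt, by simp, ?_⟩
    rw [show deriv (fun t => ∫ x, f (t, x)) = fun t => ∫ x, DD eT f (t, x) from
      funext fun t => (hd hf t).deriv]
    exact ih (hf.dd eT)

/-- A smooth cutoff to the truncated cone `{s < t, ‖x‖ < ρ + t}`. -/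
def coneCut (s ρ T k : ℝ) (p : Spt) : ℝ :=
  smoothTransition (k * (p.1 - s)) * smoothTransition (T + 1 - p.1)
    * smoothTransition (k * ((ρ + p.1) ^ 2 - ‖p.2‖ ^ 2))

theorem coneCut_smooth (s ρ T k : ℝ) : ContDiff ℝ (⊤ : ℕ∞) (coneCut s ρ T k) := by
  have h : ContDiff ℝ (⊤ : ℕ∞) fun p : Spt => ‖p.2‖ ^ 2 := contDiff_snd.norm_sq ℝ
  exact ((smoothTransition.contDiff.comp (by fun_prop)).mul
    (smoothTransition.contDiff.comp (by fun_prop))).mul (smoothTransition.contDiff.comp (by fun_prop))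

theorem coneCut_nonneg (s ρ T k : ℝ) (p : Spt) : 0 ≤ coneCut s ρ T k p :=
  mul_nonneg (mul_nonneg (smoothTransition.nonneg _) (smoothTransition.nonneg _))
    (smoothTransition.nonneg _)

theorem coneCut_le_one (s ρ T k : ℝ) (p : Spt) : coneCut s ρ T k p ≤ 1 :=
  mul_le_one₀ (mul_le_one₀ (smoothTransition.le_one _) (smoothTransition.nonneg _)
    (smoothTransition.le_one _)) (smoothTransition.nonneg _) (smoothTransition.le_one _)

theorem coneCut_zero {s ρ T k : ℝ} (hk : 0 < k) (hs : 0 ≤ s) (hρ : 0 ≤ ρ) {p : Spt}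
    (hp : p.1 ≤ s ∨ ρ + p.1 ≤ ‖p.2‖) : coneCut s ρ T k p = 0 := by
  unfold coneCut
  by_cases h : p.1 ≤ s
  · rw [smoothTransition.zero_of_nonpos (mul_nonpos_of_nonneg_of_nonpos hk.le (by linarith))]
    simp
  · have h1 := hp.resolve_left h
    push Not at h
    rw [smoothTransition.zero_of_nonpos (x := k * ((ρ + p.1) ^ 2 - ‖p.2‖ ^ 2))
      (mul_nonpos_of_nonneg_of_nonpos hk.le ?_)]
    · simp
    · have : 0 ≤ ρ + p.1 := by linarith
      nlinarith [norm_nonneg p.2]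

theorem coneCut_src {s ρ T k : ℝ} (hk : 0 < k) (hs : 0 ≤ s) (hρ : 0 ≤ ρ) (hT : 0 ≤ T)
    {f : Spt → ℝ} (hf : ContDiff ℝ (⊤ : ℕ∞) f) :
    Src (fun p => coneCut s ρ T k p * f p) (ρ + T + 1) where
  smooth := (coneCut_smooth s ρ T k).mul hf
  nonneg := by positivity
  supp := fun p hp => by
    have : coneCut s ρ T k p = 0 := by
      by_cases h1 : p.1 ≤ s
      · exact coneCut_zero hk hs hρ (Or.inl h1)
      by_cases h2 : T + 1 ≤ p.1
      · unfold coneCut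
        rw [smoothTransition.zero_of_nonpos (x := T + 1 - p.1) (by linarith)]
        simp
      push Not at h1 h2
      refine coneCut_zero hk hs hρ (Or.inr ?_)
      rcases hp with hp | hp
      · rw [abs_of_pos (by linarith)] at hp
        linarith
      · linarith
    rw [this, zero_mul]

theorem coneCut_tendsto {s ρ T : ℝ} {p : Spt} (hs : 0 ≤ s) (hρ : 0 ≤ ρ) (h1 : s < p.1)
    (hT : p.1 ≤ T) (h2 : ‖p.2‖ < ρ + p.1) :
    ∀ᶠ n : ℕ in Filter.atTop, coneCut s ρ T (n + 1) p = 1 := by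
  have ha : 0 < p.1 - s := by linarith
  have hb : 0 < (ρ + p.1) ^ 2 - ‖p.2‖ ^ 2 := by nlinarith [norm_nonneg p.2]
  obtain ⟨n1, hn1⟩ := exists_nat_gt (1 / (p.1 - s))
  obtain ⟨n2, hn2⟩ := exists_nat_gt (1 / ((ρ + p.1) ^ 2 - ‖p.2‖ ^ 2))
  rw [div_lt_iff₀ ha] at hn1
  rw [div_lt_iff₀ hb] at hn2
  filter_upwards [Filter.eventually_ge_atTop n1, Filter.eventually_ge_atTop n2] with n h3 h4
  have h3' : (n1:ℝ) ≤ n := by exact_mod_cast h3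
  have h4' : (n2:ℝ) ≤ n := by exact_mod_cast h4
  unfold coneCut
  rw [smoothTransition.one_of_one_le (by nlinarith), smoothTransition.one_of_one_le (by linarith),
    smoothTransition.one_of_one_le (by nlinarith)]
  simp

/-- The `L¹²` mass in the ball of radius `ρ + t`. -/
def ballMass (v : Spt → ℝ) (ρ t : ℝ) : ℝ≥0∞ :=
  ∫⁻ x in Metric.ball (0:E3) (ρ + t), ‖v (t, x)‖ₑ ^ (12:ℝ)

theorem ballMass_measurable {v : Spt → ℝ} (hv : Continuous v) (ρ : ℝ) :
    Measurable (ballMass v ρ) := by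
  have e : ballMass v ρ = fun t : ℝ =>
      ∫⁻ x, {p : Spt | ‖p.2‖ < ρ + p.1}.indicator (fun p => ‖v p‖ₑ ^ (12:ℝ)) (t, x) := by
    ext t
    unfold ballMass
    rw [← lintegral_indicator measurableSet_ball]
    refine lintegral_congr fun x => ?_
    simp [Set.indicator]
  rw [e]
  refine Measurable.lintegral_prod_right' ?_
  exact (hv.measurable.enorm.pow_const _).indicator (measurableSet_lt (by fun_prop) (by fun_prop))

theorem ballMass_lt_top {v : Spt → ℝ} (hv : Continuous v) (ρ t : ℝ) : ballMass v ρ t < ⊤ := by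
  obtain ⟨C, hC⟩ := ((isCompact_closedBall (0:E3) (ρ + t)).image
    (f := fun x => ‖v (t, x)‖) (by fun_prop)).isBounded.bddAbove
  refine setLIntegral_lt_top_of_le_nnreal (measure_ball_lt_top.ne)
    ⟨(max C 0).toNNReal ^ (12:ℝ), fun x hx => ?_⟩
  rw [ENNReal.coe_rpow_of_nonneg _ (by norm_num)]
  refine ENNReal.rpow_le_rpow ?_ (by norm_num)
  rw [← ofReal_norm]
  exact ENNReal.ofReal_le_ofReal ((hC ⟨x, Metric.ball_subset_closedBall hx, rfl⟩).trans
    (le_max_left _ _))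

/-- The smoothly truncated `L¹²` mass. -/
def cutMass (v : Spt → ℝ) (s ρ T k t : ℝ) : ℝ := ∫ x, coneCut s ρ T k (t, x) * v (t, x) ^ 12

section
variable {v : Spt → ℝ} {s ρ T k t : ℝ}

theorem enorm_pow_twelve (a : ℝ) : ENNReal.ofReal (a ^ 12) = ‖a‖ₑ ^ (12:ℝ) := by
  rw [show a ^ 12 = |a| ^ 12 from (Even.pow_abs (by decide) a).symm, ENNReal.ofReal_pow
    (abs_nonneg _), ← Real.norm_eq_abs, ofReal_norm]
  norm_cast

theorem cutMass_nonneg : 0 ≤ cutMass v s ρ T k t :=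
  integral_nonneg fun x => mul_nonneg (coneCut_nonneg _ _ _ _ _) (Even.pow_nonneg (by decide) _)

theorem ofReal_cutMass (hv : ContDiff ℝ (⊤ : ℕ∞) v) (hk : 0 < k) (hs : 0 ≤ s) (hρ : 0 ≤ ρ)
    (hT : 0 ≤ T) : ENNReal.ofReal (cutMass v s ρ T k t)
      = ∫⁻ x, ENNReal.ofReal (coneCut s ρ T k (t, x) * v (t, x) ^ 12) := by
  have hS := coneCut_src (k := k) hk hs hρ hT (hv.pow 12)
  exact ofReal_integral_eq_lintegral_ofReal
    (integrable_of_ball (hS.slice_cont t) (hS.slice_zero t))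
    (Filter.Eventually.of_forall fun x =>
      mul_nonneg (coneCut_nonneg _ _ _ _ _) (Even.pow_nonneg (by decide) _))

theorem cutMass_le (hv : ContDiff ℝ (⊤ : ℕ∞) v) (hk : 0 < k) (hs : 0 ≤ s) (hρ : 0 ≤ ρ)
    (hT : 0 ≤ T) : ENNReal.ofReal (cutMass v s ρ T k t) ≤ ballMass v ρ t := by
  rw [ofReal_cutMass hv hk hs hρ hT, ballMass, ← lintegral_indicator measurableSet_ball]
  refine lintegral_mono fun x => ?_
  by_cases hx : x ∈ Metric.ball (0:E3) (ρ + t)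
  · rw [Set.indicator_of_mem hx, ← enorm_pow_twelve]
    exact ENNReal.ofReal_le_ofReal (mul_le_of_le_one_left (Even.pow_nonneg (by decide) _)
      (coneCut_le_one _ _ _ _ _))
  · rw [coneCut_zero (p := (t, x)) hk hs hρ (Or.inr (by simpa using hx))]
    simp

theorem cutMass_zero (hk : 0 < k) (hs : 0 ≤ s) (hρ : 0 ≤ ρ) (ht : t ≤ s) :
    cutMass v s ρ T k t = 0 := by
  unfold cutMass
  have : ∀ x, coneCut s ρ T k (t, x) = 0 := fun x => coneCut_zero hk hs hρ (Or.inl ht)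
  simp [this]

theorem cutMass_tendsto (hv : ContDiff ℝ (⊤ : ℕ∞) v) (hs : 0 ≤ s) (hρ : 0 ≤ ρ) (hst : s < t)
    (htT : t ≤ T) : Filter.Tendsto (fun n : ℕ => cutMass v s ρ T (n + 1) t) Filter.atTop
      (nhds (ballMass v ρ t).toReal) := by
  have hT : 0 ≤ T := by linarith
  have hvc : Continuous fun x => v (t, x) := hv.continuous.comp (by fun_prop)
  have h1 : Filter.Tendsto (fun n : ℕ => ENNReal.ofReal (cutMass v s ρ T (n + 1) t)) Filter.atTop
      (nhds (ballMass v ρ t)) := by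
    have e : (fun n : ℕ => ENNReal.ofReal (cutMass v s ρ T (n + 1) t)) = fun n : ℕ =>
        ∫⁻ x, ENNReal.ofReal (coneCut s ρ T (n + 1) (t, x) * v (t, x) ^ 12) :=
      funext fun n => ofReal_cutMass hv (by positivity) hs hρ hT
    rw [e, ballMass, ← lintegral_indicator measurableSet_ball]
    refine tendsto_lintegral_of_dominated_convergence
      ((Metric.ball (0:E3) (ρ + t)).indicator fun x => ‖v (t, x)‖ₑ ^ (12:ℝ)) (fun n => ?_)
      (fun n => Filter.Eventually.of_forall fun x => ?_) ?_
      (Filter.Eventually.of_forall fun x => ?_)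
    · exact (((coneCut_smooth _ _ _ _).continuous.comp (by fun_prop)).mul
        (hvc.pow 12)).measurable.ennreal_ofReal
    · by_cases hx : x ∈ Metric.ball (0:E3) (ρ + t)
      · rw [Set.indicator_of_mem hx, ← enorm_pow_twelve]
        exact ENNReal.ofReal_le_ofReal (mul_le_of_le_one_left (Even.pow_nonneg (by decide) _)
          (coneCut_le_one _ _ _ _ _))
      · have hn : (0:ℝ) < n + 1 := by positivity
        beta_reduce
        rw [coneCut_zero (p := (t, x)) hn hs hρ (Or.inr (by simpa using hx))]
        simp
    · rw [lintegral_indicator measurableSet_ball]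
      exact (ballMass_lt_top hv.continuous ρ t).ne
    · by_cases hx : x ∈ Metric.ball (0:E3) (ρ + t)
      · rw [Set.indicator_of_mem hx, ← enorm_pow_twelve]
        refine tendsto_const_nhds.congr' ?_
        filter_upwards [coneCut_tendsto (p := (t, x)) hs hρ hst htT (by simpa using hx)] with n hn
        rw [hn, one_mul]
      · have : ∀ n : ℕ, coneCut s ρ T (n + 1) (t, x) = 0 := fun n =>
          coneCut_zero (by positivity) hs hρ (Or.inr (by simpa using hx))
        simp [this, hx]
  have h2 := (ENNReal.tendsto_toReal (ballMass_lt_top hv.continuous ρ t).ne).comp h1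
  refine h2.congr fun n => ?_
  simp [ENNReal.toReal_ofReal cutMass_nonneg]

theorem cutMass_smooth (hv : ContDiff ℝ (⊤ : ℕ∞) v) (hk : 0 < k) (hs : 0 ≤ s) (hρ : 0 ≤ ρ)
    (hT : 0 ≤ T) : ContDiff ℝ (⊤ : ℕ∞) (cutMass v s ρ T k) :=
  contDiff_infty.2 fun n => slice_integral_smooth n (coneCut_src hk hs hρ hT (hv.pow 12))

end

/-- The time weight making the test source extremal. -/
def cutWeight (v : Spt → ℝ) (s ρ T k t : ℝ) : ℝ := (cutMass v s ρ T k t + 1 / k) ^ (-(2/3) : ℝ)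

/-- The test source. -/
def cutSource (v : Spt → ℝ) (s ρ T k : ℝ) (p : Spt) : ℝ :=
  coneCut s ρ T k p * (cutWeight v s ρ T k p.1 * v p ^ 11)

section
variable {v : Spt → ℝ} {s ρ T k : ℝ}

theorem cutMass_add_pos (hk : 0 < k) (t : ℝ) : 0 < cutMass v s ρ T k t + 1 / k := by
  have : 0 ≤ cutMass v s ρ T k t := cutMass_nonneg
  positivity

theorem cutWeight_pos (hk : 0 < k) (t : ℝ) : 0 < cutWeight v s ρ T k t :=
  rpow_pos_of_pos (cutMass_add_pos hk t) _

theorem cutSource_src (hv : ContDiff ℝ (⊤ : ℕ∞) v) (hk : 0 < k) (hs : 0 ≤ s) (hρ : 0 ≤ ρ)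
    (hT : 0 ≤ T) : Src (cutSource v s ρ T k) (ρ + T + 1) := by
  have h1 : ContDiff ℝ (⊤ : ℕ∞) fun p : Spt => cutWeight v s ρ T k p.1 := by
    have h2 : ContDiff ℝ (⊤ : ℕ∞) (cutWeight v s ρ T k) :=
      ((cutMass_smooth hv hk hs hρ hT).add contDiff_const).rpow_const_of_ne
        fun t => (cutMass_add_pos hk t).ne'
    exact h2.comp contDiff_fst
  exact coneCut_src hk hs hρ hT (h1.mul (hv.pow 11))

theorem mul_cutSource (p : Spt) : v p * cutSource v s ρ T k p
    = cutWeight v s ρ T k p.1 * (coneCut s ρ T k p * v p ^ 12) := by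
  unfold cutSource; ring

theorem lintegral_mul_cutSource (hv : ContDiff ℝ (⊤ : ℕ∞) v) (hk : 0 < k) (hs : 0 ≤ s)
    (hρ : 0 ≤ ρ) (hT : 0 ≤ T) (t : ℝ) : ∫⁻ x, ‖v (t, x) * cutSource v s ρ T k (t, x)‖ₑ
      = ENNReal.ofReal (cutWeight v s ρ T k t * cutMass v s ρ T k t) := by
  have hw := cutWeight_pos (v := v) (s := s) (ρ := ρ) (T := T) hk t
  have hS := coneCut_src (k := k) hk hs hρ hT (hv.pow 12)
  have hm : Measurable fun x => ENNReal.ofReal (coneCut s ρ T k (t, x) * v (t, x) ^ 12) :=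
    (hS.slice_cont t).measurable.ennreal_ofReal
  rw [ENNReal.ofReal_mul hw.le, ofReal_cutMass hv hk hs hρ hT, ← lintegral_const_mul _ hm]
  refine lintegral_congr fun x => ?_
  have h0 : 0 ≤ coneCut s ρ T k (t, x) * v (t, x) ^ 12 :=
    mul_nonneg (coneCut_nonneg _ _ _ _ _) (Even.pow_nonneg (by decide) _)
  rw [mul_cutSource, Real.enorm_of_nonneg (mul_nonneg hw.le h0), ENNReal.ofReal_mul hw.le]

theorem enorm_cutSource_le (hk : 0 < k) (t : ℝ) (x : E3) :
    ‖cutSource v s ρ T k (t, x)‖ₑ ^ (12/11:ℝ) ≤ ENNReal.ofReal (cutWeight v s ρ T k t ^ (12/11:ℝ))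
      * ENNReal.ofReal (coneCut s ρ T k (t, x) * v (t, x) ^ 12) := by
  have hw := cutWeight_pos (v := v) (s := s) (ρ := ρ) (T := T) hk t
  have hχ := coneCut_nonneg s ρ T k (t, x)
  have e : ‖cutSource v s ρ T k (t, x)‖
      = coneCut s ρ T k (t, x) * (cutWeight v s ρ T k t * |v (t, x)| ^ 11) := by
    unfold cutSource
    rw [norm_mul, norm_mul, norm_of_nonneg hχ, norm_of_nonneg hw.le, norm_pow, Real.norm_eq_abs]
  rw [← ofReal_norm, ENNReal.ofReal_rpow_of_nonneg (norm_nonneg _) (by norm_num),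
    ← ENNReal.ofReal_mul (by positivity), e]
  refine ENNReal.ofReal_le_ofReal ?_
  rw [mul_rpow hχ (by positivity), mul_rpow hw.le (by positivity), ← Real.rpow_natCast,
    ← Real.rpow_mul (abs_nonneg _)]
  have e2 : |v (t, x)| ^ (((11:ℕ):ℝ) * (12/11)) = v (t, x) ^ 12 := by
    rw [← Even.pow_abs (by decide : Even 12), ← Real.rpow_natCast]
    norm_num
  have e3 : coneCut s ρ T k (t, x) ^ (12/11:ℝ) ≤ coneCut s ρ T k (t, x) := by
    have := rpow_le_rpow_of_exponent_ge' hχ (coneCut_le_one s ρ T k (t, x)) zero_le_one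
      (by norm_num : (1:ℝ) ≤ 12/11)
    rwa [rpow_one] at this
  rw [e2]
  calc _ ≤ coneCut s ρ T k (t, x) * (cutWeight v s ρ T k t ^ (12/11:ℝ) * v (t, x) ^ 12) :=
        mul_le_mul_of_nonneg_right e3 (mul_nonneg (by positivity)
          (Even.pow_nonneg (by decide) _))
    _ = _ := by ring

theorem pastNorm_cutSource_le (hv : ContDiff ℝ (⊤ : ℕ∞) v) (hk : 0 < k) (hs : 0 ≤ s)
    (hρ : 0 ≤ ρ) (hT : 0 ≤ T) : pastNorm (cutSource v s ρ T k) T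
      ≤ ∫⁻ t in Ioc s T, ballMass v ρ t ^ (1/3:ℝ) := by
  have key : ∀ t, (∫⁻ x, ‖cutSource v s ρ T k (t, x)‖ₑ ^ (12/11:ℝ)) ^ (11/9:ℝ)
      ≤ ENNReal.ofReal (cutMass v s ρ T k t) ^ (1/3:ℝ) := fun t => by
    have hw := cutWeight_pos (v := v) (s := s) (ρ := ρ) (T := T) hk t
    have hS := coneCut_src (k := k) hk hs hρ hT (hv.pow 12)
    have hm : Measurable fun x => ENNReal.ofReal (coneCut s ρ T k (t, x) * v (t, x) ^ 12) :=
      (hS.slice_cont t).measurable.ennreal_ofReal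
    have h1 := lintegral_mono (μ := volume) fun x =>
      enorm_cutSource_le (v := v) (s := s) (ρ := ρ) (T := T) hk t x
    rw [lintegral_const_mul _ hm, ← ofReal_cutMass hv hk hs hρ hT,
      ← ENNReal.ofReal_mul (by positivity)] at h1
    refine (ENNReal.rpow_le_rpow h1 (by norm_num)).trans ?_
    have hA : 0 ≤ cutMass v s ρ T k t := cutMass_nonneg
    have hA' := cutMass_add_pos (v := v) (s := s) (ρ := ρ) (T := T) hk t
    rw [ENNReal.ofReal_rpow_of_nonneg (by positivity) (by norm_num),
      ENNReal.ofReal_rpow_of_nonneg hA (by norm_num)]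
    refine ENNReal.ofReal_le_ofReal ?_
    rw [mul_rpow (by positivity) hA, ← rpow_mul hw.le, cutWeight, ← rpow_mul hA'.le]
    rcases hA.eq_or_lt with h0 | h0
    · rw [← h0]; norm_num
    calc (cutMass v s ρ T k t + 1 / k) ^ (-(2/3) * (12/11 * (11/9)) : ℝ)
          * cutMass v s ρ T k t ^ (11/9:ℝ)
        ≤ cutMass v s ρ T k t ^ (-(2/3) * (12/11 * (11/9)) : ℝ)
          * cutMass v s ρ T k t ^ (11/9:ℝ) := by
          refine mul_le_mul_of_nonneg_right ?_ (by positivity)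
          exact rpow_le_rpow_of_nonpos h0 (by have : 0 < 1 / k := by positivity
                                              linarith) (by norm_num)
      _ = _ := by rw [← rpow_add h0]; norm_num
  refine (setLIntegral_mono' measurableSet_Iic fun t _ => key t).trans ?_
  refine (setLIntegral_le_of_zero measurableSet_Iic (measurableSet_Ioc (a := s) (b := T))
    fun t ht ht' => ?_).trans (setLIntegral_mono' measurableSet_Ioc fun t _ =>
      ENNReal.rpow_le_rpow (cutMass_le hv hk hs hρ hT) (by norm_num))
  have hts : t ≤ s := by
    by_contra hcon
    exact ht' ⟨not_le.1 hcon, ht⟩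
  rw [cutMass_zero hk hs hρ hts]
  simp

theorem cutWeight_mul_tendsto (hv : ContDiff ℝ (⊤ : ℕ∞) v) (hs : 0 ≤ s) (hρ : 0 ≤ ρ) {t : ℝ}
    (hst : s < t) (htT : t ≤ T) : Filter.Tendsto (fun n : ℕ =>
      ENNReal.ofReal (cutWeight v s ρ T (n + 1) t * cutMass v s ρ T (n + 1) t)) Filter.atTop
      (nhds (ballMass v ρ t ^ (1/3:ℝ))) := by
  have hT : 0 ≤ T := by linarith
  have hlt := ballMass_lt_top hv.continuous ρ t
  have hlim := cutMass_tendsto hv hs hρ hst htT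
  have e0 : ballMass v ρ t = ENNReal.ofReal (ballMass v ρ t).toReal :=
    (ENNReal.ofReal_toReal hlt.ne).symm
  rcases (ENNReal.toReal_nonneg (a := ballMass v ρ t)).eq_or_lt with h0 | h0
  · have h1 : ballMass v ρ t = 0 := by rw [e0, ← h0]; simp
    have h2 : ∀ n : ℕ, cutMass v s ρ T (n + 1) t = 0 := fun n => by
      have := cutMass_le (t := t) (k := n + 1) hv (by positivity) hs hρ hT
      rw [h1, nonpos_iff_eq_zero, ENNReal.ofReal_eq_zero] at this
      exact le_antisymm this cutMass_nonneg
    simp [h1, h2]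
  · have h1 : Filter.Tendsto (fun n : ℕ => cutMass v s ρ T (n + 1) t + 1 / ((n:ℝ) + 1))
        Filter.atTop (nhds (ballMass v ρ t).toReal) := by
      simpa using hlim.add tendsto_one_div_add_atTop_nhds_zero_nat
    have h2 := (h1.rpow_const (p := (-(2/3):ℝ)) (Or.inl h0.ne')).mul hlim
    have h3 := ENNReal.tendsto_ofReal h2
    have e : ENNReal.ofReal ((ballMass v ρ t).toReal ^ (-(2/3):ℝ) * (ballMass v ρ t).toReal)
        = ballMass v ρ t ^ (1/3:ℝ) := by
      rw [← rpow_add_one h0.ne']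
      conv_rhs => rw [e0]
      rw [ENNReal.ofReal_rpow_of_pos h0]
      norm_num
    rw [e] at h3
    exact h3

end

/-- The self-improving inequality for the `L⁴L¹²` norm on a truncated cone. -/
theorem Sol.cone_ineq {v : Spt → ℝ} {E s ρ T : ℝ} (hv : Sol v E) (hs : 0 ≤ s) (hsT : s < T)
    (hρ : 0 ≤ ρ) {d : ℝ≥0∞}
    (hd : ∀ τ, 0 < τ → τ ≤ T → ∀ z, ∫⁻ x in Metric.closedBall z τ, ‖v (τ, x)‖ₑ ^ (6:ℝ) ≤ d) :
    ENNReal.ofReal c0 * ∫⁻ t in Ioc s T, ballMass v ρ t ^ (1/3:ℝ)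
      ≤ (ENNReal.ofReal (2 * √(2 * E)) * K1 ^ (1/2:ℝ) + 9 * K1 ^ (1/2:ℝ) * d ^ (1/6:ℝ)
        * ∫⁻ t in Ioc s T, ballMass v ρ t ^ (1/3:ℝ))
        * (∫⁻ t in Ioc s T, ballMass v ρ t ^ (1/3:ℝ)) ^ (3/4:ℝ) := by
  have hT : 0 ≤ T := by linarith
  have hsm := hv.smooth
  set X := ∫⁻ t in Ioc s T, ballMass v ρ t ^ (1/3:ℝ) with hX
  set f : ℕ → ℝ → ℝ≥0∞ := fun n t =>
    ENNReal.ofReal (cutWeight v s ρ T (n + 1) t * cutMass v s ρ T (n + 1) t) with hf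
  have hn : ∀ n : ℕ, (0:ℝ) < n + 1 := fun n => by positivity
  have hfm : ∀ n, Measurable (f n) := fun n => by
    have h1 := (cutMass_smooth hsm (hn n) hs hρ hT).continuous.measurable
    exact (((h1.add_const _).pow_const _).mul h1).ennreal_ofReal
  have hbound : ∀ n, ENNReal.ofReal c0 * ∫⁻ t in Ioc s T, f n t
      ≤ (ENNReal.ofReal (2 * √(2 * E)) * K1 ^ (1/2:ℝ) + 9 * K1 ^ (1/2:ℝ) * d ^ (1/6:ℝ) * X)
        * X ^ (3/4:ℝ) := fun n => by
    have hp := pastNorm_cutSource_le hsm (hn n) hs hρ hT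
    have hcb := Src.cone_bound (ρ := ρ) hv (cutSource_src hsm (hn n) hs hρ hT) hs hsT
      (fun p _ => by
        rw [mul_cutSource]
        exact mul_nonneg (cutWeight_pos (hn n) _).le (mul_nonneg (coneCut_nonneg _ _ _ _ _)
          (Even.pow_nonneg (by decide) _)))
      (fun p _ h => by rw [cutSource, coneCut_zero (hn n) hs hρ h, zero_mul]) hd
    refine le_trans ?_ (hcb.trans (mul_le_mul_right (ENNReal.rpow_le_rpow hp (by norm_num)) _))
    refine mul_le_mul_right ?_ _
    refine (lintegral_mono_set Ioc_subset_Iic_self).trans (lintegral_mono fun t => ?_)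
    rw [lintegral_mul_cutSource hsm (hn n) hs hρ hT]
  have hFat : X ≤ Filter.liminf (fun n => ∫⁻ t in Ioc s T, f n t) Filter.atTop := by
    refine le_trans ?_ (lintegral_liminf_le hfm)
    refine setLIntegral_mono' measurableSet_Ioc fun t ht => ?_
    exact (cutWeight_mul_tendsto hsm hs hρ ht.1 ht.2).liminf_eq.ge
  have hc : ENNReal.ofReal c0 ≠ 0 := by simpa using c0_pos
  have hc' : ENNReal.ofReal c0 ≠ ⊤ := ENNReal.ofReal_ne_top
  rw [mul_comm, ← ENNReal.le_div_iff_mul_le (Or.inl hc) (Or.inl hc')]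
  refine hFat.trans (Filter.liminf_le_of_frequently_le' (Filter.Frequently.of_forall fun n => ?_))
  rw [ENNReal.le_div_iff_mul_le (Or.inl hc) (Or.inl hc'), mul_comm]
  exact hbound n

/-! ### The continuity argument -/

theorem exists_ballMass_le {v : Spt → ℝ} (hv : Continuous v) (ρ T : ℝ) :
    ∃ C : ℝ≥0, ∀ t ∈ Icc 0 T, ballMass v ρ t ≤ C := by
  obtain ⟨C, hC⟩ := ((isCompact_Icc (a := 0) (b := T)).prod
    (isCompact_closedBall (0:E3) (ρ + T))).image (f := fun p => ‖v p‖) (by fun_prop)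
    |>.isBounded.bddAbove
  have hfin : ENNReal.ofReal (max C 0) ^ (12:ℝ) * volume (Metric.ball (0:E3) (ρ + T)) ≠ ⊤ :=
    ENNReal.mul_ne_top (ENNReal.rpow_ne_top_of_nonneg (by norm_num) ENNReal.ofReal_ne_top)
      measure_ball_lt_top.ne
  refine ⟨(ENNReal.ofReal (max C 0) ^ (12:ℝ) * volume (Metric.ball (0:E3) (ρ + T))).toNNReal,
    fun t ht => ?_⟩
  rw [ENNReal.coe_toNNReal hfin, ← setLIntegral_const]
  refine (setLIntegral_mono' measurableSet_ball fun x hx => ?_).trans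
    (lintegral_mono_set (Metric.ball_subset_ball (by linarith [ht.2])))
  refine ENNReal.rpow_le_rpow ?_ (by norm_num)
  rw [← ofReal_norm]
  refine ENNReal.ofReal_le_ofReal ((hC ⟨(t, x), ⟨ht, ?_⟩, rfl⟩).trans (le_max_left _ _))
  rw [mem_closedBall_zero_iff]
  have := mem_ball_zero_iff.1 hx
  linarith [ht.2]

/-- The real constant `K1 ^ (1/2)`. -/
def k1 : ℝ := √(12 * c0 * vol1 ^ (1/6:ℝ))

theorem k1_pos : 0 < k1 := by
  have := c0_pos
  have := vol1_pos
  unfold k1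
  positivity

theorem K1_rpow_half : K1 ^ (1/2:ℝ) = ENNReal.ofReal k1 := by
  have := c0_pos
  have := vol1_pos
  unfold K1 k1
  rw [ENNReal.ofReal_rpow_of_nonneg (by positivity) (by norm_num), Real.sqrt_eq_rpow]

theorem Sol.cone_small {v : Spt → ℝ} {E ρ T δ : ℝ} (hv : Sol v E) (hE : 0 < E) (hT : 0 < T)
    (hρ : 0 ≤ ρ) (hδ : 0 ≤ δ)
    (hδ' : 9 * k1 * δ * (2 * (2 * √(2 * E) * k1) / c0) ^ 4 < 2 * √(2 * E) * k1)
    (hd : ∀ τ, 0 < τ → τ ≤ T → ∀ z, ∫⁻ x in Metric.closedBall z τ, ‖v (τ, x)‖ₑ ^ (6:ℝ)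
      ≤ ENNReal.ofReal (δ ^ 6)) :
    ∫⁻ t in Ioc 0 T, ballMass v ρ t ^ (1/3:ℝ)
      ≤ ENNReal.ofReal ((2 * (2 * √(2 * E) * k1) / c0) ^ 4) := by
  have hc := c0_pos
  have hk := k1_pos
  set b := 2 * √(2 * E) * k1 with hb
  have hb0 : 0 < b := by positivity
  set M := 2 * b / c0 with hM
  have hM0 : 0 < M := by positivity
  obtain ⟨C, hC⟩ := exists_ballMass_le hv.smooth.continuous ρ T
  set g : ℝ → ℝ := fun t => (ballMass v ρ t).toReal ^ (1/3:ℝ) with hg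
  have hgm : Measurable g :=
    (ballMass_measurable hv.smooth.continuous ρ).ennreal_toReal.pow_const _
  have hg0 : ∀ t, 0 ≤ g t := fun t => by positivity
  have hgi : IntegrableOn g (Icc 0 T) := by
    refine Measure.integrableOn_of_bounded (M := (C:ℝ) ^ (1/3:ℝ)) (by simp)
      hgm.aestronglyMeasurable ?_
    refine (ae_restrict_iff' measurableSet_Icc).2 (Filter.Eventually.of_forall fun t ht => ?_)
    rw [norm_of_nonneg (hg0 t)]
    exact rpow_le_rpow ENNReal.toReal_nonneg (ENNReal.toReal_le_coe_of_le_coe (hC t ht))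
      (by norm_num)
  set x : ℝ → ℝ := fun s => ∫ t in s..T, g t with hx
  have hgu : IntegrableOn g (uIcc 0 T) := by rwa [uIcc_of_le hT.le]
  have hxc : ContinuousOn x (Icc 0 T) := by
    have := intervalIntegral.continuousOn_primitive_interval_left hgu
    rwa [uIcc_of_le hT.le] at this
  have hX : ∀ s ∈ Icc 0 T, ∫⁻ t in Ioc s T, ballMass v ρ t ^ (1/3:ℝ) = ENNReal.ofReal (x s) := by
    intro s hs
    simp only [hx]
    rw [intervalIntegral.integral_of_le hs.2, ofReal_integral_eq_lintegral_ofReal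
      (hgi.mono_set fun t ht => ⟨hs.1.trans ht.1.le, ht.2⟩) (Filter.Eventually.of_forall hg0)]
    refine lintegral_congr fun t => ?_
    have hlt := ballMass_lt_top hv.smooth.continuous ρ t
    rw [← ENNReal.ofReal_rpow_of_nonneg ENNReal.toReal_nonneg (by norm_num),
      ENNReal.ofReal_toReal hlt.ne]
  have hx0 : ∀ s ∈ Icc 0 T, 0 ≤ x s := fun s hs =>
    intervalIntegral.integral_nonneg hs.2 fun t _ => hg0 t
  have hineq : ∀ s ∈ Ico 0 T, c0 * x s ≤ (b + 9 * k1 * δ * x s) * x s ^ (3/4:ℝ) := by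
    intro s hs
    have hsI : s ∈ Icc 0 T := ⟨hs.1, hs.2.le⟩
    have h := hv.cone_ineq hs.1 hs.2 hρ hd
    have hxs := hx0 s hsI
    rw [hX s hsI, K1_rpow_half, ← ENNReal.ofReal_mul hc.le, ← ENNReal.ofReal_mul (by positivity),
      ENNReal.ofReal_rpow_of_nonneg (by positivity) (by norm_num), ← Real.rpow_natCast,
      ← rpow_mul hδ, ENNReal.ofReal_rpow_of_nonneg hxs (by norm_num),
      show (9:ℝ≥0∞) = ENNReal.ofReal 9 by norm_num, ← ENNReal.ofReal_mul (by norm_num),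
      ← ENNReal.ofReal_mul (by positivity), ← ENNReal.ofReal_mul (by positivity),
      ← ENNReal.ofReal_add hb0.le (by positivity), ← ENNReal.ofReal_mul (by positivity),
      ENNReal.ofReal_le_ofReal_iff (by positivity)] at h
    norm_num at h
    norm_num
    exact h
  have hne : ∀ s ∈ Icc 0 T, x s ≠ M ^ 4 := by
    intro s hs hcon
    have hsT : s < T := by
      refine lt_of_le_of_ne hs.2 fun h => ?_
      have : x s = 0 := by simp [hx, h]
      rw [this] at hcon
      exact absurd hcon.symm (by positivity)
    have h := hineq s ⟨hs.1, hsT⟩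
    have e : (M ^ 4) ^ (3/4:ℝ) = M ^ 3 := by
      rw [← Real.rpow_natCast, ← rpow_mul hM0.le, ← Real.rpow_natCast]
      norm_num
    rw [hcon, e] at h
    have e2 : c0 * M = 2 * b := by rw [hM]; field_simp
    have h3 : 0 < M ^ 3 := by positivity
    nlinarith
  have hlt : x 0 < M ^ 4 := by
    by_contra hcon
    push Not at hcon
    have hxT : x T = 0 := by simp [hx]
    have := intermediate_value_Icc' hT.le hxc
    obtain ⟨s, hs, hs'⟩ := this (show M ^ 4 ∈ Icc (x T) (x 0) from ⟨by rw [hxT]; positivity, hcon⟩)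
    exact hne s hs hs'
  rw [hX 0 ⟨le_rfl, hT.le⟩]
  exact ENNReal.ofReal_le_ofReal hlt.le

/-- The full `L¹²` mass at time `t`. -/
def mass12 (v : Spt → ℝ) (t : ℝ) : ℝ≥0∞ := ∫⁻ x, ‖v (t, x)‖ₑ ^ (12:ℝ)

theorem ballMass_iSup {v : Spt → ℝ} (hv : Continuous v) {t : ℝ} (ht : 0 ≤ t) :
    ⨆ n : ℕ, ballMass v n t = mass12 v t := by
  have hm : Measurable fun x => ‖v (t, x)‖ₑ ^ (12:ℝ) :=
    (Continuous.measurable (hv.comp (by fun_prop))).enorm.pow_const _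
  have e : ∀ n : ℕ, ballMass v n t
      = ∫⁻ x, (Metric.ball (0:E3) (n + t)).indicator (fun x => ‖v (t, x)‖ₑ ^ (12:ℝ)) x :=
    fun n => (lintegral_indicator measurableSet_ball _).symm
  simp only [e]
  rw [← lintegral_iSup (fun n => hm.indicator measurableSet_ball)]
  · refine lintegral_congr fun x => le_antisymm
      (iSup_le fun n => Set.indicator_le_self _ _ _) ?_
    obtain ⟨n, hn⟩ := exists_nat_gt ‖x‖
    refine le_trans ?_ (le_iSup _ n)
    rw [Set.indicator_of_mem (by simpa using by linarith)]
  · intro m n hmn x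
    refine Set.indicator_le_indicator_of_subset (Metric.ball_subset_ball ?_) (fun _ => zero_le) x
    have : (m:ℝ) ≤ n := by exact_mod_cast hmn
    linarith

theorem Sol.small_of_no_bubble : ∃ C c : ℝ, 1 ≤ C ∧ 0 < c ∧ c ≤ 1 ∧ ∀ (v : Spt → ℝ) (E T : ℝ),
    Sol v E → 1 ≤ E → 0 < T →
    (∀ τ, 0 < τ → τ ≤ T → ∀ z, ∫ x in Metric.closedBall z τ, v (τ, x) ^ 6 ≤ c / E ^ 9) →
    ∫⁻ t in Ioc 0 T, mass12 v t ^ (1/3:ℝ) ≤ ENNReal.ofReal (C * E ^ 2) := by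
  have hc := c0_pos
  have hk := k1_pos
  set B := (2 * (2 * √2 * k1) / c0) ^ 4 with hB
  have hB0 : 0 < B := by positivity
  set c1 := min 1 (√2 * k1 / (9 * k1 * B)) with hc1
  have hc10 : 0 < c1 := lt_min one_pos (by positivity)
  refine ⟨max 1 B, c1 ^ 6, le_max_left _ _, by positivity,
    pow_le_one₀ hc10.le (min_le_left _ _), fun v E T hv hE hT hd => ?_⟩
  have hE0 : 0 < E := by linarith
  have hsE : √E ^ 2 = E := Real.sq_sqrt hE0.le
  have hsE0 : 0 < √E := Real.sqrt_pos.2 hE0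
  have hs2 : √(2 * E) = √2 * √E := Real.sqrt_mul (by norm_num) _
  have e4 : (2 * (2 * √(2 * E) * k1) / c0) ^ 4 = B * E ^ 2 := by
    rw [hs2, hB]
    nth_rewrite 2 [← hsE]
    ring
  have hδ' : 9 * k1 * (c1 / √E ^ 3) * (2 * (2 * √(2 * E) * k1) / c0) ^ 4 < 2 * √(2 * E) * k1 := by
    rw [e4, hs2]
    have h1 : c1 * (9 * k1 * B) ≤ √2 * k1 := by
      rw [← le_div_iff₀ (by positivity)]; exact min_le_right _ _
    have h2 : 9 * k1 * (c1 / √E ^ 3) * (B * E ^ 2) = c1 * (9 * k1 * B) * √E := by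
      nth_rewrite 2 [← hsE]
      field_simp
    rw [h2]
    have h3 : 0 < √2 * k1 * √E := by positivity
    have h4 := mul_le_mul_of_nonneg_right h1 hsE0.le
    linarith
  have e6 : (c1 / √E ^ 3) ^ 6 = c1 ^ 6 / E ^ 9 := by
    nth_rewrite 2 [← hsE]
    rw [div_pow]; ring
  have hdd : ∀ τ, 0 < τ → τ ≤ T → ∀ z, ∫⁻ x in Metric.closedBall z τ, ‖v (τ, x)‖ₑ ^ (6:ℝ)
      ≤ ENNReal.ofReal ((c1 / √E ^ 3) ^ 6) := by
    intro τ h1 h2 z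
    rw [e6]
    refine le_trans (le_of_eq ?_) (ENNReal.ofReal_le_ofReal (hd τ h1 h2 z))
    rw [ofReal_integral_eq_lintegral_ofReal (hv.int_pow6 τ).integrableOn
      (Filter.Eventually.of_forall fun x => Even.pow_nonneg (by decide) _)]
    refine lintegral_congr fun x => ?_
    rw [← Even.pow_abs (by decide : Even 6), ENNReal.ofReal_pow (abs_nonneg _),
      ← Real.norm_eq_abs, ofReal_norm]
    norm_cast
  have hn : ∀ n : ℕ, ∫⁻ t in Ioc 0 T, ballMass v n t ^ (1/3:ℝ) ≤ ENNReal.ofReal (B * E ^ 2) :=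
    fun n => by
      have := hv.cone_small (ρ := n) hE0 hT (by positivity) (by positivity) hδ' hdd
      rwa [e4] at this
  have hlim : ∫⁻ t in Ioc 0 T, mass12 v t ^ (1/3:ℝ)
      = ⨆ n : ℕ, ∫⁻ t in Ioc 0 T, ballMass v n t ^ (1/3:ℝ) := by
    rw [← lintegral_iSup]
    · refine setLIntegral_congr_fun measurableSet_Ioc fun t ht => ?_
      rw [← ballMass_iSup hv.smooth.continuous ht.1.le]
      exact (ENNReal.orderIsoRpow (1/3) (by norm_num)).map_iSup _
    · exact fun n => (ballMass_measurable hv.smooth.continuous _).pow_const _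
    · intro m n hmn t
      refine ENNReal.rpow_le_rpow (lintegral_mono_set (Metric.ball_subset_ball ?_)) (by norm_num)
      have : (m:ℝ) ≤ n := by exact_mod_cast hmn
      linarith
  rw [hlim]
  refine iSup_le fun n => (hn n).trans (ENNReal.ofReal_le_ofReal ?_)
  exact mul_le_mul_of_nonneg_right (le_max_right _ _) (by positivity)


theorem setLIntegral_Ioc_add (f : ℝ → ℝ≥0∞) (a T : ℝ) :
    ∫⁻ t in Ioc 0 T, f (t + a) = ∫⁻ t in Ioc a (a + T), f t := by
  have h := (measurePreserving_add_right (volume : Measure ℝ) a).setLIntegral_comp_preimage_emb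
    (measurableEmbedding_addRight a) f (Ioc a (a + T))
  rw [← h]
  congr 2
  ext t
  simp only [mem_Ioc, mem_preimage]
  constructor <;> rintro ⟨h1, h2⟩ <;> constructor <;> linarith

theorem setLIntegral_Ioc_sub (f : ℝ → ℝ≥0∞) (b T : ℝ) :
    ∫⁻ t in Ioc 0 T, f (b - t) = ∫⁻ t in Ico (b - T) b, f t := by
  have h := (Measure.measurePreserving_sub_left (volume : Measure ℝ) b).setLIntegral_comp_preimage_emb
    (measurableEmbedding_subLeft b) f (Ico (b - T) b)
  rw [← h]
  congr 2
  ext t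
  simp only [mem_Ioc, mem_Ico, mem_preimage]
  constructor <;> rintro ⟨h1, h2⟩ <;> constructor <;> linarith

theorem Sol.exists_bubble : ∃ C c : ℝ, 1 ≤ C ∧ 0 < c ∧ c ≤ 1 ∧ ∀ (v : Spt → ℝ) (E a b : ℝ),
    Sol v E → 1 ≤ E → a < b →
    ENNReal.ofReal (C * E ^ 2) < ∫⁻ t in Ioo a b, mass12 v t ^ (1/3:ℝ) →
    ∃ (p : Spt) (R : ℝ), 0 < R ∧ a ≤ p.1 - R ∧ p.1 + R ≤ b ∧
      c / E ^ 9 ≤ ∫ x in Metric.closedBall p.2 R, v (p.1, x) ^ 6 := by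
  obtain ⟨C, c, hC, hc, hc1, H⟩ := Sol.small_of_no_bubble
  refine ⟨2 * C, c, by linarith, hc, hc1, fun v E a b hv hE hab hI => ?_⟩
  by_contra! hno
  obtain ⟨T, hT, hb⟩ : ∃ T : ℝ, 0 < T ∧ b = a + 2 * T := ⟨(b - a) / 2, by linarith, by ring⟩
  have h1 := H _ E T (hv.translate (a, 0)) hE hT (fun τ hτ hτT z => by
    have := hno (τ + a, z) τ hτ (by simp) (by simp only; linarith)
    simpa using this.le)
  have h2 := H _ E T (hv.reverse.translate (-b, 0)) hE hT (fun τ hτ hτT z => by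
    have := hno (b - τ, z) τ hτ (by simp only; linarith) (by simp)
    have e : -(τ + -b) = b - τ := by ring
    simpa [e] using this.le)
  have e1 : ∀ t, mass12 (fun p => v (p + (a, 0))) t = mass12 v (t + a) := fun t => by
    simp [mass12]
  have e2 : ∀ t, mass12 (fun p => (fun p : Spt => v (-p.1, p.2)) (p + (-b, 0))) t
      = mass12 v (b - t) := fun t => by
    have e : -(t + -b) = b - t := by ring
    simp [mass12, e]
  simp only [e1] at h1
  simp only [e2] at h2
  rw [setLIntegral_Ioc_add (fun t => mass12 v t ^ (1/3:ℝ))] at h1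
  rw [setLIntegral_Ioc_sub (fun t => mass12 v t ^ (1/3:ℝ))] at h2
  refine absurd hI (not_lt.2 ?_)
  calc ∫⁻ t in Ioo a b, mass12 v t ^ (1/3:ℝ)
      ≤ ∫⁻ t in Ioc a (a + T) ∪ Ico (b - T) b, mass12 v t ^ (1/3:ℝ) := by
        refine lintegral_mono_set fun t ht => ?_
        rcases le_or_gt t (a + T) with h | h
        · exact Or.inl ⟨ht.1, h⟩
        · exact Or.inr ⟨by linarith, ht.2⟩
    _ ≤ _ := lintegral_union_le _ _ _
    _ ≤ ENNReal.ofReal (C * E ^ 2) + ENNReal.ofReal (C * E ^ 2) := add_le_add h1 h2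
    _ = ENNReal.ofReal (2 * C * E ^ 2) := by
        rw [← ENNReal.ofReal_add (by positivity) (by positivity)]
        congr 1; ring


theorem exists_window {f : ℝ → ℝ≥0∞} (hf : Measurable f) {A : ℝ≥0∞} (hA : A < ∫⁻ t, f t) :
    ∃ n : ℕ, A < ∫⁻ t in Ioo (-(n:ℝ)) n, min (f t) n := by
  have hm : ∀ n : ℕ, Measurable ((Ioo (-(n:ℝ)) n).indicator fun t => min (f t) (n:ℝ≥0∞)) :=
    fun n => (hf.min measurable_const).indicator measurableSet_Ioo
  have hmono : Monotone fun (n : ℕ) t => (Ioo (-(n:ℝ)) n).indicator (fun t => min (f t) (n:ℝ≥0∞)) t := by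
    intro m n hmn t
    have hc : (m:ℝ) ≤ n := by exact_mod_cast hmn
    refine (indicator_le_indicator_of_subset (Ioo_subset_Ioo (neg_le_neg hc) hc)
      (fun _ => zero_le) t).trans (indicator_le_indicator ?_)
    exact min_le_min le_rfl (by exact_mod_cast hmn)
  have hsup : ∀ t, ⨆ n : ℕ, (Ioo (-(n:ℝ)) n).indicator (fun t => min (f t) (n:ℝ≥0∞)) t = f t := by
    intro t
    refine le_antisymm (iSup_le fun n => ?_) ?_
    · exact (indicator_le_self _ _ t).trans (min_le_left _ _)
    · refine le_of_forall_lt fun y hy => ?_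
      obtain ⟨n, hn⟩ := ENNReal.exists_nat_gt (ne_top_of_lt hy)
      obtain ⟨m, hm⟩ := exists_nat_gt |t|
      refine lt_of_lt_of_le ?_ (le_iSup _ (max n m))
      have ht : t ∈ Ioo (-((max n m : ℕ):ℝ)) ((max n m : ℕ):ℝ) := by
        have := hm.trans_le (by exact_mod_cast le_max_right n m : (m:ℝ) ≤ ((max n m : ℕ):ℝ))
        exact abs_lt.1 this
      rw [indicator_of_mem ht]
      exact lt_min hy (hn.trans_le (by exact_mod_cast le_max_left n m))
  have h := lintegral_iSup (μ := volume) hm hmono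
  simp only [hsup] at h
  rw [h] at hA
  obtain ⟨n, hn⟩ := lt_iSup_iff.1 hA
  exact ⟨n, by rwa [lintegral_indicator measurableSet_Ioo] at hn⟩

theorem exists_partition {f : ℝ → ℝ≥0∞} (hf : Measurable f) {K : ℝ} (hK : 0 ≤ K) {N : ℕ}
    (hN : 0 < N) (hA : ENNReal.ofReal (N * K) < ∫⁻ t, f t) :
    ∃ s : ℕ → ℝ, (∀ i < N, s i < s (i + 1)) ∧
      ∀ i < N, ENNReal.ofReal K < ∫⁻ t in Ioo (s i) (s (i + 1)), f t := by
  obtain ⟨n, hn⟩ := exists_window hf hA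
  set g : ℝ → ℝ := fun t => (min (f t) (n:ℝ≥0∞)).toReal with hg
  have hfin : ∀ t, min (f t) (n:ℝ≥0∞) ≠ ⊤ := fun t =>
    ne_top_of_le_ne_top (ENNReal.natCast_ne_top n) (min_le_right _ _)
  have hg0 : ∀ t, 0 ≤ g t := fun t => ENNReal.toReal_nonneg
  have hgn : ∀ t, g t ≤ n := fun t => by
    have := ENNReal.toReal_mono (ENNReal.natCast_ne_top n) (min_le_right (f t) (n:ℝ≥0∞))
    simpa using this
  have hgm : Measurable g := (hf.min measurable_const).ennreal_toReal
  have hgi : ∀ a b, IntervalIntegrable g volume a b := fun a b => by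
    refine (intervalIntegrable_const (c := (n:ℝ))).mono_fun hgm.aestronglyMeasurable
      (Filter.Eventually.of_forall fun t => ?_)
    simp only
    rw [Real.norm_of_nonneg (hg0 t), Real.norm_of_nonneg (Nat.cast_nonneg n)]
    exact hgn t
  have hset : ∀ a b, a ≤ b → ∫⁻ t in Ioo a b, min (f t) n = ENNReal.ofReal (∫ t in a..b, g t) := by
    intro a b hab
    rw [intervalIntegral.integral_of_le hab, integral_Ioc_eq_integral_Ioo,
      ofReal_integral_eq_lintegral_ofReal
        (((hgi a b).1).mono_set Ioo_subset_Ioc_self) (Filter.Eventually.of_forall hg0)]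
    refine lintegral_congr fun t => ?_
    rw [hg, ENNReal.ofReal_toReal (hfin t)]
  set F : ℝ → ℝ := fun s => ∫ t in (-(n:ℝ))..s, g t with hF
  have hnn : -(n:ℝ) ≤ n := by linarith [Nat.cast_nonneg (α := ℝ) n]
  have hFc : Continuous F := intervalIntegral.continuous_primitive hgi _
  have hF0 : F (-(n:ℝ)) = 0 := by simp [hF]
  rw [hset _ _ hnn] at hn
  have hFn : N * K < F n := (ENNReal.ofReal_lt_ofReal_iff_of_nonneg (by positivity)).1 hn
  have hN' : (0:ℝ) < N := by exact_mod_cast hN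
  have hNK : 0 ≤ N * K := by positivity
  have hL : K < F n / N := by rw [lt_div_iff₀ hN']; linarith
  have hLpos : 0 < F n / N := by linarith
  have hex : ∀ i : ℕ, ∃ s, i ≤ N → F s = i * (F n / N) := by
    intro i
    by_cases hi : i ≤ N
    · have hi' : (i:ℝ) ≤ N := by exact_mod_cast hi
      have : (i:ℝ) * (F n / N) ∈ Icc (F (-(n:ℝ))) (F n) := by
        rw [hF0]
        refine ⟨by positivity, ?_⟩
        calc (i:ℝ) * (F n / N) ≤ N * (F n / N) := by gcongr
          _ = F n := by field_simp
      obtain ⟨s, -, hs⟩ := intermediate_value_Icc hnn hFc.continuousOn this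
      exact ⟨s, fun _ => hs⟩
    · exact ⟨0, fun h => absurd h hi⟩
  choose s hs using hex
  have hFm : Monotone F := fun a b hab => by
    have := intervalIntegral.integral_add_adjacent_intervals (hgi (-(n:ℝ)) a) (hgi a b)
    have h2 := intervalIntegral.integral_nonneg (μ := volume) hab (fun t _ => hg0 t)
    simp only [hF]; linarith
  have hdiff : ∀ i < N, F (s (i + 1)) - F (s i) = F n / N := fun i hi => by
    rw [hs i hi.le, hs (i + 1) hi]; push_cast; ring
  have hlt : ∀ i < N, s i < s (i + 1) := fun i hi => by
    by_contra! h
    have := hFm h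
    linarith [hdiff i hi]
  refine ⟨s, hlt, fun i hi => ?_⟩
  calc ENNReal.ofReal K < ENNReal.ofReal (∫ t in (s i)..(s (i + 1)), g t) := by
        rw [← intervalIntegral.integral_interval_sub_left (hgi (-(n:ℝ)) _) (hgi _ _)]
        exact (ENNReal.ofReal_lt_ofReal_iff_of_nonneg hK).2 (hL.trans_eq (hdiff i hi).symm)
    _ = ∫⁻ t in Ioo (s i) (s (i + 1)), min (f t) n := (hset _ _ (hlt i hi).le).symm
    _ ≤ _ := lintegral_mono fun t => min_le_left _ _

theorem mass12_measurable {v : Spt → ℝ} (hv : Continuous v) : Measurable (mass12 v) := by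
  have h : Measurable fun p : Spt => ‖v p‖ₑ ^ (12:ℝ) := (hv.measurable.enorm).pow_const _
  exact h.lintegral_prod_right'

theorem exists_bub {v : Spt → ℝ} {d : ℝ} {N : ℕ} {s : ℕ → ℝ} {p : ℕ → Spt} {r : ℕ → ℝ}
    (hs : ∀ i < N, s i < s (i + 1)) (hr : ∀ i < N, 0 < r i)
    (h1 : ∀ i < N, s i ≤ (p i).1 - r i) (h2 : ∀ i < N, (p i).1 + r i ≤ s (i + 1))
    (hm : ∀ i < N, d ≤ ∫ x in Metric.closedBall (p i).2 (r i), v ((p i).1, x) ^ 6) :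
    ∃ (R : Spt → ℝ) (P : Finset Spt), Bub v d R P ∧ P.card = N := by
  classical
  have hmono : ∀ i j, i ≤ j → j ≤ N → s i ≤ s j := by
    intro i j hij
    induction j, hij using Nat.le_induction with
    | base => intro _; exact le_rfl
    | succ j _ ih => intro hj; exact (ih (by omega)).trans (hs j (by omega)).le
  have hsep : ∀ i j, i < j → j < N → (p i).1 + r i ≤ (p j).1 ∧ (p i).1 + r j ≤ (p j).1 := by
    intro i j hij hj
    have := hmono (i + 1) j hij hj.le
    have a1 := h2 i (hij.trans hj)
    have a2 := h1 j hj
    have a3 := hr j hj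
    have a4 := hr i (hij.trans hj)
    constructor <;> linarith
  set q : Fin N → Spt := fun i => p i with hq
  have hinj : Function.Injective q := by
    intro i j hij
    by_contra hne
    have hne' : (i:ℕ) ≠ j := fun h => hne (Fin.ext h)
    have he : (p i).1 = (p j).1 := congrArg Prod.fst hij
    rcases lt_or_gt_of_ne hne' with h | h
    · linarith [(hsep i j h j.2).1, hr i i.2]
    · linarith [(hsep j i h i.2).1, hr j j.2]
  set R : Spt → ℝ := Function.extend q (fun i => r i) 0 with hR
  have hRq : ∀ i, R (q i) = r i := fun i => hinj.extend_apply _ _ i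
  refine ⟨R, Finset.univ.image q, ⟨?_, ?_, ?_⟩, ?_⟩
  · intro x hx
    obtain ⟨i, -, rfl⟩ := Finset.mem_image.1 hx
    rw [hRq]; exact hr i i.2
  · intro x hx
    obtain ⟨i, -, rfl⟩ := Finset.mem_image.1 hx
    rw [hRq]; exact hm i i.2
  · intro x hx y hy hxy
    obtain ⟨i, -, rfl⟩ := Finset.mem_image.1 hx
    obtain ⟨j, -, rfl⟩ := Finset.mem_image.1 hy
    rw [hRq]
    have hne' : (i:ℕ) ≠ j := fun h => hxy (congrArg q (Fin.ext h))
    rcases lt_or_gt_of_ne hne' with h | h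
    · rw [abs_sub_comm]
      refine le_trans ?_ (le_abs_self _)
      have := (hsep i j h j.2).1
      simp only [hq]; linarith
    · refine le_trans ?_ (le_abs_self _)
      have := (hsep j i h i.2).2
      simp only [hq]; linarith
  · rw [Finset.card_image_of_injective _ hinj, Finset.card_univ, Fintype.card_fin]

theorem Sol.lintegral_mass12_le : ∃ C : ℝ, 1 ≤ C ∧ ∀ (v : Spt → ℝ) (E : ℝ), Sol v E → 1 ≤ E →
    ∫⁻ t, mass12 v t ^ (1/3:ℝ) ≤ ENNReal.ofReal ((C * E ^ 20) ^ (C * E ^ 38)) := by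
  obtain ⟨C₀, c, hC₀, hc, hc1, H⟩ := Sol.exists_bubble
  obtain ⟨C₁, hC₁, H₁⟩ := exists_card_le
  have hCc : 0 ≤ C₁ / c ^ 4 := by positivity
  refine ⟨2 * C₀ + C₁ / c ^ 4 + 1, by linarith, fun v E hv hE => ?_⟩
  set C := 2 * C₀ + C₁ / c ^ 4 + 1 with hC
  have hE0 : 0 < E := by linarith
  set d := c / E ^ 9 with hd
  have hd0 : 0 < d := by positivity
  have hd1 : d ≤ 1 := by
    rw [hd, div_le_one (by positivity)]; exact hc1.trans (one_le_pow₀ hE)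
  set M := (C₁ * (E ^ 2 / d ^ 2)) ^ (C₁ * (E ^ 2 / d ^ 4)) with hM
  have hM0 : 0 ≤ M := by positivity
  set N := ⌊M⌋₊ + 1 with hN
  have hMN : M < N := by rw [hN]; push_cast; exact Nat.lt_floor_add_one M
  have hNM : (N:ℝ) ≤ M + 1 := by
    rw [hN]; push_cast; linarith [Nat.floor_le hM0]
  have hle : ∫⁻ t, mass12 v t ^ (1/3:ℝ) ≤ ENNReal.ofReal (N * (C₀ * E ^ 2)) := by
    by_contra! hlt
    obtain ⟨s, hs, hsI⟩ := exists_partition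
      ((mass12_measurable hv.smooth.continuous).pow_const (1/3:ℝ)) (by positivity)
      (Nat.succ_pos _) hlt
    have hex : ∀ i : ℕ, ∃ (p : Spt) (R : ℝ), i < N → 0 < R ∧ s i ≤ p.1 - R ∧ p.1 + R ≤ s (i + 1) ∧
        d ≤ ∫ x in Metric.closedBall p.2 R, v (p.1, x) ^ 6 := by
      intro i
      by_cases hi : i < N
      · obtain ⟨p, R, h⟩ := H v E _ _ hv hE (hs i hi) (hsI i hi)
        exact ⟨p, R, fun _ => h⟩
      · exact ⟨0, 0, fun h => absurd h hi⟩
    choose p r hpr using hex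
    obtain ⟨R, P, hB, hP⟩ := exists_bub hs (fun i hi => (hpr i hi).1) (fun i hi => (hpr i hi).2.1)
      (fun i hi => (hpr i hi).2.2.1) (fun i hi => (hpr i hi).2.2.2)
    have := H₁ v E d hv hE hd0 hd1 P R hB
    rw [hP] at this
    exact absurd hMN (not_lt.2 this)
  refine hle.trans (ENNReal.ofReal_le_ofReal ?_)
  have e1 : C₁ * (E ^ 2 / d ^ 2) = C₁ / c ^ 2 * E ^ 20 := by
    rw [hd]; field_simp
  have e2 : C₁ * (E ^ 2 / d ^ 4) = C₁ / c ^ 4 * E ^ 38 := by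
    rw [hd]; field_simp
  have hc2 : C₁ / c ^ 2 ≤ C₁ / c ^ 4 :=
    div_le_div_of_nonneg_left (by linarith) (by positivity)
      (pow_le_pow_of_le_one hc.le hc1 (by norm_num))
  have hC1' : 1 ≤ C₁ / c ^ 2 := by
    rw [le_div_iff₀ (by positivity), one_mul]
    exact (pow_le_one₀ hc.le hc1).trans hC₁
  have hE20 : 1 ≤ E ^ 20 := one_le_pow₀ hE
  have hE38 : 1 ≤ E ^ 38 := one_le_pow₀ hE
  have hM1 : 1 ≤ M := by
    rw [hM, e1]
    exact Real.one_le_rpow (by nlinarith) (by positivity)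
  have hB1 : 1 ≤ C * E ^ 20 := by nlinarith
  calc N * (C₀ * E ^ 2) ≤ (M + 1) * (C₀ * E ^ 2) := by gcongr
    _ ≤ (2 * M) * (C₀ * E ^ 2) := by gcongr; linarith
    _ = M * (2 * C₀ * E ^ 2) := by ring
    _ ≤ M * (C * E ^ 20) := by
        gcongr
        · linarith
        · norm_num
    _ ≤ (C * E ^ 20) ^ (C₁ / c ^ 4 * E ^ 38) * (C * E ^ 20) := by
        gcongr
        rw [hM, e1, e2]
        refine Real.rpow_le_rpow (by positivity) ?_ (by positivity)
        gcongr
        linarith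
    _ = (C * E ^ 20) ^ (C₁ / c ^ 4 * E ^ 38 + 1) := by
        rw [Real.rpow_add (by linarith), Real.rpow_one]
    _ ≤ (C * E ^ 20) ^ (C * E ^ 38) := by
        refine Real.rpow_le_rpow_of_exponent_le hB1 ?_
        rw [hC]; nlinarith


theorem IsSchwartz.integrable_pow {f : E3 → ℝ} (hf : IsSchwartz f) {n : ℕ} (hn : Even n)
    (hn0 : n ≠ 0) : Integrable (fun x => f x ^ n) := by
  have h := ((⟨f, hf.1, hf.2⟩ : SchwartzMap E3 ℝ).memLp n volume).integrable_norm_pow hn0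
  refine h.congr (Filter.Eventually.of_forall fun x => ?_)
  exact hn.pow_abs (f x)

theorem IsSchwartz.integrable_DD_sq {f : E3 → ℝ} (hf : IsSchwartz f) (e : E3) :
    Integrable (fun x => DD e f x ^ 2) := by
  set g : SchwartzMap E3 ℝ := ⟨f, hf.1, hf.2⟩ with hg
  have h := ((SchwartzMap.fderivCLM ℝ E3 ℝ g).memLp (2:ℕ) volume).integrable_norm_pow two_ne_zero
  refine (h.const_mul (‖e‖ ^ 2)).mono' ?_ (Filter.Eventually.of_forall fun x => ?_)
  · have hc : Continuous (fun x => fderiv ℝ f x e) :=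
      (hf.1.continuous_fderiv (by simp)).clm_apply continuous_const
    exact (hc.pow 2).aestronglyMeasurable
  · have h1 : ‖fderiv ℝ f x e‖ ≤ ‖fderiv ℝ f x‖ * ‖e‖ := (fderiv ℝ f x).le_opNorm e
    have h2 : SchwartzMap.fderivCLM ℝ E3 ℝ g x = fderiv ℝ f x := rfl
    rw [h2, norm_pow, ← mul_pow, mul_comm]
    exact pow_le_pow_left₀ (norm_nonneg _) h1 2

theorem norm_gradient_sq (f : E3 → ℝ) (x : E3) :
    ‖gradient f x‖ ^ 2 = ∑ i, DD (EuclideanSpace.single i 1) f x ^ 2 := by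
  rw [EuclideanSpace.norm_sq_eq]
  refine Finset.sum_congr rfl fun i _ => ?_
  have h : inner ℝ (gradient f x) (EuclideanSpace.single i (1:ℝ))
      = fderiv ℝ f x (EuclideanSpace.single i 1) := by
    simp [gradient]
  have h2 : inner ℝ (gradient f x) (EuclideanSpace.single i (1:ℝ)) = gradient f x i := by
    rw [EuclideanSpace.inner_single_right]; simp
  rw [Real.norm_eq_abs, sq_abs, ← h2, h, DD]

theorem lap_eq {f : E3 → ℝ} (hf : ContDiff ℝ (⊤ : ℕ∞) f) (x : E3) :
    lap f x = ∑ i, DD (EuclideanSpace.single i 1) (DD (EuclideanSpace.single i 1) f) x := by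
  refine Finset.sum_congr rfl fun i _ => ?_
  have hd : DifferentiableAt ℝ (fderiv ℝ f) x :=
    ((hf.fderiv_right (m := 1) (by norm_cast)).differentiable (by norm_num)) x
  have h : HasFDerivAt (fun y => fderiv ℝ f y (EuclideanSpace.single i 1))
      ((fderiv ℝ (fderiv ℝ f) x).flip (EuclideanSpace.single i 1)) x := by
    have := hd.hasFDerivAt.clm_apply
      (hasFDerivAt_const (EuclideanSpace.single i (1:ℝ) : E3) x)
    simpa using this
  rw [iteratedFDeriv_two_apply]
  have e : DD (EuclideanSpace.single i 1) f = fun y => fderiv ℝ f y (EuclideanSpace.single i 1) :=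
    rfl
  rw [e, DD, h.fderiv]
  simp

theorem Sol.of_isNLW {u : ℝ → E3 → ℝ} {E : ℝ} (hu : IsNLW u) (hE : ∀ t, energy u t ≤ E) :
    Sol (uncurry u) E := by
  obtain ⟨h1, h2, h3⟩ := hu
  rw [univ_prod_univ, contDiffOn_univ] at h1
  have ht : ∀ t x, tderiv u t x = DD eT (uncurry u) (t, x) := fun t x =>
    (hasDerivAt_slice_t (f := uncurry u) (smooth_diffAt h1)).deriv
  have htt : ∀ t x, tderiv2 u t x = DD eT (DD eT (uncurry u)) (t, x) := fun t x => by
    have := (hasDerivAt_slice_t (f := DD eT (uncurry u)) (t := t) (x := x)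
      (smooth_diffAt (DD_smooth h1))).deriv
    rw [← this, tderiv2]
    congr 1
    ext s
    exact ht s x
  have hx : ∀ t i, DD (EuclideanSpace.single i 1) (u t)
      = fun y => DD (eX i) (uncurry u) (t, y) := fun t i => by
    ext y
    exact DD_slice_x (f := uncurry u) (smooth_diffAt h1) i
  have hlap : ∀ t x, lap (u t) x = ∑ i, DD (eX i) (DD (eX i) (uncurry u)) (t, x) := fun t x => by
    rw [lap_eq (h2 t (mem_univ _)).1.1]
    refine Finset.sum_congr rfl fun i _ => ?_
    rw [hx]
    exact DD_slice_x (smooth_diffAt (DD_smooth h1)) i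
  have hed : ∀ t x, (1/2) * (tderiv u t x) ^ 2 + (1/2) * ‖gradient (u t) x‖ ^ 2
      + (1/6) * (u t x) ^ 6 = ed (uncurry u) (t, x) := fun t x => by
    rw [norm_gradient_sq, ht, ed, gsq]
    simp only [hx, uncurry]
  refine ⟨h1, ?_, ?_, ?_, ?_⟩
  · rintro ⟨t, x⟩
    have := h3 t (mem_univ _) x
    rw [htt, hlap] at this
    simp only [uncurry] at this ⊢
    linarith
  · intro t
    obtain ⟨s1, s2⟩ := h2 t (mem_univ _)
    simp only [← hed, norm_gradient_sq]
    exact (((s2.integrable_pow even_two two_ne_zero).const_mul _).add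
      ((integrable_finsetSum _ fun i _ => s1.integrable_DD_sq _).const_mul _)).add
      ((s1.integrable_pow (by decide) (by norm_num)).const_mul _)
  · intro t
    simp only [← hed]
    exact hE t
  · intro t
    exact (h2 t (mem_univ _)).1.integrable_pow even_two two_ne_zero

theorem mixNorm_four_twelve (u : ℝ → E3 → ℝ) :
    mixNorm 4 12 univ u = (∫⁻ t, mass12 (uncurry u) t ^ (1/3:ℝ)) ^ (1/4:ℝ) := by
  simp only [mixNorm, xNorm, Measure.restrict_univ, mass12, uncurry, enorm_eq_nnnorm]
  congr 1
  refine lintegral_congr fun t => ?_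
  rw [← ENNReal.rpow_mul]
  norm_num

theorem exists_exponent_bound {C : ℝ} (hC : 1 ≤ C) : ∃ C' : ℝ, 0 < C' ∧ ∀ E : ℝ, 0 ≤ E →
    (C * max E 1 ^ 20) ^ (C * max E 1 ^ 38) ≤ C' * (1 + E) ^ (C' * E ^ ((105:ℝ)/2)) := by
  obtain ⟨n, hn⟩ := pow_unbounded_of_one_lt C (one_lt_two (α := ℝ))
  have hCC : 1 ≤ C ^ C := Real.one_le_rpow hC (by linarith)
  have hnC : 0 ≤ ((n:ℝ) + 20) * C := by positivity
  refine ⟨C ^ C + (n + 20) * C, by linarith, fun E hE => ?_⟩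
  have h1E : 1 ≤ 1 + E := by linarith
  have hR : 1 ≤ (1 + E) ^ ((C ^ C + (n + 20) * C) * E ^ ((105:ℝ)/2)) :=
    Real.one_le_rpow h1E (by positivity)
  rcases le_total E 1 with h | h
  · rw [max_eq_right h, one_pow, one_pow, mul_one]
    nlinarith
  · rw [max_eq_left h]
    have hb : C * E ^ 20 ≤ (1 + E) ^ ((n:ℝ) + 20) := by
      have : (1 + E) ^ ((n:ℝ) + 20) = (1 + E) ^ n * (1 + E) ^ 20 := by
        rw [← pow_add, ← Real.rpow_natCast]; push_cast; rfl
      rw [this]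
      refine mul_le_mul ?_ ?_ (by positivity) (by positivity)
      · exact hn.le.trans (pow_le_pow_left₀ (by norm_num) (by linarith) n)
      · exact pow_le_pow_left₀ hE (by linarith) 20
    have hp : E ^ 38 ≤ E ^ ((105:ℝ)/2) := by
      rw [← Real.rpow_natCast]
      exact Real.rpow_le_rpow_of_exponent_le h (by norm_num)
    calc (C * E ^ 20) ^ (C * E ^ 38) ≤ ((1 + E) ^ ((n:ℝ) + 20)) ^ (C * E ^ 38) :=
          Real.rpow_le_rpow (by positivity) hb (by positivity)
      _ = (1 + E) ^ (((n:ℝ) + 20) * (C * E ^ 38)) := (Real.rpow_mul (by linarith) _ _).symm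
      _ ≤ (1 + E) ^ ((C ^ C + (n + 20) * C) * E ^ ((105:ℝ)/2)) := by
          refine Real.rpow_le_rpow_of_exponent_le h1E ?_
          rw [← mul_assoc]
          exact mul_le_mul (by linarith) hp (by positivity) (by positivity)
      _ ≤ _ := le_mul_of_one_le_left (by positivity) (by linarith)

/-- the `L⁴_t L¹²_x` spacetime bound of Tao. -/
theorem stmt1 :
    ∃ C : ℝ, 0 < C ∧ ∀ (E : ℝ) (u : ℝ → E3 → ℝ),
      IsNLW u → (∀ t : ℝ, energy u t ≤ E) →
      mixNorm 4 12 univ u ≤ ENNReal.ofReal (C * (1 + E) ^ (C * E ^ ((105:ℝ)/2))) := by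
  obtain ⟨C, hC, H⟩ := Sol.lintegral_mass12_le
  obtain ⟨C', hC', H'⟩ := exists_exponent_bound hC
  refine ⟨C', hC', fun E u hu hE => ?_⟩
  have h0 : 0 ≤ E := (Sol.of_isNLW hu hE).nonneg
  have hs : Sol (uncurry u) (max E 1) := Sol.of_isNLW hu fun t => (hE t).trans (le_max_left _ _)
  have h1 : 1 ≤ max E 1 := le_max_right _ _
  have hX : 1 ≤ (C * max E 1 ^ 20) ^ (C * max E 1 ^ 38) :=
    Real.one_le_rpow (one_le_mul_of_one_le_of_one_le hC (one_le_pow₀ h1)) (by positivity)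
  rw [mixNorm_four_twelve]
  calc _ ≤ ENNReal.ofReal ((C * max E 1 ^ 20) ^ (C * max E 1 ^ 38)) ^ (1/4:ℝ) :=
        ENNReal.rpow_le_rpow (H _ _ hs h1) (by norm_num)
    _ ≤ ENNReal.ofReal ((C * max E 1 ^ 20) ^ (C * max E 1 ^ 38)) ^ (1:ℝ) :=
        ENNReal.rpow_le_rpow_of_exponent_le (ENNReal.one_le_ofReal.2 hX) (by norm_num)
    _ ≤ _ := by
        rw [ENNReal.rpow_one]
        exact ENNReal.ofReal_le_ofReal (H' E h0)

end
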